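/- Let D be a field and let k ≥ 1, n ≥ 1. If D is infinite and either (k = 1 and n ≥ 2) or (2 ≤ k ≤ n), then the relative integral group homology H_k(O_{n+1,n+1}(D), O_{n,n}(D); Z) vanishes; equivalently, the map H_k(O_{n,n}(D); Z) → H_k(O_{n+1,n+1}(D); Z) induced by the hyperbolic embedding is surjective and the induced map in degree k − 1 is injective. If D is a finite field, the same conclusion holds provided n ≥ 2k. -/

import Mathlib

namespace Stmt3

open Finsupp in
/-- The `n`-th differential of the (inhomogeneous) bar complex computing the homology of the
group `G` with trivial coefficients in the commutative ring `R`.  The module of `n`-chains is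
the free `R`-module on `n`-tuples of elements of `G`, and on a basis element
`(g₁, …, g_{n+1})` the differential is
`(g₂,…,g_{n+1}) + ∑ᵢ (-1)ⁱ (g₁,…,gᵢgᵢ₊₁,…,g_{n+1}) + (-1)^{n+1} (g₁,…,g_n)`. -/
noncomputable def barDiff (R : Type) [CommRing R] (G : Type*) [Group G] (n : ℕ) :
    ((Fin (n + 1) → G) →₀ R) →ₗ[R] ((Fin n → G) →₀ R) :=
  Finsupp.lift ((Fin n → G) →₀ R) R (Fin (n + 1) → G) fun c =>
    Finsupp.single (fun j : Fin n => c j.succ) (1 : R)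
      + ∑ i : Fin n, Finsupp.single
          (fun j : Fin n => if (j : ℕ) < (i : ℕ) then c (Fin.castSucc j)
            else if (j : ℕ) = (i : ℕ) then c (Fin.castSucc i) * c i.succ
            else c j.succ) ((-1 : R) ^ ((i : ℕ) + 1))
      + Finsupp.single (fun j : Fin n => c (Fin.castSucc j)) ((-1 : R) ^ (n + 1))

/-- The submodule of `k`-cycles of the bar complex of `G` (with trivial coefficients `R`). -/
noncomputable def barCycles (R : Type) [CommRing R] (G : Type*) [Group G] :
    (k : ℕ) → Submodule R ((Fin k → G) →₀ R)
  | 0 => ⊤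
  | (k + 1) => LinearMap.ker (barDiff R G k)

/-- The submodule of `k`-boundaries of the bar complex of `G`. -/
noncomputable def barBoundaries (R : Type) [CommRing R] (G : Type*) [Group G] (k : ℕ) :
    Submodule R ((Fin k → G) →₀ R) :=
  LinearMap.range (barDiff R G k)

/-- Group homology `H_k(G; R)` with trivial coefficients, defined via the bar complex as the
image of the `k`-cycles in the quotient of the `k`-chains by the `k`-boundaries
(i.e. as `Z_k / B_k`). -/
noncomputable def barHomology (R : Type) [CommRing R] (G : Type*) [Group G] (k : ℕ) :=
  ↥(Submodule.map (barBoundaries R G k).mkQ (barCycles R G k))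

noncomputable instance (R : Type) [CommRing R] (G : Type*) [Group G] (k : ℕ) :
    AddCommGroup (barHomology R G k) :=
  inferInstanceAs (AddCommGroup ↥(Submodule.map (barBoundaries R G k).mkQ (barCycles R G k)))

noncomputable instance (R : Type) [CommRing R] (G : Type*) [Group G] (k : ℕ) :
    Module R (barHomology R G k) :=
  inferInstanceAs (Module R ↥(Submodule.map (barBoundaries R G k).mkQ (barCycles R G k)))

/-- The map induced on bar chains by a map `φ : G' → G` of groups; for a group homomorphism
`φ` this is the usual chain map inducing `H_k(φ) : H_k(G'; R) → H_k(G; R)`. -/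
noncomputable def barMap (R : Type) [CommRing R] {G' G : Type*} [Group G'] [Group G]
    (φ : G' → G) (k : ℕ) : ((Fin k → G') →₀ R) →ₗ[R] ((Fin k → G) →₀ R) :=
  Finsupp.lmapDomain R R fun c => φ ∘ c

/-- The statement that the map `H_k(G'; R) → H_k(G; R)` induced by `φ : G' → G` is
surjective, expressed at the chain level of the bar complexes:  every `k`-cycle of `G` differs
from the image of a `k`-cycle of `G'` by a `k`-boundary. -/
def BarInducedSurj (R : Type) [CommRing R] {G' G : Type*} [Group G'] [Group G]
    (φ : G' → G) (k : ℕ) : Prop :=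
  ∀ z ∈ barCycles R G k, ∃ w ∈ barCycles R G' k,
    z - barMap R φ k w ∈ barBoundaries R G k

/-- The statement that the map `H_k(G'; R) → H_k(G; R)` induced by `φ : G' → G` is
injective, expressed at the chain level of the bar complexes:  a `k`-cycle of `G'` whose image
is a `k`-boundary of `G` is already a `k`-boundary of `G'`. -/
def BarInducedInj (R : Type) [CommRing R] {G' G : Type*} [Group G'] [Group G]
    (φ : G' → G) (k : ℕ) : Prop :=
  ∀ w ∈ barCycles R G' k,
    barMap R φ k w ∈ barBoundaries R G k → w ∈ barBoundaries R G' k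

open Matrix

variable (D : Type) [Field D]

/-- The Gram matrix `H_n = [[0, Iₙ], [Iₙ, 0]]` of the hyperbolic symmetric bilinear form of
Witt index `n` with respect to a hyperbolic basis `e_{−n}, …, e_{−1}, e_1, …, e_n`. -/
def Hmat (n : ℕ) : Matrix (Fin n ⊕ Fin n) (Fin n ⊕ Fin n) D :=
  Matrix.fromBlocks 0 1 1 0

/-- The orthogonal group `O_{n,n}(D) = {A ∈ GL_{2n}(D) : Aᵀ Hₙ A = Hₙ}` of the hyperbolic
symmetric bilinear form of Witt index `n`. -/
def OGroup (n : ℕ) : Subgroup (GL (Fin n ⊕ Fin n) D) where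
  carrier := {A : GL (Fin n ⊕ Fin n) D |
    (A : Matrix (Fin n ⊕ Fin n) (Fin n ⊕ Fin n) D)ᵀ * Hmat D n *
      (A : Matrix (Fin n ⊕ Fin n) (Fin n ⊕ Fin n) D) = Hmat D n}
  one_mem' := by simp
  mul_mem' := by
    intro a b ha hb
    simp only [Set.mem_setOf_eq, Units.val_mul, Matrix.transpose_mul] at ha hb ⊢
    calc (b : Matrix _ _ D)ᵀ * (a : Matrix _ _ D)ᵀ * Hmat D n *
          ((a : Matrix _ _ D) * (b : Matrix _ _ D))
        = (b : Matrix _ _ D)ᵀ * ((a : Matrix _ _ D)ᵀ * Hmat D n * (a : Matrix _ _ D)) *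
          (b : Matrix _ _ D) := by simp only [Matrix.mul_assoc]
      _ = Hmat D n := by rw [ha, hb]
  inv_mem' := by
    intro a ha
    simp only [Set.mem_setOf_eq] at ha ⊢
    calc ((a⁻¹ : GL _ D) : Matrix _ _ D)ᵀ * Hmat D n * ((a⁻¹ : GL _ D) : Matrix _ _ D)
        = ((a⁻¹ : GL _ D) : Matrix _ _ D)ᵀ *
            ((a : Matrix _ _ D)ᵀ * Hmat D n * (a : Matrix _ _ D)) *
            ((a⁻¹ : GL _ D) : Matrix _ _ D) := by rw [ha]
      _ = ((a : Matrix _ _ D) * ((a⁻¹ : GL _ D) : Matrix _ _ D))ᵀ * Hmat D n *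
            ((a : Matrix _ _ D) * ((a⁻¹ : GL _ D) : Matrix _ _ D)) := by
          simp only [Matrix.transpose_mul, Matrix.mul_assoc]
      _ = Hmat D n := by rw [Units.mul_inv]; simp

theorem mem_oGroup_iff (n : ℕ) (A : GL (Fin n ⊕ Fin n) D) :
    A ∈ OGroup D n ↔
      (A : Matrix (Fin n ⊕ Fin n) (Fin n ⊕ Fin n) D)ᵀ * Hmat D n *
        (A : Matrix (Fin n ⊕ Fin n) (Fin n ⊕ Fin n) D) = Hmat D n :=
  Iff.rfl

/-- The identification of the index sets of the hyperbolic bases, where the two new basis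
vectors `e_{−(n+1)}` and `e_{n+1}` are appended at the last position of each of the two
blocks of `n` basis vectors. -/
def sumEquiv (n : ℕ) : ((Fin n ⊕ Fin n) ⊕ (Fin 1 ⊕ Fin 1)) ≃ (Fin (n + 1) ⊕ Fin (n + 1)) where
  toFun := Sum.elim (Sum.map Fin.castSucc Fin.castSucc)
    (Sum.elim (fun _ => Sum.inl (Fin.last n)) (fun _ => Sum.inr (Fin.last n)))
  invFun := Sum.elim
    (fun i => Fin.lastCases (Sum.inr (Sum.inl 0)) (fun j => Sum.inl (Sum.inl j)) i)
    (fun i => Fin.lastCases (Sum.inr (Sum.inr 0)) (fun j => Sum.inl (Sum.inr j)) i)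
  left_inv := by
    rintro ((i | i) | (x | x))
    · simp
    · simp
    · simp only [Sum.elim_inl, Sum.elim_inr, Fin.lastCases_last]
      rw [Subsingleton.elim (0 : Fin 1) x]
    · simp only [Sum.elim_inl, Sum.elim_inr, Fin.lastCases_last]
      rw [Subsingleton.elim (0 : Fin 1) x]
  right_inv := by
    rintro (i | i) <;> induction i using Fin.lastCases <;> simp

/-- The matrix `diag(A, I₂)` extending `A` by the identity on the two new basis vectors
`e_{−(n+1)}`, `e_{n+1}`. -/
noncomputable def embMat (n : ℕ)
    (A : Matrix (Fin n ⊕ Fin n) (Fin n ⊕ Fin n) D) :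
    Matrix (Fin (n + 1) ⊕ Fin (n + 1)) (Fin (n + 1) ⊕ Fin (n + 1)) D :=
  (Matrix.fromBlocks A 0 0 (1 : Matrix (Fin 1 ⊕ Fin 1) (Fin 1 ⊕ Fin 1) D)).submatrix
    (sumEquiv n).symm (sumEquiv n).symm

theorem hmat_decomp (n : ℕ) :
    (Matrix.fromBlocks (Hmat D n) 0 0 (Hmat D 1)).submatrix
      (sumEquiv n).symm (sumEquiv n).symm = Hmat D (n + 1) := by
  have key : ∀ p q, Matrix.fromBlocks (Hmat D n) 0 0 (Hmat D 1) p q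
      = Hmat D (n + 1) (sumEquiv n p) (sumEquiv n q) := by
    rintro ((p | p) | (p | p)) ((q | q) | (q | q)) <;>
      simp [sumEquiv, Hmat, Matrix.one_apply, Fin.castSucc_inj,
        (Fin.castSucc_lt_last _).ne, (Fin.castSucc_lt_last _).ne'] <;>
      exact Subsingleton.elim _ _
  ext x y
  rw [Matrix.submatrix_apply, key, Equiv.apply_symm_apply, Equiv.apply_symm_apply]

/-- The extension-by-the-identity map `GL_{2n}(D) → GL_{2n+2}(D)`. -/
noncomputable def embGL (n : ℕ) (A : GL (Fin n ⊕ Fin n) D) :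
    GL (Fin (n + 1) ⊕ Fin (n + 1)) D where
  val := embMat D n (A : Matrix _ _ D)
  inv := embMat D n ((A⁻¹ : GL _ D) : Matrix _ _ D)
  val_inv := by
    simp only [embMat, Matrix.submatrix_mul_equiv, Matrix.fromBlocks_multiply,
      Matrix.mul_zero, Matrix.zero_mul, Matrix.mul_one, Matrix.one_mul, add_zero, zero_add,
      Units.mul_inv, Matrix.fromBlocks_one, Matrix.submatrix_one_equiv]
  inv_val := by
    simp only [embMat, Matrix.submatrix_mul_equiv, Matrix.fromBlocks_multiply,
      Matrix.mul_zero, Matrix.zero_mul, Matrix.mul_one, Matrix.one_mul, add_zero, zero_add,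
      Units.inv_mul, Matrix.fromBlocks_one, Matrix.submatrix_one_equiv]

/-- The hyperbolic embedding `O_{n,n}(D) → O_{n+1,n+1}(D)`, acting as `A` on the old basis
vectors and fixing the two new hyperbolic basis vectors `e_{−(n+1)}` and `e_{n+1}`. -/
noncomputable def embO (n : ℕ) (A : ↥(OGroup D n)) : ↥(OGroup D (n + 1)) :=
  ⟨embGL D n ↑A, by
    have hA := (mem_oGroup_iff D n ↑A).1 A.2
    rw [mem_oGroup_iff]
    show (embMat D n (((A : GL (Fin n ⊕ Fin n) D) : Matrix _ _ D)))ᵀ * Hmat D (n + 1) *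
        embMat D n (((A : GL (Fin n ⊕ Fin n) D) : Matrix _ _ D)) = Hmat D (n + 1)
    rw [← hmat_decomp D n]
    simp only [embMat, Matrix.transpose_submatrix, Matrix.fromBlocks_transpose,
      Matrix.submatrix_mul_equiv, Matrix.fromBlocks_multiply]
    simp [hA]⟩

end Stmt3

namespace Stmt3
open Finsupp

set_option linter.all false
set_option linter.unusedSectionVars false
set_option linter.unusedSimpArgs false
set_option linter.unusedVariables false

section machine

/-- The differential of the inhomogeneous bar complex with coefficients in a module. -/
noncomputable def dd {G M : Type} [Group G] [AddCommGroup M] (ρ : G →* AddMonoid.End M) (n : ℕ) :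
    ((Fin (n + 1) → G) →₀ M) →+ ((Fin n → G) →₀ M) :=
  Finsupp.liftAddHom fun g =>
    (singleAddHom (fun i => g i.succ)).comp (ρ (g 0)⁻¹) +
    ∑ j : Fin (n + 1), (-1 : ℤ) ^ ((j : ℕ) + 1) • (singleAddHom (Fin.contractNth j (· * ·) g) :
      M →+ ((Fin n → G) →₀ M))

variable {G M : Type} [Group G] [AddCommGroup M] (ρ : G →* AddMonoid.End M)

theorem dd_single (n : ℕ) (g : Fin (n + 1) → G) (m : M) :
    dd ρ n (single g m) = single (fun i => g i.succ) (ρ (g 0)⁻¹ m) +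
      ∑ j : Fin (n + 1), (-1 : ℤ) ^ ((j : ℕ) + 1) • single (Fin.contractNth j (· * ·) g) m := by
  simp [dd, AddMonoidHom.finsetSum_apply]
  rfl

/-- The linear representation attached to an additive one. -/
def toRep : Representation ℤ G M where
  toFun g := (ρ g).toIntLinearMap
  map_one' := by rw [map_one]; rfl
  map_mul' a b := by rw [map_mul]; rfl

theorem dd_eq (n : ℕ) (x : (Fin (n + 1) → G) →₀ M) :
    dd ρ n x = (groupHomology.inhomogeneousChains.d (Rep.of (toRep ρ)) n).hom x := by
  induction x using Finsupp.induction_linear with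
  | zero => simp
  | add a b ha hb => rw [map_add, map_add, ha, hb]
  | single g m =>
    rw [dd_single]
    exact (groupHomology.inhomogeneousChains.d_single (A := Rep.of (toRep ρ)) n g m).symm

theorem dd_dd (n : ℕ) (x : (Fin (n + 2) → G) →₀ M) : dd ρ n (dd ρ (n + 1) x) = 0 := by
  rw [dd_eq, dd_eq]
  have := groupHomology.inhomogeneousChains.d_comp_d (A := Rep.of (toRep ρ)) (n := n)
  exact congrArg (fun f => f.hom x) this

/-- cycles -/
noncomputable def cyc : (k : ℕ) → AddSubgroup ((Fin k → G) →₀ M)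
  | 0 => ⊤
  | (k + 1) => (dd ρ k).ker

/-- boundaries -/
noncomputable def bnd (k : ℕ) : AddSubgroup ((Fin k → G) →₀ M) := (dd ρ k).range

theorem mem_cyc_succ {k : ℕ} {x : (Fin (k + 1) → G) →₀ M} : x ∈ cyc ρ (k + 1) ↔ dd ρ k x = 0 :=
  Iff.rfl

theorem dd_mem_cyc {k : ℕ} (x : (Fin (k + 1) → G) →₀ M) : dd ρ k x ∈ cyc ρ k := by
  cases k with
  | zero => trivial
  | succ k => exact dd_dd ρ k x

/-- Homology of `G` with coefficients in `ρ`. -/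
abbrev HH (k : ℕ) : Type := ↥(cyc ρ k) ⧸ (bnd ρ k).addSubgroupOf (cyc ρ k)

/-- The class of a cycle. -/
noncomputable def cls {k : ℕ} (z : (Fin k → G) →₀ M) (hz : z ∈ cyc ρ k) : HH ρ k :=
  QuotientAddGroup.mk ⟨z, hz⟩

theorem cls_surj {k : ℕ} (x : HH ρ k) : ∃ z hz, x = cls ρ (k := k) z hz := by
  induction x using QuotientAddGroup.induction_on with
  | H z => exact ⟨z.1, z.2, rfl⟩

theorem cls_eq_zero {k : ℕ} {z : (Fin k → G) →₀ M} (hz : z ∈ cyc ρ k) :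
    cls ρ z hz = 0 ↔ ∃ y, dd ρ k y = z := by
  rw [cls, QuotientAddGroup.eq_zero_iff, AddSubgroup.mem_addSubgroupOf]
  exact Iff.rfl

theorem cls_add {k : ℕ} {z z' : (Fin k → G) →₀ M} (hz : z ∈ cyc ρ k) (hz' : z' ∈ cyc ρ k) :
    cls ρ z hz + cls ρ z' hz' = cls ρ (z + z') (add_mem hz hz') := rfl

theorem cls_sub {k : ℕ} {z z' : (Fin k → G) →₀ M} (hz : z ∈ cyc ρ k) (hz' : z' ∈ cyc ρ k) :
    cls ρ z hz - cls ρ z' hz' = cls ρ (z - z') (sub_mem hz hz') := rfl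

theorem cls_eq {k : ℕ} {z z' : (Fin k → G) →₀ M} (hz : z ∈ cyc ρ k) (hz' : z' ∈ cyc ρ k) :
    cls ρ z hz = cls ρ z' hz' ↔ ∃ y, dd ρ k y = z - z' := by
  rw [← sub_eq_zero, cls_sub, cls_eq_zero]

end machine

/-- Morphism of pairs (group, module). -/
structure RMor {G M G' M' : Type} [Group G] [AddCommGroup M] [Group G'] [AddCommGroup M']
    (ρ : G →* AddMonoid.End M) (ρ' : G' →* AddMonoid.End M') where
  φ : G →* G'
  f : M →+ M'
  comm : ∀ g m, f (ρ g m) = ρ' (φ g) (f m)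

section mor
variable {G M G' M' G'' M'' : Type} [Group G] [AddCommGroup M] [Group G'] [AddCommGroup M']
  [Group G''] [AddCommGroup M'']
  {ρ : G →* AddMonoid.End M} {ρ' : G' →* AddMonoid.End M'} {ρ'' : G'' →* AddMonoid.End M''}

def RMor.comp (b : RMor ρ' ρ'') (a : RMor ρ ρ') : RMor ρ ρ'' where
  φ := b.φ.comp a.φ
  f := b.f.comp a.f
  comm g m := by simp [a.comm, b.comm]

/-- identity -/
def RMor.id (ρ : G →* AddMonoid.End M) : RMor ρ ρ where
  φ := MonoidHom.id G
  f := AddMonoidHom.id M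
  comm _ _ := rfl

/-- chain map -/
noncomputable def cmap (φ : G → G') (f : M →+ M') (q : ℕ) :
    ((Fin q → G) →₀ M) →+ ((Fin q → G') →₀ M') :=
  Finsupp.liftAddHom fun g => (singleAddHom (φ ∘ g)).comp f

@[simp] theorem cmap_single (φ : G → G') (f : M →+ M') (q : ℕ) (g : Fin q → G) (m : M) :
    cmap φ f q (single g m) = single (φ ∘ g) (f m) := by
  simp [cmap]

theorem dd_cmap (a : RMor ρ ρ') (q : ℕ) (x : (Fin (q + 1) → G) →₀ M) :
    dd ρ' q (cmap a.φ a.f (q + 1) x) = cmap a.φ a.f q (dd ρ q x) := by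
  induction x using Finsupp.induction_linear with
  | zero => simp
  | add x y hx hy => simp only [map_add, hx, hy]
  | single g m =>
    simp only [cmap_single, dd_single, map_add, map_sum, map_zsmul, a.comm, Function.comp_apply,
      map_inv, Fin.comp_contractNth _ _ (map_mul a.φ)]
    rfl

theorem cmap_mem_cyc (a : RMor ρ ρ') {q : ℕ} {x : (Fin q → G) →₀ M} (hx : x ∈ cyc ρ q) :
    cmap a.φ a.f q x ∈ cyc ρ' q := by
  cases q with
  | zero => trivial
  | succ q => rw [mem_cyc_succ, dd_cmap, (mem_cyc_succ ρ).1 hx, map_zero]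

/-- Induced map on homology. -/
noncomputable def Hmap (a : RMor ρ ρ') (q : ℕ) : HH ρ q →+ HH ρ' q :=
  QuotientAddGroup.map _ _
    (((cmap a.φ a.f q).comp (cyc ρ q).subtype).codRestrict (cyc ρ' q)
      (fun x => cmap_mem_cyc a x.2)) (by
    rintro ⟨x, hx⟩ ⟨y, hy⟩
    exact ⟨cmap a.φ a.f (q + 1) y, by rw [dd_cmap, hy]; rfl⟩)

theorem Hmap_cls (a : RMor ρ ρ') {q : ℕ} {x : (Fin q → G) →₀ M} (hx : x ∈ cyc ρ q) :
    Hmap a q (cls ρ x hx) = cls ρ' (cmap a.φ a.f q x) (cmap_mem_cyc a hx) := rfl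

theorem cmap_comp (φ' : G' → G'') (f' : M' →+ M'') (φ : G → G') (f : M →+ M') (q : ℕ)
    (x : (Fin q → G) →₀ M) :
    cmap φ' f' q (cmap φ f q x) = cmap (φ' ∘ φ) (f'.comp f) q x := by
  induction x using Finsupp.induction_linear with
  | zero => simp
  | add x y hx hy => simp only [map_add, hx, hy]
  | single g m => simp [Function.comp_assoc]

theorem cmap_id (q : ℕ) (x : (Fin q → G) →₀ M) :
    cmap (fun g : G => g) (AddMonoidHom.id M) q x = x := by
  induction x using Finsupp.induction_linear with
  | zero => simp
  | add x y hx hy => simp only [map_add, hx, hy]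
  | single g m => simp; rfl

theorem Hmap_comp (b : RMor ρ' ρ'') (a : RMor ρ ρ') (q : ℕ) (x : HH ρ q) :
    Hmap b q (Hmap a q x) = Hmap (b.comp a) q x := by
  obtain ⟨z, hz, rfl⟩ := cls_surj ρ x
  simp only [Hmap_cls]
  congr 1
  exact cmap_comp _ _ _ _ _ _

theorem RMor.ext' {a b : RMor ρ ρ'} (h1 : ∀ g, a.φ g = b.φ g) (h2 : ∀ m, a.f m = b.f m) :
    a = b := by
  cases a; cases b
  obtain rfl := MonoidHom.ext h1
  obtain rfl := AddMonoidHom.ext h2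
  rfl

theorem Hmap_id' (a : RMor ρ ρ) (h1 : ∀ g, a.φ g = g) (h2 : ∀ m, a.f m = m) (q : ℕ)
    (x : HH ρ q) : Hmap a q x = x := by
  obtain ⟨z, hz, rfl⟩ := cls_surj ρ x
  simp only [Hmap_cls]
  congr 1
  have e1 : (a.φ : G → G) = fun g => g := funext h1
  have e2 : a.f = AddMonoidHom.id M := AddMonoidHom.ext h2
  rw [e1, e2, cmap_id]

end mor

end Stmt3

namespace Stmt3
open Finsupp
set_option linter.all false
set_option linter.unusedSectionVars false
set_option linter.unusedSimpArgs false
set_option linter.unusedVariables false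

/-- Short exact sequence of modules over a fixed group. -/
structure SES {G A B C : Type} [Group G] [AddCommGroup A] [AddCommGroup B] [AddCommGroup C]
    (ρA : G →* AddMonoid.End A) (ρB : G →* AddMonoid.End B) (ρC : G →* AddMonoid.End C) where
  f : A →+ B
  g : B →+ C
  fe : ∀ h a, f (ρA h a) = ρB h (f a)
  ge : ∀ h b, g (ρB h b) = ρC h (g b)
  inj : Function.Injective f
  surj : Function.Surjective g
  exact : ∀ b, g b = 0 → ∃ a, f a = b
  gf : ∀ a, g (f a) = 0

section ses
variable {G A B C : Type} [Group G] [AddCommGroup A] [AddCommGroup B] [AddCommGroup C]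
    {ρA : G →* AddMonoid.End A} {ρB : G →* AddMonoid.End B} {ρC : G →* AddMonoid.End C}

/-- first map -/
def SES.mf (S : SES ρA ρB ρC) : RMor ρA ρB := ⟨MonoidHom.id G, S.f, S.fe⟩
/-- second map -/
def SES.mg (S : SES ρA ρB ρC) : RMor ρB ρC := ⟨MonoidHom.id G, S.g, S.ge⟩

theorem mem_cyc_zero (ρ : G →* AddMonoid.End A) (z : (Fin 0 → G) →₀ A) : z ∈ cyc ρ 0 := trivial

theorem cmap_apply (f : A →+ B) (q : ℕ) (x : (Fin q → G) →₀ A) (c : Fin q → G) :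
    cmap (MonoidHom.id G) f q x c = f (x c) := by
  induction x using Finsupp.induction_linear with
  | zero => simp
  | add x y hx hy => simp only [map_add, hx, hy, Finsupp.add_apply]
  | single g m =>
    classical
    rw [cmap_single]
    have : (⇑(MonoidHom.id G) ∘ g) = g := rfl
    rw [this, single_apply, single_apply]
    split_ifs <;> simp

theorem SES.cf_inj (S : SES ρA ρB ρC) (q : ℕ) {x y : (Fin q → G) →₀ A}
    (h : cmap (MonoidHom.id G) S.f q x = cmap (MonoidHom.id G) S.f q y) : x = y := by
  ext c
  apply S.inj
  rw [← cmap_apply, ← cmap_apply, h]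

theorem SES.cg_surj (S : SES ρA ρB ρC) (q : ℕ) (z : (Fin q → G) →₀ C) :
    ∃ y, cmap (MonoidHom.id G) S.g q y = z := by
  induction z using Finsupp.induction_linear with
  | zero => exact ⟨0, by simp⟩
  | add x y hx hy =>
    obtain ⟨a, rfl⟩ := hx
    obtain ⟨b, rfl⟩ := hy
    exact ⟨a + b, map_add _ _ _⟩
  | single g m =>
    obtain ⟨b, rfl⟩ := S.surj m
    exact ⟨single g b, by rw [cmap_single]; rfl⟩

theorem SES.c_exact (S : SES ρA ρB ρC) (q : ℕ) (y : (Fin q → G) →₀ B)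
    (h : cmap (MonoidHom.id G) S.g q y = 0) :
    ∃ x, cmap (MonoidHom.id G) S.f q x = y := by
  classical
  have h1 : ∀ c, S.g (y c) = 0 := fun c => by rw [← cmap_apply, h]; rfl
  choose s hs using S.exact
  let t : B → A := fun b => if hb : S.g b = 0 then s b hb else 0
  have ht : ∀ b, S.g b = 0 → S.f (t b) = b := fun b hb => by simp [t, hb, hs]
  have t0 : t 0 = 0 := by
    apply S.inj
    rw [ht 0 (map_zero _), map_zero]
  refine ⟨Finsupp.mapRange t t0 y, ?_⟩
  ext c
  rw [cmap_apply, Finsupp.mapRange_apply, ht _ (h1 c)]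

theorem SES.c_gf (S : SES ρA ρB ρC) (q : ℕ) (x : (Fin q → G) →₀ A) :
    cmap (MonoidHom.id G) S.g q (cmap (MonoidHom.id G) S.f q x) = 0 := by
  ext c
  rw [cmap_apply, cmap_apply, S.gf]; rfl

theorem SES.ddF (S : SES ρA ρB ρC) (q : ℕ) (x : (Fin (q + 1) → G) →₀ A) :
    dd ρB q (cmap (MonoidHom.id G) S.f (q + 1) x) = cmap (MonoidHom.id G) S.f q (dd ρA q x) :=
  dd_cmap S.mf q x
theorem SES.ddG (S : SES ρA ρB ρC) (q : ℕ) (x : (Fin (q + 1) → G) →₀ B) :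
    dd ρC q (cmap (MonoidHom.id G) S.g (q + 1) x) = cmap (MonoidHom.id G) S.g q (dd ρB q x) :=
  dd_cmap S.mg q x

/-- The connecting homomorphism as a relation. -/
def SES.D (S : SES ρA ρB ρC) (i : ℕ) (x : HH ρC (i + 1)) (y : HH ρA i) : Prop :=
  ∃ (b : (Fin (i + 1) → G) →₀ B) (a : (Fin i → G) →₀ A) (ha : a ∈ cyc ρA i)
    (hb : cmap (MonoidHom.id G) S.g (i + 1) b ∈ cyc ρC (i + 1)),
    x = cls ρC _ hb ∧ y = cls ρA a ha ∧ dd ρB i b = cmap (MonoidHom.id G) S.f i a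

theorem SES.D_cyc (S : SES ρA ρB ρC) {i : ℕ} {b : (Fin (i + 1) → G) →₀ B} {a : (Fin i → G) →₀ A}
    (h : dd ρB i b = cmap (MonoidHom.id G) S.f i a) : a ∈ cyc ρA i := by
  cases i with
  | zero => trivial
  | succ i =>
    apply S.cf_inj
    rw [← S.ddF, ← h, dd_dd, map_zero]

theorem SES.D_ex (S : SES ρA ρB ρC) {i : ℕ} (x : HH ρC (i + 1)) : ∃ y, S.D i x y := by
  obtain ⟨z, hz, rfl⟩ := cls_surj ρC x
  obtain ⟨b, rfl⟩ := S.cg_surj _ z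
  obtain ⟨a, ha⟩ := S.c_exact i (dd ρB i b) (by rw [← S.ddG]; exact hz)
  exact ⟨cls ρA a (S.D_cyc ha.symm), b, a, S.D_cyc ha.symm, hz, rfl, rfl, ha.symm⟩

theorem SES.D_F (S : SES ρA ρB ρC) {i : ℕ} {x : HH ρC (i + 1)} {y : HH ρA i} (h : S.D i x y) :
    Hmap S.mf i y = 0 := by
  obtain ⟨b, a, ha, hb, rfl, rfl, h⟩ := h
  rw [Hmap_cls, cls_eq_zero]
  exact ⟨b, h⟩

theorem SES.F_D (S : SES ρA ρB ρC) {i : ℕ} {y : HH ρA i} (h : Hmap S.mf i y = 0) :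
    ∃ x, S.D i x y := by
  obtain ⟨a, ha, rfl⟩ := cls_surj ρA y
  rw [Hmap_cls, cls_eq_zero] at h
  obtain ⟨b, hb⟩ := h
  have : cmap (MonoidHom.id G) S.g (i + 1) b ∈ cyc ρC (i + 1) := by
    rw [mem_cyc_succ, S.ddG, hb]
    exact S.c_gf i a
  exact ⟨cls ρC _ this, b, a, ha, this, rfl, rfl, hb⟩

theorem SES.D_zero (S : SES ρA ρB ρC) {i : ℕ} {x : HH ρC (i + 1)} (h : S.D i x 0) :
    ∃ b, Hmap S.mg (i + 1) b = x := by
  obtain ⟨b, a, ha, hb, rfl, h0, h⟩ := h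
  obtain ⟨w, hw⟩ := (cls_eq_zero ρA ha).1 h0.symm
  have hc : b - cmap (MonoidHom.id G) S.f (i + 1) w ∈ cyc ρB (i + 1) := by
    rw [mem_cyc_succ, map_sub, h, S.ddF, hw, sub_self]
  refine ⟨cls ρB _ hc, ?_⟩
  rw [Hmap_cls]
  congr 1
  have e : cmap (MonoidHom.id G) S.g (i + 1) (b - cmap (MonoidHom.id G) S.f (i + 1) w)
      = cmap (MonoidHom.id G) S.g (i + 1) b := by rw [map_sub, S.c_gf, sub_zero]
  exact e

theorem SES.D_G (S : SES ρA ρB ρC) {i : ℕ} {w : HH ρB (i + 1)} {y : HH ρA i}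
    (h : S.D i (Hmap S.mg (i + 1) w) y) : y = 0 := by
  obtain ⟨z, hz, rfl⟩ := cls_surj ρB w
  obtain ⟨b, a, ha, hb, h1, rfl, h⟩ := h
  rw [Hmap_cls] at h1
  obtain ⟨c, hc⟩ := (cls_eq _ _ _).1 h1
  obtain ⟨e, rfl⟩ := S.cg_surj _ c
  rw [S.ddG] at hc
  have : cmap (MonoidHom.id G) S.g (i + 1) (dd ρB (i + 1) e - (z - b)) = 0 := by
    rw [map_sub, hc, map_sub]; exact sub_self _
  obtain ⟨v, hv⟩ := S.c_exact _ _ this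
  rw [cls_eq_zero]
  refine ⟨v, S.cf_inj _ ?_⟩
  rw [← S.ddF, hv, map_sub, map_sub, dd_dd, (mem_cyc_succ _).1 hz, h]
  simp

theorem SES.D_sub (S : SES ρA ρB ρC) {i : ℕ} {x x' : HH ρC (i + 1)} {y y' : HH ρA i}
    (h : S.D i x y) (h' : S.D i x' y') : S.D i (x - x') (y - y') := by
  obtain ⟨b, a, ha, hb, rfl, rfl, h⟩ := h
  obtain ⟨b', a', ha', hb', rfl, rfl, h'⟩ := h'
  refine ⟨b - b', a - a', sub_mem ha ha', by rw [map_sub]; exact sub_mem hb hb', ?_, rfl, ?_⟩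
  · rw [cls_sub]; congr 1; exact (map_sub _ _ _).symm
  · rw [map_sub, h, h', map_sub]

theorem SES.D_uniq (S : SES ρA ρB ρC) {i : ℕ} {x : HH ρC (i + 1)} {y y' : HH ρA i}
    (h : S.D i x y) (h' : S.D i x y') : y = y' := by
  have := S.D_sub h h'
  rw [sub_self, ← map_zero (Hmap S.mg (i + 1))] at this
  exact sub_eq_zero.1 (S.D_G this)

theorem SES.F_G (S : SES ρA ρB ρC) {i : ℕ} {w : HH ρB i}
    (h : Hmap S.mg i w = 0) : ∃ y, Hmap S.mf i y = w := by
  obtain ⟨z, hz, rfl⟩ := cls_surj ρB w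
  rw [Hmap_cls, cls_eq_zero] at h
  obtain ⟨c, hc⟩ := h
  obtain ⟨e, rfl⟩ := S.cg_surj _ c
  rw [S.ddG] at hc
  have : cmap (MonoidHom.id G) S.g i (z - dd ρB i e) = 0 := by
    rw [map_sub, hc]; exact sub_self _
  obtain ⟨v, hv⟩ := S.c_exact _ _ this
  have hvc : v ∈ cyc ρA i := by
    cases i with
    | zero => trivial
    | succ i =>
      apply S.cf_inj
      rw [← S.ddF, hv, map_sub, dd_dd, (mem_cyc_succ _).1 hz]
      simp
  refine ⟨cls ρA v hvc, ?_⟩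
  rw [Hmap_cls, cls_eq]
  refine ⟨-e, ?_⟩
  have : cmap (S.mf.φ) S.mf.f i v = z - dd ρB i e := hv
  rw [this, map_neg]; abel

theorem SES.G_F (S : SES ρA ρB ρC) {i : ℕ} (y : HH ρA i) : Hmap S.mg i (Hmap S.mf i y) = 0 := by
  obtain ⟨z, hz, rfl⟩ := cls_surj ρA y
  rw [Hmap_cls, Hmap_cls, cls_eq_zero]
  refine ⟨0, ?_⟩
  rw [map_zero]
  exact (S.c_gf i z).symm

theorem SES.G_surj0 (S : SES ρA ρB ρC) (x : HH ρC 0) : ∃ w, Hmap S.mg 0 w = x := by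
  obtain ⟨z, hz, rfl⟩ := cls_surj ρC x
  obtain ⟨b, rfl⟩ := S.cg_surj _ z
  exact ⟨cls ρB b (mem_cyc_zero _ _), rfl⟩

variable {G' A' B' C' : Type} [Group G'] [AddCommGroup A'] [AddCommGroup B'] [AddCommGroup C']
    {ρA' : G' →* AddMonoid.End A'} {ρB' : G' →* AddMonoid.End B'} {ρC' : G' →* AddMonoid.End C'}

structure SES.Mor (S : SES ρA ρB ρC) (S' : SES ρA' ρB' ρC') where
  a : RMor ρA ρA'
  b : RMor ρB ρB'
  c : RMor ρC ρC'
  hφa : ∀ g, a.φ g = b.φ g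
  hφc : ∀ g, c.φ g = b.φ g
  hf : ∀ x, b.f (S.f x) = S'.f (a.f x)
  hg : ∀ x, c.f (S.g x) = S'.g (b.f x)

theorem SES.Mor.hF {S : SES ρA ρB ρC} {S' : SES ρA' ρB' ρC'} (m : S.Mor S') (i : ℕ)
    (x : HH ρA i) : Hmap m.b i (Hmap S.mf i x) = Hmap S'.mf i (Hmap m.a i x) := by
  rw [Hmap_comp, Hmap_comp]
  congr 1
  congr 1
  exact RMor.ext' (fun g => (m.hφa g).symm) m.hf

theorem SES.Mor.hG {S : SES ρA ρB ρC} {S' : SES ρA' ρB' ρC'} (m : S.Mor S') (i : ℕ)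
    (x : HH ρB i) : Hmap m.c i (Hmap S.mg i x) = Hmap S'.mg i (Hmap m.b i x) := by
  rw [Hmap_comp, Hmap_comp]
  congr 1
  congr 1
  exact RMor.ext' (fun g => (m.hφc g)) m.hg

theorem SES.Mor.D {S : SES ρA ρB ρC} {S' : SES ρA' ρB' ρC'} (m : S.Mor S') {i : ℕ}
    {x : HH ρC (i + 1)} {y : HH ρA i} (h : S.D i x y) :
    S'.D i (Hmap m.c (i + 1) x) (Hmap m.a i y) := by
  obtain ⟨b, a, ha, hb, rfl, rfl, h⟩ := h
  have e1 : cmap (m.c).φ (m.c).f (i + 1) (cmap (MonoidHom.id G) S.g (i + 1) b)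
      = cmap (MonoidHom.id G') S'.g (i + 1) (cmap m.b.φ m.b.f (i + 1) b) := by
    rw [cmap_comp, cmap_comp]
    have h1 : (m.c.φ : G → G') ∘ (MonoidHom.id G) = (MonoidHom.id G') ∘ m.b.φ := by
      funext g; exact m.hφc g
    have h2 : m.c.f.comp S.g = S'.g.comp m.b.f := AddMonoidHom.ext m.hg
    rw [h1, h2]
  have e2 : cmap (m.b).φ (m.b).f i (cmap (MonoidHom.id G) S.f i a)
      = cmap (MonoidHom.id G') S'.f i (cmap m.a.φ m.a.f i a) := by
    rw [cmap_comp, cmap_comp]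
    have h1 : (m.b.φ : G → G') ∘ (MonoidHom.id G) = (MonoidHom.id G') ∘ m.a.φ := by
      funext g; exact (m.hφa g).symm
    have h2 : m.b.f.comp S.f = S'.f.comp m.a.f := AddMonoidHom.ext m.hf
    rw [h1, h2]
  refine ⟨cmap m.b.φ m.b.f (i + 1) b, cmap m.a.φ m.a.f i a, cmap_mem_cyc _ ha, ?_, ?_, rfl, ?_⟩
  · rw [← e1]; exact cmap_mem_cyc _ hb
  · rw [Hmap_cls]; congr 1
  · rw [dd_cmap, h, e2]

end ses

section h0
variable {G M : Type} [Group G] [AddCommGroup M] (ρ : G →* AddMonoid.End M)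

/-- class of an element in `H_0` -/
noncomputable def h0 (m : M) : HH ρ 0 := cls ρ (single (fun i => i.elim0) m) (mem_cyc_zero _ _)

theorem h0_surj (x : HH ρ 0) : ∃ m, x = h0 ρ m := by
  obtain ⟨z, hz, rfl⟩ := cls_surj ρ x
  refine ⟨z (fun i => i.elim0), ?_⟩
  unfold h0
  congr 1
  refine Finsupp.ext fun c => ?_
  obtain rfl : c = fun i => i.elim0 := Subsingleton.elim _ _
  simp

theorem h0_add (m m' : M) : h0 ρ (m + m') = h0 ρ m + h0 ρ m' := by
  unfold h0; rw [cls_add]; congr 1; exact single_add _ _ _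

theorem dd_zero_single (g : Fin 1 → G) (m : M) :
    dd ρ 0 (single g m) = single (fun i => i.elim0) (ρ (g 0)⁻¹ m - m) := by
  rw [dd_single]
  simp only [Fin.sum_univ_one, single_sub]
  refine Finsupp.ext fun c => ?_
  obtain rfl : c = fun i => i.elim0 := Subsingleton.elim _ _
  simp [Finsupp.single_apply, sub_eq_add_neg, Subsingleton.elim _ (fun i : Fin 0 => (i.elim0 : G))]

/-- the hom version -/
noncomputable def h0Hom : M →+ HH ρ 0 :=
  AddMonoidHom.mk' (h0 ρ) (h0_add ρ)

theorem h0_act (g : G) (m : M) : h0 ρ (ρ g m) = h0 ρ m := by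
  unfold h0
  rw [cls_eq]
  refine ⟨single (fun _ => g⁻¹) m, ?_⟩
  rw [dd_zero_single]; simp

/-- functionals on `M` invariant under `G` kill boundaries -/
theorem h0_eq_zero {m : M} (h : h0 ρ m = 0) {Q : Type} [AddCommGroup Q] (Φ : M →+ Q)
    (hΦ : ∀ g m, Φ (ρ g m) = Φ m) : Φ m = 0 := by
  unfold h0 at h
  rw [cls_eq_zero] at h
  obtain ⟨y, hy⟩ := h
  have : ∀ y, Φ (dd ρ 0 y (fun i => i.elim0)) = 0 := by
    intro y
    induction y using Finsupp.induction_linear with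
    | zero => simp
    | add x y hx hy => simp only [map_add, hx, hy, Finsupp.add_apply, add_zero]
    | single g m => rw [dd_zero_single]; simp [hΦ]
  have := this y
  rw [hy] at this
  simpa using this

theorem Hmap_h0 {G' M' : Type} [Group G'] [AddCommGroup M'] {ρ' : G' →* AddMonoid.End M'}
    (a : RMor ρ ρ') (m : M) : Hmap a 0 (h0 ρ m) = h0 ρ' (a.f m) := by
  unfold h0
  rw [Hmap_cls]
  congr 1
  rw [cmap_single]
  congr 1
  funext i; exact i.elim0

end h0

end Stmt3

namespace Stmt3
open Finsupp
set_option linter.all false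
set_option linter.unusedSectionVars false
set_option linter.unusedSimpArgs false
set_option linter.unusedVariables false

section ind
variable {P X N : Type} [Group P] [AddCommGroup N]

theorem rep_mul (ρ : P →* AddMonoid.End N) (g h : P) (n : N) : ρ (g * h) n = ρ g (ρ h n) := by
  rw [map_mul]; rfl
theorem rep_one (ρ : P →* AddMonoid.End N) (n : N) : ρ 1 n = n := by
  rw [map_one]; rfl
theorem rep_inv (ρ : P →* AddMonoid.End N) (g : P) (n : N) : ρ g⁻¹ (ρ g n) = n := by
  rw [← rep_mul, inv_mul_cancel, rep_one]
theorem rep_inv' (ρ : P →* AddMonoid.End N) (g : P) (n : N) : ρ g (ρ g⁻¹ n) = n := by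
  rw [← rep_mul, mul_inv_cancel, rep_one]

/-- auxiliary map -/
noncomputable def indAux {N' Y : Type} [AddCommGroup N'] (a : X → Y) (t : N →+ N') :
    (X →₀ N) →+ (Y →₀ N') :=
  Finsupp.liftAddHom fun x => (singleAddHom (a x)).comp t

@[simp] theorem indAux_single {N' Y : Type} [AddCommGroup N'] (a : X → Y) (t : N →+ N') (x : X)
    (n : N) : indAux a t (single x n) = single (a x) (t n) := by
  simp [indAux]

/-- Permutation module with twisted coefficients. -/
noncomputable def ind (α : P →* Equiv.Perm X) (τ : P →* AddMonoid.End N) :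
    P →* AddMonoid.End (X →₀ N) where
  toFun p := indAux (α p) (τ p)
  map_one' := by
    refine Finsupp.addHom_ext fun x n => ?_
    refine (indAux_single _ _ _ _).trans ?_
    rw [map_one, map_one]; rfl
  map_mul' p q := by
    refine Finsupp.addHom_ext fun x n => ?_
    refine (indAux_single _ _ _ _).trans ?_
    refine Eq.symm ((congrArg (indAux (α p) (τ p)) (indAux_single _ _ _ _)).trans ?_)
    refine (indAux_single _ _ _ _).trans ?_
    rw [map_mul, map_mul]; rfl

@[simp] theorem ind_single (α : P →* Equiv.Perm X) (τ : P →* AddMonoid.End N) (p : P) (x : X)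
    (n : N) : ind α τ p (single x n) = single (α p x) (τ p n) :=
  indAux_single _ _ _ _

theorem ind_apply (α : P →* Equiv.Perm X) (τ : P →* AddMonoid.End N) (p : P) (x : X)
    (z : X →₀ N) : ind α τ p z (α p x) = τ p (z x) := by
  classical
  induction z using Finsupp.induction_linear with
  | zero => simp
  | add x y hx hy => simp only [map_add, hx, hy, Finsupp.add_apply]
  | single y n =>
    rw [ind_single, single_apply, single_apply]
    simp only [EmbeddingLike.apply_eq_iff_eq]
    split_ifs <;> simp

/-- augmentation -/
noncomputable def aug (X N : Type) [AddCommGroup N] : (X →₀ N) →+ N :=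
  Finsupp.liftAddHom fun _ => AddMonoidHom.id N

@[simp] theorem aug_single (x : X) (n : N) : aug X N (single x n) = n := by simp [aug]

theorem aug_ind (α : P →* Equiv.Perm X) (τ : P →* AddMonoid.End N) (p : P) (z : X →₀ N) :
    aug X N (ind α τ p z) = τ p (aug X N z) := by
  induction z using Finsupp.induction_linear with
  | zero => simp
  | add x y hx hy => simp only [map_add, hx, hy]
  | single y n => simp

/-- restriction to an invariant subgroup -/
def subRep (ρ : P →* AddMonoid.End N) (A : AddSubgroup N) (hA : ∀ g, ∀ m ∈ A, ρ g m ∈ A) :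
    P →* AddMonoid.End A where
  toFun g := ((ρ g).comp A.subtype).codRestrict A (fun x => hA g x x.2)
  map_one' := by ext x; exact rep_one ρ x
  map_mul' g h := by ext x; exact rep_mul ρ g h x

@[simp] theorem subRep_coe (ρ : P →* AddMonoid.End N) (A : AddSubgroup N)
    (hA : ∀ g, ∀ m ∈ A, ρ g m ∈ A) (g : P) (x : A) : ((subRep ρ A hA g x : A) : N) = ρ g x := rfl

variable {M : Type} [AddCommGroup M]

/-- kernel short exact sequence -/
def kerSES (ρ : P →* AddMonoid.End N) (ρ' : P →* AddMonoid.End M) (f : N →+ M)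
    (he : ∀ g n, f (ρ g n) = ρ' g (f n)) (hs : Function.Surjective f) :
    SES (subRep ρ f.ker (fun g m hm => by
      rw [AddMonoidHom.mem_ker] at *; rw [he, hm, map_zero])) ρ ρ' where
  f := f.ker.subtype
  g := f
  fe _ _ := rfl
  ge := he
  inj := Subtype.val_injective
  surj := hs
  exact b hb := ⟨⟨b, hb⟩, rfl⟩
  gf a := a.2

theorem aug_surj [Nonempty X] : Function.Surjective (aug X N) := fun n =>
  ⟨single (Classical.arbitrary X) n, by simp⟩

/-- contracting homotopy -/
noncomputable def hty (α : P →* Equiv.Perm X) (τ : P →* AddMonoid.End N) (σ : X → P) (q : ℕ) :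
    ((Fin q → P) →₀ (X →₀ N)) →+ ((Fin (q + 1) → P) →₀ (X →₀ N)) :=
  Finsupp.liftAddHom fun g => Finsupp.liftAddHom fun x =>
    (singleAddHom (Fin.cons (σ x)⁻¹ g : Fin (q + 1) → P)).comp
      ((ind α τ (σ x)⁻¹).comp (singleAddHom x))

theorem hty_single (α : P →* Equiv.Perm X) (τ : P →* AddMonoid.End N) (σ : X → P) (q : ℕ)
    (g : Fin q → P) (x : X) (n : N) : hty α τ σ q (single g (single x n)) =
      single (Fin.cons (σ x)⁻¹ g : Fin (q + 1) → P) (ind α τ (σ x)⁻¹ (single x n)) := by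
  rw [hty, Finsupp.liftAddHom_apply_single, Finsupp.liftAddHom_apply_single]; rfl

theorem contractNth_zero_cons {q : ℕ} (γ : P) (g : Fin (q + 1) → P) :
    Fin.contractNth 0 (· * ·) (Fin.cons γ g : Fin (q + 2) → P) =
      (Fin.cons (γ * g 0) (fun i => g i.succ) : Fin (q + 1) → P) := by
  funext k
  refine Fin.cases ?_ (fun k => ?_) k
  · rw [Fin.contractNth_apply_of_eq _ _ _ _ rfl]; rfl
  · rw [Fin.contractNth_apply_of_gt _ _ _ _ (by simp)]; rfl

theorem contractNth_succ_cons {q : ℕ} (γ : P) (g : Fin (q + 1) → P) (j : Fin (q + 1)) :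
    Fin.contractNth j.succ (· * ·) (Fin.cons γ g : Fin (q + 2) → P) =
      (Fin.cons γ (Fin.contractNth j (· * ·) g) : Fin (q + 1) → P) := by
  funext k
  refine Fin.cases ?_ (fun k => ?_) k
  · rw [Fin.contractNth_apply_of_lt _ _ _ _ (by simp)]; rfl
  · simp only [Fin.cons_succ]
    rcases lt_trichotomy (k : ℕ) (j : ℕ) with h | h | h
    · rw [Fin.contractNth_apply_of_lt _ _ _ _ h, Fin.contractNth_apply_of_lt _ _ _ _ (by simpa)]
      simp
    · rw [Fin.contractNth_apply_of_eq _ _ _ _ h, Fin.contractNth_apply_of_eq _ _ _ _ (by simpa)]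
      rfl
    · rw [Fin.contractNth_apply_of_gt _ _ _ _ h, Fin.contractNth_apply_of_gt _ _ _ _ (by simpa)]
      rfl

theorem dd_hty (α : P →* Equiv.Perm X) (τ : P →* AddMonoid.End N) (σ : X → P)
    (hσ : ∀ p x, σ (α p x) = p * σ x) (q : ℕ) (z : (Fin (q + 1) → P) →₀ (X →₀ N)) :
    dd (ind α τ) (q + 1) (hty α τ σ (q + 1) z) + hty α τ σ q (dd (ind α τ) q z) = z := by
  induction z using Finsupp.induction_linear with
  | zero => simp
  | add x y hx hy =>
    rw [map_add, map_add, map_add, map_add]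
    nth_rw 3 [← hx]; nth_rw 3 [← hy]
    abel
  | single g m =>
    induction m using Finsupp.induction_linear with
    | zero => simp
    | add x y hx hy =>
      rw [single_add, map_add, map_add, map_add, map_add]
      nth_rw 3 [← hx]; nth_rw 3 [← hy]
      abel
    | single x n =>
      rw [hty_single, dd_single, dd_single, map_add, map_sum, Fin.sum_univ_succ]
      simp only [map_zsmul]
      rw [ind_single α τ (g 0)⁻¹]
      rw [hty_single, hσ]
      have e1 : ((g 0)⁻¹ * σ x)⁻¹ = (σ x)⁻¹ * g 0 := by group
      rw [e1]
      simp only [hty_single, contractNth_zero_cons, contractNth_succ_cons, Fin.cons_zero,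
        Fin.cons_succ, rep_inv]
      have e2 : (ind α τ ((σ x)⁻¹ * g 0)) (single ((α (g 0)⁻¹) x) ((τ (g 0)⁻¹) n))
          = ind α τ (σ x)⁻¹ (single x n) := by
        rw [← ind_single α τ, ← rep_mul]; congr 1; simp
      rw [e2]
      have e3 : ∀ j : Fin (q + 1), ((-1 : ℤ)) ^ (((j.succ : Fin (q + 2)) : ℕ) + 1)
          = - (-1 : ℤ) ^ ((j : ℕ) + 1) := by
        intro j; rw [Fin.val_succ, pow_succ]; ring
      have e4 : ((ind α τ) ((σ x)⁻¹)⁻¹) ((ind α τ (σ x)⁻¹) (single x n)) = single x n :=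
        rep_inv _ _ _
      simp only [e3, neg_smul, Finset.sum_neg_distrib, e4]
      simp
      abel

theorem ind_acyclic (α : P →* Equiv.Perm X) (τ : P →* AddMonoid.End N) (σ : X → P)
    (hσ : ∀ p x, σ (α p x) = p * σ x) (q : ℕ) (x : HH (ind α τ) (q + 1)) : x = 0 := by
  obtain ⟨z, hz, rfl⟩ := cls_surj _ x
  rw [cls_eq_zero]
  have := dd_hty α τ σ hσ q z
  rw [(mem_cyc_succ _).1 hz, map_zero, add_zero] at this
  exact ⟨_, this⟩

variable {G : Type} [Group G]

/-- translation action through a hom -/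
def lm (φ : P →* G) : P →* Equiv.Perm G where
  toFun p := Equiv.mulLeft (φ p)
  map_one' := by ext; simp
  map_mul' p q := by ext; simp [mul_assoc]

@[simp] theorem lm_apply (φ : P →* G) (p : P) (g : G) : lm φ p g = φ p * g := rfl

theorem lm_acyclic (φ : P →* G) (hφ : Function.Injective φ) (τ : P →* AddMonoid.End N)
    (q : ℕ) (x : HH (ind (lm φ) τ) (q + 1)) : x = 0 := by
  classical
  -- choose representatives of right cosets
  let s : Quotient (QuotientGroup.rightRel φ.range) → G := Quotient.out
  have h : ∀ g : G, ∃ p : P, φ p * s (Quotient.mk _ g) = g := by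
    intro g
    have : (QuotientGroup.rightRel φ.range) (s (Quotient.mk _ g)) g := Quotient.mk_out g
    rw [QuotientGroup.rightRel_apply] at this
    obtain ⟨p, hp⟩ := this
    exact ⟨p, by rw [hp]; group⟩
  choose σ hs using h
  refine ind_acyclic (lm φ) τ σ ?_ q x
  intro p g
  apply hφ
  have e : (Quotient.mk (QuotientGroup.rightRel φ.range) (φ p * g)) = Quotient.mk _ g := by
    apply Quotient.sound
    change (QuotientGroup.rightRel φ.range) _ _
    rw [QuotientGroup.rightRel_apply]
    exact ⟨p⁻¹, by simp⟩
  have h1 := hs (φ p * g)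
  have h2 := hs g
  rw [e] at h1
  have : φ (σ (φ p * g)) * s ⟦g⟧ = φ (p * σ g) * s ⟦g⟧ := by
    rw [h1, map_mul, mul_assoc, h2]
  exact mul_right_cancel this

end ind

end Stmt3

namespace Stmt3
open Finsupp
set_option linter.all false
set_option linter.unusedSectionVars false
set_option linter.unusedSimpArgs false
set_option linter.unusedVariables false

section shift
variable {P G N : Type} [Group P] [Group G] [AddCommGroup N]

/-- the kernel of the augmentation as a representation -/
noncomputable def kRep (φ : P →* G) (τ : P →* AddMonoid.End N) :
    P →* AddMonoid.End (aug G N).ker :=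
  subRep (ind (lm φ) τ) (aug G N).ker (fun g m hm => by
      rw [AddMonoidHom.mem_ker] at *; rw [aug_ind, hm, map_zero])

/-- the dimension shifting sequence -/
noncomputable def shSES (φ : P →* G) (τ : P →* AddMonoid.End N) :
    SES (kRep φ τ) (ind (lm φ) τ) τ :=
  kerSES (ind (lm φ) τ) τ (aug G N) (aug_ind _ _) aug_surj

variable {P' G' N' : Type} [Group P'] [Group G'] [AddCommGroup N']

theorem aug_indAux (θ : G → G') (f : N →+ N') (x : G →₀ N) :
    aug G' N' (indAux θ f x) = f (aug G N x) := by
  induction x using Finsupp.induction_linear with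
  | zero => simp
  | add x y hx hy => simp only [map_add, hx, hy]
  | single y n => simp

variable {φ : P →* G} {φ' : P' →* G'} {τ : P →* AddMonoid.End N} {τ' : P' →* AddMonoid.End N'}

noncomputable def indMor (a : RMor τ τ') (θ : G → G') (hθ : ∀ p g, θ (φ p * g) = φ' (a.φ p) * θ g) :
    RMor (ind (lm φ) τ) (ind (lm φ') τ') where
  φ := a.φ
  f := indAux θ a.f
  comm p x := by
    induction x using Finsupp.induction_linear with
    | zero => simp
    | add x y hx hy => simp only [map_add, hx, hy]
    | single y n => simp [hθ, a.comm]

/-- induced morphism on kernels -/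
noncomputable def kMor (a : RMor τ τ') (θ : G → G') (hθ : ∀ p g, θ (φ p * g) = φ' (a.φ p) * θ g) :
    RMor (kRep φ τ) (kRep φ' τ') where
  φ := a.φ
  f := ((indAux θ a.f).comp (aug G N).ker.subtype).codRestrict (aug G' N').ker (fun x => by
    have := x.2
    rw [AddMonoidHom.mem_ker] at *
    simp only [AddMonoidHom.comp_apply]
    rw [aug_indAux]
    exact (congrArg _ this).trans (map_zero _))
  comm p x := Subtype.ext ((indMor a θ hθ).comm p x.1)

/-- induced morphism of sequences -/
noncomputable def shMor (a : RMor τ τ') (θ : G → G') (hθ : ∀ p g, θ (φ p * g) = φ' (a.φ p) * θ g) :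
    (shSES φ τ).Mor (shSES φ' τ') where
  a := kMor a θ hθ
  b := indMor a θ hθ
  c := a
  hφa _ := rfl
  hφc _ := rfl
  hf _ := rfl
  hg x := (aug_indAux θ a.f x).symm

theorem sh_inj (hφ : Function.Injective φ) {i : ℕ} {x x' : HH τ (i + 1)} {y : HH (kRep φ τ) i}
    (h : (shSES φ τ).D i x y) (h' : (shSES φ τ).D i x' y) : x = x' := by
  have := (shSES φ τ).D_sub h h'
  rw [sub_self] at this
  obtain ⟨b, hb⟩ := SES.D_zero _ this
  rw [lm_acyclic φ hφ τ i b, map_zero] at hb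
  exact sub_eq_zero.1 hb.symm

end shift

theorem Hmap_conj (i : ℕ) : ∀ {G M G' M' : Type} [Group G] [AddCommGroup M] [Group G']
    [AddCommGroup M'] {ρ : G →* AddMonoid.End M} {ρ' : G' →* AddMonoid.End M'}
    (a a' : RMor ρ ρ') (g : G') (h1 : ∀ p, a'.φ p = g * a.φ p * g⁻¹)
    (h2 : ∀ m, a'.f m = ρ' g (a.f m)) (x : HH ρ i), Hmap a i x = Hmap a' i x := by
  induction i with
  | zero =>
    intro G M G' M' _ _ _ _ ρ ρ' a a' g h1 h2 x
    obtain ⟨m, rfl⟩ := h0_surj ρ x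
    rw [Hmap_h0, Hmap_h0, h2, h0_act]
  | succ i ih =>
    intro G M G' M' _ _ _ _ ρ ρ' a a' g h1 h2 x
    let m := shMor (φ := MonoidHom.id G) (φ' := MonoidHom.id G') a a.φ (fun p g => by simp)
    let m' := shMor (φ := MonoidHom.id G) (φ' := MonoidHom.id G') a' (fun h => g * a.φ h)
      (fun p h => by simp [h1, mul_assoc])
    obtain ⟨y, hy⟩ := (shSES (MonoidHom.id G) ρ).D_ex x
    have e1 := m.D hy
    have e2 := m'.D hy
    have e3 : Hmap m.a i y = Hmap m'.a i y := by
      refine ih m.a m'.a g h1 ?_ y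
      intro z
      apply Subtype.ext
      change indAux _ _ (z.1) = (ind _ _ g) (indAux _ _ z.1)
      generalize z.1 = w
      induction w using Finsupp.induction_linear with
      | zero => simp
      | add x y hx hy => simp only [map_add, hx, hy]
      | single y n => simp [h2]
    rw [e3] at e1
    exact sh_inj (fun _ _ h => h) e1 e2

section shapiro
variable {P N G M : Type} [Group P] [AddCommGroup N] [Group G] [AddCommGroup M]
    {τ : P →* AddMonoid.End N} {ρ : G →* AddMonoid.End M}

/-- Data exhibiting `M` as induced from `N`. -/
structure Sh (a : RMor τ ρ) (r : M →+ N) : Prop where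
  inj : Function.Injective a.φ
  rj : ∀ n, r (a.f n) = n
  r0 : ∀ g, g ∉ a.φ.range → ∀ n, r (ρ g (a.f n)) = 0
  gen : ∀ m, m ∈ AddSubgroup.closure {m | ∃ g n, m = ρ g (a.f n)}

theorem Sh.dec {a : RMor τ ρ} {r : M →+ N} (h : Sh a r) :
    ∃ c : M →+ (G →₀ N), (∀ m, m = (c m).sum fun t n => ρ t (a.f n)) ∧
      (∀ m t, c m t = 0 ∨ c m t = r (ρ t⁻¹ m)) ∧
      (∀ g n, ∃ t p, g = t * a.φ p ∧ c (ρ g (a.f n)) = single t (τ p n)) := by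
  classical
  let s : G ⧸ a.φ.range → G := Quotient.out
  have hs : ∀ g : G, ∃ p : P, s (QuotientGroup.mk g) * a.φ p = g := by
    intro g
    obtain ⟨⟨q, p, rfl⟩, hq⟩ := QuotientGroup.mk_out_eq_mul a.φ.range g
    refine ⟨p⁻¹, ?_⟩
    have : s (QuotientGroup.mk g) = g * a.φ p := hq
    rw [this]; simp
  choose p hp using hs
  let e : M → G ⧸ a.φ.range → N := fun m q => r (ρ (s q)⁻¹ m)
  have key : ∀ g n q, e (ρ g (a.f n)) q = if q = QuotientGroup.mk g then τ (p g) n else 0 := by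
    intro g n q
    have e1 : e (ρ g (a.f n)) q = r (ρ ((s q)⁻¹ * s (QuotientGroup.mk g)) (a.f (τ (p g) n))) := by
      simp only [e]
      rw [a.comm, ← rep_mul, ← rep_mul, mul_assoc, hp]
    rw [e1]
    split_ifs with hq
    · rw [hq, inv_mul_cancel, rep_one, h.rj]
    · apply h.r0
      intro hmem
      apply hq
      have := QuotientGroup.eq.2 hmem
      have e2 : ∀ q, (QuotientGroup.mk (s q) : G ⧸ a.φ.range) = q := fun q => Quotient.out_eq q
      rwa [e2, e2] at this
  have fin : ∀ m, (Function.support (e m)).Finite := by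
    intro m
    induction h.gen m using AddSubgroup.closure_induction with
    | mem x hx =>
      obtain ⟨g, n, rfl⟩ := hx
      refine Set.Finite.subset (Set.finite_singleton (QuotientGroup.mk g)) ?_
      intro q hq
      by_contra hne
      apply hq
      rw [key, if_neg (by simpa using hne)]
    | zero => convert Set.finite_empty; ext q; simp [e]
    | add x y _ _ hx hy =>
      refine (hx.union hy).subset ?_
      intro q hq
      by_contra hne
      simp only [Set.mem_union, Function.mem_support, not_or, not_not] at hne
      apply hq
      have : e (x + y) q = e x q + e y q := by simp [e]
      rw [this, hne.1, hne.2, add_zero]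
    | neg x _ hx =>
      convert hx using 1
      ext q
      simp [e]
  let c0 : M →+ (G ⧸ a.φ.range →₀ N) := AddMonoidHom.mk' (fun m => Finsupp.ofSupportFinite (e m) (fin m))
    (by intro x y; ext q; simp [e, Finsupp.ofSupportFinite_coe])
  have c0a : ∀ m q, c0 m q = e m q := fun m q => rfl
  have c0s : ∀ g n, c0 (ρ g (a.f n)) = single (QuotientGroup.mk g) (τ (p g) n) := by
    intro g n
    ext q
    rw [c0a, key, single_apply]
    simp only [eq_comm]
  refine ⟨(indAux s (AddMonoidHom.id N)).comp c0, ?_, ?_, ?_⟩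
  · intro m
    have hz : ∀ t : G, ρ t (a.f 0) = 0 := fun t => by simp
    have ha : ∀ (t : G) (x y : N), ρ t (a.f (x + y)) = ρ t (a.f x) + ρ t (a.f y) := fun t => by simp
    let S : (G →₀ N) →+ M := Finsupp.liftAddHom fun t => (ρ t : M →+ M).comp a.f
    have hS : ∀ x, (x.sum fun t n => ρ t (a.f n)) = S x := fun x => rfl
    simp only [hS]
    have hS1 : ∀ t n, S (single t n) = ρ t (a.f n) := fun t n => by
      rw [← hS, Finsupp.sum_single_index (hz t)]
    induction h.gen m using AddSubgroup.closure_induction with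
    | mem x hx =>
      obtain ⟨g, n, rfl⟩ := hx
      simp only [AddMonoidHom.comp_apply]
      rw [c0s, indAux_single, hS1]
      simp only [AddMonoidHom.id_apply]
      rw [a.comm, ← rep_mul, hp]
    | zero => simp
    | add x y _ _ hx hy => rw [map_add, map_add, ← hx, ← hy]
    | neg x _ hx => rw [map_neg, map_neg, ← hx]
  · intro m t
    by_cases ht : ∃ q, s q = t
    · right
      obtain ⟨q, rfl⟩ := ht
      have sinj : Function.Injective s := Quotient.out_injective
      have : ∀ z : G ⧸ a.φ.range →₀ N, indAux s (AddMonoidHom.id N) z (s q) = z q := by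
        intro z
        induction z using Finsupp.induction_linear with
        | zero => simp
        | add x y hx hy => simp only [map_add, hx, hy, Finsupp.add_apply]
        | single y n => rw [indAux_single, single_apply, single_apply]; simp [sinj.eq_iff]
      exact this _
    · left
      have : ∀ z : G ⧸ a.φ.range →₀ N, indAux s (AddMonoidHom.id N) z t = 0 := by
        intro z
        induction z using Finsupp.induction_linear with
        | zero => simp
        | add x y hx hy => simp only [map_add, hx, hy, Finsupp.add_apply, add_zero]
        | single y n =>
          rw [indAux_single, single_apply, if_neg]
          exact fun h => ht ⟨_, h⟩
      exact this _
  · intro g n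
    refine ⟨s (QuotientGroup.mk g), p g, (hp g).symm, ?_⟩
    simp only [AddMonoidHom.comp_apply]
    rw [c0s, indAux_single]; rfl

theorem Sh.bij0 {a : RMor τ ρ} {r : M →+ N} (h : Sh a r) : Function.Bijective (Hmap a 0) := by
  obtain ⟨c, h1, h2, h3⟩ := h.dec
  constructor
  · rw [injective_iff_map_eq_zero]
    intro x hx
    obtain ⟨n, rfl⟩ := h0_surj τ x
    rw [Hmap_h0] at hx
    let Φ : M →+ HH τ 0 := ((aug G (HH τ 0)).comp (indAux (fun g : G => g) (h0Hom τ))).comp c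
    have hΦ : ∀ g n, Φ (ρ g (a.f n)) = h0 τ n := by
      intro g n
      obtain ⟨t, p, rfl, hc⟩ := h3 g n
      simp only [Φ, AddMonoidHom.comp_apply, hc, indAux_single, aug_single]
      exact h0_act τ p n
    have := h0_eq_zero ρ hx Φ (by
      intro g m
      induction h.gen m using AddSubgroup.closure_induction with
      | mem x hx =>
        obtain ⟨g', n, rfl⟩ := hx
        rw [← rep_mul, hΦ, hΦ]
      | zero => simp
      | add x y _ _ hx hy => rw [map_add, map_add, map_add, hx, hy]
      | neg x _ hx => rw [map_neg, map_neg, map_neg, hx])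
    have e := hΦ 1 n
    rw [rep_one] at e
    rw [← e, this]
  · intro x
    obtain ⟨m, rfl⟩ := h0_surj ρ x
    suffices h : ∃ y, Hmap a 0 y = h0Hom ρ m from h
    induction h.gen m using AddSubgroup.closure_induction with
    | mem x hx =>
      obtain ⟨g, n, rfl⟩ := hx
      exact ⟨h0 τ n, by rw [Hmap_h0]; exact (h0_act ρ g _).symm⟩
    | zero => exact ⟨0, by simp⟩
    | add x y _ _ hx hy =>
      obtain ⟨x', hx⟩ := hx
      obtain ⟨y', hy⟩ := hy
      exact ⟨x' + y', by rw [map_add, map_add, hx, hy]⟩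
    | neg x _ hx =>
      obtain ⟨x', hx⟩ := hx
      exact ⟨-x', by rw [map_neg, map_neg, hx]⟩

/-- The morphism used for shifting in Shapiro's lemma -/
noncomputable def shpMor (a : RMor τ ρ) : (shSES a.φ τ).Mor (shSES (MonoidHom.id G) ρ) :=
  shMor a (fun g => g) (fun _ _ => rfl)

theorem Sh.ind {a : RMor τ ρ} {r : M →+ N} (h : Sh a r) :
    Sh (shpMor a).b (indAux (fun g : G => g) r) where
  inj := h.inj
  rj z := by
    change indAux _ _ (indAux _ _ z) = z
    induction z using Finsupp.induction_linear with
    | zero => simp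
    | add x y hx hy => simp only [map_add, hx, hy]
    | single y n => simp [h.rj]
  r0 g hg z := by
    change indAux _ _ (Stmt3.ind _ _ g (indAux _ _ z)) = 0
    induction z using Finsupp.induction_linear with
    | zero => simp
    | add x y hx hy => simp only [map_add, hx, hy, add_zero]
    | single y n =>
      rw [indAux_single, ind_single, indAux_single, h.r0 g hg, single_zero]
  gen z := by
    induction z using Finsupp.induction_linear with
    | zero => exact zero_mem _
    | add x y hx hy => exact add_mem hx hy
    | single y m =>
      induction h.gen m using AddSubgroup.closure_induction with
      | mem x hx =>
        obtain ⟨g, n, rfl⟩ := hx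
        refine AddSubgroup.subset_closure ⟨g, single (g⁻¹ * y) n, ?_⟩
        change _ = Stmt3.ind _ _ g (indAux _ _ _)
        rw [indAux_single, ind_single]; simp
      | zero => rw [single_zero]; exact zero_mem _
      | add x y _ _ hx hy => rw [single_add]; exact add_mem hx hy
      | neg x _ hx => rw [single_neg]; exact neg_mem hx

theorem Sh.ker {a : RMor τ ρ} {r : M →+ N} (h : Sh a r) : ∃ r', Sh (shpMor a).a r' := by
  have hi := h.ind
  have hk : ∀ x : G →₀ M, x ∈ (aug G M).ker → indAux (fun g : G => g) r x ∈ (aug G N).ker := by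
    intro x hx
    rw [AddMonoidHom.mem_ker] at *
    rw [aug_indAux, hx, map_zero]
  refine ⟨((indAux (fun g : G => g) r).comp (aug G M).ker.subtype).codRestrict (aug G N).ker
    (fun x => hk x.1 x.2), h.inj, ?_, ?_, ?_⟩
  · intro n; exact Subtype.ext (hi.rj n.1)
  · intro g hg n; exact Subtype.ext (hi.r0 g hg n.1)
  · intro m
    obtain ⟨c, h1, h2, -⟩ := hi.dec
    have hc : ∀ t, c m.1 t ∈ (aug G N).ker := by
      intro t
      rcases h2 m.1 t with e | e
      · rw [e]; exact zero_mem _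
      · rw [e]; exact hk _ (kRep (MonoidHom.id G) ρ t⁻¹ m).2
    have e : m = ∑ t ∈ (c m.1).support,
        kRep (MonoidHom.id G) ρ t ((shpMor a).a.f ⟨c m.1 t, hc t⟩) := by
      apply Subtype.ext
      rw [AddSubgroup.val_finset_sum]
      exact h1 m.1
    rw [e]
    exact sum_mem fun t _ => AddSubgroup.subset_closure ⟨t, _, rfl⟩

end shapiro

theorem Sh.bij (i : ℕ) : ∀ {P N G M : Type} [Group P] [AddCommGroup N] [Group G] [AddCommGroup M]
    {τ : P →* AddMonoid.End N} {ρ : G →* AddMonoid.End M} {a : RMor τ ρ} {r : M →+ N} (h : Sh a r),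
    Function.Bijective (Hmap a i) := by
  induction i with
  | zero => intro P N G M _ _ _ _ τ ρ a r h; exact h.bij0
  | succ i ih =>
    intro P N G M _ _ _ _ τ ρ a r h
    obtain ⟨r', h'⟩ := h.ker
    have b1 := ih h'
    have b2 := ih h.ind
    let m := shpMor a
    constructor
    · rw [injective_iff_map_eq_zero]
      intro x hx
      obtain ⟨y, hy⟩ := SES.D_ex (shSES a.φ τ) x
      have e := m.D hy
      have hx' : Hmap m.c (i + 1) x = 0 := hx
      rw [hx', ← map_zero (Hmap (shSES (MonoidHom.id G) ρ).mg (i+1))] at e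
      have := SES.D_G _ e
      rw [← map_zero (Hmap m.a i)] at this
      rw [b1.1 this] at hy
      refine sh_inj h.inj hy ?_
      have := SES.D_sub _ hy hy
      rwa [sub_self, sub_self] at this
    · intro x
      obtain ⟨y, hy⟩ := SES.D_ex (shSES (MonoidHom.id G) ρ) x
      obtain ⟨y', rfl⟩ := b1.2 y
      have e1 := SES.D_F _ hy
      have e2 : Hmap (shSES a.φ τ).mf i y' = 0 := by
        apply b2.1
        rw [map_zero, ← e1]
        exact m.hF i y'
      obtain ⟨x', hx'⟩ := SES.F_D _ e2
      exact ⟨x', sh_inj (fun _ _ h => h) (m.D hx') hy⟩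

section conn
variable {G M G' M' : Type} [Group G] [AddCommGroup M] [Group G'] [AddCommGroup M']
  {ρ : G →* AddMonoid.End M} {ρ' : G' →* AddMonoid.End M'}

def Conn (a : RMor ρ ρ') (s : ℕ) : Prop :=
  (∀ i, i < s → Function.Surjective (Hmap a i)) ∧ ∀ i, i + 1 < s → Function.Injective (Hmap a i)

theorem Conn.mono {a : RMor ρ ρ'} {s t : ℕ} (h : Conn a s) (ht : t ≤ s) : Conn a t :=
  ⟨fun i hi => h.1 i (by omega), fun i hi => h.2 i (by omega)⟩

variable {A B C A' B' C' : Type} [AddCommGroup A] [AddCommGroup B] [AddCommGroup C]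
    {ρA : G →* AddMonoid.End A} {ρB : G →* AddMonoid.End B} {ρC : G →* AddMonoid.End C}
    [AddCommGroup A'] [AddCommGroup B'] [AddCommGroup C']
    {ρA' : G' →* AddMonoid.End A'} {ρB' : G' →* AddMonoid.End B'} {ρC' : G' →* AddMonoid.End C'}

theorem Conn.ses {S : SES ρA ρB ρC} {S' : SES ρA' ρB' ρC'} (m : S.Mor S') {s : ℕ}
    (hA : Conn m.a s) (hB : Conn m.b (s + 1)) : Conn m.c (s + 1) := by
  constructor
  · intro i hi x
    cases i with
    | zero =>
      obtain ⟨w, rfl⟩ := S'.G_surj0 x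
      obtain ⟨w, rfl⟩ := hB.1 0 hi w
      exact ⟨_, m.hG 0 w⟩
    | succ i =>
      obtain ⟨y, hy⟩ := S'.D_ex x
      obtain ⟨y, rfl⟩ := hA.1 i (by omega) y
      have e1 := S'.D_F hy
      rw [← m.hF] at e1
      have e2 : Hmap S.mf i y = 0 := hB.2 i (by omega) (by rw [e1, map_zero])
      obtain ⟨x', hx'⟩ := S.F_D e2
      have e3 := S'.D_sub hy (m.D hx')
      rw [sub_self] at e3
      obtain ⟨b, hb⟩ := S'.D_zero e3
      obtain ⟨b, rfl⟩ := hB.1 (i + 1) hi b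
      rw [← m.hG] at hb
      refine ⟨Hmap S.mg (i + 1) b + x', ?_⟩
      rw [map_add, hb]; abel
  · intro i hi
    rw [injective_iff_map_eq_zero]
    intro x hx
    have hb : ∃ b, Hmap S.mg i b = x := by
      cases i with
      | zero => exact S.G_surj0 x
      | succ i =>
        obtain ⟨y, hy⟩ := S.D_ex x
        have e := m.D hy
        rw [hx, ← map_zero (Hmap S'.mg (i + 1))] at e
        have e2 := S'.D_G e
        have e3 : y = 0 := hA.2 i (by omega) (by rw [e2, map_zero])
        rw [e3] at hy
        exact S.D_zero hy
    obtain ⟨b, rfl⟩ := hb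
    rw [m.hG] at hx
    obtain ⟨a', ha'⟩ := S'.F_G hx
    obtain ⟨a, rfl⟩ := hA.1 i (by omega) a'
    rw [← m.hF] at ha'
    have := hB.2 i hi ha'
    rw [← this, S.G_F]

end conn

end Stmt3

namespace Stmt3
open Finsupp
set_option linter.all false
set_option linter.unusedSectionVars false
set_option linter.unusedSimpArgs false
set_option linter.unusedVariables false

section lists
variable {α : Type}

/-- prepend a word -/
noncomputable def pre (π : List α) : (List α →₀ ℤ) →+ (List α →₀ ℤ) :=
  indAux (fun w => π ++ w) (AddMonoidHom.id ℤ)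

@[simp] theorem pre_single (π w : List α) (n : ℤ) : pre π (single w n) = single (π ++ w) n := by
  simp [pre]

/-- boundary of a word -/
noncomputable def bdw : List α → (List α →₀ ℤ)
  | [] => 0
  | a :: w => single w 1 - pre [a] (bdw w)

/-- boundary -/
noncomputable def bd : (List α →₀ ℤ) →+ (List α →₀ ℤ) :=
  Finsupp.liftAddHom fun w => (zmultiplesHom _ (bdw w))

theorem bd_single (w : List α) (n : ℤ) : bd (single w n) = n • bdw w := by
  simp [bd]

theorem single_smul' (w : List α) (n : ℤ) : (single w n : List α →₀ ℤ) = n • single w 1 := by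
  simp

theorem bd_pre_one (a : α) (x : List α →₀ ℤ) : bd (pre [a] x) = x - pre [a] (bd x) := by
  induction x using Finsupp.induction_linear with
  | zero => simp
  | add x y hx hy => simp only [map_add, hx, hy]; abel
  | single w n =>
    rw [pre_single, bd_single, bd_single, map_zsmul, single_smul' w n, ← smul_sub]; rfl

theorem pre_nil (x : List α →₀ ℤ) : pre [] x = x := by
  induction x using Finsupp.induction_linear with
  | zero => simp
  | add x y hx hy => simp only [map_add, hx, hy]
  | single w n => simp

theorem pre_append (π π' : List α) (x : List α →₀ ℤ) : pre (π ++ π') x = pre π (pre π' x) := by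
  induction x using Finsupp.induction_linear with
  | zero => simp
  | add x y hx hy => simp only [map_add, hx, hy]
  | single w n => simp

theorem bdw_bd (w : List α) : bd (bdw w) = 0 := by
  induction w with
  | nil => simp [bdw]
  | cons a w ih =>
    rw [bdw, map_sub, bd_pre_one, ih, bd_single]; simp

theorem bd_bd (x : List α →₀ ℤ) : bd (bd x) = 0 := by
  induction x using Finsupp.induction_linear with
  | zero => simp
  | add x y hx hy => simp only [map_add, hx, hy, add_zero]
  | single w n => rw [bd_single, map_zsmul, bdw_bd, smul_zero]

/-- words supported in a set -/
def CC (S : Set (List α)) : AddSubgroup (List α →₀ ℤ) where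
  carrier := {x | ∀ w, x w ≠ 0 → w ∈ S}
  zero_mem' := by simp
  add_mem' := by
    intro x y hx hy w hw
    by_cases h : x w = 0
    · exact hy w (fun h' => hw (by simp [h, h']))
    · exact hx w h
  neg_mem' := by intro x hx w hw; exact hx w (by simpa using hw)

theorem mem_CC {S : Set (List α)} {x : List α →₀ ℤ} : x ∈ CC S ↔ ∀ w, x w ≠ 0 → w ∈ S := Iff.rfl

theorem single_mem_CC {S : Set (List α)} {w : List α} (hw : w ∈ S) (n : ℤ) : single w n ∈ CC S := by
  classical
  intro w' h
  rw [single_apply] at h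
  split_ifs at h with e
  · exact e ▸ hw
  · exact absurd rfl h

theorem CC_mono {S T : Set (List α)} (h : S ⊆ T) : CC S ≤ CC T := fun _ hx w hw => h (hx w hw)

theorem CC_ind {S : Set (List α)} {p : (List α →₀ ℤ) → Prop} (h0 : p 0)
    (hadd : ∀ x y, p x → p y → p (x + y)) (hs : ∀ w ∈ S, ∀ n, p (single w n))
    {x : List α →₀ ℤ} (hx : x ∈ CC S) : p x := by
  classical
  rw [← Finsupp.sum_single x, Finsupp.sum]
  refine Finset.sum_induction _ p hadd h0 (fun w hw => hs w (hx w (by simpa using hw)) _)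

theorem CC_map {S T : Set (List α)} (f : (List α →₀ ℤ) →+ (List α →₀ ℤ))
    (h : ∀ w ∈ S, f (single w 1) ∈ CC T) {x : List α →₀ ℤ} (hx : x ∈ CC S) : f x ∈ CC T := by
  refine CC_ind (p := fun x => f x ∈ CC T) (by simp) (fun x y hx hy => by
    rw [map_add]; exact add_mem hx hy) (fun w hw n => ?_) hx
  rw [single_smul', map_zsmul]
  exact zsmul_mem (h w hw) n

theorem bdw_face (w : List α) : bdw w = ∑ i ∈ Finset.range w.length,
    (-1 : ℤ) ^ i • (single (w.eraseIdx i) 1 : List α →₀ ℤ) := by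
  induction w with
  | nil => simp [bdw]
  | cons a w ih =>
    rw [bdw, ih, List.length_cons, Finset.sum_range_succ', map_sum]
    have : ∀ i, pre [a] ((-1 : ℤ) ^ i • (single (w.eraseIdx i) 1 : List α →₀ ℤ)) =
      -((-1 : ℤ) ^ (i + 1) • single ((a :: w).eraseIdx (i + 1)) 1) := by
      intro i; rw [map_zsmul, pre_single, pow_succ]; simp
    simp only [this, Finset.sum_neg_distrib]
    simp
    abel

theorem bdw_mem {S T : Set (List α)} (h : ∀ w ∈ S, ∀ i < w.length, w.eraseIdx i ∈ T)
    {x : List α →₀ ℤ} (hx : x ∈ CC S) : bd x ∈ CC T := by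
  refine CC_map bd (fun w hw => ?_) hx
  rw [bd_single, one_smul, bdw_face]
  exact sum_mem fun i hi => zsmul_mem (single_mem_CC (h w hw i (by simpa using hi)) 1) _

variable {G : Type} [Group G] [MulAction G α]

/-- action on words -/
def lperm (G α : Type) [Group G] [MulAction G α] : G →* Equiv.Perm (List α) where
  toFun g := ⟨List.map (g • ·), List.map (g⁻¹ • ·),
    fun w => by simp [Function.comp_def], fun w => by simp [Function.comp_def]⟩
  map_one' := by ext w : 1; simp
  map_mul' g h := by ext w : 1; simp [mul_smul, Function.comp_def]

theorem lperm_apply (g : G) (w : List α) : lperm G α g w = w.map (g • ·) := rfl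

/-- action on chains -/
noncomputable def lrep (G α : Type) [Group G] [MulAction G α] :
    G →* AddMonoid.End (List α →₀ ℤ) := ind (lperm G α) 1

@[simp] theorem lrep_single (g : G) (w : List α) (n : ℤ) :
    lrep G α g (single w n) = single (w.map (g • ·)) n := by
  rw [lrep, ind_single]; rfl

theorem lrep_pre (g : G) (π : List α) (x : List α →₀ ℤ) :
    lrep G α g (pre π x) = pre (π.map (g • ·)) (lrep G α g x) := by
  induction x using Finsupp.induction_linear with
  | zero => simp
  | add x y hx hy => simp only [map_add, hx, hy]
  | single w n => simp

theorem lrep_bd (g : G) (x : List α →₀ ℤ) : bd (lrep G α g x) = lrep G α g (bd x) := by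
  induction x using Finsupp.induction_linear with
  | zero => simp
  | add x y hx hy => simp only [map_add, hx, hy]
  | single w n =>
    rw [lrep_single, bd_single, bd_single, map_zsmul]
    congr 1
    induction w with
    | nil => simp [bdw]
    | cons a w ih => simp [bdw, ih, lrep_pre]

/-- invariance of a set of words -/
def WInv (G : Type) [Group G] [MulAction G α] (S : Set (List α)) : Prop :=
  ∀ g : G, ∀ w ∈ S, w.map (g • ·) ∈ S

theorem CC_inv {S : Set (List α)} (hS : WInv G S) (g : G) (x : List α →₀ ℤ) (hx : x ∈ CC S) :
    lrep G α g x ∈ CC S :=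
  CC_map (lrep G α g) (fun w hw => by
    have e : lrep G α g (single w 1) ∈ CC S := by
      rw [lrep_single]; exact single_mem_CC (hS g w hw) 1
    exact e) hx

/-- chains in `S` as a representation -/
noncomputable def cRep (S : Set (List α)) (hS : WInv G S) : G →* AddMonoid.End (CC S) :=
  subRep (lrep G α) (CC S) (CC_inv hS)

/-- cycles in `S` -/
noncomputable def ZZ (S : Set (List α)) : AddSubgroup (List α →₀ ℤ) := CC S ⊓ bd.ker

theorem ZZ_inv {S : Set (List α)} (hS : WInv G S) (g : G) (x : List α →₀ ℤ) (hx : x ∈ ZZ S) :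
    lrep G α g x ∈ ZZ S :=
  ⟨CC_inv hS g x hx.1, by
    change bd _ = 0; rw [lrep_bd, show bd x = 0 from hx.2, map_zero]⟩

/-- cycles as a representation -/
noncomputable def zRep (S : Set (List α)) (hS : WInv G S) : G →* AddMonoid.End (ZZ S) :=
  subRep (lrep G α) (ZZ S) (ZZ_inv hS)

/-- exactness -/
def Exact (S T : Set (List α)) : Prop := ∀ x ∈ ZZ S, ∃ y ∈ CC T, bd y = x

/-- exact sequence of cycles and chains -/
noncomputable def zSES {S T : Set (List α)} (hS : WInv G S) (hT : WInv G T)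
    (h : ∀ w ∈ T, ∀ i < w.length, w.eraseIdx i ∈ S) (hex : Exact S T) :
    SES (zRep T hT) (cRep T hT) (zRep S hS) where
  f := AddSubgroup.inclusion inf_le_left
  g := (bd.comp (CC T).subtype).codRestrict (ZZ S) (fun x => ⟨bdw_mem h x.2, bd_bd _⟩)
  fe _ _ := rfl
  ge g x := Subtype.ext (lrep_bd g x.1)
  inj _ _ h := Subtype.ext (congrArg (fun y : CC T => (y : List α →₀ ℤ)) h)
  surj z := by
    obtain ⟨y, hy, e⟩ := hex z.1 z.2
    exact ⟨⟨y, hy⟩, Subtype.ext e⟩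
  exact b hb := ⟨⟨b.1, b.2, congrArg (fun y : ZZ S => (y : List α →₀ ℤ)) hb⟩, rfl⟩
  gf a := Subtype.ext a.2.2

/-- A fixed chain gives a morphism from trivial coefficients. -/
noncomputable def fixMor {P N : Type} [Group P] [AddCommGroup N] {ρ : G →* AddMonoid.End N}
    (ι : P →* G) (x : N) (hx : ∀ p, ρ (ι p) x = x) : RMor (1 : P →* AddMonoid.End ℤ) ρ where
  φ := ι
  f := zmultiplesHom _ x
  comm p n := by
    simp only [zmultiplesHom_apply, map_zsmul, hx]
    rfl

/-- base word as a chain -/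
noncomputable def bw {S : Set (List α)} (u : List α) (hu : u ∈ S) : CC S :=
  ⟨single u 1, single_mem_CC hu 1⟩

theorem bw_fix {P : Type} [Group P] (ι : P →* G) {S : Set (List α)} (hS : WInv G S) (u : List α)
    (hu : u ∈ S) (hfix : ∀ p, u.map (ι p • ·) = u) (p : P) :
    cRep S hS (ι p) (bw u hu) = bw u hu :=
  Subtype.ext (by change lrep G α _ (single u 1) = single u 1; rw [lrep_single, hfix])

/-- the Shapiro morphism of a base word -/
noncomputable def wMor {P : Type} [Group P] (ι : P →* G) {S : Set (List α)} (hS : WInv G S)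
    (u : List α) (hu : u ∈ S) (hfix : ∀ p, u.map (ι p • ·) = u) :
    RMor (1 : P →* AddMonoid.End ℤ) (cRep S hS) :=
  fixMor ι (bw u hu) (bw_fix ι hS u hu hfix)

theorem wMor_sh {P : Type} [Group P] (ι : P →* G) (hι : Function.Injective ι)
    {S : Set (List α)} (hS : WInv G S)
    (u : List α) (hu : u ∈ S) (hfix : ∀ p, u.map (ι p • ·) = u)
    (hst : ∀ g : G, u.map (g • ·) = u → g ∈ ι.range)
    (htr : ∀ w ∈ S, ∃ g : G, u.map (g • ·) = w) :
    Sh (wMor ι hS u hu hfix) ((Finsupp.applyAddHom u).comp (CC S).subtype) where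
  inj := hι
  rj n := by
    change (n • bw u hu).1 u = n
    simp [bw]
  r0 g hg n := by
    have e : ((cRep S hS g) (n • bw u hu)).1 u = 0 := by
      change (lrep G α g (n • single u 1)) u = 0
      rw [map_zsmul, lrep_single]
      classical
      rw [Finsupp.smul_apply, single_apply, if_neg, smul_zero]
      exact fun h => hg (hst g h)
    exact e
  gen m := by
    obtain ⟨x, hx⟩ := m
    suffices h : ∃ hx : x ∈ CC S, (⟨x, hx⟩ : CC S) ∈
        AddSubgroup.closure {m | ∃ g n, m = (cRep S hS g) ((wMor ι hS u hu hfix).f n)} from h.2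
    refine CC_ind (p := fun x => ∃ hx : x ∈ CC S, (⟨x, hx⟩ : CC S) ∈
        AddSubgroup.closure {m | ∃ g n, m = (cRep S hS g) ((wMor ι hS u hu hfix).f n)})
      ⟨zero_mem _, zero_mem _⟩ ?_ ?_ hx
    · rintro x y ⟨hx, hx'⟩ ⟨hy, hy'⟩
      exact ⟨add_mem hx hy, add_mem hx' hy'⟩
    · intro w hw n
      refine ⟨single_mem_CC hw n, AddSubgroup.subset_closure ?_⟩
      obtain ⟨g, rfl⟩ := htr w hw
      refine ⟨g, n, Subtype.ext ?_⟩
      change _ = lrep G α g (n • single u 1)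
      rw [map_zsmul, lrep_single]; simp

end lists

end Stmt3

namespace Stmt3
open Finsupp
set_option linter.all false
set_option linter.unusedSectionVars false
set_option linter.unusedSimpArgs false
set_option linter.unusedVariables false

section move
variable {α : Type} (R : α → α → Prop)

/-- words with pairwise related letters from `L` -/
def WW (L : Set α) (l : ℕ) : Set (List α) :=
  {w | w.Pairwise R ∧ (∀ a ∈ w, a ∈ L) ∧ w.length = l}

theorem bdw_append (π w : List α) :
    bdw (π ++ w) - (-1 : ℤ) ^ π.length • pre π (bdw w) ∈
      CC {v | ∃ i < π.length, v = π.eraseIdx i ++ w} := by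
  induction π with
  | nil => simp [pre_nil]
  | cons a π ih =>
    have h1 : bdw (a :: π ++ w) - (-1 : ℤ) ^ (a :: π).length • pre (a :: π) (bdw w) =
        single (π ++ w) 1 - pre [a] (bdw (π ++ w) - (-1 : ℤ) ^ π.length • pre π (bdw w)) := by
      rw [List.cons_append, bdw, map_sub, map_zsmul, ← pre_append, List.length_cons, pow_succ]
      simp
      abel
    rw [h1]
    refine sub_mem (single_mem_CC (S := {v | ∃ i < (a :: π).length, v = (a :: π).eraseIdx i ++ w})
      ⟨0, by simp, by simp⟩ 1) (CC_map _ ?_ ih)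
    rintro v ⟨i, hi, rfl⟩
    rw [pre_single]
    exact single_mem_CC (S := {v | ∃ i < (a :: π).length, v = (a :: π).eraseIdx i ++ w})
      ⟨i + 1, by simpa using hi, by simp⟩ 1

variable {R}

theorem WW_erase {L : Set α} {l : ℕ} {w : List α} (hw : w ∈ WW R L (l + 1)) {i : ℕ}
    (hi : i < w.length) : w.eraseIdx i ∈ WW R L l := by
  refine ⟨hw.1.sublist (List.eraseIdx_sublist ..), fun a ha => hw.2.1 a (List.mem_of_mem_eraseIdx ha), ?_⟩
  rw [List.length_eraseIdx_of_lt hi, hw.2.2]; rfl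

open Classical in
/-- component along an initial word -/
noncomputable def rs (π : List α) : (List α →₀ ℤ) →+ (List α →₀ ℤ) :=
  Finsupp.liftAddHom fun w =>
    if w.take π.length = π then singleAddHom (w.drop π.length) else 0

open Classical in
theorem rs_single (π w : List α) (n : ℤ) :
    rs π (single w n) = if w.take π.length = π then single (w.drop π.length) n else 0 := by
  rw [rs, Finsupp.liftAddHom_apply_single]
  split_ifs <;> rfl

theorem rs_pre (π : List α) (x : List α →₀ ℤ) : rs π (pre π x) = x := by
  induction x using Finsupp.induction_linear with
  | zero => simp
  | add x y hx hy => simp only [map_add, hx, hy]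
  | single w n => rw [pre_single, rs_single]; simp

theorem rs_pre_ne (π ϖ : List α) (h : ϖ ≠ π) (hl : ϖ.length = π.length) (x : List α →₀ ℤ) :
    rs π (pre ϖ x) = 0 := by
  induction x using Finsupp.induction_linear with
  | zero => simp
  | add x y hx hy => simp only [map_add, hx, hy, add_zero]
  | single w n =>
    rw [pre_single, rs_single, if_neg]
    rw [← hl]; simpa using h

/-- words whose letters beyond position `m` are in `L'` -/
def TT (R : α → α → Prop) (L L' : Set α) (m l : ℕ) : Set (List α) :=
  {w | w ∈ WW R L l ∧ ∀ a ∈ w.drop m, a ∈ L'}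

def lk (R : α → α → Prop) (L' : Set α) (π : List α) : Set α := {a | a ∈ L' ∧ ∀ b ∈ π, R b a}

theorem rs_bd {L L' : Set α} {m l : ℕ} (π0 : List α) (b : α) (hm : π0.length = m) (hb : b ∉ L')
    {x : List α →₀ ℤ} (hml : m + 1 ≤ l) (hx : x ∈ CC (TT R L L' (m + 1) l)) :
    rs (π0 ++ [b]) (bd x) = (-1 : ℤ) ^ (m + 1) • bd (rs (π0 ++ [b]) x) := by
  refine CC_ind (p := fun x => rs (π0 ++ [b]) (bd x) = (-1 : ℤ) ^ (m + 1) • bd (rs (π0 ++ [b]) x))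
    (by simp) (fun x y hx hy => by simp only [map_add, hx, hy, smul_add]) ?_ hx
  intro w hw n
  set π := π0 ++ [b] with hπ
  have hlπ : π.length = m + 1 := by simp [hπ, hm]
  obtain ⟨ϖ, g, rfl, hϖ⟩ : ∃ ϖ g, w = ϖ ++ g ∧ ϖ.length = m + 1 :=
    ⟨w.take (m + 1), w.drop (m + 1), by simp, by simp [hw.1.2.2]; omega⟩
  have hg : ∀ a ∈ g, a ∈ L' := by
    intro a ha; apply hw.2 a; rw [← hϖ]; simpa using ha
  have h1 := bdw_append ϖ g
  have h2 : rs π (bdw (ϖ ++ g) - (-1 : ℤ) ^ ϖ.length • pre ϖ (bdw g)) = 0 := by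
    refine CC_ind (p := fun x => rs π x = 0) (by simp)
      (fun x y hx hy => by simp only [map_add, hx, hy, add_zero]) ?_ h1
    rintro v ⟨i, hi, rfl⟩ n
    rw [rs_single, if_neg]
    intro h
    have hl : (ϖ.eraseIdx i).length = m := by rw [List.length_eraseIdx_of_lt hi]; omega
    rw [hlπ, List.take_append, hl, List.take_of_length_le (by omega), hπ] at h
    have h3 := List.append_inj h (by omega)
    have : b ∈ g.take (m + 1 - m) := by rw [h3.2]; simp
    exact hb (hg b (List.mem_of_mem_take this))
  rw [map_sub, sub_eq_zero] at h2
  rw [bd_single, map_zsmul, h2, single_smul', map_zsmul, map_zsmul, map_zsmul, hϖ, smul_comm]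
  congr 2
  by_cases e : ϖ = π
  · have : (single (π ++ g) 1 : List α →₀ ℤ) = pre π (single g 1) := by simp
    rw [e, rs_pre, this, rs_pre, bd_single, one_smul]
  · rw [rs_pre_ne π ϖ e (by omega)]
    have : (single (ϖ ++ g) 1 : List α →₀ ℤ) = pre ϖ (single g 1) := by simp
    rw [this, rs_pre_ne π ϖ e (by omega)]; simp

theorem TT_erase {L L' : Set α} {m l : ℕ} (hLL : L' ⊆ L) {π w : List α} (hπ : π ∈ WW R L (m + 1))
    (hml : m + 1 ≤ l)
    (hw : w ∈ WW R (lk R L' π) (l - m)) {i : ℕ} (hi : i < π.length) :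
    π.eraseIdx i ++ w ∈ TT R L L' m l := by
  have hl : (π.eraseIdx i).length = m := by rw [List.length_eraseIdx_of_lt hi, hπ.2.2]; rfl
  refine ⟨⟨?_, ?_, ?_⟩, ?_⟩
  · rw [List.pairwise_append]
    exact ⟨(WW_erase hπ hi).1, hw.1, fun a ha b hb => (hw.2.1 b hb).2 a (List.mem_of_mem_eraseIdx ha)⟩
  · intro a ha
    rcases List.mem_append.1 ha with h | h
    · exact hπ.2.1 a (List.mem_of_mem_eraseIdx h)
    · exact hLL (hw.2.1 a h).1
  · rw [List.length_append, hl, hw.2.2]; omega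
  · intro a ha
    rw [← hl, List.drop_left] at ha
    exact (hw.2.1 a ha).1

theorem move_step {L L' : Set α} {m l : ℕ} (hLL : L' ⊆ L) (hml : m + 1 ≤ l)
    (hlk : ∀ π ∈ WW R L (m + 1), Exact (WW R (lk R L' π) (l - (m + 1))) (WW R (lk R L' π) (l - m)))
    {x : List α →₀ ℤ} (hx : x ∈ ZZ (TT R L L' (m + 1) l)) :
    ∃ y ∈ CC (WW R L (l + 1)), x - bd y ∈ ZZ (TT R L L' m l) := by
  classical
  -- the bad prefixes
  let Q : Finset (List α) := (x.support.image (fun w => w.take (m + 1))).filter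
    (fun π => ∃ π0 b, π = π0 ++ [b] ∧ π0.length = m ∧ b ∉ L')
  have hQ : ∀ π ∈ Q, π ∈ WW R L (m + 1) ∧ ∃ π0 b, π = π0 ++ [b] ∧ π0.length = m ∧ b ∉ L' := by
    intro π hπ
    obtain ⟨h1, h2⟩ := Finset.mem_filter.1 hπ
    obtain ⟨w, hw, rfl⟩ := Finset.mem_image.1 h1
    have hw' := hx.1 w (by simpa using hw)
    exact ⟨⟨hw'.1.1.sublist (List.take_sublist ..), fun a ha => hw'.1.2.1 a (List.mem_of_mem_take ha),
      by rw [List.length_take, hw'.1.2.2]; omega⟩, h2⟩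
  have hbd : ∀ π ∈ Q, bd (rs π x) = 0 := by
    intro π hπ
    obtain ⟨-, π0, b, rfl, hm, hb⟩ := hQ π hπ
    have := rs_bd π0 b hm hb hml hx.1
    rw [show bd x = 0 from hx.2, map_zero] at this
    have h2 := congrArg (fun z => (-1 : ℤ) ^ (m + 1) • z) this
    simp only [smul_zero, smul_smul, ← mul_pow] at h2
    simpa using h2.symm
  have hrs : ∀ π ∈ Q, rs π x ∈ CC (WW R (lk R L' π) (l - (m + 1))) := by
    intro π hπ
    have hlπ := (hQ π hπ).1.2.2
    refine CC_map (rs π) ?_ hx.1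
    intro w hw
    rw [rs_single]
    split_ifs with h
    · apply single_mem_CC
      rw [hlπ] at h ⊢
      have e : w = π ++ w.drop (m + 1) := by rw [← h]; simp
      have hp := hw.1.1
      rw [e, List.pairwise_append] at hp
      refine ⟨hp.2.1, fun a ha => ⟨hw.2 a ha, fun b hb => hp.2.2 b hb a ha⟩, ?_⟩
      rw [List.length_drop, hw.1.2.2]
    · exact zero_mem _
  have hh : ∀ π, ∃ h : List α →₀ ℤ, π ∈ Q → h ∈ CC (WW R (lk R L' π) (l - m)) ∧ bd h = rs π x := by
    intro π
    by_cases hπ : π ∈ Q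
    · obtain ⟨h, h1, h2⟩ := hlk π (hQ π hπ).1 (rs π x) ⟨hrs π hπ, hbd π hπ⟩
      exact ⟨h, fun _ => ⟨h1, h2⟩⟩
    · exact ⟨0, fun h => absurd h hπ⟩
  choose h hh using hh
  let y : List α →₀ ℤ := ∑ π ∈ Q, (-1 : ℤ) ^ (m + 1) • pre π (h π)
  have hy : y ∈ CC (WW R L (l + 1)) := by
    refine sum_mem fun π hπ => zsmul_mem ?_ _
    refine CC_map (pre π) ?_ (hh π hπ).1
    intro w hw
    rw [pre_single]
    apply single_mem_CC
    have hp := (hQ π hπ).1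
    refine ⟨?_, ?_, ?_⟩
    · rw [List.pairwise_append]
      exact ⟨hp.1, hw.1, fun a ha b hb => (hw.2.1 b hb).2 a ha⟩
    · intro a ha
      rcases List.mem_append.1 ha with h | h
      · exact hp.2.1 a h
      · exact hLL (hw.2.1 a h).1
    · rw [List.length_append, hp.2.2, hw.2.2]; omega
  -- boundary of initial word times filling
  have hpre : ∀ π ∈ Q, ∀ z ∈ CC (WW R (lk R L' π) (l - m)),
      bd (pre π z) - (-1 : ℤ) ^ (m + 1) • pre π (bd z) ∈ CC (TT R L L' m l) := by
    intro π hπ z hz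
    refine CC_ind (p := fun z => bd (pre π z) - (-1 : ℤ) ^ (m + 1) • pre π (bd z) ∈
      CC (TT R L L' m l)) (by simp) ?_ ?_ hz
    · intro a b ha hb
      have := add_mem ha hb
      convert this using 1
      simp only [map_add, smul_add]; abel
    · intro w hw n
      have h1 := bdw_append π w
      rw [(hQ π hπ).1.2.2] at h1
      have : bd (pre π (single w n)) - (-1 : ℤ) ^ (m + 1) • pre π (bd (single w n)) =
          n • (bdw (π ++ w) - (-1 : ℤ) ^ (m + 1) • pre π (bdw w)) := by
        rw [pre_single, bd_single, bd_single, map_zsmul, smul_comm, smul_sub]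
      rw [this]
      refine zsmul_mem (CC_mono ?_ h1) n
      rintro v ⟨i, hi, rfl⟩
      exact TT_erase hLL (hQ π hπ).1 hml hw (by rw [(hQ π hπ).1.2.2]; exact hi)
  have h3 : x - ∑ π ∈ Q, pre π (rs π x) ∈ CC (TT R L L' m l) := by
    have hS : x ∈ CC {w | w ∈ TT R L L' (m + 1) l ∧ w ∈ x.support} :=
      fun w hw => ⟨hx.1 w hw, by simpa using hw⟩
    refine CC_ind (p := fun x => x - ∑ π ∈ Q, pre π (rs π x) ∈ CC (TT R L L' m l)) (by simp) ?_ ?_ hS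
    · intro a b ha hb
      have := add_mem ha hb
      convert this using 1
      simp only [map_add, Finset.sum_add_distrib]; abel
    · rintro w ⟨hw, hwx⟩ n
      have hlw : (w.take (m + 1)).length = m + 1 := by rw [List.length_take, hw.1.2.2]; omega
      by_cases hq : w.take (m + 1) ∈ Q
      · rw [Finset.sum_eq_single_of_mem _ hq]
        · rw [rs_single, hlw, if_pos rfl, pre_single]; simp
        · intro π hπ hne
          rw [rs_single, (hQ π hπ).1.2.2, if_neg hne.symm, map_zero]
      · rw [Finset.sum_eq_zero, sub_zero]
        · apply single_mem_CC
          refine ⟨hw.1, ?_⟩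
          have hlt : m < w.length := by rw [hw.1.2.2]; omega
          rw [List.drop_eq_getElem_cons hlt]
          intro a ha
          rcases List.mem_cons.1 ha with rfl | ha
          · by_contra hbad
            apply hq
            refine Finset.mem_filter.2 ⟨Finset.mem_image.2 ⟨w, hwx, rfl⟩, w.take m, w[m], ?_, ?_, hbad⟩
            · rw [List.take_succ_eq_append_getElem hlt]
            · rw [List.length_take]; omega
          · exact hw.2 a ha
        · intro π hπ
          rw [rs_single, (hQ π hπ).1.2.2, if_neg, map_zero]
          rintro rfl; exact hq hπ
  refine ⟨y, hy, ?_, ?_⟩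
  · have : x - bd y = (x - ∑ π ∈ Q, pre π (rs π x)) -
        ∑ π ∈ Q, (-1 : ℤ) ^ (m + 1) • (bd (pre π (h π)) - (-1 : ℤ) ^ (m + 1) • pre π (bd (h π))) := by
      have e : ∀ π ∈ Q, (-1 : ℤ) ^ (m + 1) • (bd (pre π (h π)) - (-1 : ℤ) ^ (m + 1) • pre π (bd (h π)))
          = bd ((-1 : ℤ) ^ (m + 1) • pre π (h π)) - pre π (rs π x) := by
        intro π hπ
        rw [smul_sub, smul_smul, ← mul_pow, map_zsmul, (hh π hπ).2]; simp
      rw [Finset.sum_congr rfl e, Finset.sum_sub_distrib, ← map_sum]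
      abel
    rw [this]
    have h4 : ∑ π ∈ Q, (-1 : ℤ) ^ (m + 1) • (bd (pre π (h π)) - (-1 : ℤ) ^ (m + 1) • pre π (bd (h π)))
        ∈ CC (TT R L L' m l) := sum_mem fun π hπ => zsmul_mem (hpre π hπ _ (hh π hπ).1) _
    exact (CC (TT R L L' m l)).sub_mem h3 h4
  · change bd _ = 0
    rw [map_sub, bd_bd, show bd x = 0 from hx.2, sub_zero]

theorem move {L L' : Set α} {l : ℕ} (hLL : L' ⊆ L)
    (hlk : ∀ m < l, ∀ π ∈ WW R L (m + 1),
      Exact (WW R (lk R L' π) (l - (m + 1))) (WW R (lk R L' π) (l - m)))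
    {x : List α →₀ ℤ} (hx : x ∈ ZZ (WW R L l)) :
    ∃ y ∈ CC (WW R L (l + 1)), x - bd y ∈ ZZ (WW R L' l) := by
  have key : ∀ k ≤ l, ∃ y ∈ CC (WW R L (l + 1)), x - bd y ∈ ZZ (TT R L L' (l - k) l) := by
    intro k hk
    induction k with
    | zero =>
      refine ⟨0, zero_mem _, ?_⟩
      rw [map_zero, sub_zero]
      refine ⟨CC_mono ?_ hx.1, hx.2⟩
      intro w hw
      exact ⟨hw, by intro a ha; rw [List.drop_of_length_le (by rw [hw.2.2]; omega)] at ha; simp at ha⟩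
    | succ k ih =>
      obtain ⟨y, hy, h⟩ := ih (by omega)
      obtain ⟨m, hm⟩ : ∃ m, l - k = m + 1 := ⟨l - k - 1, by omega⟩
      rw [hm] at h
      obtain ⟨y', hy', h'⟩ := move_step hLL (by omega) (hlk m (by omega)) h
      refine ⟨y + y', add_mem hy hy', ?_⟩
      rw [map_add, ← sub_sub, show l - (k + 1) = m by omega]
      exact h'
  obtain ⟨y, hy, h⟩ := key l le_rfl
  refine ⟨y, hy, CC_mono ?_ h.1, h.2⟩
  intro w hw
  exact ⟨hw.1.1, fun a ha => hw.2 a (by simpa using ha), hw.1.2.2⟩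

end move

end Stmt3

namespace Stmt3
open Finsupp
set_option linter.all false
set_option linter.unusedSectionVars false
set_option linter.unusedSimpArgs false
set_option linter.unusedVariables false

section hyp
variable {D V : Type} [Field D] [AddCommGroup V] [Module D V] (B : V →ₗ[D] V →ₗ[D] D)

/-- hyperbolic pairs -/
def HP (a : V × V) : Prop := B a.1 a.1 = 0 ∧ B a.2 a.2 = 0 ∧ B a.1 a.2 = 1

/-- orthogonal pairs -/
def OR (a b : V × V) : Prop := B a.1 b.1 = 0 ∧ B a.1 b.2 = 0 ∧ B a.2 b.1 = 0 ∧ B a.2 b.2 = 0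

/-- hyperbolic pairs in a subspace -/
def HL (W : Submodule D V) : Set (V × V) := {a | HP B a ∧ a.1 ∈ W ∧ a.2 ∈ W}

/-- orthogonal complement of a word -/
def perp (π : List (V × V)) : Submodule D V where
  carrier := {x | ∀ a ∈ π, B a.1 x = 0 ∧ B a.2 x = 0}
  zero_mem' := by simp
  add_mem' := by
    intro x y hx hy a ha
    simp [(hx a ha).1, (hx a ha).2, (hy a ha).1, (hy a ha).2]
  smul_mem' := by
    intro c x hx a ha
    simp [(hx a ha).1, (hx a ha).2]

theorem mem_perp {π : List (V × V)} {x : V} :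
    x ∈ perp B π ↔ ∀ a ∈ π, B a.1 x = 0 ∧ B a.2 x = 0 := Iff.rfl

/-- genus at least `g` -/
def gen (W : Submodule D V) (g : ℕ) : Prop := ∃ w, w ∈ WW (OR B) (HL B W) g

variable {B}

theorem lk_HL (W : Submodule D V) (π : List (V × V)) :
    lk (OR B) (HL B W) π = HL B (W ⊓ perp B π) := by
  ext a
  simp only [lk, HL, OR, Set.mem_setOf_eq, Submodule.mem_inf, mem_perp]
  constructor
  · rintro ⟨⟨h1, h2, h3⟩, h4⟩
    exact ⟨h1, ⟨h2, fun b hb => ⟨(h4 b hb).1, (h4 b hb).2.2.1⟩⟩, h3,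
      fun b hb => ⟨(h4 b hb).2.1, (h4 b hb).2.2.2⟩⟩
  · rintro ⟨h1, ⟨h2, h3⟩, h4, h5⟩
    exact ⟨⟨h1, h2, h4⟩, fun b hb => ⟨(h3 b hb).1, (h5 b hb).1, (h3 b hb).2, (h5 b hb).2⟩⟩

theorem HL_mono {W W' : Submodule D V} (h : W ≤ W') : HL B W ⊆ HL B W' :=
  fun a ha => ⟨ha.1, h ha.2.1, h ha.2.2⟩

theorem WW_mono' {α : Type} {R : α → α → Prop} {L L' : Set α} (h : L ⊆ L') (l : ℕ) :
    WW R L l ⊆ WW R L' l := fun w hw => ⟨hw.1, fun a ha => h (hw.2.1 a ha), hw.2.2⟩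

theorem gen.mono {W W' : Submodule D V} (h : W ≤ W') {g : ℕ} (hg : gen B W g) : gen B W' g := by
  obtain ⟨w, hw⟩ := hg
  exact ⟨w, WW_mono' (HL_mono h) g hw⟩

theorem gen.le {W : Submodule D V} {g g' : ℕ} (hg : gen B W g) (h : g' ≤ g) : gen B W g' := by
  obtain ⟨w, hw⟩ := hg
  refine ⟨w.take g', hw.1.sublist (List.take_sublist ..),
    fun a ha => hw.2.1 a (List.mem_of_mem_take ha), ?_⟩
  rw [List.length_take, hw.2.2]; omega

theorem WW_map {W1 W2 : Submodule D V} (T : V → V) (hT : ∀ x ∈ W1, T x ∈ W2)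
    (hB : ∀ x ∈ W1, ∀ y ∈ W1, B (T x) (T y) = B x y) {g : ℕ} {w : List (V × V)}
    (hw : w ∈ WW (OR B) (HL B W1) g) :
    w.map (fun a => (T a.1, T a.2)) ∈ WW (OR B) (HL B W2) g := by
  refine ⟨?_, ?_, by simpa using hw.2.2⟩
  · rw [List.pairwise_map]
    refine hw.1.imp_of_mem ?_
    intro a b ha hb h
    have ha' := hw.2.1 a ha
    have hb' := hw.2.1 b hb
    exact ⟨by simp only [hB _ ha'.2.1 _ hb'.2.1, h.1], by simp only [hB _ ha'.2.1 _ hb'.2.2, h.2.1],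
      by simp only [hB _ ha'.2.2 _ hb'.2.1, h.2.2.1], by simp only [hB _ ha'.2.2 _ hb'.2.2, h.2.2.2]⟩
  · intro a ha
    obtain ⟨b, hb, rfl⟩ := List.mem_map.1 ha
    have hb' := hw.2.1 b hb
    exact ⟨⟨by simp only [hB _ hb'.2.1 _ hb'.2.1, hb'.1.1], by simp only [hB _ hb'.2.2 _ hb'.2.2, hb'.1.2.1],
      by simp only [hB _ hb'.2.1 _ hb'.2.2, hb'.1.2.2]⟩, hT _ hb'.2.1, hT _ hb'.2.2⟩

theorem gen.map {W1 W2 : Submodule D V} (T : V → V) (hT : ∀ x ∈ W1, T x ∈ W2)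
    (hB : ∀ x ∈ W1, ∀ y ∈ W1, B (T x) (T y) = B x y) {g : ℕ} (h : gen B W1 g) : gen B W2 g := by
  obtain ⟨w, hw⟩ := h
  exact ⟨_, WW_map T hT hB hw⟩


theorem OR_symm (hB : ∀ x y, B x y = B y x) {a b : V × V} (h : OR B a b) : OR B b a :=
  ⟨by rw [hB]; exact h.1, by rw [hB]; exact h.2.2.1, by rw [hB]; exact h.2.1, by rw [hB]; exact h.2.2.2⟩

theorem WW_perm (hB : ∀ x y, B x y = B y x) {L : Set (V × V)} {g : ℕ} {w w' : List (V × V)} (hw : w ∈ WW (OR B) L g)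
    (h : w.Perm w') : w' ∈ WW (OR B) L g :=
  ⟨(h.pairwise_iff (fun h => OR_symm hB h)).1 hw.1, fun a ha => hw.2.1 a (h.mem_iff.2 ha),
    by rw [← h.length_eq, hw.2.2]⟩

theorem gen_ker (hB : ∀ x y, B x y = B y x) {W : Submodule D V} {g : ℕ} (h : gen B W (g + 1)) (φ : V →ₗ[D] D) :
    gen B (W ⊓ LinearMap.ker φ) g := by
  classical
  obtain ⟨w, hw⟩ := h
  by_cases hall : ∀ a ∈ w, φ a.1 = 0 ∧ φ a.2 = 0
  · refine gen.le (g := g + 1) ⟨w, hw.1, fun a ha => ?_, hw.2.2⟩ (by omega)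
    have := hw.2.1 a ha
    exact ⟨this.1, ⟨this.2.1, (hall a ha).1⟩, this.2.2, (hall a ha).2⟩
  · push Not at hall
    obtain ⟨a, ha, hφ⟩ := hall
    obtain ⟨w', hp⟩ := List.perm_cons_erase ha |> fun h => (⟨_, h⟩ : ∃ w', w.Perm (a :: w'))
    have hw' := WW_perm hB hw hp
    have haW := hw'.2.1 a (by simp)
    obtain ⟨u, huW, huu, hu, hφu⟩ : ∃ u ∈ W, B u u = 0 ∧ (∀ b ∈ w', B u b.1 = 0 ∧ B u b.2 = 0) ∧
        φ u ≠ 0 := by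
      have hc := List.pairwise_cons.1 hw'.1
      by_cases h1 : φ a.1 = 0
      · exact ⟨a.2, haW.2.2, haW.1.2.1, fun b hb => ⟨(hc.1 b hb).2.2.1, (hc.1 b hb).2.2.2⟩, hφ h1⟩
      · exact ⟨a.1, haW.2.1, haW.1.1, fun b hb => ⟨(hc.1 b hb).1, (hc.1 b hb).2.1⟩, h1⟩
    have hg : gen B (W ⊓ LinearMap.ker (B u)) g := by
      refine ⟨w', (List.pairwise_cons.1 hw'.1).2, fun b hb => ?_, by simpa using hw'.2.2⟩
      have := hw'.2.1 b (by simp [hb])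
      exact ⟨this.1, ⟨this.2.1, (hu b hb).1⟩, this.2.2, (hu b hb).2⟩
    refine hg.map (fun x => x - (φ x / φ u) • u) ?_ ?_
    · rintro x ⟨hx, -⟩
      refine ⟨sub_mem hx (W.smul_mem _ huW), ?_⟩
      change φ _ = 0
      rw [map_sub, map_smul, smul_eq_mul, div_mul_cancel₀ _ hφu, sub_self]
    · rintro x ⟨-, hx⟩ y ⟨-, hy⟩
      replace hx : B u x = 0 := hx
      replace hy : B u y = 0 := hy
      have hx' : B x u = 0 := by rw [hB, hx]
      simp [huu, hx', hy]

theorem gen_pair (hB : ∀ x y, B x y = B y x) {W : Submodule D V} {g : ℕ} (h : gen B W (g + 1)) {a : V × V} (ha : a ∈ HL B W) :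
    gen B (W ⊓ perp B [a]) g := by
  refine (gen_ker hB h (B a.1)).map (fun x => x - B a.2 x • a.1) ?_ ?_
  · rintro x ⟨hx, hx'⟩
    replace hx' : B a.1 x = 0 := hx'
    refine ⟨sub_mem hx (W.smul_mem _ ha.2.1), ?_⟩
    have e : B a.2 a.1 = 1 := by rw [hB]; exact ha.1.2.2
    simp [mem_perp, ha.1.1, hx', e]
  · rintro x ⟨-, hx⟩ y ⟨-, hy⟩
    replace hx : B a.1 x = 0 := hx
    replace hy : B a.1 y = 0 := hy
    have hx' : B x a.1 = 0 := by rw [hB, hx]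
    simp [ha.1.1, hx', hy]

theorem gen_word (hB : ∀ x y, B x y = B y x) {m : ℕ} : ∀ {W : Submodule D V} {g : ℕ} (h : gen B W (g + m)) {π : List (V × V)}
    (hπ : π ∈ WW (OR B) (HL B W) m), gen B (W ⊓ perp B π) g := by
  induction m with
  | zero =>
    intro W g h π hπ
    obtain rfl := List.eq_nil_of_length_eq_zero hπ.2.2
    refine h.mono ?_
    intro x hx
    exact ⟨hx, by simp [mem_perp]⟩
  | succ m ih =>
    intro W g h π hπ
    obtain ⟨a, π, rfl⟩ := List.exists_cons_of_length_eq_add_one hπ.2.2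
    have hc := List.pairwise_cons.1 hπ.1
    have h1 := gen_pair hB h (hπ.2.1 a (by simp))
    have h2 : π ∈ WW (OR B) (HL B (W ⊓ perp B [a])) m := by
      refine ⟨hc.2, fun b hb => ?_, by simpa using hπ.2.2⟩
      have := hπ.2.1 b (by simp [hb])
      have ho := hc.1 b hb
      exact ⟨this.1, ⟨this.2.1, by simp [mem_perp, ho.1, ho.2.2.1]⟩,
        this.2.2, by simp [mem_perp, ho.2.1, ho.2.2.2]⟩
    refine (ih h1 h2).mono ?_
    rintro x ⟨⟨hx, hx1⟩, hx2⟩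
    refine ⟨hx, ?_⟩
    intro b hb
    rcases List.mem_cons.1 hb with rfl | hb
    · exact hx1 b (by simp)
    · exact hx2 b hb

theorem HP_exact (hB : ∀ x y, B x y = B y x) (l : ℕ) : ∀ {W : Submodule D V} (h : gen B W (2 * l + 1)),
    Exact (WW (OR B) (HL B W) l) (WW (OR B) (HL B W) (l + 1)) := by
  induction l using Nat.strong_induction_on with
  | _ l ih =>
    intro W h x hx
    obtain ⟨a, ha⟩ : ∃ a, a ∈ HL B W := by
      obtain ⟨w, hw⟩ := h
      obtain ⟨a, w, rfl⟩ := List.exists_cons_of_length_eq_add_one hw.2.2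
      exact ⟨a, hw.2.1 a (by simp)⟩
    set W1 := W ⊓ LinearMap.ker (B a.1) with hW1
    set W0 := W ⊓ perp B [a] with hW0
    have h10 : W0 ≤ W1 := by
      rintro y ⟨h1, h2⟩
      exact ⟨h1, (h2 a (by simp)).1⟩
    -- step 1
    obtain ⟨y1, hy1, h1⟩ := move (R := OR B) (L := HL B W) (L' := HL B W1) (HL_mono inf_le_left) (by
      intro m hm π hπ
      rw [lk_HL]
      have hg : gen B (W1 ⊓ perp B π) (2 * (l - (m + 1)) + 1) := by
        have h1 : gen B (W ⊓ perp B π) (2 * l - m) :=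
          gen_word hB (h.le (g' := 2 * l - m + (m + 1)) (by omega)) hπ
        have h2 := gen_ker hB (h1.le (g' := 2 * (l - (m + 1)) + 1 + 1) (by omega)) (B a.1)
        refine h2.mono ?_
        rintro y ⟨⟨p, q⟩, r⟩
        exact ⟨⟨p, r⟩, q⟩
      have := ih (l - (m + 1)) (by omega) hg
      rwa [show l - (m + 1) + 1 = l - m by omega] at this) hx
    -- step 2
    obtain ⟨y2, hy2, h2⟩ := move (R := OR B) (L := HL B W1) (L' := HL B W0) (HL_mono h10) (by
      intro m hm π hπ
      rw [lk_HL]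
      have hg : gen B (W0 ⊓ perp B π) (2 * (l - (m + 1)) + 1) := by
        let T : V → V := fun x => x - B a.2 x • a.1
        have hπ' : π.map (fun a => (T a.1, T a.2)) ∈ WW (OR B) (HL B W0) (m + 1) := by
          refine WW_map T ?_ ?_ hπ
          · rintro x ⟨hx, hx'⟩
            replace hx' : B a.1 x = 0 := hx'
            refine ⟨sub_mem hx (W.smul_mem _ ha.2.1), ?_⟩
            have e : B a.2 a.1 = 1 := by rw [hB]; exact ha.1.2.2
            simp [mem_perp, ha.1.1, hx', e, T]
          · rintro x ⟨-, hx⟩ y ⟨-, hy⟩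
            replace hx : B a.1 x = 0 := hx
            replace hy : B a.1 y = 0 := hy
            have hx' : B x a.1 = 0 := by rw [hB, hx]
            simp [ha.1.1, hx', hy, T]
        have h1 : gen B W0 (2 * l) := gen_pair hB h ha
        have h2 := gen_word hB (h1.le (g' := 2 * (l - (m + 1)) + 1 + (m + 1)) (by omega)) hπ'
        refine h2.mono ?_
        rintro y ⟨p, q⟩
        refine ⟨p, ?_⟩
        intro b hb
        have := q _ (List.mem_map_of_mem hb)
        have ey := (p.2 a (by simp)).1
        simpa [T, ey] using this
      have := ih (l - (m + 1)) (by omega) hg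
      rwa [show l - (m + 1) + 1 = l - m by omega] at this) h1
    refine ⟨y1 + y2 + pre [a] (x - bd y1 - bd y2), add_mem (add_mem hy1 ?_) ?_, ?_⟩
    · exact CC_mono (WW_mono' (HL_mono inf_le_left) _) hy2
    · refine CC_map (pre [a]) ?_ h2.1
      intro w hw
      rw [pre_single]
      apply single_mem_CC
      refine ⟨?_, ?_, by simp [hw.2.2]⟩
      · rw [List.singleton_append, List.pairwise_cons]
        refine ⟨fun b hb => ?_, hw.1⟩
        have := hw.2.1 b hb
        have p1 := this.2.1.2 a (by simp)
        have p2 := this.2.2.2 a (by simp)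
        exact ⟨p1.1, p2.1, p1.2, p2.2⟩
      · intro b hb
        rcases List.mem_cons.1 hb with rfl | hb
        · exact ha
        · exact HL_mono inf_le_left (hw.2.1 b hb)
    · rw [map_add, map_add, bd_pre_one, show bd (x - bd y1 - bd y2) = 0 from h2.2, map_zero]
      abel

end hyp

end Stmt3

namespace Stmt3
open Finsupp
set_option linter.all false
set_option linter.unusedSectionVars false
set_option linter.unusedSimpArgs false
set_option linter.unusedVariables false

section times
variable {P G N : Type} [Group P] [Group G] [AddCommGroup N]

/-- fixed elements -/
def Fx (ρ : G →* AddMonoid.End N) (ι : P →* G) : AddSubgroup N where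
  carrier := {x | ∀ p, ρ (ι p) x = x}
  zero_mem' p := map_zero _
  add_mem' hx hy p := by
    have h1 := hx p
    have h2 := hy p
    exact (map_add (ρ (ι p)) _ _).trans (by rw [h1, h2])
  neg_mem' hx p := by
    have h1 := hx p
    exact (map_neg (ρ (ι p)) _).trans (by rw [h1])

/-- product with a fixed element -/
noncomputable def tm (ρ : G →* AddMonoid.End N) (ι : P →* G) (i : ℕ)
    (y : HH (1 : P →* AddMonoid.End ℤ) i) : Fx ρ ι →+ HH ρ i :=
  AddMonoidHom.mk' (fun x => Hmap (fixMor ι x.1 x.2) i y) (by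
    intro x x'
    obtain ⟨z, hz, rfl⟩ := cls_surj _ y
    simp only [Hmap_cls]
    rw [cls_add]
    congr 1
    clear hz
    induction z using Finsupp.induction_linear with
    | zero => simp
    | add a b ha hb =>
      simp only [map_add, ha, hb]; abel
    | single c m =>
      simp only [cmap_single]
      refine Eq.trans ?_ (single_add _ _ _)
      congr 1
      change m • (x.1 + x'.1) = m • x.1 + m • x'.1
      rw [smul_add])

theorem tm_apply (ρ : G →* AddMonoid.End N) (ι : P →* G) (i : ℕ)
    (y : HH (1 : P →* AddMonoid.End ℤ) i) (x : Fx ρ ι) :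
    tm ρ ι i y x = Hmap (fixMor ι x.1 x.2) i y := rfl

theorem tm_conj (ρ : G →* AddMonoid.End N) (ι : P →* G) (i : ℕ)
    (y : HH (1 : P →* AddMonoid.End ℤ) i) (x x' : Fx ρ ι) (g : G) (hg : ∀ p, g * ι p = ι p * g)
    (h : ρ g x.1 = x'.1) : tm ρ ι i y x = tm ρ ι i y x' := by
  rw [tm_apply, tm_apply]
  refine Hmap_conj i _ _ g ?_ ?_ y
  · intro p
    change ι p = g * ι p * g⁻¹
    rw [hg]; group
  · intro m
    change m • x'.1 = ρ g (m • x.1)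
    rw [map_zsmul, h]

theorem tm_map {N' : Type} [AddCommGroup N'] (ρ : G →* AddMonoid.End N) (ρ' : G →* AddMonoid.End N')
    (ι : P →* G) (i : ℕ) (y : HH (1 : P →* AddMonoid.End ℤ) i) (b : RMor ρ ρ') (hb : ∀ g, b.φ g = g)
    (x : Fx ρ ι) (x' : Fx ρ' ι) (h : b.f x.1 = x'.1) :
    Hmap b i (tm ρ ι i y x) = tm ρ' ι i y x' := by
  rw [tm_apply, tm_apply, Hmap_comp]
  congr 1
  congr 1
  refine RMor.ext' (fun g => hb _) ?_
  intro m
  change b.f (m • x.1) = m • x'.1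
  rw [map_zsmul, h]

/-- change of groups with trivial coefficients -/
def triv {P Q : Type} [Group P] [Group Q] (j : P →* Q) :
    RMor (1 : P →* AddMonoid.End ℤ) (1 : Q →* AddMonoid.End ℤ) where
  φ := j
  f := AddMonoidHom.id ℤ
  comm _ _ := rfl

theorem tm_triv {Q : Type} [Group Q] (ρ : G →* AddMonoid.End N) (ι : P →* G) (j : Q →* P) (i : ℕ)
    (y : HH (1 : Q →* AddMonoid.End ℤ) i) (x : Fx ρ ι) (x' : Fx ρ (ι.comp j)) (h : x.1 = x'.1) :
    tm ρ ι i (Hmap (triv j) i y) x = tm ρ (ι.comp j) i y x' := by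
  rw [tm_apply, tm_apply, Hmap_comp]
  congr 1
  congr 1
  refine RMor.ext' (fun g => rfl) ?_
  intro m
  change m • x.1 = m • x'.1
  rw [h]

end times

section hyp
variable {D V : Type} [Field D] [AddCommGroup V] [Module D V] (B : V →ₗ[D] V →ₗ[D] D)

/-- pointwise stabilizer of a word in the isometry group -/
def stab (w : List (V × V)) : Subgroup (V ≃ₗ[D] V) where
  carrier := {g | (∀ x y, B (g x) (g y) = B x y) ∧ ∀ a ∈ w, g a.1 = a.1 ∧ g a.2 = a.2}
  one_mem' := ⟨fun _ _ => rfl, fun _ _ => ⟨rfl, rfl⟩⟩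
  mul_mem' := by
    intro g h hg hh
    refine ⟨fun x y => ?_, fun a ha => ⟨?_, ?_⟩⟩
    · change B (g (h x)) (g (h y)) = _
      rw [hg.1, hh.1]
    · change g (h a.1) = _
      rw [(hh.2 a ha).1, (hg.2 a ha).1]
    · change g (h a.2) = _
      rw [(hh.2 a ha).2, (hg.2 a ha).2]
  inv_mem' := by
    intro g hg
    refine ⟨fun x y => ?_, fun a ha => ⟨?_, ?_⟩⟩
    · change B (g.symm x) (g.symm y) = _
      rw [← hg.1, LinearEquiv.apply_symm_apply, LinearEquiv.apply_symm_apply]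
    · change g.symm a.1 = _
      rw [LinearEquiv.symm_apply_eq, (hg.2 a ha).1]
    · change g.symm a.2 = _
      rw [LinearEquiv.symm_apply_eq, (hg.2 a ha).2]

variable {B}

theorem stab_mono {w w' : List (V × V)} (h : w ⊆ w') : stab B w' ≤ stab B w :=
  fun g hg => ⟨hg.1, fun a ha => hg.2 a (h ha)⟩

theorem smul_pair {w : List (V × V)} (g : stab B w) (a : V × V) :
    g • a = (g.1 a.1, g.1 a.2) := rfl

theorem stab_perp {w : List (V × V)} (g : stab B w) {x : V} (hx : x ∈ perp B w) :
    g.1 x ∈ perp B w := by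
  intro a ha
  have h1 := g.2.1 a.1 x
  have h2 := g.2.1 a.2 x
  rw [(g.2.2 a ha).1] at h1
  rw [(g.2.2 a ha).2] at h2
  rw [h1, h2]; exact hx a ha

variable (B)
/-- words orthogonal to a word -/
def SW (w : List (V × V)) (l : ℕ) : Set (List (V × V)) := WW (OR B) (HL B (perp B w)) l
variable {B}

theorem SW_inv (w : List (V × V)) (l : ℕ) : WInv (stab B w) (SW B w l) := by
  intro g u hu
  exact WW_map (fun x => g.1 x) (fun x hx => stab_perp g hx) (fun x _ y _ => g.2.1 x y) hu

theorem SW_face (w : List (V × V)) (l : ℕ) : ∀ u ∈ SW B w (l + 1), ∀ i < u.length,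
    u.eraseIdx i ∈ SW B w l := by
  intro u hu i hi
  exact ⟨hu.1.sublist (List.eraseIdx_sublist ..), fun a ha => hu.2.1 a (List.mem_of_mem_eraseIdx ha),
    by rw [List.length_eraseIdx_of_lt hi, hu.2.2]; rfl⟩


theorem SW_append (hB : ∀ x y, B x y = B y x) {w u : List (V × V)} {l m : ℕ} (hw : w ∈ WW (OR B) (HL B ⊤) m)
    (hu : u ∈ SW B w l) : u ++ w ∈ WW (OR B) (HL B ⊤) (l + m) := by
  refine ⟨?_, ?_, by simp [hu.2.2, hw.2.2]⟩
  · rw [List.pairwise_append]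
    refine ⟨hu.1, hw.1, fun a ha b hb => ?_⟩
    have h := hu.2.1 a ha
    have h1 := h.2.1 b hb
    have h2 := h.2.2 b hb
    refine OR_symm hB ⟨h1.1, h2.1, h1.2, h2.2⟩
  · intro a ha
    rcases List.mem_append.1 ha with ha | ha
    · exact HL_mono le_top (hu.2.1 a ha)
    · exact hw.2.1 a ha

theorem SW_of_append (hB : ∀ x y, B x y = B y x) {w u : List (V × V)} {l m : ℕ} 
    (hu : u ++ w ∈ WW (OR B) (HL B ⊤) m) (hl : u.length = l) : u ∈ SW B w l := by
  have h := List.pairwise_append.1 hu.1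
  refine ⟨h.1, fun a ha => ?_, hl⟩
  refine ⟨(hu.2.1 a (by simp [ha])).1, fun b hb => ?_, fun b hb => ?_⟩
  · have := OR_symm hB (h.2.2 a ha b hb)
    exact ⟨this.1, this.2.2.1⟩
  · have := OR_symm hB (h.2.2 a ha b hb)
    exact ⟨this.2.1, this.2.2.2⟩

/-- isometry between full words -/
theorem full_iso (hB : ∀ x y, B x y = B y x) {N : ℕ} (hfull : ∀ w ∈ WW (OR B) (HL B ⊤) N, perp B w = ⊥)
    {w w' : List (V × V)} (hw : w ∈ WW (OR B) (HL B ⊤) N) (hw' : w' ∈ WW (OR B) (HL B ⊤) N) :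
    ∃ g : V ≃ₗ[D] V, (∀ x y, B (g x) (g y) = B x y) ∧ w.map (fun a => (g a.1, g a.2)) = w' := by
  -- transfer map
  let T : (Fin N → V × V) → (Fin N → V × V) → V →ₗ[D] V := fun c c' =>
    ∑ i, ((B (c i).2).smulRight (c' i).1 + (B (c i).1).smulRight (c' i).2)
  have hT : ∀ c c' x, T c c' x = ∑ i, (B (c i).2 x • (c' i).1 + B (c i).1 x • (c' i).2) := by
    intro c c' x; simp [T]
  have key : ∀ w ∈ WW (OR B) (HL B ⊤) N, ∃ c : Fin N → V × V, w = List.ofFn c ∧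
      (∀ i j, B (c i).1 (c j).1 = 0) ∧ (∀ i j, B (c i).2 (c j).2 = 0) ∧
      (∀ i j, B (c i).1 (c j).2 = if i = j then 1 else 0) ∧
      (∀ i j, B (c i).2 (c j).1 = if i = j then 1 else 0) := by
    intro w hw
    obtain ⟨c, rfl⟩ : ∃ c : Fin N → V × V, w = List.ofFn c := by
      have := hw.2.2
      subst this
      exact ⟨w.get, by simp⟩
    have h1 : ∀ i j, i ≠ j → OR B (c i) (c j) := by
      have := List.pairwise_ofFn.1 hw.1
      intro i j hij
      rcases lt_or_gt_of_ne hij with h | h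
      · exact this h
      · exact OR_symm hB (this h)
    have h2 : ∀ i, HP B (c i) := fun i => (hw.2.1 (c i) (by simp)).1
    refine ⟨c, rfl, ?_, ?_, ?_, ?_⟩ <;> intro i j <;> by_cases hij : i = j
    · subst hij; exact (h2 i).1
    · exact (h1 i j hij).1
    · subst hij; exact (h2 i).2.1
    · exact (h1 i j hij).2.2.2
    · subst hij; simpa using (h2 i).2.2
    · simpa [hij] using (h1 i j hij).2.1
    · subst hij; rw [hB]; simpa using (h2 i).2.2
    · simpa [hij] using (h1 i j hij).2.2.1
  obtain ⟨c, rfl, c1, c2, c3, c4⟩ := key w hw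
  obtain ⟨c', rfl, d1, d2, d3, d4⟩ := key w' hw'
  have ex : ∀ c : Fin N → V × V, List.ofFn c ∈ WW (OR B) (HL B ⊤) N →
      (∀ i j, B (c i).1 (c j).1 = 0) → (∀ i j, B (c i).2 (c j).2 = 0) →
      (∀ i j, B (c i).1 (c j).2 = if i = j then 1 else 0) →
      (∀ i j, B (c i).2 (c j).1 = if i = j then 1 else 0) → ∀ x, T c c x = x := by
    intro c hc c1 c2 c3 c4 x
    have : x - T c c x ∈ perp B (List.ofFn c) := by
      intro a ha
      obtain ⟨i, rfl⟩ := (List.mem_ofFn' _ _).1 ha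
      simp [hT, map_sum, c1, c2, c3, c4]
    rw [hfull _ hc, Submodule.mem_bot, sub_eq_zero] at this
    exact this.symm
  have t1 : ∀ c c' : Fin N → V × V, 
      (∀ i j, B (c i).1 (c j).1 = 0) → (∀ i j, B (c i).2 (c j).2 = 0) →
      (∀ i j, B (c i).1 (c j).2 = if i = j then 1 else 0) →
      (∀ i j, B (c i).2 (c j).1 = if i = j then 1 else 0) →
      (∀ j, T c c' (c j).1 = (c' j).1) ∧ (∀ j, T c c' (c j).2 = (c' j).2) := by
    intro c c' c1 c2 c3 c4
    constructor <;> intro j <;> simp [hT, c1, c2, c3, c4]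
  have tt : ∀ c c' : Fin N → V × V, (∀ x, T c c x = x) →
      (∀ j, T c' c (c' j).1 = (c j).1) ∧ (∀ j, T c' c (c' j).2 = (c j).2) →
      ∀ x, T c' c (T c c' x) = x := by
    intro c c' h h' x
    rw [hT c c', map_sum]
    conv_rhs => rw [← h x, hT]
    simp [h'.1, h'.2]
  refine ⟨LinearEquiv.ofLinear (T c c') (T c' c) (LinearMap.ext (tt c' c (ex c' hw' d1 d2 d3 d4)
    (t1 c c' c1 c2 c3 c4))) (LinearMap.ext (tt c c' (ex c hw c1 c2 c3 c4) (t1 c' c d1 d2 d3 d4))), ?_, ?_⟩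
  · intro x y
    change B (T c c' x) (T c c' y) = _
    have e1 : ∀ j, B (T c c' x) (c' j).1 = B x (c j).1 := by
      intro j; simp [hT, map_sum, d1, d4, d3, hB x]
    have e2 : ∀ j, B (T c c' x) (c' j).2 = B x (c j).2 := by
      intro j; simp [hT, map_sum, d2, d4, d3, hB x]
    rw [hT c c' y, map_sum]
    conv_rhs => rw [← ex c hw c1 c2 c3 c4 y, hT, map_sum]
    simp [e1, e2]
  · rw [List.map_ofFn]
    congr 1
    funext j
    have := t1 c c' c1 c2 c3 c4
    exact Prod.ext (this.1 j) (this.2 j)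

theorem SW_trans (hB : ∀ x y, B x y = B y x) {N : ℕ} (hfull : ∀ w ∈ WW (OR B) (HL B ⊤) N, perp B w = ⊥)
    (hN : gen B ⊤ N) {m l : ℕ} (hml : l + m ≤ N) {w : List (V × V)} (hw : w ∈ WW (OR B) (HL B ⊤) m)
    {u u' : List (V × V)} (hu : u ∈ SW B w l) (hu' : u' ∈ SW B w l) :
    ∃ g : stab B w, u.map (g • ·) = u' := by
  have ext : ∀ u ∈ SW B w l, ∃ t, t ++ (u ++ w) ∈ WW (OR B) (HL B ⊤) N ∧ t.length = N - (l + m) := by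
    intro u hu
    have h := SW_append hB hw hu
    obtain ⟨t, ht⟩ := gen_word (g := N - (l + m)) hB (by rwa [Nat.sub_add_cancel hml]) h
    rw [top_inf_eq] at ht
    have := SW_append hB h ht
    rw [Nat.sub_add_cancel hml] at this
    exact ⟨t, this, ht.2.2⟩
  obtain ⟨t, ht, htl⟩ := ext u hu
  obtain ⟨t', ht', htl'⟩ := ext u' hu'
  obtain ⟨g, hg, e⟩ := full_iso hB hfull ht ht'
  rw [List.map_append, List.map_append] at e
  have e1 := (List.append_inj e (by simp [htl, htl'])).2
  have e2 := List.append_inj e1 (by simp [hu.2.2, hu'.2.2])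
  refine ⟨⟨g, hg, ?_⟩, e2.1⟩
  intro a ha
  have := List.map_inj_left.1 (e2.2.trans (List.map_id w).symm) a ha
  exact ⟨congrArg Prod.fst this, congrArg Prod.snd this⟩

end hyp
end Stmt3

namespace Stmt3
open Finsupp
set_option linter.all false
set_option linter.unusedSectionVars false
set_option linter.unusedSimpArgs false
set_option linter.unusedVariables false

section hyp
variable {D V : Type} [Field D] [AddCommGroup V] [Module D V] {B : V →ₗ[D] V →ₗ[D] D}

/-- split hyperbolic space of genus `N` -/
structure HypSp (B : V →ₗ[D] V →ₗ[D] D) (N : ℕ) : Prop where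
  symm : ∀ x y, B x y = B y x
  full : ∀ w ∈ WW (OR B) (HL B ⊤) N, perp B w = ⊥
  gen : gen B ⊤ N

/-- inclusion of stabilizers -/
def sinc (B : V →ₗ[D] V →ₗ[D] D) (u w : List (V × V)) : stab B (u ++ w) →* stab B w :=
  Subgroup.inclusion (stab_mono (by simp))

theorem sinc_coe (u w : List (V × V)) (g : stab B (u ++ w)) : (sinc B u w g).1 = g.1 := rfl

theorem sinc_fix (u w : List (V × V)) (g : stab B (u ++ w)) (v : List (V × V)) (hv : v ⊆ u) :
    v.map (sinc B u w g • ·) = v := by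
  refine (List.map_inj_left.2 fun a ha => ?_).trans (List.map_id v)
  have := g.2.2 a (List.mem_append_left _ (hv ha))
  exact Prod.ext this.1 this.2

/-- fixed words -/
noncomputable def fw (u w : List (V × V)) {l : ℕ} (v : List (V × V)) (hv : v ∈ SW B w l) (hvu : v ⊆ u) :
    Fx (cRep (SW B w l) (SW_inv w l)) (sinc B u w) :=
  ⟨bw v hv, bw_fix _ _ _ _ fun p => sinc_fix u w p v hvu⟩

theorem SW_len {w u : List (V × V)} {l : ℕ} (h : u ∈ SW B w l) : u.length = l := h.2.2

theorem fw_congr {u w : List (V × V)} {l : ℕ} {v v' : List (V × V)} (h : v = v')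
    (hv : v ∈ SW B w l) (hvu : v ⊆ u) (hv' : v' ∈ SW B w l) (hvu' : v' ⊆ u) :
    fw u w v hv hvu = fw u w v' hv' hvu' := by subst h; rfl

/-- isometry exchanging two letters -/
theorem swap_iso (hB : ∀ x y, B x y = B y x) {a b : V × V} (ha : HP B a) (hb : HP B b)
    (hab : OR B a b) : ∃ g : V ≃ₗ[D] V, (∀ x y, B (g x) (g y) = B x y) ∧
      (∀ x, g x = x - B x (a.2 - b.2) • (a.1 - b.1) - B x (a.1 - b.1) • (a.2 - b.2)) ∧
      g a.1 = b.1 ∧ g a.2 = b.2 ∧ g b.1 = a.1 ∧ g b.2 = a.2 := by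
  obtain ⟨a1, a2, a3⟩ := ha
  obtain ⟨b1, b2, b3⟩ := hb
  obtain ⟨c1, c2, c3, c4⟩ := hab
  have a4 : B a.2 a.1 = 1 := by rw [hB, a3]
  have b4 : B b.2 b.1 = 1 := by rw [hB, b3]
  have d1 : B b.1 a.1 = 0 := by rw [hB, c1]
  have d2 : B b.1 a.2 = 0 := by rw [hB, c3]
  have d3 : B b.2 a.1 = 0 := by rw [hB, c2]
  have d4 : B b.2 a.2 = 0 := by rw [hB, c4]
  let T : V →ₗ[D] V := LinearMap.id - (B (a.2 - b.2)).smulRight (a.1 - b.1)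
    - (B (a.1 - b.1)).smulRight (a.2 - b.2)
  have hT : ∀ x, T x = x - B x (a.2 - b.2) • (a.1 - b.1) - B x (a.1 - b.1) • (a.2 - b.2) := by
    intro x; simp only [T, LinearMap.sub_apply, LinearMap.id_apply, LinearMap.smulRight_apply, hB x]
  have hTT : ∀ x, T (T x) = x := by
    intro x
    rw [hT (T x), hT x]
    simp only [map_sub, map_smul, LinearMap.sub_apply, LinearMap.smul_apply, smul_eq_mul,
      a1, a2, a3, a4, b1, b2, b3, b4, c1, c2, c3, c4, d1, d2, d3, d4]
    module
  refine ⟨LinearEquiv.ofLinear T T (LinearMap.ext hTT) (LinearMap.ext hTT), ?_, hT, ?_, ?_, ?_, ?_⟩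
  · intro x y
    change B (T x) (T y) = _
    rw [hT, hT]
    simp only [map_sub, map_smul, LinearMap.sub_apply, LinearMap.smul_apply, smul_eq_mul,
      a1, a2, a3, a4, b1, b2, b3, b4, c1, c2, c3, c4, d1, d2, d3, d4, hB y a.1, hB y a.2, hB y b.1, hB y b.2,
      hB x a.1, hB x a.2, hB x b.1, hB x b.2]
    ring
  all_goals
    change T _ = _
    rw [hT]
    simp only [map_sub, map_smul, LinearMap.sub_apply, LinearMap.smul_apply, smul_eq_mul,
      a1, a2, a3, a4, b1, b2, b3, b4, c1, c2, c3, c4, d1, d2, d3, d4]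
    module

theorem fw_swap (hB : ∀ x y, B x y = B y x) (w l1 l2 : List (V × V)) (a b : V × V) {l : ℕ}
    (hu : l1 ++ a :: b :: l2 ∈ SW B w (l + 1))
    (h1 : l1 ++ a :: l2 ∈ SW B w l) (h2 : l1 ++ b :: l2 ∈ SW B w l)
    (i : ℕ) (y : HH (1 : stab B ((l1 ++ a :: b :: l2) ++ w) →* AddMonoid.End ℤ) i) :
    tm _ _ i y (fw (l1 ++ a :: b :: l2) w (l1 ++ a :: l2) h1 (by intro x; simp; tauto)) =
    tm _ _ i y (fw (l1 ++ a :: b :: l2) w (l1 ++ b :: l2) h2 (by intro x; simp; tauto)) := by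
  have ha := hu.2.1 a (by simp)
  have hb := hu.2.1 b (by simp)
  have hp := List.pairwise_append.1 hu.1
  have hp2 := List.pairwise_cons.1 hp.2.1
  have hp3 := List.pairwise_cons.1 hp2.2
  have hab : OR B a b := hp2.1 b (by simp)
  obtain ⟨g, hg, hgx, g1, g2, g3, g4⟩ := swap_iso hB ha.1 hb.1 hab
  have fixp : ∀ x, B a.1 x = 0 → B a.2 x = 0 → B b.1 x = 0 → B b.2 x = 0 → g x = x := by
    intro x e1 e2 e3 e4
    rw [hgx, map_sub, map_sub, hB x, hB x, hB x, hB x, e1, e2, e3, e4]; simp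
  have hw : ∀ c ∈ w, g c.1 = c.1 ∧ g c.2 = c.2 := by
    intro c hc
    have h1 := ha.2.1 c hc
    have h2 := ha.2.2 c hc
    have h3 := hb.2.1 c hc
    have h4 := hb.2.2 c hc
    constructor <;> apply fixp <;> rw [hB]
    exacts [h1.1, h2.1, h3.1, h4.1, h1.2, h2.2, h3.2, h4.2]
  have hor : ∀ c, OR B a c → OR B b c → (g c.1, g c.2) = c := by
    intro c h1 h2
    refine Prod.ext (fixp _ h1.1 h1.2.2.1 h2.1 h2.2.2.1) (fixp _ h1.2.1 h1.2.2.2 h2.2.1 h2.2.2.2)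
  refine tm_conj _ _ i y _ _ ⟨g, hg, hw⟩ ?_ ?_
  · intro p
    have pa := p.2.2 a (by simp)
    have pb := p.2.2 b (by simp)
    refine Subtype.ext (LinearEquiv.ext fun x => ?_)
    change g (p.1 x) = p.1 (g x)
    have e : ∀ z, p.1 z = z → B (p.1 x) z = B x z := by
      intro z hz
      conv_lhs => rw [← hz]
      exact p.2.1 x z
    rw [hgx, hgx]
    simp only [map_sub, map_smul]
    rw [e _ pa.1, e _ pa.2, e _ pb.1, e _ pb.2, pa.1, pa.2, pb.1, pb.2]
  · refine Subtype.ext ?_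
    refine (lrep_single (G := stab B w) ⟨g, hg, hw⟩ (l1 ++ a :: l2) 1).trans ?_
    change single _ _ = single _ _
    congr 1
    rw [List.map_append, List.map_cons]
    have e1 : ∀ t : List (V × V), (∀ c ∈ t, OR B a c ∧ OR B b c) →
        t.map ((⟨g, hg, hw⟩ : stab B w) • ·) = t := by
      intro t ht
      refine (List.map_inj_left.2 fun c hc => ?_).trans (List.map_id t)
      exact hor c (ht c hc).1 (ht c hc).2
    rw [e1 l1 fun c hc => ⟨OR_symm hB (hp.2.2 c hc a (by simp)), OR_symm hB (hp.2.2 c hc b (by simp))⟩,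
      e1 l2 fun c hc => ⟨hp2.1 c (by simp [hc]), hp3.1 c hc⟩]
    have : ((⟨g, hg, hw⟩ : stab B w) • a) = b := Prod.ext g1 g2
    rw [this]

theorem fw_face (hB : ∀ x y, B x y = B y x) (w u : List (V × V)) {l : ℕ}
    (hu : u ∈ SW B w (l + 1)) (i : ℕ) (y : HH (1 : stab B (u ++ w) →* AddMonoid.End ℤ) i)
    (j : ℕ) (hj : j < u.length) :
    tm _ _ i y (fw u w (u.eraseIdx j) (SW_face w l u hu j hj) (List.eraseIdx_subset ..)) =
    tm _ _ i y (fw u w (u.eraseIdx 0) (SW_face w l u hu 0 (by omega)) (List.eraseIdx_subset ..)) := by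
  induction j with
  | zero => rfl
  | succ j ih =>
    rw [← ih (by omega)]
    obtain ⟨l1, a, b, l2, rfl, hl⟩ : ∃ l1 a b l2, u = l1 ++ a :: b :: l2 ∧ l1.length = j := by
      refine ⟨u.take j, u[j], u[j+1], u.drop (j + 2), ?_, by simp; omega⟩
      rw [List.getElem_cons_drop, List.getElem_cons_drop, List.take_append_drop]
    have e1 : (l1 ++ a :: b :: l2).eraseIdx (j + 1) = l1 ++ a :: l2 := by
      rw [List.eraseIdx_append_of_length_le (by omega), hl]; simp
    have e2 : (l1 ++ a :: b :: l2).eraseIdx j = l1 ++ b :: l2 := by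
      rw [List.eraseIdx_append_of_length_le (by omega), hl]; simp
    have h1 : l1 ++ a :: l2 ∈ SW B w l := e1 ▸ SW_face w l _ hu (j + 1) hj
    have h2 : l1 ++ b :: l2 ∈ SW B w l := e2 ▸ SW_face w l _ hu j (by omega)
    rw [fw_congr e1 _ _ h1 (by intro x; simp; tauto), fw_congr e2 _ _ h2 (by intro x; simp; tauto)]
    exact fw_swap hB w l1 l2 a b hu h1 h2 i y

/-- boundary of a word as fixed chain -/
theorem bd_fw (hB : ∀ x y, B x y = B y x) (w u : List (V × V)) {l : ℕ}
    (hu : u ∈ SW B w (l + 1)) (i : ℕ) (y : HH (1 : stab B (u ++ w) →* AddMonoid.End ℤ) i)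
    (x : Fx (cRep (SW B w l) (SW_inv w l)) (sinc B u w)) (hx : x.1.1 = bdw u) :
    tm _ _ i y x = (∑ j ∈ Finset.range (l + 1), (-1 : ℤ) ^ j) •
      tm _ _ i y (fw u w (u.eraseIdx 0) (SW_face w l u hu 0 (by rw [SW_len hu]; omega)) (List.eraseIdx_subset ..)) := by
  have e : x = ∑ j : Fin (l + 1), (-1 : ℤ) ^ (j : ℕ) • fw u w (u.eraseIdx j)
      (SW_face w l u hu j (by rw [SW_len hu]; exact j.2)) (List.eraseIdx_subset ..) := by
    apply Subtype.ext
    apply Subtype.ext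
    refine hx.trans ((bdw_face u).trans ?_)
    refine (show _ = ∑ j ∈ Finset.range (l + 1), (-1 : ℤ) ^ j •
      (single (u.eraseIdx j) 1 : List (V × V) →₀ ℤ) by rw [SW_len hu]).trans ?_
    rw [Finset.sum_range, AddSubgroup.val_finset_sum, AddSubgroup.val_finset_sum]
    rfl
  rw [← zmultiplesHom_apply, e, map_sum, map_sum, Finset.sum_range]
  refine Finset.sum_congr rfl fun j _ => ?_
  rw [map_zsmul, zmultiplesHom_apply, fw_face hB w u hu i y j (by rw [SW_len hu]; exact j.2)]

end hyp
end Stmt3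

namespace Stmt3
open Finsupp
set_option linter.all false
set_option linter.unusedSectionVars false
set_option linter.unusedSimpArgs false
set_option linter.unusedVariables false

section hyp
variable {D V : Type} [Field D] [AddCommGroup V] [Module D V] {B : V →ₗ[D] V →ₗ[D] D}

theorem Sh_bij {N m l : ℕ} (H : HypSp B N) (hml : l + m ≤ N) {w u : List (V × V)}
    (hw : w ∈ WW (OR B) (HL B ⊤) m) (hu : u ∈ SW B w l) (i : ℕ) :
    Function.Bijective (fun y => tm _ (sinc B u w) i y (fw u w u hu (fun _ h => h))) := by
  refine (wMor_sh (sinc B u w) ?_ (SW_inv w l) u hu (fun p => sinc_fix u w p u (fun _ h => h)) ?_ ?_).bij i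
  · exact Subgroup.inclusion_injective _
  · intro g hg
    refine ⟨⟨g.1, g.2.1, fun a ha => ?_⟩, rfl⟩
    rcases List.mem_append.1 ha with ha | ha
    · have := List.map_inj_left.1 (hg.trans (List.map_id u).symm) a ha
      exact ⟨congrArg Prod.fst this, congrArg Prod.snd this⟩
    · exact g.2.2 a ha
  · intro u' hu'
    exact SW_trans H.symm H.full H.gen hml hw hu hu'

noncomputable def zinc (w : List (V × V)) (l : ℕ) :
    RMor (zRep (SW B w l) (SW_inv w l)) (cRep (SW B w l) (SW_inv w l)) where
  φ := MonoidHom.id _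
  f := AddSubgroup.inclusion inf_le_left
  comm _ _ := rfl

theorem SW_exact {N m n l : ℕ} (H : HypSp B N) (hmn : n + m = N) (hl : 2 * l + 1 ≤ n)
    {w : List (V × V)} (hw : w ∈ WW (OR B) (HL B ⊤) m) : Exact (SW B w l) (SW B w (l + 1)) := by
  refine HP_exact H.symm l (W := perp B w) ?_
  have := gen_word H.symm (g := n) (by rw [hmn]; exact H.gen) hw
  rw [top_inf_eq] at this
  exact this.le hl

/-- boundary as map to chains -/
theorem tm_bd {w u : List (V × V)} {l : ℕ} (hB : ∀ x y, B x y = B y x) (hu : u ∈ SW B w (l + 1))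
    (hex : Exact (SW B w l) (SW B w (l + 1))) (i : ℕ)
    (y : HH (1 : stab B (u ++ w) →* AddMonoid.End ℤ) i) :
    Hmap (zinc w l) i (Hmap (zSES (SW_inv w l) (SW_inv w (l + 1)) (SW_face w l) hex).mg i
      (tm _ (sinc B u w) i y (fw u w u hu (fun _ h => h)))) =
    (∑ j ∈ Finset.range (l + 1), (-1 : ℤ) ^ j) •
      tm _ _ i y (fw u w (u.eraseIdx 0) (SW_face w l u hu 0 (by rw [SW_len hu]; omega)) (List.eraseIdx_subset ..)) := by
  set x := fw u w u hu (fun _ h => h)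
  let M := (zinc w l).comp (zSES (SW_inv w l) (SW_inv w (l + 1)) (SW_face w l) hex).mg
  have hx : ∀ p, cRep (SW B w l) (SW_inv w l) (sinc B u w p) (M.f x.1) = M.f x.1 := by
    intro p
    have := M.comm (sinc B u w p) x.1
    rw [x.2 p] at this
    exact this.symm
  rw [Hmap_comp]
  refine (tm_map _ _ _ i y M (fun _ => rfl) x ⟨M.f x.1, hx⟩ rfl).trans ?_
  refine bd_fw hB w u hu i y _ ?_
  change bd (single u 1) = _
  rw [bd_single, one_smul]

theorem tm_tail {w v : List (V × V)} {a : V × V} {l : ℕ} (hv : v ∈ SW B w l) (i : ℕ)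
    (y : HH (1 : stab B ((a :: v) ++ w) →* AddMonoid.End ℤ) i) (hs : v ⊆ a :: v) :
    tm _ (sinc B (a :: v) w) i y (fw (a :: v) w v hv hs) =
      tm _ (sinc B v w) i (Hmap (triv (sinc B [a] (v ++ w))) i y) (fw v w v hv (fun _ h => h)) :=
  (tm_triv _ (sinc B v w) (sinc B [a] (v ++ w)) i y (fw v w v hv (fun _ h => h))
    (fw (a :: v) w v hv hs) rfl).symm

theorem alt_even (l : ℕ) (h : Even l) : (∑ j ∈ Finset.range l, (-1 : ℤ) ^ j) = 0 := by
  obtain ⟨k, rfl⟩ := h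
  induction k with
  | zero => simp
  | succ k ih =>
    rw [show k + 1 + (k + 1) = k + k + 1 + 1 by ring, Finset.sum_range_succ, Finset.sum_range_succ, ih,
      pow_succ]
    ring

theorem alt_odd (l : ℕ) (h : Even l) : (∑ j ∈ Finset.range (l + 1), (-1 : ℤ) ^ j) = 1 := by
  rw [Finset.sum_range_succ, alt_even l h, h.neg_one_pow]; rfl

theorem mg_surj {w : List (V × V)} {l : ℕ} (hex : Exact (SW B w l) (SW B w (l + 1))) (i : ℕ)
    (h : ∀ i', i = i' + 1 → Function.Injective (Hmap (zinc (B := B) w (l + 1)) i')) :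
    Function.Surjective (Hmap (zSES (SW_inv w l) (SW_inv w (l + 1)) (SW_face w l) hex).mg i) := by
  set S := zSES (SW_inv (B := B) w l) (SW_inv w (l + 1)) (SW_face w l) hex
  intro x
  cases i with
  | zero => exact S.G_surj0 x
  | succ i =>
    obtain ⟨y, hy⟩ := S.D_ex x
    have h0 := S.D_F hy
    have : y = 0 := h i rfl (h0.trans (map_zero _).symm)
    subst this
    exact S.D_zero hy

/-- stability statements -/
def Ep (B : V →ₗ[D] V →ₗ[D] D) (N k n : ℕ) : Prop :=
  ∀ m w, n + m = N → w ∈ WW (OR B) (HL B ⊤) m → ∀ a ∈ HL B (perp B w),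
    Function.Surjective (Hmap (triv (sinc B [a] w)) k)

/-- stability statements -/
def Mo (B : V →ₗ[D] V →ₗ[D] D) (N k n : ℕ) : Prop :=
  ∀ m w, n + m = N → w ∈ WW (OR B) (HL B ⊤) m → ∀ a ∈ HL B (perp B w),
    Function.Injective (Hmap (triv (sinc B [a] w)) k)

theorem SW_ne {N m l : ℕ} (H : HypSp B N) (hml : l + m ≤ N) {w : List (V × V)}
    (hw : w ∈ WW (OR B) (HL B ⊤) m) : ∃ u, u ∈ SW B w l := by
  obtain ⟨t, ht⟩ := gen_word (g := l) H.symm (H.gen.le hml) hw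
  rw [top_inf_eq] at ht
  exact ⟨t, ht⟩

theorem SW_cons {w v : List (V × V)} {a : V × V} {l : ℕ} (h : a :: v ∈ SW B w (l + 1))
    (hB : ∀ x y, B x y = B y x) :
    v ∈ SW B w l ∧ a ∈ HL B (perp B (v ++ w)) := by
  have h1 := List.pairwise_cons.1 h.1
  refine ⟨⟨h1.2, fun b hb => h.2.1 b (by simp [hb]), by simpa using h.2.2⟩, ?_⟩
  have ha := h.2.1 a (by simp)
  refine ⟨ha.1, ?_, ?_⟩ <;> intro b hb <;> rcases List.mem_append.1 hb with hb | hb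
  · have := OR_symm hB (h1.1 b hb); exact ⟨this.1, this.2.2.1⟩
  · exact ha.2.1 b hb
  · have := OR_symm hB (h1.1 b hb); exact ⟨this.2.1, this.2.2.2⟩
  · exact ha.2.2 b hb

theorem SW_cons' {w v : List (V × V)} {a : V × V} {l : ℕ} (hB : ∀ x y, B x y = B y x)
    (hv : v ∈ SW B w l)
    (ha : a ∈ HL B (perp B (v ++ w))) : a :: v ∈ SW B w (l + 1) := by
  refine ⟨List.pairwise_cons.2 ⟨fun b hb => ?_, hv.1⟩, ?_, by simp [hv.2.2]⟩
  · have h1 := ha.2.1 b (by simp [hb])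
    have h2 := ha.2.2 b (by simp [hb])
    exact OR_symm hB ⟨h1.1, h2.1, h1.2, h2.2⟩
  · intro b hb
    rcases List.mem_cons.1 hb with rfl | hb
    · exact ⟨ha.1, fun c hc => ha.2.1 c (by simp [hc]), fun c hc => ha.2.2 c (by simp [hc])⟩
    · exact hv.2.1 b hb

theorem inj_step {N n : ℕ} (H : HypSp B N)
    (ihE : ∀ n' < n, ∀ k, 2 * k < n' → Ep B N k n') (ihM : ∀ n' < n, ∀ k, 2 * k + 2 < n' → Mo B N k n')
    {m : ℕ} (hmn : n + m = N) {w : List (V × V)} (hw : w ∈ WW (OR B) (HL B ⊤) m) (i : ℕ) :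
    ∀ l, 1 ≤ l → 2 * i + 2 * l + 1 ≤ n → (Odd l ∧ 2 * i + l + 2 ≤ n ∨ Even l ∧ 2 * i + l + 3 ≤ n) →
    Function.Injective (Hmap (zinc (B := B) w l) i) := by
  induction i using Nat.strong_induction_on with
  | _ i ih =>
  intro l hl hn hpar
  have hex := SW_exact H hmn (l := l) (by omega) hw
  have hsur := mg_surj hex i (by
    rintro i' rfl
    refine ih i' (by omega) (l + 1) (by omega) (by omega) ?_
    rcases hpar with ⟨p, q⟩ | ⟨p, q⟩
    · right; exact ⟨p.add_one, by omega⟩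
    · left; exact ⟨p.add_one, by omega⟩)
  rw [injective_iff_map_eq_zero]
  intro ζ hζ
  obtain ⟨u, hu⟩ := SW_ne H (l := l + 1) (by omega) hw
  obtain ⟨a, v, rfl⟩ := List.exists_cons_of_length_eq_add_one (SW_len hu)
  obtain ⟨hv, ha⟩ := SW_cons hu H.symm
  have hvw := SW_append H.symm hw hv
  have huw := SW_append H.symm hw hu
  obtain ⟨x, rfl⟩ := hsur ζ
  obtain ⟨y, rfl⟩ := (Sh_bij H (by omega) hw hu i).2 x
  change Hmap _ i (Hmap _ i (tm _ (sinc B (a :: v) w) i y (fw (a :: v) w (a :: v) hu (fun _ h => h)))) = 0 at hζ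
  change (Hmap _ i (tm _ (sinc B (a :: v) w) i y (fw (a :: v) w (a :: v) hu (fun _ h => h)))) = 0
  rcases hpar with ⟨p, q⟩ | ⟨p, q⟩
  · -- odd case
    obtain ⟨b, hb⟩ : ∃ b, b ∈ HL B (perp B (a :: v ++ w)) := by
      obtain ⟨t, ht⟩ := SW_ne H (l := 1) (by omega) huw
      obtain ⟨b, t, rfl⟩ := List.exists_cons_of_length_eq_add_one (SW_len ht)
      exact ⟨b, ht.2.1 b (by simp)⟩
    obtain ⟨y', rfl⟩ := ihE (n - (l + 1)) (by omega) i (by omega) (l + 1 + m) (a :: v ++ w) (by omega) huw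
      b hb y
    have hu' := SW_cons' H.symm hu hb
    have e1 := tm_tail (a := b) hu i y' (List.subset_cons_self ..)
    have hmem : bdw (b :: a :: v) ∈ CC (SW B w (l + 1)) := by
      have := bdw_mem (SW_face w (l + 1)) (single_mem_CC hu' 1)
      rwa [bd_single, one_smul] at this
    have hfix : ∀ p, cRep (SW B w (l + 1)) (SW_inv w (l + 1)) (sinc B (b :: a :: v) w p) ⟨_, hmem⟩ =
        ⟨_, hmem⟩ := by
      intro p
      refine Subtype.ext ?_
      change lrep (stab B w) (V × V) (sinc B (b :: a :: v) w p) (bdw (b :: a :: v)) = bdw (b :: a :: v)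
      have := lrep_bd (sinc B (b :: a :: v) w p) (single (b :: a :: v) 1)
      rw [bd_single, one_smul] at this
      refine this.symm.trans ?_
      rw [lrep_single, sinc_fix _ _ _ _ (fun _ h => h), bd_single, one_smul]
    let x' : Fx (cRep (SW B w (l+1)) (SW_inv w (l+1))) (sinc B (b :: a :: v) w) := ⟨⟨_, hmem⟩, hfix⟩
    have e2 := bd_fw H.symm w (b :: a :: v) hu' i y' x' rfl
    rw [alt_odd (l + 1) p.add_one, one_smul] at e2
    have e3 := tm_map _ _ _ i y' (zSES (SW_inv w l) (SW_inv w (l + 1)) (SW_face w l) hex).mg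
      (fun _ => rfl) x' 0 (by
        refine Subtype.ext ?_
        change bd (bdw (b :: a :: v)) = 0
        have := bd_bd (single (b :: a :: v) 1)
        rwa [bd_single, one_smul] at this)
    rw [map_zero] at e3
    refine Eq.trans ?_ e3
    refine congrArg _ ?_
    exact e1.symm.trans e2.symm
  · rw [tm_bd H.symm hu hex i y, alt_odd l p, one_smul] at hζ
    change tm _ (sinc B (a :: v) w) i y (fw (a :: v) w v hv _) = 0 at hζ
    replace hζ := (tm_tail hv i y (List.subset_cons_self ..)).symm.trans hζ
    have h1 := (Sh_bij H (by omega) hw hv i).1 (hζ.trans (by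
      change 0 = tm _ (sinc B v w) i 0 _
      rw [tm_apply, map_zero]))
    have h2 := ihM (n - l) (by omega) i (by omega) (l + m) (v ++ w) (by omega) hvw a ha
      (h1.trans (map_zero _).symm)
    rw [h2, tm_apply, map_zero, map_zero]


theorem nil_mem (w : List (V × V)) : ([] : List (V × V)) ∈ SW B w 0 := by
  refine ⟨by simp, by simp, rfl⟩

theorem single_mem_SW {w : List (V × V)} {a : V × V} (ha : a ∈ HL B (perp B w)) :
    [a] ∈ SW B w 1 := by
  refine ⟨by simp, by simpa using ha, rfl⟩

theorem zinc_zero_inj (w : List (V × V)) (i : ℕ) : Function.Injective (Hmap (zinc (B := B) w 0) i) := by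
  let M : RMor (cRep (SW B w 0) (SW_inv w 0)) (zRep (SW B w 0) (SW_inv w 0)) :=
    { φ := MonoidHom.id _
      f := AddMonoidHom.mk' (fun x => ⟨x.1, x.2, by
        change bd x.1 = 0
        refine CC_ind (S := SW B w 0) (p := fun x => bd x = 0) (map_zero _) ?_ ?_ x.2
        · intro x y hx hy; rw [map_add, hx, hy, add_zero]
        · intro u hu n
          obtain rfl := List.eq_nil_of_length_eq_zero (SW_len hu)
          rw [bd_single]; simp [bdw]⟩) (fun _ _ => rfl)
      comm := fun _ _ => rfl }
  have : ∀ x, Hmap M i (Hmap (zinc (B := B) w 0) i x) = x := by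
    intro x
    rw [Hmap_comp]
    exact Hmap_id' _ (fun _ => rfl) (fun _ => rfl) i x
  exact Function.LeftInverse.injective this

theorem tm_zero' {P G N : Type} [Group P] [Group G] [AddCommGroup N]
    (ρ : G →* AddMonoid.End N) (ι : P →* G) (i : ℕ)
    {y : HH (1 : P →* AddMonoid.End ℤ) i} (h : y = 0) (x : Fx ρ ι) : tm ρ ι i y x = 0 := by
  rw [h, tm_apply, map_zero]

theorem finite_stab {N : ℕ} (H : HypSp B N) (n : ℕ) :
    (∀ k, 2 * k < n → Ep B N k n) ∧ (∀ k, 2 * k + 2 < n → Mo B N k n) := by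
  induction n using Nat.strong_induction_on with
  | _ n ihn =>
  have step := fun m hmn w hw => inj_step H (n := n) (fun n' h => (ihn n' h).1) (fun n' h => (ihn n' h).2)
    (m := m) hmn (w := w) hw
  constructor
  · intro k hk m w hmn hw a ha x
    have hex := SW_exact H hmn (l := 0) (by omega) hw
    have hu := single_mem_SW ha
    have hsur := mg_surj hex k (by
      rintro i rfl
      exact step m hmn w hw i 1 (by omega) (by omega) (Or.inl ⟨by decide, by omega⟩))
    have hnb := Sh_bij H (l := 0) (by omega) hw (nil_mem w) k
    let z0 : Fx (zRep (SW B w 0) (SW_inv w 0)) (sinc B [] w) := ⟨⟨single [] 1, single_mem_CC (nil_mem w) 1, by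
      change bd (single [] 1) = 0
      rw [bd_single]; simp [bdw]⟩, fun p => Subtype.ext (lrep_single (G := stab B w) _ _ _)⟩
    obtain ⟨t, ht⟩ := hsur (tm _ (sinc B [] w) k x z0)
    obtain ⟨y, hy⟩ := (Sh_bij H (by omega) hw hu k).2 t
    subst hy
    refine ⟨y, hnb.1 ?_⟩
    clear hsur hnb
    have e1 := tm_map _ _ _ k x (zinc w 0) (fun _ => rfl) z0 (fw [] w [] (nil_mem w) (fun _ h => h)) rfl
    have e2 := congrArg (fun t => Hmap (zinc w 0) k t) ht
    have e3 := tm_bd H.symm hu hex k y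
    rw [alt_odd 0 (by decide), one_smul] at e3
    have e4 := tm_tail (nil_mem w) k y (a := a) (by simp)
    exact e4.symm.trans (e3.symm.trans (e2.trans e1))
  · intro k hk m w hmn hw a ha
    have hex := SW_exact H hmn (l := 0) (by omega) hw
    have hu := single_mem_SW ha
    have hnb := Sh_bij H (l := 0) (by omega) hw (nil_mem w) k
    rw [injective_iff_map_eq_zero]
    intro y hy
    have e3 := tm_bd H.symm hu hex k y
    rw [alt_odd 0 (by decide), one_smul] at e3
    have e4 := tm_tail (nil_mem w) k y (a := a) (by simp)
    replace e4 := e4.trans (tm_zero' _ (sinc B [] w) k hy _)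
    have e6 := zinc_zero_inj w k (((e3.trans e4)).trans (map_zero _).symm)
    obtain ⟨ζ, hζ⟩ := (zSES (SW_inv w 0) (SW_inv w 1) (SW_face w 0) hex).F_G e6
    have hex1 := SW_exact H hmn (l := 1) (by omega) hw
    have hsur := mg_surj hex1 k (by
      rintro i rfl
      exact step m hmn w hw i 2 (by omega) (by omega) (Or.inr ⟨by decide, by omega⟩))
    obtain ⟨u, hu2⟩ := SW_ne H (l := 2) (by omega) hw
    obtain ⟨t, rfl⟩ := hsur ζ
    obtain ⟨y2, rfl⟩ := (Sh_bij H (by omega) hw hu2 k).2 t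
    have e7 := tm_bd H.symm hu2 hex1 k y2
    rw [alt_even 2 (by decide)] at e7
    replace e7 := e7.trans (zero_zsmul _)
    have e8 := (Sh_bij H (by omega) hw hu k).1 (a₁ := y) (a₂ := 0) (hζ.symm.trans (e7.trans (by
      change 0 = tm _ (sinc B [a] w) k 0 _
      rw [tm_apply, map_zero])))
    exact e8
end hyp
end Stmt3

namespace Stmt3
open Finsupp
set_option linter.all false
set_option linter.unusedSectionVars false
set_option linter.unusedSimpArgs false
set_option linter.unusedVariables false

section bar
variable {G G' : Type} [Group G] [Group G']

theorem dd_bar (n : ℕ) (x : (Fin (n + 1) → G) →₀ ℤ) :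
    dd (1 : G →* AddMonoid.End ℤ) n x = barDiff ℤ G n x := by
  induction x using Finsupp.induction_linear with
  | zero => simp
  | add a b ha hb => rw [map_add, map_add, ha, hb]
  | single g m =>
    rw [dd_single, Fin.sum_univ_castSucc, barDiff, Finsupp.lift_apply, Finsupp.sum_single_index (by simp),
      smul_add, smul_add, Finset.smul_sum, ← add_assoc]
    simp only [smul_single', Finsupp.smul_single, smul_eq_mul, mul_one]
    congr 1
    · congr 1
      refine Finset.sum_congr rfl fun i _ => ?_
      have : (Fin.contractNth i.castSucc (· * ·) g) = (fun j : Fin n => if (j : ℕ) < (i : ℕ) then g (Fin.castSucc j)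
            else if (j : ℕ) = (i : ℕ) then g (Fin.castSucc i) * g i.succ
            else g j.succ) := by
        funext j
        simp only [Fin.contractNth, Fin.val_castSucc]
        split_ifs with h1 h2
        · rfl
        · obtain rfl := Fin.ext h2; rfl
        · rfl
      rw [this, Fin.val_castSucc, mul_comm]
    · have : (Fin.contractNth (Fin.last n) (· * ·) g) = (fun j : Fin n => g j.castSucc) := by
        funext j
        simp only [Fin.contractNth, Fin.val_last, j.2, if_true]
      rw [this, Fin.val_last, mul_comm]

theorem cyc_bar (k : ℕ) (x : (Fin k → G) →₀ ℤ) :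
    x ∈ cyc (1 : G →* AddMonoid.End ℤ) k ↔ x ∈ barCycles ℤ G k := by
  cases k with
  | zero => exact ⟨fun _ => trivial, fun _ => trivial⟩
  | succ k =>
    rw [mem_cyc_succ, dd_bar]; rfl

theorem bnd_bar (k : ℕ) (x : (Fin k → G) →₀ ℤ) :
    (∃ y, dd (1 : G →* AddMonoid.End ℤ) k y = x) ↔ x ∈ barBoundaries ℤ G k := by
  simp only [dd_bar]; rfl

theorem cmap_bar (φ : G → G') (k : ℕ) (x : (Fin k → G) →₀ ℤ) :
    cmap φ (AddMonoidHom.id ℤ) k x = barMap ℤ φ k x := by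
  induction x using Finsupp.induction_linear with
  | zero => simp
  | add a b ha hb => rw [map_add, map_add, ha, hb]
  | single g m => rw [cmap_single]; simp [barMap]

theorem bar_surj (φ : G →* G') (k : ℕ) (h : Function.Surjective (Hmap (triv φ) k)) :
    BarInducedSurj ℤ φ k := by
  intro z hz
  obtain ⟨x, hx⟩ := h (cls _ z ((cyc_bar k z).2 hz))
  obtain ⟨w, hw, rfl⟩ := cls_surj _ x
  refine ⟨w, (cyc_bar k w).1 hw, ?_⟩
  rw [← bnd_bar, ← cmap_bar]
  exact (cls_eq _ _ _).1 hx.symm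

theorem bar_inj (φ : G →* G') (k : ℕ) (h : Function.Injective (Hmap (triv φ) k)) :
    BarInducedInj ℤ φ k := by
  intro w hw hb
  rw [← bnd_bar, ← cmap_bar] at hb
  have hw' := (cyc_bar k w).2 hw
  have : Hmap (triv φ) k (cls _ w hw') = 0 := by
    rw [Hmap_cls]; exact (cls_eq_zero _ _).2 hb
  have := h (this.trans (map_zero _).symm)
  exact (bnd_bar k w).1 ((cls_eq_zero _ _).1 this)

theorem triv_comp {G'' : Type} [Group G''] (ψ : G' →* G'') (φ : G →* G') (k : ℕ) (x) :
    Hmap (triv ψ) k (Hmap (triv φ) k x) = Hmap (triv (ψ.comp φ)) k x := by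
  rw [Hmap_comp]; rfl

theorem triv_bij (e : G ≃* G') (k : ℕ) : Function.Bijective (Hmap (triv e.toMonoidHom) k) := by
  have h1 : ∀ x, Hmap (triv e.symm.toMonoidHom) k (Hmap (triv e.toMonoidHom) k x) = x := by
    intro x; rw [triv_comp]
    exact Hmap_id' _ (fun g => e.symm_apply_apply g) (fun _ => rfl) k x
  have h2 : ∀ x, Hmap (triv e.toMonoidHom) k (Hmap (triv e.symm.toMonoidHom) k x) = x := by
    intro x; rw [triv_comp]
    exact Hmap_id' _ (fun g => e.apply_symm_apply g) (fun _ => rfl) k x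
  exact ⟨Function.LeftInverse.injective h1, Function.RightInverse.surjective h2⟩

theorem triv_sq {K K' : Type} [Group K] [Group K'] (φ : G →* G') (ψ : K →* K') (η : G ≃* K) (θ : G' ≃* K')
    (h : ∀ g, θ (φ g) = ψ (η g)) (k : ℕ) :
    (Function.Surjective (Hmap (triv ψ) k) → Function.Surjective (Hmap (triv φ) k)) ∧
    (Function.Injective (Hmap (triv ψ) k) → Function.Injective (Hmap (triv φ) k)) := by
  have e : ∀ x, Hmap (triv θ.toMonoidHom) k (Hmap (triv φ) k x) =
      Hmap (triv ψ) k (Hmap (triv η.toMonoidHom) k x) := by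
    intro x
    rw [triv_comp, triv_comp]
    congr 2
    exact RMor.ext' h (fun _ => rfl)
  constructor
  · intro hs y
    obtain ⟨z, hz⟩ := hs (Hmap (triv θ.toMonoidHom) k y)
    obtain ⟨x, rfl⟩ := (triv_bij η k).2 z
    exact ⟨x, (triv_bij θ k).1 ((e x).trans hz)⟩
  · intro hi x x' hx
    refine (triv_bij η k).1 (hi ?_)
    rw [← e, ← e, hx]

end bar

section model
variable (D : Type) [Field D]

/-- model space -/
abbrev MV (N : ℕ) : Type := (Fin N ⊕ Fin N) → D

/-- model form -/
noncomputable def mB (N : ℕ) : MV D N →ₗ[D] MV D N →ₗ[D] D := Matrix.toLinearMap₂' D (Hmat D N)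

theorem mB_apply (N : ℕ) (x y : MV D N) :
    mB D N x y = ∑ i, x (Sum.inl i) * y (Sum.inr i) + ∑ i, x (Sum.inr i) * y (Sum.inl i) := by
  rw [mB, Matrix.toLinearMap₂'_apply']
  simp [Hmat, dotProduct, Matrix.mulVec, Matrix.one_apply]

theorem mB_symm (N : ℕ) (x y : MV D N) : mB D N x y = mB D N y x := by
  rw [mB_apply, mB_apply, add_comm]
  congr 1 <;> exact Finset.sum_congr rfl fun _ _ => mul_comm _ _

/-- basis letters -/
def mL (N : ℕ) (i : Fin N) : MV D N × MV D N := (Pi.single (Sum.inl i) 1, Pi.single (Sum.inr i) 1)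

theorem mHyp (N : ℕ) : HypSp (mB D N) N where
  symm := mB_symm D N
  full := by
    intro w hw
    obtain ⟨c, rfl⟩ : ∃ c : Fin N → MV D N × MV D N, w = List.ofFn c := by
      obtain ⟨h1, h2, h3⟩ := hw
      exact ⟨fun i => w.get (i.cast h3.symm), by
        apply List.ext_get (by simp [h3]); intro n h1 h2; simp⟩
    have hB := mB_symm D N
    have h1 : ∀ i j, i ≠ j → OR (mB D N) (c i) (c j) := by
      have := List.pairwise_ofFn.1 hw.1
      intro i j hij
      rcases lt_or_gt_of_ne hij with h | h
      · exact this h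
      · exact OR_symm hB (this h)
    have h2 : ∀ i, HP (mB D N) (c i) := fun i => (hw.2.1 (c i) (by simp)).1
    have c1 : ∀ i j, mB D N (c i).1 (c j).1 = 0 := by
      intro i j; by_cases hij : i = j
      · subst hij; exact (h2 i).1
      · exact (h1 i j hij).1
    have c2 : ∀ i j, mB D N (c i).2 (c j).2 = 0 := by
      intro i j; by_cases hij : i = j
      · subst hij; exact (h2 i).2.1
      · exact (h1 i j hij).2.2.2
    have c3 : ∀ i j, mB D N (c i).1 (c j).2 = if i = j then 1 else 0 := by
      intro i j; by_cases hij : i = j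
      · subst hij; simpa using (h2 i).2.2
      · simpa [hij] using (h1 i j hij).2.1
    have c4 : ∀ i j, mB D N (c i).2 (c j).1 = if i = j then 1 else 0 := by
      intro i j; rw [hB, c3]; simp only [eq_comm]
    let Φ : MV D N →ₗ[D] MV D N := LinearMap.pi (Sum.elim (fun i => mB D N (c i).1) (fun i => mB D N (c i).2))
    have hs : Function.Surjective Φ := by
      intro y
      refine ⟨∑ i, (y (Sum.inl i) • (c i).2 + y (Sum.inr i) • (c i).1), ?_⟩
      funext s
      rcases s with s | s
      · change mB D N (c s).1 _ = _
        simp [map_sum, c1, c3]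
      · change mB D N (c s).2 _ = _
        simp [map_sum, c2, c4]
    have hi := LinearMap.injective_iff_surjective.2 hs
    rw [eq_bot_iff]
    intro x hx
    refine hi (Eq.trans ?_ (map_zero _).symm)
    funext s
    rcases s with s | s
    · exact (hx (c s) (by simp)).1
    · exact (hx (c s) (by simp)).2
  gen := by
    refine ⟨List.ofFn (mL D N), ?_, ?_, by simp⟩
    · rw [List.pairwise_ofFn]
      intro i j hij
      refine ⟨?_, ?_, ?_, ?_⟩ <;> simp [mB_apply, mL, Pi.single_apply, hij.ne, hij.ne']
    · intro a ha
      obtain ⟨i, rfl⟩ := (List.mem_ofFn' _ _).1 ha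
      refine ⟨⟨?_, ?_, ?_⟩, trivial, trivial⟩ <;> simp [mB_apply, mL, Pi.single_apply]

end model
end Stmt3

namespace Stmt3
open Finsupp
open Matrix
set_option linter.all false
set_option linter.unusedSectionVars false
set_option linter.unusedSimpArgs false
set_option linter.unusedVariables false

section iso
variable (D : Type) [Field D]

/-- linear equivalence of an invertible matrix -/
noncomputable def glEq (N : ℕ) : GL (Fin N ⊕ Fin N) D ≃* (MV D N ≃ₗ[D] MV D N) :=
  Matrix.GeneralLinearGroup.toLin.trans (LinearMap.GeneralLinearGroup.generalLinearEquiv D (MV D N))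

theorem glEq_apply (N : ℕ) (A : GL (Fin N ⊕ Fin N) D) (x : MV D N) :
    glEq D N A x = (A : Matrix _ _ D).mulVec x := rfl

theorem mB_mat (N : ℕ) (x y : MV D N) : mB D N x y = x ⬝ᵥ (Hmat D N).mulVec y := by
  rw [mB, Matrix.toLinearMap₂'_apply']

theorem mem_O_iff (N : ℕ) (A : GL (Fin N ⊕ Fin N) D) :
    A ∈ OGroup D N ↔ glEq D N A ∈ stab (mB D N) [] := by
  have key : ∀ x y, mB D N (glEq D N A x) (glEq D N A y) =
      x ⬝ᵥ ((A : Matrix _ _ D)ᵀ * Hmat D N * (A : Matrix _ _ D)).mulVec y := by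
    intro x y
    rw [mB_mat, glEq_apply, glEq_apply, Matrix.mulVec_mulVec, Matrix.mul_assoc, ← Matrix.mulVec_mulVec y (A.val)ᵀ,
      Matrix.dotProduct_mulVec x, Matrix.vecMul_transpose]
  rw [mem_oGroup_iff]
  constructor
  · intro h
    refine ⟨fun x y => ?_, by simp⟩
    rw [key, h, mB_mat]
  · intro h
    refine (Matrix.toLinearMap₂' (n := Fin N ⊕ Fin N) (m := Fin N ⊕ Fin N) (S₁ := D) (S₂ := D) (N₂ := D) D).injective ?_
    refine LinearMap.ext fun x => LinearMap.ext fun y => ?_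
    rw [Matrix.toLinearMap₂'_apply', Matrix.toLinearMap₂'_apply']
    rw [← key, ← mB_mat]
    exact h.1 x y

/-- orthogonal group as stabilizer -/
noncomputable def oEq (N : ℕ) : OGroup D N ≃* stab (mB D N) [] where
  toFun A := ⟨glEq D N A.1, (mem_O_iff D N A.1).1 A.2⟩
  invFun g := ⟨(glEq D N).symm g.1, (mem_O_iff D N _).2 (by rw [MulEquiv.apply_symm_apply]; exact g.2)⟩
  left_inv A := Subtype.ext (MulEquiv.symm_apply_apply _ _)
  right_inv g := Subtype.ext (MulEquiv.apply_symm_apply _ _)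
  map_mul' A B := Subtype.ext (map_mul _ _ _)

theorem embMat_mul (n : ℕ) (A B : Matrix (Fin n ⊕ Fin n) (Fin n ⊕ Fin n) D) :
    embMat D n (A * B) = embMat D n A * embMat D n B := by
  simp only [embMat, Matrix.submatrix_mul_equiv, Matrix.fromBlocks_multiply,
      Matrix.mul_zero, Matrix.zero_mul, Matrix.mul_one, Matrix.one_mul, add_zero, zero_add]

/-- embedding as homomorphism -/
noncomputable def embHom (n : ℕ) : OGroup D n →* OGroup D (n + 1) :=
  MonoidHom.mk' (embO D n) (by
    intro A B
    refine Subtype.ext (Units.ext ?_)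
    exact embMat_mul D n _ _)

theorem embMat_mulVec (n : ℕ) (A : Matrix (Fin n ⊕ Fin n) (Fin n ⊕ Fin n) D) (x : MV D (n + 1)) (s) :
    (embMat D n A).mulVec x (sumEquiv n s) =
      (Matrix.fromBlocks A 0 0 (1 : Matrix (Fin 1 ⊕ Fin 1) (Fin 1 ⊕ Fin 1) D)).mulVec (x ∘ sumEquiv n) s := by
  rw [embMat, Matrix.submatrix_mulVec_equiv]
  simp

theorem emb_fix (n : ℕ) (A : OGroup D n) : (oEq D (n + 1) (embHom D n A)).1 ∈
    stab (mB D (n + 1)) [mL D (n + 1) (Fin.last n)] := by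
  refine ⟨(oEq D (n + 1) (embHom D n A)).2.1, ?_⟩
  intro a ha
  obtain rfl := List.mem_singleton.1 ha
  have : ∀ t : Fin 1 ⊕ Fin 1, (embMat D n (A.1 : Matrix _ _ D)).mulVec (Pi.single (sumEquiv n (Sum.inr t)) 1) =
      Pi.single (sumEquiv n (Sum.inr t)) 1 := by
    intro t
    funext s
    obtain ⟨s, rfl⟩ := (sumEquiv n).surjective s
    rw [embMat_mulVec]
    have : (Pi.single (sumEquiv n (Sum.inr t)) 1 : MV D (n + 1)) ∘ sumEquiv n = Pi.single (Sum.inr t) 1 := by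
      funext r; simp [Pi.single_apply]
    rw [this, Matrix.mulVec_single_one]
    rcases s with s | s
    · simp [Matrix.col, Pi.single_apply]
    · simp [Matrix.col, Pi.single_apply, Matrix.one_apply]
  exact ⟨this (Sum.inl 0), this (Sum.inr 0)⟩

/-- small group -/
noncomputable def smHom (n : ℕ) : OGroup D n →* stab (mB D (n + 1)) ([mL D (n + 1) (Fin.last n)] ++ []) where
  toFun A := ⟨_, emb_fix D n A⟩
  map_one' := Subtype.ext (by
    have := congrArg Subtype.val (map_one ((oEq D (n+1)).toMonoidHom.comp (embHom D n)))
    exact this)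
  map_mul' A B := Subtype.ext (by
    have := congrArg Subtype.val (map_mul ((oEq D (n+1)).toMonoidHom.comp (embHom D n)) A B)
    exact this)

theorem embMat_inj (n : ℕ) : Function.Injective (embMat D n) := by
  intro A B h
  ext i j
  have := congrFun (congrFun h (sumEquiv n (Sum.inl i))) (sumEquiv n (Sum.inl j))
  simpa [embMat] using this

theorem glEq_symm_fix (n : ℕ) (g : MV D (n + 1) ≃ₗ[D] MV D (n + 1))
    (h : g ∈ stab (mB D (n + 1)) [mL D (n + 1) (Fin.last n)]) :
    ∃ A, ((glEq D (n + 1)).symm g).val = embMat D n A := by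
  set M := ((glEq D (n + 1)).symm g).val with hM
  have hg : ∀ x, g x = M.mulVec x := by
    intro x
    rw [hM, ← glEq_apply, MulEquiv.apply_symm_apply]
  refine ⟨(M.submatrix (sumEquiv n) (sumEquiv n)).toBlocks₁₁, ?_⟩
  have h2 := h.2 _ (List.mem_singleton_self _)
  have col : ∀ t : Fin 1 ⊕ Fin 1, M.mulVec (Pi.single (sumEquiv n (Sum.inr t)) 1) =
      Pi.single (sumEquiv n (Sum.inr t)) 1 := by
    rintro (t | t)
    · rw [← hg]; exact h2.1
    · rw [← hg]; exact h2.2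
  have row : ∀ (t : Fin 1 ⊕ Fin 1) x, g x (sumEquiv n (Sum.inr t)) = x (sumEquiv n (Sum.inr t)) := by
    intro t x
    have e1 : ∀ x, mB D (n + 1) x (mL D (n + 1) (Fin.last n)).1 = x (Sum.inr (Fin.last n)) := by
      intro x; simp [mB_apply, mL, Pi.single_apply]
    have e2 : ∀ x, mB D (n + 1) x (mL D (n + 1) (Fin.last n)).2 = x (Sum.inl (Fin.last n)) := by
      intro x; simp [mB_apply, mL, Pi.single_apply]
    rcases t with t | t
    · have := h.1 x (mL D (n + 1) (Fin.last n)).2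
      rw [h2.2, e2, e2] at this
      exact this
    · have := h.1 x (mL D (n + 1) (Fin.last n)).1
      rw [h2.1, e1, e1] at this
      exact this
  ext i j
  obtain ⟨i, rfl⟩ := (sumEquiv n).surjective i
  obtain ⟨j, rfl⟩ := (sumEquiv n).surjective j
  rw [embMat, Matrix.submatrix_apply, Equiv.symm_apply_apply, Equiv.symm_apply_apply]
  have colj : ∀ a b, M a b = M.mulVec (Pi.single b 1) a := by
    intro a b; rw [Matrix.mulVec_single_one]; rfl
  rcases j with j | j
  · rcases i with i | i
    · rfl
    · rw [colj, ← hg, row]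
      simp [Pi.single_apply]
  · rw [colj, col]
    rcases i with i | i
    · simp [Pi.single_apply]
    · simp [Pi.single_apply, Matrix.one_apply]

theorem smHom_bij (n : ℕ) : Function.Bijective (smHom D n) := by
  constructor
  · intro A B h
    have h1 : (oEq D (n + 1) (embHom D n A)).1 = (oEq D (n + 1) (embHom D n B)).1 := by
      have := congrArg Subtype.val h
      exact this
    have h2 := (oEq D (n + 1)).injective (Subtype.ext h1)
    have h3 : embMat D n (A.1 : Matrix _ _ D) = embMat D n (B.1 : Matrix _ _ D) :=
      congrArg (fun X : OGroup D (n + 1) => X.1.val) h2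
    exact Subtype.ext (Units.ext (embMat_inj D n h3))
  · intro g
    obtain ⟨A, hA⟩ := glEq_symm_fix D n g.1 g.2
    obtain ⟨A', hA'⟩ := glEq_symm_fix D n g⁻¹.1 g⁻¹.2
    have e1 : embMat D n 1 = 1 := by simp [embMat]
    have m1 : A * A' = 1 := by
      apply embMat_inj D n
      rw [embMat_mul, ← hA, ← hA', e1, ← Units.val_mul, ← map_mul]
      change ((glEq D (n + 1)).symm (g * g⁻¹).1).val = 1
      rw [mul_inv_cancel]; change ((glEq D (n + 1)).symm 1).val = 1
      rw [map_one]; rfl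
    have m2 : A' * A = 1 := mul_eq_one_comm.1 m1
    let U : GL (Fin n ⊕ Fin n) D := ⟨A, A', m1, m2⟩
    have hU : (embGL D n U) = (glEq D (n + 1)).symm g.1 := Units.ext hA.symm
    have hUO : U ∈ OGroup D n := by
      have h1 : embGL D n U ∈ OGroup D (n + 1) := by
        rw [mem_O_iff, hU, MulEquiv.apply_symm_apply]
        exact ⟨g.2.1, by simp⟩
      rw [mem_oGroup_iff] at h1 ⊢
      change (embMat D n A)ᵀ * _ * embMat D n A = _ at h1
      change Aᵀ * _ * A = _
      rw [← hmat_decomp D n] at h1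
      simp only [embMat, Matrix.transpose_submatrix, Matrix.fromBlocks_transpose,
        Matrix.submatrix_mul_equiv, Matrix.fromBlocks_multiply] at h1
      ext i j
      have := congrFun (congrFun h1 (sumEquiv n (Sum.inl i))) (sumEquiv n (Sum.inl j))
      simpa using this
    refine ⟨⟨U, hUO⟩, Subtype.ext ?_⟩
    change glEq D (n + 1) (embGL D n U) = _
    rw [hU, MulEquiv.apply_symm_apply]

theorem frozen_surj (k n : ℕ)
    (h : Function.Surjective (Hmap (triv (sinc (mB D (n + 1)) [mL D (n + 1) (Fin.last n)] [])) k)) :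
    BarInducedSurj ℤ (embO D n) k :=
  bar_surj (embHom D n) k ((triv_sq (embHom D n) _ (MulEquiv.ofBijective _ (smHom_bij D n)) (oEq D (n + 1))
    (fun _ => rfl) k).1 h)

theorem frozen_inj (k n : ℕ)
    (h : Function.Injective (Hmap (triv (sinc (mB D (n + 1)) [mL D (n + 1) (Fin.last n)] [])) k)) :
    BarInducedInj ℤ (embO D n) k :=
  bar_inj (embHom D n) k ((triv_sq (embHom D n) _ (MulEquiv.ofBijective _ (smHom_bij D n)) (oEq D (n + 1))
    (fun _ => rfl) k).2 h)

theorem mL_mem (N : ℕ) (i : Fin N) : mL D N i ∈ HL (mB D N) (perp (mB D N) []) := by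
  refine ⟨⟨?_, ?_, ?_⟩, ?_, ?_⟩
  iterate 3 simp [mB_apply, mL, Pi.single_apply]
  all_goals intro a ha; simp at ha

theorem finite_branch (k n : ℕ) (hk : 1 ≤ k) (h : 2 * k ≤ n) :
    BarInducedSurj ℤ (embO D n) k ∧ BarInducedInj ℤ (embO D n) (k - 1) := by
  have hw : ([] : List (MV D (n + 1) × MV D (n + 1))) ∈ WW (OR (mB D (n + 1))) (HL (mB D (n + 1)) ⊤) 0 :=
    ⟨by simp, by simp, rfl⟩
  have F := finite_stab (mHyp D (n + 1)) (n + 1)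
  exact ⟨frozen_surj D k n (F.1 k (by omega) 0 [] rfl hw _ (mL_mem D _ _)),
    frozen_inj D (k - 1) n (F.2 (k - 1) (by omega) 0 [] rfl hw _ (mL_mem D _ _))⟩

end iso
end Stmt3

namespace Stmt3
open Finsupp
set_option linter.all false
set_option linter.unusedSectionVars false
set_option linter.unusedSimpArgs false
set_option linter.unusedVariables false

section sq
variable {G1 M1 G2 M2 G1' M1' G2' M2' : Type} [Group G1] [AddCommGroup M1] [Group G2]
  [AddCommGroup M2] [Group G1'] [AddCommGroup M1'] [Group G2'] [AddCommGroup M2']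
  {ρ1 : G1 →* AddMonoid.End M1} {ρ2 : G2 →* AddMonoid.End M2}
  {ρ1' : G1' →* AddMonoid.End M1'} {ρ2' : G2' →* AddMonoid.End M2'}

theorem Conn.sq {a : RMor ρ1 ρ2} {b : RMor ρ1' ρ2'} (l : RMor ρ1 ρ1') (r : RMor ρ2 ρ2')
    (h1 : ∀ g, r.φ (a.φ g) = b.φ (l.φ g)) (h2 : ∀ m, r.f (a.f m) = b.f (l.f m))
    (hl : ∀ i, Function.Bijective (Hmap l i)) (hr : ∀ i, Function.Bijective (Hmap r i)) (s : ℕ) :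
    Conn a s ↔ Conn b s := by
  have e : ∀ i x, Hmap r i (Hmap a i x) = Hmap b i (Hmap l i x) := by
    intro i x
    rw [Hmap_comp, Hmap_comp]
    congr 2
    exact RMor.ext' h1 h2
  constructor
  · rintro ⟨hs, hi⟩
    refine ⟨fun i h y => ?_, fun i h x x' hx => ?_⟩
    · obtain ⟨y, rfl⟩ := (hr i).2 y
      obtain ⟨y, rfl⟩ := hs i h y
      exact ⟨_, (e i y).symm⟩
    · obtain ⟨x, rfl⟩ := (hl i).2 x
      obtain ⟨x', rfl⟩ := (hl i).2 x'
      rw [← e, ← e] at hx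
      rw [hi i h ((hr i).1 hx)]
  · rintro ⟨hs, hi⟩
    refine ⟨fun i h y => ?_, fun i h x x' hx => ?_⟩
    · obtain ⟨z, hz⟩ := hs i h (Hmap r i y)
      obtain ⟨x, rfl⟩ := (hl i).2 z
      exact ⟨x, (hr i).1 ((e i x).trans hz)⟩
    · refine (hl i).1 (hi i h ?_)
      rw [← e, ← e, hx]

/-- isomorphisms of coefficients and groups induce isomorphisms -/
theorem Hmap_bij (a : RMor ρ1 ρ2) (h1 : Function.Bijective a.φ) (h2 : Function.Bijective a.f) (i : ℕ) :
    Function.Bijective (Hmap a i) := by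
  let e1 := MulEquiv.ofBijective a.φ h1
  let e2 := AddEquiv.ofBijective a.f h2
  let b : RMor ρ2 ρ1 := ⟨e1.symm.toMonoidHom, e2.symm.toAddMonoidHom, fun g m => by
    apply h2.1
    have k1 : ∀ x, a.f (e2.symm x) = x := fun x => e2.apply_symm_apply x
    have k2 : ∀ x, a.φ (e1.symm x) = x := fun x => e1.apply_symm_apply x
    change a.f (e2.symm _) = a.f (ρ1 (e1.symm g) (e2.symm m))
    rw [a.comm, k1, k1, k2]⟩
  have i1 : ∀ x, Hmap b i (Hmap a i x) = x := by
    intro x; rw [Hmap_comp]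
    exact Hmap_id' _ (fun g => e1.symm_apply_apply g) (fun g => e2.symm_apply_apply g) i x
  have i2 : ∀ x, Hmap a i (Hmap b i x) = x := by
    intro x; rw [Hmap_comp]
    exact Hmap_id' _ (fun g => e1.apply_symm_apply g) (fun g => e2.apply_symm_apply g) i x
  exact ⟨Function.LeftInverse.injective i1, Function.RightInverse.surjective i2⟩

/-- restriction along a homomorphism -/
def resMor (φ : G1 →* G2) (ρ : G2 →* AddMonoid.End M2) : RMor (ρ.comp φ) ρ :=
  ⟨φ, AddMonoidHom.id _, fun _ _ => rfl⟩

theorem Conn.of_res (a : RMor ρ1 ρ2) (h : Function.Bijective a.f) {s : ℕ}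
    (hc : Conn (resMor a.φ ρ2) s) : Conn a s := by
  let l : RMor ρ1 (ρ2.comp a.φ) := ⟨MonoidHom.id _, a.f, a.comm⟩
  refine (Conn.sq (a := a) (b := resMor a.φ ρ2) l (RMor.id ρ2) (fun _ => rfl) (fun _ => rfl) ?_ ?_ s).2 hc
  · exact Hmap_bij l Function.bijective_id h
  · exact Hmap_bij _ Function.bijective_id Function.bijective_id

theorem Conn.res_of {a : RMor ρ1 ρ2} (h : Function.Bijective a.f) {s : ℕ}
    (hc : Conn a s) : Conn (resMor a.φ ρ2) s := by
  let l : RMor ρ1 (ρ2.comp a.φ) := ⟨MonoidHom.id _, a.f, a.comm⟩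
  refine (Conn.sq (a := a) (b := resMor a.φ ρ2) l (RMor.id ρ2) (fun _ => rfl) (fun _ => rfl) ?_ ?_ s).1 hc
  · exact Hmap_bij l Function.bijective_id h
  · exact Hmap_bij _ Function.bijective_id Function.bijective_id

end sq

section univ
variable {G G' : Type} [Group G] [Group G']

theorem free_dec {X : Type} (q : ℕ) (z : (Fin q → G) →₀ (X →₀ ℤ)) : ∃ S : Finset X, ∀ S' , S ⊆ S' →
    z = ∑ x ∈ S', cmap (MonoidHom.id G) ((singleAddHom x).comp (applyAddHom x)) q z := by
  classical
  induction z using Finsupp.induction_linear with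
  | zero => exact ⟨∅, fun _ _ => by simp⟩
  | add a b ha hb =>
    obtain ⟨S, hS⟩ := ha
    obtain ⟨T, hT⟩ := hb
    refine ⟨S ∪ T, fun S' h => ?_⟩
    simp only [map_add, Finset.sum_add_distrib]
    rw [← hS S' (Finset.union_subset_left h), ← hT S' (Finset.union_subset_right h)]
  | single c m =>
    refine ⟨m.support, fun S' h => ?_⟩
    have e : ∀ x ∈ S', cmap (MonoidHom.id G) ((singleAddHom x).comp (applyAddHom x)) q (single c m)
        = singleAddHom c (single x (m x)) := by
      intro x _; rw [cmap_single]; rfl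
    rw [Finset.sum_congr rfl e, ← map_sum]
    change single c m = single c _
    congr 1
    conv_lhs => rw [← Finsupp.sum_single m]
    exact Finsupp.sum_of_support_subset _ h _ (by simp)

/-- inclusion of a coordinate -/
noncomputable def inx (G : Type) [Group G] {X : Type} (x : X) : RMor (1 : G →* AddMonoid.End ℤ) (1 : G →* AddMonoid.End (X →₀ ℤ)) :=
  ⟨MonoidHom.id G, singleAddHom x, fun _ _ => rfl⟩
/-- projection to a coordinate -/
noncomputable def prx (G : Type) [Group G] {X : Type} (x : X) : RMor (1 : G →* AddMonoid.End (X →₀ ℤ)) (1 : G →* AddMonoid.End ℤ) :=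
  ⟨MonoidHom.id G, applyAddHom x, fun _ _ => rfl⟩

theorem free_decH {X : Type} (q : ℕ) (y : HH (1 : G →* AddMonoid.End (X →₀ ℤ)) q) :
    ∃ S : Finset X, y = ∑ x ∈ S, Hmap (inx G x) q (Hmap (prx G x) q y) := by
  obtain ⟨z, hz, rfl⟩ := cls_surj _ y
  obtain ⟨S, hS⟩ := free_dec q z
  refine ⟨S, ?_⟩
  simp only [Hmap_comp]
  let F : ↥(cyc (1 : G →* AddMonoid.End (X →₀ ℤ)) q) →+ HH (1 : G →* AddMonoid.End (X →₀ ℤ)) q :=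
    QuotientAddGroup.mk' _
  have e : (⟨z, hz⟩ : ↥(cyc (1 : G →* AddMonoid.End (X →₀ ℤ)) q)) =
      ∑ x ∈ S, ⟨_, cmap_mem_cyc ((inx G x).comp (prx G x)) hz⟩ := by
    apply Subtype.ext
    rw [AddSubgroup.val_finset_sum]
    exact hS S (Finset.Subset.refl _)
  have := congrArg F e
  rw [map_sum] at this
  exact this

theorem free_conn {φ : G →* G'} {s : ℕ} (h : Conn (triv φ) s) (X : Type) :
    Conn (resMor φ (1 : G' →* AddMonoid.End (X →₀ ℤ))) s := by
  have e1 : ∀ q (x : X) (u : HH (1 : G →* AddMonoid.End ℤ) q),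
    Hmap (inx G' x) q (Hmap (triv φ) q u) = Hmap (resMor φ (1 : G' →* AddMonoid.End (X →₀ ℤ))) q
      (Hmap (inx G x) q u) := by
    intro q x u
    rw [Hmap_comp]
    exact Eq.symm (Hmap_comp (resMor φ (1 : G' →* AddMonoid.End (X →₀ ℤ))) (inx G x) q u)
  have e2 : ∀ q (x : X) (u : HH (1 : G →* AddMonoid.End (X →₀ ℤ)) q),
    Hmap (prx G' x) q (Hmap (resMor φ (1 : G' →* AddMonoid.End (X →₀ ℤ))) q u)
      = Hmap (triv φ) q (Hmap (prx G x) q u) := by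
    intro q x u
    refine (Hmap_comp (prx G' x) (resMor φ (1 : G' →* AddMonoid.End (X →₀ ℤ))) q u).trans ?_
    rw [Hmap_comp]
    rfl
  refine ⟨fun i hi y => ?_, fun i hi => ?_⟩
  · obtain ⟨S, hS⟩ := free_decH i y
    choose u hu using fun x => h.1 i hi (Hmap (prx G' x) i y)
    refine ⟨∑ x ∈ S, Hmap (inx G x) i (u x), ?_⟩
    rw [map_sum]
    refine Eq.trans ?_ hS.symm
    refine Finset.sum_congr rfl fun x _ => ?_
    exact (e1 i x (u x)).symm.trans (congrArg _ (hu x))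
  · rw [injective_iff_map_eq_zero]
    intro y hy
    obtain ⟨S, hS⟩ := free_decH (G := G) i y
    refine hS.trans (Finset.sum_eq_zero fun x _ => ?_)
    have : Hmap (prx G x) i y = 0 := by
      apply h.2 i hi
      rw [← e2, map_zero]
      exact (congrArg _ hy).trans (map_zero _)
    rw [this, map_zero]

theorem univ_conn {φ : G →* G'} : ∀ {s : ℕ} (h : Conn (triv φ) s) (N : Type) [AddCommGroup N],
    Conn (resMor φ (1 : G' →* AddMonoid.End N)) s := by
  intro s
  induction s with
  | zero => intro h N _; exact ⟨fun i hi => by omega, fun i hi => by omega⟩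
  | succ s ih =>
    intro h N _
    let f : (N →₀ ℤ) →+ N := Finsupp.liftAddHom fun n => (zmultiplesHom N n)
    have hf : Function.Surjective f := fun n => ⟨single n 1, by simp [f]⟩
    let S := kerSES (1 : G →* AddMonoid.End (N →₀ ℤ)) (1 : G →* AddMonoid.End N) f (fun _ _ => rfl) hf
    let S' := kerSES (1 : G' →* AddMonoid.End (N →₀ ℤ)) (1 : G' →* AddMonoid.End N) f (fun _ _ => rfl) hf
    let m : S.Mor S' := ⟨⟨φ, AddMonoidHom.id _, fun _ _ => rfl⟩, ⟨φ, AddMonoidHom.id _, fun _ _ => rfl⟩,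
      ⟨φ, AddMonoidHom.id _, fun _ _ => rfl⟩, fun _ => rfl, fun _ => rfl, fun _ => rfl, fun _ => rfl⟩
    have hA : Conn m.a s := ih (h.mono (by omega)) f.ker
    have hB : Conn m.b (s + 1) := free_conn h N
    exact Conn.ses m hA hB

end univ

section klemma
variable {P Q G N : Type} [Group P] [Group Q] [Group G] [AddCommGroup N]

/-- Shapiro map for the kernel of a surjection -/
noncomputable def qMor (π : P →* Q) (j : G →* P) (ρ : P →* AddMonoid.End N)
    (h1 : ∀ g, π (j g) = 1) (h2 : ∀ g n, ρ (j g) n = n) :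
    RMor (1 : G →* AddMonoid.End N) (ind (lm π) ρ) :=
  ⟨j, singleAddHom 1, fun g n => by
    refine Eq.symm ((ind_single _ _ _ _ _).trans ?_)
    rw [lm_apply, h1, h2]; simp⟩

theorem qMor_sh (π : P →* Q) (j : G →* P) (ρ : P →* AddMonoid.End N)
    (h1 : ∀ g, π (j g) = 1) (h2 : ∀ g n, ρ (j g) n = n) (hj : Function.Injective j)
    (hr : ∀ p, π p = 1 → p ∈ j.range) (hπ : Function.Surjective π) :
    Sh (qMor π j ρ h1 h2) (applyAddHom 1) := by
  classical
  refine ⟨hj, fun n => by simp [qMor], ?_, ?_⟩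
  · intro g hg n
    have hne : π g ≠ 1 := fun h => hg (hr g h)
    change (ind (lm π) ρ g (single 1 n)) 1 = 0
    rw [ind_single, lm_apply, single_apply, if_neg (by simpa using hne)]
  · intro m
    induction m using Finsupp.induction_linear with
    | zero => exact zero_mem _
    | add a b ha hb => exact add_mem ha hb
    | single q n =>
      obtain ⟨g, rfl⟩ := hπ q
      refine AddSubgroup.subset_closure ⟨g, ρ g⁻¹ n, ?_⟩
      change _ = ind (lm π) ρ g (single 1 _)
      rw [ind_single, lm_apply, rep_inv', mul_one]

theorem K_conn {P' G' : Type} [Group P'] [Group G'] (φ : P' →* P) (π : P →* Q) (j : G →* P)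
    (j' : G' →* P') (κ : G' →* G) (hj : Function.Injective j) (hj' : Function.Injective j')
    (h1 : ∀ g, π (j g) = 1) (hr : ∀ p, π p = 1 → p ∈ j.range)
    (hr' : ∀ p, π (φ p) = 1 → p ∈ j'.range) (hπ : Function.Surjective (π.comp φ))
    (hκ : ∀ g, φ (j' g) = j (κ g)) : ∀ {s : ℕ} (hc : Conn (triv κ) s) {N : Type} [AddCommGroup N]
    (ρ : P →* AddMonoid.End N) (hρ : ∀ g n, ρ (j g) n = n), Conn (resMor φ ρ) s := by
  intro s
  induction s with
  | zero => intro _ N _ ρ hρ; exact ⟨fun i hi => by omega, fun i hi => by omega⟩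
  | succ s ih =>
    intro hc N _ ρ hρ
    let m := shMor (φ := π.comp φ) (φ' := π) (resMor φ ρ) (fun q => q) (fun p g => rfl)
    have hid : ∀ x : Q →₀ N, indAux (fun q => q) (resMor φ ρ).f x = x := by
      intro x
      induction x using Finsupp.induction_linear with
      | zero => simp
      | add a b ha hb => rw [map_add, ha, hb]
      | single q n => rw [indAux_single]; rfl
    have hA : Conn m.a s := by
      refine Conn.of_res m.a ?_ ?_
      · constructor
        · intro x y h
          have := congrArg Subtype.val h
          apply Subtype.ext
          have e : indAux (fun q => q) (resMor φ ρ).f x.1 = indAux (fun q => q) (resMor φ ρ).f y.1 := this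
          rwa [hid, hid] at e
        · intro y
          exact ⟨y, Subtype.ext (hid y.1)⟩
      · refine ih (hc.mono (by omega)) (kRep π ρ) ?_
        intro g n
        apply Subtype.ext
        change ind (lm π) ρ (j g) n.1 = n.1
        generalize n.1 = x
        induction x using Finsupp.induction_linear with
        | zero => simp
        | add a b ha hb => rw [map_add, ha, hb]
        | single q n => rw [ind_single, lm_apply, h1, one_mul, hρ]
    have h1' : ∀ g, (π.comp φ) (j' g) = 1 := fun g => by
      change π (φ (j' g)) = 1
      rw [hκ, h1]
    have hρ' : ∀ g n, (ρ.comp φ) (j' g) n = n := fun g n => by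
      change ρ (φ (j' g)) n = n
      rw [hκ, hρ]
    have hB : Conn m.b (s + 1) := by
      refine (Conn.sq (qMor (π.comp φ) j' (ρ.comp φ) h1' hρ') (qMor π j ρ h1 hρ) (a := resMor κ (1 : G →* AddMonoid.End N)) ?_ ?_ ?_ ?_ _).1
        (univ_conn hc N)
      · intro g; exact (hκ g).symm
      · intro n
        change single 1 n = indAux (fun q => q) (resMor φ ρ).f (single 1 n)
        rw [hid]
      · intro i
        exact (qMor_sh (π.comp φ) j' (ρ.comp φ) h1' hρ' hj' hr' hπ).bij i
      · intro i
        exact (qMor_sh π j ρ h1 hρ hj hr (fun q => by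
          obtain ⟨p, hp⟩ := hπ q; exact ⟨φ p, hp⟩)).bij i
    exact Conn.ses m hA hB

end klemma
end Stmt3

namespace Stmt3
open Finsupp
set_option linter.all false
set_option linter.unusedSectionVars false
set_option linter.unusedSimpArgs false
set_option linter.unusedVariables false

section ns
variable {G N : Type} [Group G] [AddCommGroup N]

open Classical in
/-- The endomorphism of a representation given by a group endomorphism. -/
noncomputable def nm (ρ : G →* AddMonoid.End N) (r : G →* G) : RMor ρ ρ :=
  if h : ∀ g, ρ (r g) = ρ g then ⟨r, AddMonoidHom.id N, fun g m => by rw [h]; rfl⟩ else RMor.id ρ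

theorem nm_eq (ρ : G →* AddMonoid.End N) (r : G →* G) (h : ∀ g, ρ (r g) = ρ g) :
    nm ρ r = ⟨r, AddMonoidHom.id N, fun g m => by rw [h]; rfl⟩ := by
  rw [nm, dif_pos h]

/-- alternating product of the operators -/
noncomputable def nop (ρ : G →* AddMonoid.End N) (q : ℕ) (l : List (G →* G)) (y : HH ρ q) : HH ρ q :=
  l.foldr (fun r y => y - Hmap (nm ρ r) q y) y

theorem nop_cons (ρ : G →* AddMonoid.End N) (q : ℕ) (r : G →* G) (l : List (G →* G)) (y : HH ρ q) :
    nop ρ q (r :: l) y = nop ρ q l y - Hmap (nm ρ r) q (nop ρ q l y) := rfl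

theorem ns_lemma (q : ℕ) : ∀ {N : Type} [AddCommGroup N] (ρ : G →* AddMonoid.End N)
    (l : List (G →* G)) (hq : q < l.length) (h1 : ∀ r ∈ l, ∀ g, ρ (r g) = ρ g)
    (h2 : l.Pairwise fun r r' => ∀ g, r (g⁻¹ * r' g) = g⁻¹ * r' g) (y : HH ρ q), nop ρ q l y = 0 := by
  induction q with
  | zero =>
    intro N _ ρ l hq h1 h2 y
    cases l with
    | nil => simp at hq
    | cons r l =>
      rw [nop_cons]
      generalize nop ρ 0 l y = z
      obtain ⟨m, rfl⟩ := h0_surj ρ z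
      rw [Hmap_h0, nm_eq _ _ (h1 r (by simp))]
      exact sub_self _
  | succ q ih =>
    intro N _ ρ l hq h1 h2 y
    cases l with
    | nil => simp at hq
    | cons r l =>
      classical
      rw [List.pairwise_cons] at h2
      let K : Subgroup G := MonoidHom.eqLocus r (MonoidHom.id G)
      have hK : ∀ g, g ∈ K ↔ r g = g := fun g => Iff.rfl
      let α : G →* Equiv.Perm (G ⧸ K) := MulAction.toPermHom G (G ⧸ K)
      have hα : ∀ g (h : G), α g (QuotientGroup.mk h) = (QuotientGroup.mk (g * h) : G ⧸ K) := fun _ _ => rfl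
      let S := kerSES (ind α ρ) ρ (aug (G ⧸ K) N) (aug_ind _ _) aug_surj
      have key : ∀ r' ∈ l, ∀ g, ind α ρ (r' g) = ind α ρ g := by
        intro r' hr' g
        refine Finsupp.addHom_ext fun x n => ?_
        refine (ind_single _ _ _ _ _).trans (Eq.trans ?_ (ind_single _ _ _ _ _).symm)
        rw [h1 r' (by simp [hr'])]
        congr 1
        induction x using QuotientGroup.induction_on with
        | H h =>
          rw [hα, hα, eq_comm, QuotientGroup.eq, hK]
          have e : (g * h)⁻¹ * (r' g * h) = ((g * h)⁻¹ * r' (g * h)) * (h⁻¹ * r' h)⁻¹ := by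
            rw [map_mul]; group
          rw [e, map_mul, map_inv, h2.1 r' hr', h2.1 r' hr']
      have hD : ∀ l' : List (G →* G), (∀ r' ∈ l', r' ∈ l) → ∀ x y, S.D q x y →
          S.D q (nop _ _ l' x) (nop _ _ l' y) := by
        intro l'
        induction l' with
        | nil => intro _ x y h; exact h
        | cons r' l' ih' =>
          intro hl x y h
          have h3 := ih' (fun r hr => hl r (by simp [hr])) x y h
          rw [nop_cons, nop_cons]
          refine S.D_sub h3 ?_
          have k := key r' (hl r' (by simp))
          have k1 := h1 r' (by simp [hl r' (by simp)])
          have k2 : ∀ g, subRep (ind α ρ) (aug (G ⧸ K) N).ker (fun g m hm => by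
              rw [AddMonoidHom.mem_ker] at *; rw [aug_ind, hm, map_zero]) (r' g) =
              subRep (ind α ρ) (aug (G ⧸ K) N).ker (fun g m hm => by
              rw [AddMonoidHom.mem_ker] at *; rw [aug_ind, hm, map_zero]) g := by
            intro g
            refine AddMonoidHom.ext fun m => Subtype.ext ?_
            exact congrArg (fun t : AddMonoid.End _ => t m.1) (k g)
          let M : S.Mor S :=
            { a := nm _ r', b := nm _ r', c := nm _ r'
              hφa := fun g => by rw [nm_eq _ _ k, nm_eq _ _ k2]
              hφc := fun g => by rw [nm_eq _ _ k, nm_eq _ _ k1]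
              hf := fun g => by rw [nm_eq _ _ k, nm_eq _ _ k2]; rfl
              hg := fun g => by rw [nm_eq _ _ k, nm_eq _ _ k1]; rfl }
          exact M.D h3
      rw [nop_cons]
      obtain ⟨d, hd⟩ := S.D_ex y
      have h3 := hD l (fun _ h => h) y d hd
      have h4 : nop _ q l d = 0 := by
        refine ih _ l (by simpa using hq) ?_ h2.2 d
        intro r' hr' g
        refine AddMonoidHom.ext fun m => Subtype.ext ?_
        exact congrArg (fun t : AddMonoid.End _ => t m.1) (key r' hr' g)
      rw [h4] at h3
      obtain ⟨b, hb⟩ := S.D_zero h3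
      let sh : RMor (ρ.comp K.subtype) (ind α ρ) := ⟨K.subtype, singleAddHom (QuotientGroup.mk 1), fun g n => by
        refine Eq.symm ((ind_single _ _ _ _ _).trans ?_)
        have : α (K.subtype g) (QuotientGroup.mk 1) = QuotientGroup.mk 1 := by
          rw [hα, eq_comm, QuotientGroup.eq]; simp
        rw [this]; rfl⟩
      have hsh : Sh sh (applyAddHom (QuotientGroup.mk 1)) := by
        refine ⟨Subtype.val_injective, fun n => by simp [sh], ?_, ?_⟩
        · intro g hg n
          change (ind α ρ g (single (QuotientGroup.mk 1) n)) (QuotientGroup.mk 1) = 0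
          rw [ind_single, hα, single_apply, if_neg]
          rw [eq_comm, QuotientGroup.eq]
          intro hh
          exact hg ⟨⟨g, by simpa using hh⟩, rfl⟩
        · intro m
          induction m using Finsupp.induction_linear with
          | zero => exact zero_mem _
          | add a b ha hb => exact add_mem ha hb
          | single q n =>
            induction q using QuotientGroup.induction_on with
            | H g =>
            refine AddSubgroup.subset_closure ⟨g, ρ g⁻¹ n, ?_⟩
            change _ = ind α ρ g (single _ _)
            rw [ind_single, hα, rep_inv', mul_one]
      obtain ⟨c, rfl⟩ := (hsh.bij (q + 1)).2 b
      rw [← hb, sub_eq_zero, Hmap_comp, Hmap_comp]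
      congr 2
      rw [nm_eq _ _ (h1 r (by simp))]
      refine RMor.ext' (fun g => ?_) (fun _ => rfl)
      exact ((hK _).1 g.2).symm

end ns

section aff
variable {D : Type} [Field D]

/-- the affine-type group `Hom(U,W) ⋊ GL(U)` -/
@[ext] structure Bg (U W : Type) [AddCommGroup U] [Module D U] [AddCommGroup W] [Module D W] where
  a : U →ₗ[D] W
  g : U ≃ₗ[D] U

variable {U W W' W'' : Type} [AddCommGroup U] [Module D U] [AddCommGroup W] [Module D W]
  [AddCommGroup W'] [Module D W'] [AddCommGroup W''] [Module D W'']

instance : Mul (Bg (D := D) U W) := ⟨fun x y => ⟨y.a + x.a ∘ₗ y.g.toLinearMap, x.g * y.g⟩⟩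
instance : One (Bg (D := D) U W) := ⟨⟨0, 1⟩⟩
instance : Inv (Bg (D := D) U W) := ⟨fun x => ⟨-(x.a ∘ₗ (x.g⁻¹).toLinearMap), x.g⁻¹⟩⟩

theorem Bg.mul_a (x y : Bg (D := D) U W) : (x * y).a = y.a + x.a ∘ₗ y.g.toLinearMap := rfl
theorem Bg.mul_g (x y : Bg (D := D) U W) : (x * y).g = x.g * y.g := rfl
theorem Bg.inv_a (x : Bg (D := D) U W) : (x⁻¹).a = -(x.a ∘ₗ (x.g⁻¹).toLinearMap) := rfl
theorem Bg.inv_g (x : Bg (D := D) U W) : (x⁻¹).g = x.g⁻¹ := rfl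
theorem Bg.one_a : (1 : Bg (D := D) U W).a = 0 := rfl
theorem Bg.one_g : (1 : Bg (D := D) U W).g = 1 := rfl

theorem Bg.ext' {x y : Bg (D := D) U W} (h1 : ∀ u, x.a u = y.a u) (h2 : x.g = y.g) : x = y :=
  Bg.ext (LinearMap.ext h1) h2

instance : Group (Bg (D := D) U W) :=
  Group.ofLeftAxioms
    (fun x y z => Bg.ext' (fun u => by
      simp only [Bg.mul_a, Bg.mul_g, LinearMap.add_apply, LinearMap.comp_apply]
      exact (add_assoc _ _ _).symm) (mul_assoc _ _ _))
    (fun x => Bg.ext' (fun u => by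
      simp only [Bg.mul_a, Bg.one_a, LinearMap.add_apply, LinearMap.zero_comp, LinearMap.zero_apply, add_zero])
      (one_mul _))
    (fun x => Bg.ext' (fun u => by
      simp only [Bg.mul_a, Bg.inv_a, Bg.one_a, LinearMap.add_apply, LinearMap.comp_apply, LinearMap.neg_apply, LinearMap.zero_apply]
      have : (x.g⁻¹) (x.g u) = u := x.g.symm_apply_apply u
      have e : (x.g⁻¹).toLinearMap (x.g.toLinearMap u) = u := this
      rw [e]; simp) (inv_mul_cancel _))

/-- functoriality -/
def Bm (f : W →ₗ[D] W') : Bg (D := D) U W →* Bg (D := D) U W' where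
  toFun x := ⟨f ∘ₗ x.a, x.g⟩
  map_one' := Bg.ext' (fun u => by simp [Bg.one_a]) rfl
  map_mul' x y := Bg.ext' (fun u => by simp [Bg.mul_a]) rfl

theorem Bm_comp (f' : W' →ₗ[D] W'') (f : W →ₗ[D] W') :
    (Bm f').comp (Bm f) = (Bm (f' ∘ₗ f) : Bg (D := D) U W →* Bg (D := D) U W'') := rfl

theorem Bm_smul {μ : D} (hμ : μ ≠ 0) (q : ℕ) (y : HH (1 : Bg (D := D) U W →* AddMonoid.End ℤ) q) :
    Hmap (triv (Bm (μ • LinearMap.id))) q y = y := by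
  let s : Bg (D := D) U W := ⟨0, (LinearEquiv.smulOfNeZero D U μ hμ).symm⟩
  have h := Hmap_conj q (RMor.id (1 : Bg (D := D) U W →* AddMonoid.End ℤ)) (triv (Bm (μ • LinearMap.id))) s
    (fun p => ?_) (fun _ => rfl) y
  · rw [← h]
    exact Hmap_id' _ (fun _ => rfl) (fun _ => rfl) q y
  · rw [eq_mul_inv_iff_mul_eq]
    refine Bg.ext' (fun u => ?_) ?_
    · change 0 + μ • p.a ((LinearEquiv.smulOfNeZero D U μ hμ).symm u) = p.a u + 0
      rw [← map_smul]
      have : μ • (LinearEquiv.smulOfNeZero D U μ hμ).symm u = u :=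
        (LinearEquiv.smulOfNeZero D U μ hμ).apply_symm_apply u
      rw [this]; simp
    · change p.g * (LinearEquiv.smulOfNeZero D U μ hμ).symm = (LinearEquiv.smulOfNeZero D U μ hμ).symm * p.g
      ext u
      apply (LinearEquiv.smulOfNeZero D U μ hμ).injective
      change μ • p.g ((LinearEquiv.smulOfNeZero D U μ hμ).symm u) =
        (LinearEquiv.smulOfNeZero D U μ hμ) ((LinearEquiv.smulOfNeZero D U μ hμ).symm (p.g u))
      rw [LinearEquiv.apply_symm_apply, ← map_smul]
      congr 1
      exact (LinearEquiv.smulOfNeZero D U μ hμ).apply_symm_apply u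

/-- all nonempty subset sums are nonzero -/
def GoodT (T : Finset D) : Prop := ∀ T' ⊆ T, T'.Nonempty → ∑ x ∈ T', x ≠ 0

theorem goodT_ex [Infinite D] (p : ℕ) : ∃ T : Finset D, T.card = p ∧ GoodT T := by
  classical
  induction p with
  | zero => exact ⟨∅, rfl, fun T' h h' => by simp_all⟩
  | succ p ih =>
    obtain ⟨T, hT, hg⟩ := ih
    obtain ⟨μ, hμ⟩ := Infinite.exists_notMem_finset (T ∪ T.powerset.image fun T' => - ∑ x ∈ T', x)
    simp only [Finset.mem_union, Finset.mem_image, Finset.mem_powerset, not_or, not_exists, not_and] at hμ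
    refine ⟨insert μ T, by rw [Finset.card_insert_of_notMem hμ.1, hT], fun T' h h' => ?_⟩
    by_cases hm : μ ∈ T'
    · rw [← Finset.add_sum_erase _ _ hm]
      intro e
      refine hμ.2 (T'.erase μ) ?_ (by rw [eq_comm]; exact eq_neg_of_add_eq_zero_left e)
      intro x hx
      rw [Finset.mem_erase] at hx
      exact (Finset.mem_insert.1 (h hx.2)).resolve_left hx.1
    · refine hg T' (fun x hx => (Finset.mem_insert.1 (h hx)).resolve_left ?_) h'
      rintro rfl; exact hm hx

open Classical in
/-- kill a coordinate -/
noncomputable def zr (W : Type) [AddCommGroup W] [Module D W] (μ : D) : (D → W) →ₗ[D] (D → W) :=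
  LinearMap.pi fun ν => if ν = μ then 0 else LinearMap.proj ν
/-- weighted sum -/
noncomputable def sg (W : Type) [AddCommGroup W] [Module D W] (T : Finset D) : (D → W) →ₗ[D] W :=
  ∑ μ ∈ T, μ • LinearMap.proj μ
/-- diagonal -/
def dg (D W : Type) [Field D] [AddCommGroup W] [Module D W] : W →ₗ[D] (D → W) := LinearMap.pi fun _ => LinearMap.id

theorem sg_zr [DecidableEq D] (T : Finset D) (μ : D) : sg W T ∘ₗ zr W μ = sg W (T.erase μ) := by
  ext x : 1
  simp only [sg, zr, LinearMap.comp_apply, LinearMap.sum_apply, LinearMap.smul_apply, LinearMap.proj_apply, LinearMap.pi_apply]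
  by_cases h : μ ∈ T
  · rw [← Finset.add_sum_erase _ _ h]
    simp only [if_true, LinearMap.zero_apply, smul_zero, zero_add]
    refine Finset.sum_congr rfl fun ν hν => ?_
    rw [if_neg (Finset.ne_of_mem_erase hν)]; rfl
  · rw [Finset.erase_eq_of_notMem h]
    refine Finset.sum_congr rfl fun ν hν => ?_
    rw [if_neg (by rintro rfl; exact h hν)]; rfl

theorem sg_dg (T : Finset D) : sg W T ∘ₗ dg D W = (∑ x ∈ T, x) • LinearMap.id := by
  ext x
  simp [sg, dg, LinearMap.comp_apply, Finset.sum_smul]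

theorem Bm_zero [Infinite D] (q : ℕ) (y : HH (1 : Bg (D := D) U W →* AddMonoid.End ℤ) q) :
    Hmap (triv (Bm (0 : W →ₗ[D] W))) q y = y := by
  classical
  let F : Finset D → List D → HH (1 : Bg (D := D) U W →* AddMonoid.End ℤ) q := fun T l =>
    Hmap (triv (Bm (sg W T))) q (nop 1 q (l.map fun μ => Bm (zr W μ)) (Hmap (triv (Bm (dg D W))) q y))
  have hF0 : ∀ T, F T [] = Hmap (triv (Bm ((∑ x ∈ T, x) • LinearMap.id))) q y := by
    intro T
    change Hmap (triv (Bm (sg W T))) q (Hmap (triv (Bm (dg D W))) q y) = _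
    rw [triv_comp, Bm_comp, sg_dg]
  have hFs : ∀ T μ l, F T (μ :: l) = F T l - F (T.erase μ) l := by
    intro T μ l
    simp only [F, List.map_cons, nop_cons, map_sub]
    congr 1
    have : nm (1 : Bg (D := D) U (D → W) →* AddMonoid.End ℤ) (Bm (zr W μ)) = triv (Bm (zr W μ)) :=
      nm_eq _ _ (fun _ => rfl)
    rw [this, triv_comp, Bm_comp, sg_zr]
  have hA : ∀ l T, (∀ T' ⊆ T, T \ l.toFinset ⊆ T' → ∑ x ∈ T', x ≠ 0) → F T l = if l = [] then y else 0 := by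
    intro l
    induction l with
    | nil =>
      intro T h
      rw [hF0, Bm_smul (h T (Finset.Subset.refl _) (by simp))]; simp
    | cons μ l ih =>
      intro T h
      rw [hFs, ih T, ih (T.erase μ)]
      · simp
      · intro T' h1 h2
        refine h T' (h1.trans (Finset.erase_subset _ _)) ?_
        intro x hx
        apply h2
        simp at hx ⊢
        tauto
      · intro T' h1 h2
        refine h T' h1 ?_
        intro x hx
        apply h2
        simp at hx ⊢
        tauto
  have hB : ∀ l : List D, l.Nodup → l ≠ [] → GoodT l.toFinset → F l.toFinset l = 0 →
      Hmap (triv (Bm (0 : W →ₗ[D] W))) q y = y := by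
    intro l
    induction l with
    | nil => intro _ h; exact absurd rfl h
    | cons μ l ih =>
      intro hn _ hg h0
      rw [List.nodup_cons] at hn
      rw [hFs] at h0
      have he : (μ :: l).toFinset.erase μ = l.toFinset := by
        rw [List.toFinset_cons, Finset.erase_insert (by simpa using hn.1)]
      have hA' := hA l (μ :: l).toFinset (fun T' h1 h2 => hg T' h1 ⟨μ, h2 (by simp [hn.1])⟩)
      rw [hA', he] at h0
      by_cases hl : l = []
      · subst hl
        rw [hF0] at h0
        simp only [List.toFinset_nil, Finset.sum_empty, zero_smul, if_true] at h0
        exact (sub_eq_zero.1 h0).symm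
      · rw [if_neg hl, zero_sub, neg_eq_zero] at h0
        exact ih hn.2 hl (fun T' h => hg T' (h.trans (by intro x; simp; tauto))) h0
  obtain ⟨T, hT, hg⟩ := goodT_ex (D := D) (q + 1)
  refine hB T.toList T.nodup_toList ?_ (by simpa using hg) ?_
  · intro h
    have := congrArg List.length h
    simp [hT] at this
  · have : nop 1 q (T.toList.map fun μ => Bm (zr W μ)) (Hmap (triv (Bm (dg D W))) q y) = 0 := by
      refine ns_lemma q _ _ (by simp [hT]) (fun _ _ _ => rfl) ?_ _
      rw [List.pairwise_map]
      refine (T.nodup_toList).imp ?_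
      intro μ ν hne g
      refine Bg.ext' (fun u => ?_) rfl
      have e : ∀ u, (g⁻¹ * (Bm (zr W ν)) g).a u = zr W ν (g.a u) - g.a u := by
        intro u
        change zr W ν (g.a u) + - g.a (g.g.symm (g.g u)) = _
        rw [LinearEquiv.symm_apply_apply, sub_eq_add_neg]
      change zr W μ ((g⁻¹ * (Bm (zr W ν)) g).a u) = (g⁻¹ * (Bm (zr W ν)) g).a u
      rw [e]
      funext κ
      simp only [zr, LinearMap.pi_apply, Pi.sub_apply]
      by_cases h1 : κ = μ
      · subst h1
        simp [hne]
      · simp [h1]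
    simp only [F]
    exact (congrArg _ this).trans (map_zero _)

end aff
end Stmt3

namespace Stmt3
open Finsupp
set_option linter.all false
set_option linter.unusedSectionVars false
set_option linter.unusedSimpArgs false
set_option linter.unusedVariables false

section liw
variable {D E : Type} [Field D] [AddCommGroup E] [Module D E]

/-- linearly independent words -/
def LI (D : Type) {E : Type} [Field D] [AddCommGroup E] [Module D E] (w : List E) : Prop :=
  w.Nodup ∧ LinearIndepOn D id {x | x ∈ w}

/-- span of a word -/
abbrev sp (D : Type) {E : Type} [Field D] [AddCommGroup E] [Module D E] (w : List E) : Submodule D E :=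
  Submodule.span D {x | x ∈ w}

theorem mem_sp {w : List E} {x : E} (h : x ∈ w) : x ∈ sp D w := Submodule.subset_span h

theorem LI.nil : LI D ([] : List E) := ⟨List.nodup_nil, by
  convert linearIndepOn_empty D (id : E → E) using 1; ext; simp⟩

theorem LI_cons {a : E} {w : List E} : LI D (a :: w) ↔ a ∉ sp D w ∧ LI D w := by
  have hs : {x | x ∈ a :: w} = insert a {x | x ∈ w} := by ext; simp
  unfold LI
  rw [hs]
  constructor
  · rintro ⟨h1, h2⟩
    have h1 := List.nodup_cons.1 h1
    refine ⟨?_, h1.2, h2.mono (Set.subset_insert ..)⟩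
    exact (linearIndepOn_id_insert (by simpa using h1.1)).1 h2 |>.2
  · rintro ⟨h1, h2, h3⟩
    have : a ∉ w := fun h => h1 (mem_sp h)
    exact ⟨List.nodup_cons.2 ⟨this, h2⟩, (linearIndepOn_id_insert (by simpa using this)).2 ⟨h3, h1⟩⟩

theorem LI.sublist {w w' : List E} (h : LI D w) (hs : w'.Sublist w) : LI D w' :=
  ⟨h.1.sublist hs, h.2.mono fun _ hx => hs.subset hx⟩

theorem LI.perm {w w' : List E} (h : LI D w) (hs : w.Perm w') : LI D w' :=
  ⟨hs.nodup_iff.1 h.1, h.2.mono fun _ hx => hs.symm.subset hx⟩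

theorem LI.map {E' : Type} [AddCommGroup E'] [Module D E'] {w : List E} (h : LI D w) (f : E →ₗ[D] E')
    (hf : Function.Injective f) : LI D (w.map f) := by
  induction w with
  | nil => exact LI.nil
  | cons a w ih =>
    rw [LI_cons] at h
    rw [List.map_cons, LI_cons]
    refine ⟨fun h' => h.1 ?_, ih h.2⟩
    have : sp D (w.map f) = (sp D w).map f := by
      rw [sp, sp, Submodule.map_span]; congr 1; ext; simp
    rw [this] at h'
    obtain ⟨b, hb, e⟩ := h'
    exact hf e ▸ hb

theorem LI.finrank {w : List E} (h : LI D w) : Module.finrank D (sp D w) = w.length := by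
  classical
  have e : {x | x ∈ w} = ((w.toFinset : Finset E) : Set E) := by ext; simp
  have h2 := h.2
  rw [e] at h2
  rw [sp, e, finrank_span_finset_eq_card h2, List.toFinset_card_of_nodup h.1]

instance (w : List E) : FiniteDimensional D (sp D w) :=
  FiniteDimensional.span_of_finite D (List.finite_toSet w)

theorem sp_cons (a : E) (w : List E) : sp D (a :: w) = Submodule.span D {a} ⊔ sp D w := by
  rw [sp, sp, ← Submodule.span_union]; congr 1; ext; simp


/-- general position -/
theorem LI.gen_face {w : List E} (h : LI D w) (i : ℕ) (hi : i < (w.sum :: w).length) :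
    LI D ((w.sum :: w).eraseIdx i) := by
  cases i with
  | zero => exact h
  | succ i =>
    have hi' : i < w.length := by simpa using hi
    rw [List.eraseIdx_cons_succ, LI_cons]
    refine ⟨fun hm => ?_, h.sublist (List.eraseIdx_sublist ..)⟩
    have hp : w.Perm (w[i] :: w.eraseIdx i) := (List.getElem_cons_eraseIdx_perm hi').symm
    have h' := LI_cons.1 (h.perm hp)
    apply h'.1
    have e : w.sum = w[i] + (w.eraseIdx i).sum := by rw [hp.sum_eq, List.sum_cons]
    rw [e] at hm
    exact (Submodule.add_mem_iff_left _ (list_sum_mem fun x hx => mem_sp hx)).1 hm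

/-- a basis of a subspace as a word -/
theorem exists_LI (S : Submodule D E) [FiniteDimensional D S] {l : ℕ} (hl : l ≤ Module.finrank D S) :
    ∃ w : List E, LI D w ∧ w.length = l ∧ sp D w ≤ S := by
  induction l with
  | zero => exact ⟨[], LI.nil, rfl, by rw [sp, Submodule.span_le]; simp⟩
  | succ l ih =>
    obtain ⟨w, h1, h2, h3⟩ := ih (by omega)
    have : ∃ a ∈ S, a ∉ sp D w := by
      by_contra! hc
      have : S ≤ sp D w := hc
      have := Submodule.finrank_mono this
      rw [h1.finrank] at this; omega
    obtain ⟨a, ha, ha'⟩ := this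
    refine ⟨a :: w, LI_cons.2 ⟨ha', h1⟩, by simp [h2], ?_⟩
    rw [sp, Submodule.span_le]
    intro x hx
    rcases List.mem_cons.1 hx with rfl | hx
    · exact ha
    · exact h3 (mem_sp hx)

theorem sp_le {w : List E} {S : Submodule D E} : sp D w ≤ S ↔ ∀ x ∈ w, x ∈ S := by
  rw [sp, Submodule.span_le]; rfl

/-- extension by the identity -/
noncomputable def gext {S K : Submodule D E} (hc : IsCompl S K) (h : S ≃ₗ[D] S) : E ≃ₗ[D] E :=
  (Submodule.prodEquivOfIsCompl S K hc).symm ≪≫ₗ (h.prodCongr (LinearEquiv.refl D K)) ≪≫ₗ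
    Submodule.prodEquivOfIsCompl S K hc

theorem gext_S {S K : Submodule D E} (hc : IsCompl S K) (h : S ≃ₗ[D] S) (s : S) : gext hc h s = h s := by
  simp [gext]

theorem gext_K {S K : Submodule D E} (hc : IsCompl S K) (h : S ≃ₗ[D] S) (s : K) : gext hc h s = s := by
  simp [gext]

/-- moving a vector to another one -/
theorem exists_move {W : Submodule D E} {a b : E} (ha : a ∉ W) (hb : b ∉ W) :
    ∃ g : E ≃ₗ[D] E, g a = b ∧ ∀ x ∈ W, g x = x := by
  have : ∃ φ : E →ₗ[D] D, φ a ≠ 0 ∧ φ b ≠ 0 ∧ ∀ x ∈ W, φ x = 0 := by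
    obtain ⟨φ, h1, h2⟩ := Submodule.exists_le_ker_of_notMem ha
    obtain ⟨ψ, h3, h4⟩ := Submodule.exists_le_ker_of_notMem hb
    by_cases h5 : φ b = 0
    · by_cases h6 : ψ a = 0
      · refine ⟨φ + ψ, by simpa [h6] using h1, by simpa [h5] using h3, fun x hx => ?_⟩
        have e1 : φ x = 0 := h2 hx
        have e2 : ψ x = 0 := h4 hx
        simp [e1, e2]
      · exact ⟨ψ, h6, h3, fun x hx => h4 hx⟩
    · exact ⟨φ, h1, h5, fun x hx => h2 hx⟩
  obtain ⟨φ, h1, h2, h3⟩ := this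
  have aux : ∀ a b : E, φ a ≠ 0 → φ b ≠ 0 → ∀ x : E,
      (x + ((φ a)⁻¹ * φ x) • (b - a)) + ((φ b)⁻¹ * φ (x + ((φ a)⁻¹ * φ x) • (b - a))) • (a - b) = x := by
    intro a b ha hb x
    have : (φ b)⁻¹ * φ (x + ((φ a)⁻¹ * φ x) • (b - a)) = (φ a)⁻¹ * φ x := by
      simp only [map_add, map_smul, map_sub, smul_eq_mul]
      field_simp
      ring
    rw [this, smul_sub, smul_sub]; abel
  let f : E → E → E →ₗ[D] E := fun a b => LinearMap.id + ((φ a)⁻¹ • φ).smulRight (b - a)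
  have hf : ∀ a b x, f a b x = x + ((φ a)⁻¹ * φ x) • (b - a) := fun a b x => rfl
  refine ⟨LinearEquiv.ofLinear (f a b) (f b a) ?_ ?_, ?_, ?_⟩
  · ext x; simp only [LinearMap.comp_apply, hf, LinearMap.id_apply]; exact aux b a h2 h1 x
  · ext x; simp only [LinearMap.comp_apply, hf, LinearMap.id_apply]; exact aux a b h1 h2 x
  · change f a b a = b
    rw [hf, inv_mul_cancel₀ h1]; simp
  · intro x hx
    change f a b x = x
    rw [hf, h3 x hx]; simp

/-- two independent words of the same length are conjugate -/
theorem LI.trans : ∀ {w w' : List E} (h : LI D w) (h' : LI D w') (e : w.length = w'.length),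
    ∃ g : E ≃ₗ[D] E, w.map g = w'
  | [], [], _, _, _ => ⟨1, rfl⟩
  | a :: w, a' :: w', h, h', e => by
    rw [LI_cons] at h h'
    obtain ⟨g, hg⟩ := LI.trans h.2 h'.2 (by simpa using e)
    have hga : g a ∉ sp D w' := by
      intro hm
      apply h.1
      rw [← hg, show sp D (w.map g) = (sp D w).map g.toLinearMap by
        rw [sp, sp, Submodule.map_span]; congr 1; ext; simp] at hm
      obtain ⟨b, hb, e⟩ := hm
      exact g.injective e ▸ hb
    obtain ⟨k, hk, hk'⟩ := exists_move hga h'.1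
    refine ⟨k * g, ?_⟩
    rw [List.map_cons]
    congr 1
    rw [← hg, List.map_congr_left]
    intro x hx
    refine hk' _ (mem_sp ?_)
    rw [← hg]; exact List.mem_map_of_mem hx

theorem LI.trans_in {S K : Submodule D E} (hc : IsCompl S K) {w w' : List E} (h : LI D w) (h' : LI D w')
    (e : w.length = w'.length) (hw : ∀ x ∈ w, x ∈ S) (hw' : ∀ x ∈ w', x ∈ S) :
    ∃ h : S ≃ₗ[D] S, w.map (gext hc h) = w' := by
  have pull : ∀ {w : List E}, LI D w → (∀ x ∈ w, x ∈ S) → ∃ v : List S, v.map S.subtype = w ∧ LI D v := by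
    intro w hw hS
    induction w with
    | nil => exact ⟨[], rfl, LI.nil⟩
    | cons a w ih =>
      rw [LI_cons] at hw
      obtain ⟨v, rfl, hv⟩ := ih hw.2 (fun x hx => hS x (by simp [hx]))
      refine ⟨⟨a, hS a (by simp)⟩ :: v, rfl, LI_cons.2 ⟨fun hm => hw.1 ?_, hv⟩⟩
      rw [show sp D (v.map S.subtype) = (sp D v).map S.subtype by
        rw [sp, sp, Submodule.map_span]; congr 1; ext; simp]
      exact ⟨_, hm, rfl⟩
  obtain ⟨v, rfl, hv⟩ := pull h hw
  obtain ⟨v', rfl, hv'⟩ := pull h' hw'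
  obtain ⟨g, hg⟩ := hv.trans hv' (by simpa using e)
  refine ⟨g, ?_⟩
  rw [← hg]
  simp only [List.map_map]
  refine List.map_congr_left fun x _ => gext_S hc g x

/-- a vector avoiding spans -/
theorem exists_avoid [Infinite D] [FiniteDimensional D E] {l : ℕ} (hl : l < Module.finrank D E)
    (T : Finset (List E)) (hT : ∀ w ∈ T, w.length = l) : ∃ a : E, ∀ w ∈ T, a ∉ sp D w := by
  classical
  have h := Subspace.biUnion_ne_univ_of_top_notMem (k := D) (E := E) (s := T.image (sp D)) (by
    intro h
    obtain ⟨w, hw, e⟩ := Finset.mem_image.1 h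
    have h1 := finrank_span_finset_le_card (R := D) (w.toFinset)
    have h2 := w.toFinset_card_le
    rw [show ((w.toFinset : Finset E) : Set E) = {x | x ∈ w} by ext; simp] at h1
    change Module.finrank D (sp D w) ≤ _ at h1
    rw [e, finrank_top] at h1
    have := hT w hw
    omega)
  obtain ⟨a, ha⟩ := (Set.ne_univ_iff_exists_notMem _).1 h
  refine ⟨a, fun w hw hm => ha ?_⟩
  simp only [Set.mem_iUnion]
  exact ⟨sp D w, Finset.mem_image_of_mem _ hw, hm⟩
end liw
end Stmt3

namespace Stmt3
open Finsupp
set_option linter.all false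
set_option linter.unusedSectionVars false
set_option linter.unusedSimpArgs false
set_option linter.unusedVariables false

section glsub
variable {D E : Type} [Field D] [AddCommGroup E] [Module D E]

/-- pointwise fixer -/
def Fix (S : Submodule D E) : Subgroup (E ≃ₗ[D] E) where
  carrier := {g | ∀ x ∈ S, g x = x}
  one_mem' _ _ := rfl
  mul_mem' := by
    intro g h hg hh x hx
    change g (h x) = x
    rw [hh x hx, hg x hx]
  inv_mem' := by
    intro g hg x hx
    change g.symm x = x
    rw [LinearEquiv.symm_apply_eq, hg x hx]

/-- fixing `S` and preserving `K` -/
def GSK (S K : Submodule D E) : Subgroup (E ≃ₗ[D] E) where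
  carrier := {g | (∀ x ∈ S, g x = x) ∧ ∀ x, x ∈ K ↔ g x ∈ K}
  one_mem' := ⟨fun _ _ => rfl, fun _ => Iff.rfl⟩
  mul_mem' := by
    intro g h hg hh
    refine ⟨fun x hx => ?_, fun x => (hh.2 x).trans (hg.2 _)⟩
    change g (h x) = x
    rw [hh.1 x hx, hg.1 x hx]
  inv_mem' := by
    intro g hg
    refine ⟨fun x hx => ?_, fun x => ?_⟩
    · change g.symm x = x
      rw [LinearEquiv.symm_apply_eq, hg.1 x hx]
    · rw [hg.2 (g⁻¹ x)]
      change _ ↔ g (g.symm x) ∈ K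
      rw [LinearEquiv.apply_symm_apply]

theorem GSK_le (S K : Submodule D E) : GSK S K ≤ Fix S := fun g hg => hg.1

theorem GSK_comm {S K : Submodule D E} (hc : IsCompl S K) (h : S ≃ₗ[D] S) (p : GSK S K) :
    gext hc h * p.1 = p.1 * gext hc h := by
  ext x
  obtain ⟨⟨s, k⟩, rfl⟩ := (Submodule.prodEquivOfIsCompl S K hc).surjective x
  change gext hc h (p.1 (s.1 + k.1)) = p.1 (gext hc h (s.1 + k.1))
  rw [map_add, map_add, map_add, map_add, p.2.1 _ s.2, gext_S, gext_K, p.2.1 _ (h s).2,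
    gext_K hc h ⟨p.1 k.1, (p.2.2 _).1 k.2⟩]

variable {S K : Submodule D E} (hc : IsCompl S K)

/-- coordinates on the fixer -/
noncomputable def fA (g : E ≃ₗ[D] E) : K →ₗ[D] K :=
  K.projectionOnto S hc.symm ∘ₗ g.toLinearMap ∘ₗ K.subtype

/-- coordinates on the fixer -/
noncomputable def fa (g : E ≃ₗ[D] E) : K →ₗ[D] S :=
  S.projectionOnto K hc ∘ₗ g.toLinearMap ∘ₗ K.subtype

theorem fdec (g : E ≃ₗ[D] E) (k : K) : g k = (fa hc g k : E) + fA hc g k := by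
  exact (Submodule.projection_add_projection_eq_self hc (g k)).symm

theorem fA_mul (g h : Fix S) (k : K) : fA hc (g * h).1 k = fA hc g.1 (fA hc h.1 k) := by
  change K.projectionOnto S hc.symm (g.1 (h.1 k)) = K.projectionOnto S hc.symm (g.1 _)
  rw [fdec hc h.1 k, map_add, map_add, g.2 _ (fa hc h.1 k).2]
  simp

theorem fa_mul (g h : Fix S) (k : K) : fa hc (g * h).1 k = fa hc h.1 k + fa hc g.1 (fA hc h.1 k) := by
  change S.projectionOnto K hc (g.1 (h.1 k)) = _ + S.projectionOnto K hc (g.1 _)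
  rw [fdec hc h.1 k, map_add, map_add, g.2 _ (fa hc h.1 k).2]
  simp

theorem fA_one (k : K) : fA hc (1 : E ≃ₗ[D] E) k = k := by
  change K.projectionOnto S hc.symm k.1 = k
  simp

/-- the fixer as an affine-type group -/
noncomputable def fgam : Fix S →* Bg (D := D) K S where
  toFun g := ⟨fa hc g.1, LinearEquiv.ofLinear (fA hc g.1) (fA hc g⁻¹.1)
    (by ext k; simp only [LinearMap.comp_apply, LinearMap.id_apply]
        rw [← fA_mul, mul_inv_cancel]; exact congrArg _ (fA_one hc k))
    (by ext k; simp only [LinearMap.comp_apply, LinearMap.id_apply]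
        rw [← fA_mul, inv_mul_cancel]; exact congrArg _ (fA_one hc k))⟩
  map_one' := Bg.ext' (fun k => by
    change S.projectionOnto K hc k.1 = 0
    simp) (by ext k; exact congrArg _ (fA_one hc k))
  map_mul' g h := Bg.ext' (fun k => fa_mul hc g h k) (by ext k; exact congrArg _ (fA_mul hc g h k))

/-- linear map of an element -/
noncomputable def fbl (x : Bg (D := D) K S) : E →ₗ[D] E :=
  S.subtype ∘ₗ S.projectionOnto K hc + S.subtype ∘ₗ x.a ∘ₗ K.projectionOnto S hc.symm +
    K.subtype ∘ₗ x.g.toLinearMap ∘ₗ K.projectionOnto S hc.symm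

theorem fbl_S (x : Bg (D := D) K S) (s : S) : fbl hc x s = s := by
  simp [fbl]

theorem fbl_K (x : Bg (D := D) K S) (k : K) : fbl hc x k = (x.a k : E) + x.g k := by
  simp [fbl]

theorem fext (hc : IsCompl S K) {f g : E →ₗ[D] E} (h1 : ∀ s : S, f s = g s) (h2 : ∀ k : K, f k = g k) : f = g := by
  ext x
  obtain ⟨⟨s, k⟩, rfl⟩ := (Submodule.prodEquivOfIsCompl S K hc).surjective x
  change f (s.1 + k.1) = g (s.1 + k.1)
  rw [map_add, map_add, h1, h2]

theorem fbl_mul (x y : Bg (D := D) K S) : fbl hc (x * y) = fbl hc x ∘ₗ fbl hc y := by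
  refine fext hc (fun s => ?_) (fun k => ?_)
  · rw [LinearMap.comp_apply, fbl_S, fbl_S, fbl_S]
  · rw [LinearMap.comp_apply, fbl_K, fbl_K, map_add, fbl_S, fbl_K, Bg.mul_a, Bg.mul_g]
    simp [add_assoc]

theorem fbl_one : fbl hc 1 = LinearMap.id := by
  refine fext hc (fun s => ?_) (fun k => ?_)
  · rw [fbl_S]; rfl
  · rw [fbl_K, Bg.one_a, Bg.one_g]; simp

/-- realization -/
noncomputable def fbet : Bg (D := D) K S →* Fix S where
  toFun x := ⟨LinearEquiv.ofLinear (fbl hc x) (fbl hc x⁻¹) (by rw [← fbl_mul, mul_inv_cancel, fbl_one])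
    (by rw [← fbl_mul, inv_mul_cancel, fbl_one]), fun s hs => fbl_S hc x ⟨s, hs⟩⟩
  map_one' := Subtype.ext (LinearEquiv.toLinearMap_injective (fbl_one hc))
  map_mul' x y := Subtype.ext (LinearEquiv.toLinearMap_injective (fbl_mul hc x y))

theorem fbet_gam (g : Fix S) : fbet hc (fgam hc g) = g := by
  refine Subtype.ext (LinearEquiv.toLinearMap_injective (fext hc (fun s => ?_) (fun k => ?_)))
  · exact (fbl_S hc _ s).trans (g.2 _ s.2).symm
  · exact (fbl_K hc _ k).trans (fdec hc g.1 k).symm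

/-- retraction of the fixer -/
noncomputable def fret : Fix S →* GSK S K :=
  ((Fix S).subtype.comp ((fbet hc).comp ((Bm (0 : S →ₗ[D] S)).comp (fgam hc)))).codRestrict (GSK S K) (by
    intro g
    refine ⟨fun x hx => ((fbet hc) ((Bm (0 : S →ₗ[D] S)) (fgam hc g))).2 x hx, fun x => ?_⟩
    have key : ∀ y : Bg (D := D) K S, y.a = 0 → ∀ x ∈ K, fbl hc y x ∈ K := by
      intro y hy x hx
      rw [fbl_K hc y ⟨x, hx⟩, hy]
      simp
    set y := (Bm (0 : S →ₗ[D] S)) (fgam hc g)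
    have hy : y.a = 0 := LinearMap.zero_comp _
    refine ⟨key y hy x, fun hx => ?_⟩
    have := key y⁻¹ (by rw [Bg.inv_a, hy]; simp) _ hx
    change fbl hc y⁻¹ (fbl hc y x) ∈ K at this
    rwa [← LinearMap.comp_apply, ← fbl_mul, inv_mul_cancel, fbl_one] at this)

theorem fret_id (g : GSK S K) : fret hc (Subgroup.inclusion (GSK_le S K) g) = g := by
  refine Subtype.ext (LinearEquiv.toLinearMap_injective (fext hc (fun s => ?_) (fun k => ?_)))
  · exact (fbl_S hc _ s).trans (g.2.1 _ s.2).symm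
  · refine (fbl_K hc _ k).trans ?_
    change ((0 : S) : E) + (fA hc g.1 k : E) = g.1 k
    have : fA hc g.1 k = ⟨g.1 k, (g.2.2 _).1 k.2⟩ := by
      change K.projectionOnto S hc.symm (g.1 k) = _
      exact Submodule.projectionOnto_apply_left hc.symm ⟨g.1 k, (g.2.2 _).1 k.2⟩
    rw [this]; simp

theorem GSK_bij (hc : IsCompl S K) [Infinite D] (i : ℕ) :
    Function.Bijective (Hmap (triv (Subgroup.inclusion (GSK_le S K))) i) := by
  constructor
  · refine Function.LeftInverse.injective (g := Hmap (triv (fret hc)) i) fun x => ?_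
    rw [Hmap_comp]
    exact Hmap_id' _ (fret_id hc) (fun _ => rfl) i x
  · refine Function.RightInverse.surjective (g := Hmap (triv (fret hc)) i) fun x => ?_
    have h := Bm_zero (U := K) (W := S) i (Hmap (triv (fgam hc)) i x)
    have h2 := congrArg (Hmap (triv (fbet hc)) i) h
    rw [Hmap_comp, Hmap_comp, Hmap_comp] at h2
    rw [Hmap_comp]
    refine Eq.trans ?_ (h2.trans ?_)
    · congr 1
    · exact Hmap_id' _ (fbet_gam hc) (fun _ => rfl) i x
end glsub
end Stmt3

namespace Stmt3
open Finsupp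
set_option linter.all false
set_option linter.unusedSectionVars false
set_option linter.unusedSimpArgs false
set_option linter.unusedVariables false

section glc
variable {D E : Type} [Field D] [AddCommGroup E] [Module D E]

/-- independent words of given length -/
def LW (D E : Type) [Field D] [AddCommGroup E] [Module D E] (l : ℕ) : Set (List E) :=
  {w | LI D w ∧ w.length = l}

/-- independent words of given length in a subspace -/
def LS (S : Submodule D E) (l : ℕ) : Set (List E) := {w | w ∈ LW D E l ∧ ∀ x ∈ w, x ∈ S}

theorem LS_sub (S : Submodule D E) (l : ℕ) : LS S l ⊆ LW D E l := fun _ h => h.1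

theorem LW_inv (l : ℕ) : WInv (E ≃ₗ[D] E) (LW D E l) := fun g w hw =>
  ⟨hw.1.map g.toLinearMap g.injective, by rw [List.length_map, hw.2]⟩

theorem LW_face (l : ℕ) : ∀ u ∈ LW D E (l + 1), ∀ i < u.length, u.eraseIdx i ∈ LW D E l := fun u hu i hi =>
  ⟨hu.1.sublist (List.eraseIdx_sublist ..), by rw [List.length_eraseIdx_of_lt hi, hu.2]; rfl⟩

theorem LS_face (S : Submodule D E) (l : ℕ) : ∀ u ∈ LS S (l + 1), ∀ i < u.length, u.eraseIdx i ∈ LS S l :=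
  fun u hu i hi => ⟨LW_face l u hu.1 i hi, fun x hx => hu.2 x (List.mem_of_mem_eraseIdx hx)⟩

theorem LW_exact [Infinite D] [FiniteDimensional D E] {l : ℕ} (hl : l < Module.finrank D E) :
    Exact (LW D E l) (LW D E (l + 1)) := by
  intro x hx
  obtain ⟨a, ha⟩ := exists_avoid (D := D) (E := E) hl x.support (fun w hw => (hx.1 w (by simpa using hw)).2)
  refine ⟨pre [a] x, ?_, ?_⟩
  · have hx' : x ∈ CC {w | w ∈ LW D E l ∧ a ∉ sp D w} := fun w hw => ⟨hx.1 w hw, ha w (by simpa using hw)⟩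
    refine CC_map (pre [a]) (fun w hw => ?_) hx'
    rw [pre_single]
    exact single_mem_CC (S := LW D E (l + 1)) ⟨LI_cons.2 ⟨hw.2, hw.1.1⟩, by simp [hw.1.2]⟩ 1
  · rw [bd_pre_one, show bd x = 0 from hx.2, map_zero, sub_zero]

theorem eps_bdw (w : List E) : aug (List E) ℤ (bdw w) = ∑ j ∈ Finset.range w.length, (-1 : ℤ) ^ j := by
  rw [bdw_face, map_sum]
  refine Finset.sum_congr rfl fun i _ => ?_
  rw [map_zsmul, aug_single]; simp

theorem eps_pre (a : E) (x : List E →₀ ℤ) : aug (List E) ℤ (pre [a] x) = aug (List E) ℤ x := by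
  induction x using Finsupp.induction_linear with
  | zero => simp
  | add x y hx hy => simp only [map_add, hx, hy]
  | single w n => rw [pre_single, aug_single, aug_single]

variable {P : Type} [Group P]

theorem lrep_fixed {S : Submodule D E} {l : ℕ} {x : List E →₀ ℤ} (hx : x ∈ CC (LS S l))
    (g : E ≃ₗ[D] E) (hg : ∀ s ∈ S, g s = s) : lrep (E ≃ₗ[D] E) E g x = x := by
  refine CC_ind (p := fun x => lrep (E ≃ₗ[D] E) E g x = x) (map_zero _) ?_ ?_ hx
  · intro x y hx hy
    rw [map_add, hx, hy]
  · intro w hw n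
    rw [lrep_single]
    congr 1
    conv_rhs => rw [← List.map_id w]
    exact List.map_congr_left fun x hx => hg x (hw.2 x hx)

/-- fixed chains -/
noncomputable def fx {S : Submodule D E} {l : ℕ} (ι : P →* (E ≃ₗ[D] E)) (hι : ∀ p, ∀ s ∈ S, ι p s = s)
    (x : List E →₀ ℤ) (hx : x ∈ CC (LS S l)) : Fx (cRep (LW D E l) (LW_inv l)) ι :=
  ⟨⟨x, CC_mono (LS_sub S l) hx⟩, fun p => Subtype.ext (lrep_fixed hx (ι p) (hι p))⟩

/-- fixed cycles -/
noncomputable def fz {S : Submodule D E} {l : ℕ} (ι : P →* (E ≃ₗ[D] E)) (hι : ∀ p, ∀ s ∈ S, ι p s = s)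
    (x : List E →₀ ℤ) (hx : x ∈ CC (LS S l)) (hb : bd x = 0) : Fx (zRep (LW D E l) (LW_inv l)) ι :=
  ⟨⟨x, CC_mono (LS_sub S l) hx, hb⟩, fun p => Subtype.ext (lrep_fixed hx (ι p) (hι p))⟩

theorem GSK_fix (S K : Submodule D E) : ∀ p, ∀ s ∈ S, (GSK S K).subtype p s = s := fun p => p.2.1

theorem tm_aug {S K : Submodule D E} (hc : IsCompl S K) {l : ℕ} (i : ℕ)
    (y : HH (1 : GSK S K →* AddMonoid.End ℤ) i) {u : List E} (hu : u ∈ LS S l)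
    (x : List E →₀ ℤ) (hx : x ∈ CC (LS S l)) :
    tm _ _ i y (fx (GSK S K).subtype (GSK_fix S K) x hx) = (aug (List E) ℤ x) •
      tm _ _ i y (fx (GSK S K).subtype (GSK_fix S K) (single u 1) (single_mem_CC hu 1)) := by
  suffices h : ∃ hx : x ∈ CC (LS S l), tm _ _ i y (fx (GSK S K).subtype (GSK_fix S K) x hx) =
      (aug (List E) ℤ x) • tm _ _ i y (fx (GSK S K).subtype (GSK_fix S K) (single u 1) (single_mem_CC hu 1)) from
    h.2
  refine CC_ind (p := fun x => ∃ hx : x ∈ CC (LS S l), tm _ _ i y (fx (GSK S K).subtype (GSK_fix S K) x hx) =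
      (aug (List E) ℤ x) • tm _ _ i y (fx (GSK S K).subtype (GSK_fix S K) (single u 1) (single_mem_CC hu 1)))
    ⟨zero_mem _, ?_⟩ ?_ ?_ hx
  · rw [map_zero]
    exact (map_zero (tm _ _ i y)).trans (zero_zsmul _).symm
  · rintro x x' ⟨hx, h⟩ ⟨hx', h'⟩
    refine ⟨add_mem hx hx', ?_⟩
    rw [map_add]
    refine Eq.trans ?_ (add_zsmul _ _ _).symm
    rw [← h, ← h', ← map_add]
    rfl
  · intro w hw n
    refine ⟨single_mem_CC hw n, ?_⟩
    rw [aug_single]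
    obtain ⟨h, e⟩ := LI.trans_in hc hu.1.1 hw.1.1 (hu.1.2.trans hw.1.2.symm) hu.2 hw.2
    have h1 := tm_conj _ _ i y (fx (GSK S K).subtype (GSK_fix S K) (single u 1) (single_mem_CC hu 1))
      (fx (GSK S K).subtype (GSK_fix S K) (single w 1) (single_mem_CC hw 1)) (gext hc h)
      (fun p => GSK_comm hc h p) (by
        refine Subtype.ext ?_
        change lrep (E ≃ₗ[D] E) E (gext hc h) (single u 1) = single w 1
        rw [lrep_single]; congr 1)
    rw [h1, ← map_zsmul]
    refine congrArg _ (Subtype.ext (Subtype.ext ?_))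
    change single w n = n • single w 1
    simp

/-- inclusion of cycles in chains -/
noncomputable def lzinc (D E : Type) [Field D] [AddCommGroup E] [Module D E] (l : ℕ) :
    RMor (zRep (LW D E l) (LW_inv l)) (cRep (LW D E l) (LW_inv l)) where
  φ := MonoidHom.id _
  f := AddSubgroup.inclusion inf_le_left
  comm _ _ := rfl

theorem lmg_surj {l : ℕ} (hex : Exact (LW D E l) (LW D E (l + 1))) (i : ℕ)
    (h : ∀ i', i = i' + 1 → Function.Injective (Hmap (lzinc D E (l + 1)) i')) :
    Function.Surjective (Hmap (zSES (LW_inv l) (LW_inv (l + 1)) (LW_face l) hex).mg i) := by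
  set S := zSES (LW_inv (D := D) (E := E) l) (LW_inv (l + 1)) (LW_face l) hex
  intro x
  cases i with
  | zero => exact S.G_surj0 x
  | succ i =>
    obtain ⟨y, hy⟩ := S.D_ex x
    have h0 := S.D_F hy
    have : y = 0 := h i rfl (h0.trans (map_zero _).symm)
    subst this
    exact S.D_zero hy

theorem lzinc_zero_inj (i : ℕ) : Function.Injective (Hmap (lzinc D E 0) i) := by
  let M : RMor (cRep (LW D E 0) (LW_inv 0)) (zRep (LW D E 0) (LW_inv 0)) :=
    { φ := MonoidHom.id _
      f := AddMonoidHom.mk' (fun x => ⟨x.1, x.2, by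
        change bd x.1 = 0
        refine CC_ind (S := LW D E 0) (p := fun x => bd x = 0) (map_zero _) ?_ ?_ x.2
        · intro x y hx hy; rw [map_add, hx, hy, add_zero]
        · intro u hu n
          obtain rfl := List.eq_nil_of_length_eq_zero hu.2
          rw [bd_single]; simp [bdw]⟩) (fun _ _ => rfl)
      comm := fun _ _ => rfl }
  have : ∀ x, Hmap M i (Hmap (lzinc D E 0) i x) = x := by
    intro x
    rw [Hmap_comp]
    exact Hmap_id' _ (fun _ => rfl) (fun _ => rfl) i x
  exact Function.LeftInverse.injective this

theorem lSh_bij {l : ℕ} {u : List E} (hu : u ∈ LW D E l) (i : ℕ) :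
    Function.Bijective (fun y => tm _ (Fix (sp D u)).subtype i y
      (fx (Fix (sp D u)).subtype (fun p => p.2) (single u 1)
        (single_mem_CC (S := LS (sp D u) l) ⟨hu, fun _ h => mem_sp h⟩ 1))) := by
  refine (wMor_sh (Fix (sp D u)).subtype (Subgroup.subtype_injective _) (LW_inv l) u hu
    (fun p => ?_) ?_ ?_).bij i
  · conv_rhs => rw [← List.map_id u]
    exact List.map_congr_left fun x hx => p.2 x (mem_sp hx)
  · intro g hg
    refine ⟨⟨g, fun x hx => ?_⟩, rfl⟩
    have h := List.map_inj_left.1 (hg.trans (List.map_id u).symm)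
    refine Submodule.span_induction (p := fun x _ => g x = x) (fun x hx => h x hx) (map_zero _) ?_ ?_ hx
    · intro x y _ _ h1 h2; rw [map_add, h1, h2]
    · intro c x _ h1; rw [map_smul, h1]
  · intro w hw
    exact hu.1.trans hw.1 (hu.2.trans hw.2.symm)

/-- every class comes from the complement stabilizer -/
theorem lSh_surj [Infinite D] {l : ℕ} {u : List E} (hu : u ∈ LW D E l) {K : Submodule D E}
    (hc : IsCompl (sp D u) K) (i : ℕ) :
    Function.Bijective (fun y => tm _ (GSK (sp D u) K).subtype i y
      (fx (GSK (sp D u) K).subtype (GSK_fix _ _) (single u 1)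
        (single_mem_CC (S := LS (sp D u) l) ⟨hu, fun _ h => mem_sp h⟩ 1))) := by
  have h := (lSh_bij hu i).comp (GSK_bij hc i)
  have e : ∀ y, tm _ (GSK (sp D u) K).subtype i y
      (fx (GSK (sp D u) K).subtype (GSK_fix _ _) (single u 1)
        (single_mem_CC (S := LS (sp D u) l) ⟨hu, fun _ h => mem_sp h⟩ 1)) =
      tm _ (Fix (sp D u)).subtype i (Hmap (triv (Subgroup.inclusion (GSK_le (sp D u) K))) i y)
      (fx (Fix (sp D u)).subtype (fun p => p.2) (single u 1)
        (single_mem_CC (S := LS (sp D u) l) ⟨hu, fun _ h => mem_sp h⟩ 1)) := by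
    intro y
    exact (tm_triv _ (Fix (sp D u)).subtype (Subgroup.inclusion (GSK_le (sp D u) K)) i y _ _ rfl).symm
  have e2 := funext e
  rw [e2]
  exact h

end glc
end Stmt3

namespace Stmt3
open Finsupp
set_option linter.all false
set_option linter.unusedSectionVars false
set_option linter.unusedSimpArgs false
set_option linter.unusedVariables false

section glc
variable {D E : Type} [Field D] [AddCommGroup E] [Module D E]

theorem tm_mg {P : Type} [Group P] {S : Submodule D E} {l : ℕ} (hex : Exact (LW D E l) (LW D E (l + 1)))
    (ι : P →* (E ≃ₗ[D] E)) (hι : ∀ p, ∀ s ∈ S, ι p s = s) (i : ℕ)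
    (y : HH (1 : P →* AddMonoid.End ℤ) i)
    (x : List E →₀ ℤ) (hx : x ∈ CC (LS S (l + 1))) (hx' : bd x ∈ CC (LS S l)) :
    Hmap (zSES (LW_inv l) (LW_inv (l + 1)) (LW_face l) hex).mg i (tm _ ι i y (fx ι hι x hx)) =
      tm _ ι i y (fz ι hι (bd x) hx' (bd_bd x)) :=
  tm_map _ _ _ i y (zSES (LW_inv l) (LW_inv (l + 1)) (LW_face l) hex).mg (fun _ => rfl) _ _ rfl

theorem tm_zi {P : Type} [Group P] {S : Submodule D E} {l : ℕ}
    (ι : P →* (E ≃ₗ[D] E)) (hι : ∀ p, ∀ s ∈ S, ι p s = s) (i : ℕ)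
    (y : HH (1 : P →* AddMonoid.End ℤ) i)
    (x : List E →₀ ℤ) (hx : x ∈ CC (LS S l)) (hx' : bd x = 0) :
    Hmap (lzinc D E l) i (tm _ ι i y (fz ι hι x hx hx')) = tm _ ι i y (fx ι hι x hx) :=
  tm_map _ _ _ i y (lzinc D E l) (fun _ => rfl) _ _ rfl

theorem gen_mem {S : Submodule D E} {l : ℕ} {w : List E} (hw : w ∈ LS S l) :
    bdw (w.sum :: w) ∈ CC (LS S l) := by
  rw [bdw_face]
  refine sum_mem fun i hi => zsmul_mem (single_mem_CC (S := LS S l) ⟨⟨hw.1.1.gen_face i (by simpa using hi), ?_⟩, ?_⟩ 1) _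
  · rw [List.length_eraseIdx_of_lt (by simpa using hi)]; simp [hw.1.2]
  · intro x hx
    rcases List.mem_cons.1 (List.mem_of_mem_eraseIdx hx) with rfl | h
    · exact list_sum_mem fun x hx => hw.2 x hx
    · exact hw.2 x h

theorem bdw_LS {S : Submodule D E} {l : ℕ} {w : List E} (hw : w ∈ LS S (l + 1)) :
    bdw w ∈ CC (LS S l) := by
  have := bdw_mem (LS_face S l) (single_mem_CC hw 1)
  rwa [bd_single, one_smul] at this

theorem l_inj [Infinite D] [FiniteDimensional D E] (i : ℕ) : ∀ l, i + l + 1 ≤ Module.finrank D E →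
    Function.Injective (Hmap (lzinc D E l) i) := by
  induction i using Nat.strong_induction_on with
  | _ i ih =>
  intro l hl
  rcases Nat.eq_zero_or_pos l with rfl | hl0
  · exact lzinc_zero_inj i
  have hex := LW_exact (D := D) (E := E) (l := l) (by omega)
  have hsur := lmg_surj hex i (by
    rintro i' rfl
    exact ih i' (by omega) (l + 1) (by omega))
  rw [injective_iff_map_eq_zero]
  intro ζ hζ
  obtain ⟨w, hw1, hw2, -⟩ := exists_LI (D := D) (E := E) ⊤ (l := l + 1) (by rw [finrank_top]; omega)
  obtain ⟨a, v, rfl⟩ := List.exists_cons_of_length_eq_add_one hw2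
  have hw : a :: v ∈ LW D E (l + 1) := ⟨hw1, hw2⟩
  have hwS : a :: v ∈ LS (sp D (a :: v)) (l + 1) := ⟨hw, fun _ h => mem_sp h⟩
  have hvS : v ∈ LS (sp D (a :: v)) l := LS_face _ l _ hwS 0 (by simp)
  obtain ⟨K, hc⟩ := Submodule.exists_isCompl (sp D (a :: v))
  obtain ⟨x, rfl⟩ := hsur ζ
  obtain ⟨y, rfl⟩ := (lSh_surj hw hc i).2 x
  rcases Nat.even_or_odd l with p | p
  · change Hmap _ i (Hmap _ i (tm _ (GSK (sp D (a :: v)) K).subtype i y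
      (fx (GSK (sp D (a :: v)) K).subtype (GSK_fix _ _) (single (a :: v) 1) (single_mem_CC hwS 1)))) = 0 at hζ
    change Hmap _ i (tm _ (GSK (sp D (a :: v)) K).subtype i y
      (fx (GSK (sp D (a :: v)) K).subtype (GSK_fix _ _) (single (a :: v) 1) (single_mem_CC hwS 1))) = 0
    have hbd : bd (single (a :: v) 1) = bdw (a :: v) := by rw [bd_single, one_smul]
    rw [tm_mg hex _ _ i y _ _ (by rw [hbd]; exact bdw_LS hwS), tm_zi, tm_aug hc i y hvS, hbd, eps_bdw, hw2,
      alt_odd l p, one_zsmul] at hζ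
    -- pass to the fixer of `v`
    have hvv : v ∈ LS (sp D v) l := ⟨hvS.1, fun _ h => mem_sp h⟩
    have hle : GSK (sp D (a :: v)) K ≤ Fix (sp D v) := by
      intro g hg x hx
      exact hg.1 x (Submodule.span_mono (fun _ h => List.mem_cons_of_mem _ h) hx)
    have e1 : tm _ (Fix (sp D v)).subtype i (Hmap (triv (Subgroup.inclusion hle)) i y)
      (fx (Fix (sp D v)).subtype (fun p => p.2) (single v 1) (single_mem_CC hvv 1)) = 0 :=
      (tm_triv _ (Fix (sp D v)).subtype (Subgroup.inclusion hle) i y _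
        (fx (GSK (sp D (a :: v)) K).subtype (GSK_fix _ _) (single v 1) (single_mem_CC hvS 1)) rfl).trans hζ
    have e2 : Hmap (triv (Subgroup.inclusion hle)) i y = 0 :=
      (lSh_bij hvS.1 i).1 (e1.trans (tm_zero' _ _ i rfl _).symm)
    have hν := gen_mem hvv
    have hν0 : bd (bdw (v.sum :: v)) = 0 := bdw_bd _
    have hν' : bdw (v.sum :: v) ∈ CC (LS (sp D (a :: v)) l) :=
      CC_mono (S := LS (sp D v) l) (T := LS (sp D (a :: v)) l) (fun u hu => ⟨hu.1, fun x hx => Submodule.span_mono (fun _ h => List.mem_cons_of_mem _ h) (hu.2 x hx)⟩) hν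
    have e3 : tm _ (GSK (sp D (a :: v)) K).subtype i y
        (fz (GSK (sp D (a :: v)) K).subtype (GSK_fix _ _) _ hν' hν0) = 0 :=
      (tm_triv _ (Fix (sp D v)).subtype (Subgroup.inclusion hle) i y
        (fz (Fix (sp D v)).subtype (fun p => p.2) _ hν hν0) _ rfl).symm.trans (tm_zero' _ _ i e2 _)
    have hpre : pre [a] (bdw (v.sum :: v)) ∈ CC (LS (sp D (a :: v)) (l + 1)) := by
      refine CC_map (pre [a]) (fun u hu => ?_) hν
      rw [pre_single]
      refine single_mem_CC (S := LS (sp D (a :: v)) (l + 1)) ⟨⟨LI_cons.2 ⟨fun hm => ?_, hu.1.1⟩, by simp [hu.1.2]⟩, ?_⟩ 1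
      · exact (LI_cons.1 hw1).1 ((sp_le.2 hu.2) hm)
      · intro x hx
        rcases List.mem_cons.1 hx with rfl | hx
        · exact mem_sp (by simp)
        · exact Submodule.span_mono (fun _ h => List.mem_cons_of_mem _ h) (hu.2 x hx)
    have hb : bd (pre [a] (bdw (v.sum :: v))) = bdw (v.sum :: v) := by
      rw [bd_pre_one, hν0, map_zero, sub_zero]
    have e4 := tm_mg hex (GSK (sp D (a :: v)) K).subtype (GSK_fix _ _) i y _ hpre (by rw [hb]; exact hν')
    rw [tm_aug hc i y hwS, eps_pre, eps_bdw, List.length_cons, hvS.1.2, alt_odd l p, one_zsmul] at e4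
    refine e4.trans (Eq.trans ?_ e3)
    congr 1
    exact Subtype.ext (Subtype.ext hb)
  · have h1 := tm_aug hc i y hwS _ (gen_mem hwS)
    rw [eps_bdw, List.length_cons, hw2, alt_odd (l + 1) p.add_one, one_zsmul] at h1
    refine (congrArg _ h1.symm).trans ?_
    have h0 : bd (bdw ((a :: v).sum :: a :: v)) = 0 := bdw_bd _
    rw [tm_mg hex _ _ i y _ _ (by rw [h0]; exact zero_mem _)]
    have h2 : fz (GSK (sp D (a :: v)) K).subtype (GSK_fix _ _) (bd (bdw ((a :: v).sum :: a :: v)))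
      (S := sp D (a :: v)) (l := l) (by rw [h0]; exact zero_mem _) (bd_bd _) = 0 := Subtype.ext (Subtype.ext h0)
    exact (congrArg _ h2).trans (map_zero _)

theorem GL_conn0 [Infinite D] [FiniteDimensional D E] {m : ℕ} (hm : Module.finrank D E = m) {v : E} (hv : v ≠ 0)
    {K : Submodule D E} (hc : IsCompl (Submodule.span D {v}) K) :
    Conn (triv (GSK (Submodule.span D {v}) K).subtype) m := by
  have hS : Submodule.span D {v} = sp D [v] := by rw [sp]; congr 1; ext; simp
  rw [hS] at hc ⊢
  have hv1 : LI D [v] := LI_cons.2 ⟨by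
    intro h; apply hv
    have : sp D ([] : List E) = ⊥ := by rw [sp]; convert Submodule.span_empty using 2; ext; simp
    rwa [this] at h, LI.nil⟩
  have hvW : [v] ∈ LW D E 1 := ⟨hv1, rfl⟩
  have hvS : [v] ∈ LS (sp D [v]) 1 := ⟨hvW, fun _ h => mem_sp h⟩
  have hnil : ∀ S : Submodule D E, ([] : List E) ∈ LS S 0 := fun S => ⟨⟨LI.nil, rfl⟩, by simp⟩
  have hbd0 : bd (single ([] : List E) 1) = 0 := by rw [bd_single]; simp [bdw]
  have hbdv : bd (single [v] 1) = single [] 1 := by rw [bd_single, one_smul]; simp [bdw]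
  have hm1 : 0 < m := by
    rw [← hm]; exact Module.finrank_pos_iff_exists_ne_zero.2 ⟨v, hv⟩
  have hex := LW_exact (D := D) (E := E) (l := 0) (by omega)
  -- identification of degree zero chains
  have hfix0 : ∀ p : E ≃ₗ[D] E, ∀ s ∈ (⊥ : Submodule D E), (MonoidHom.id (E ≃ₗ[D] E)) p s = s := by
    intro p s hs
    rw [(Submodule.mem_bot D).1 hs, map_zero]
  have hsh : ∀ i, Function.Bijective (fun y => tm _ (MonoidHom.id (E ≃ₗ[D] E)) i y
      (fx (MonoidHom.id (E ≃ₗ[D] E)) hfix0 (single [] 1) (single_mem_CC (hnil ⊥) 1))) := by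
    intro i
    refine (wMor_sh (MonoidHom.id (E ≃ₗ[D] E)) Function.injective_id (LW_inv 0) [] (hnil ⊥).1
      (fun p => rfl) (fun g _ => ⟨g, rfl⟩) ?_).bij i
    intro w hw
    exact ⟨1, (List.eq_nil_of_length_eq_zero hw.2).symm⟩
  -- the basic diagram
  have key : ∀ i (y : HH (1 : GSK (sp D [v]) K →* AddMonoid.End ℤ) i),
      Hmap (zSES (LW_inv 0) (LW_inv 1) (LW_face 0) hex).mg i
        (tm _ (GSK (sp D [v]) K).subtype i y (fx _ (GSK_fix _ _) (single [v] 1) (single_mem_CC hvS 1))) =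
      tm _ (MonoidHom.id (E ≃ₗ[D] E)) i (Hmap (triv (GSK (sp D [v]) K).subtype) i y)
        (fz (MonoidHom.id (E ≃ₗ[D] E)) hfix0 (single [] 1) (single_mem_CC (hnil ⊥) 1) hbd0) := by
    intro i y
    rw [tm_mg hex _ _ i y _ _ (by rw [hbdv]; exact single_mem_CC (hnil _) 1)]
    exact (tm_triv _ (MonoidHom.id (E ≃ₗ[D] E)) (GSK (sp D [v]) K).subtype i y _ _
      (Subtype.ext hbdv.symm) |>.symm)
  constructor
  · intro i hi x
    have hsur := lmg_surj hex i (by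
      rintro i' rfl
      exact l_inj i' 1 (by omega))
    obtain ⟨t, ht⟩ := hsur (tm _ (MonoidHom.id (E ≃ₗ[D] E)) i x
        (fz (MonoidHom.id (E ≃ₗ[D] E)) hfix0 (single [] 1) (single_mem_CC (hnil ⊥) 1) hbd0))
    obtain ⟨y, rfl⟩ := (lSh_surj hvW hc i).2 t
    refine ⟨y, (hsh i).1 ?_⟩
    have h1 := congrArg (Hmap (lzinc D E 0) i) ((key i y).symm.trans ht)
    rw [tm_zi, tm_zi] at h1
    exact h1
  · intro i hi
    rw [injective_iff_map_eq_zero]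
    intro y hy
    have h1 := (key i y).trans (tm_zero' _ _ i hy _)
    obtain ⟨ζ, hζ⟩ := (zSES (LW_inv 0) (LW_inv 1) (LW_face 0) hex).F_G h1
    have hex1 := LW_exact (D := D) (E := E) (l := 1) (by omega)
    have hsur := lmg_surj hex1 i (by
      rintro i' rfl
      exact l_inj i' 2 (by omega))
    obtain ⟨w, hw1, hw2, -⟩ := exists_LI (D := D) (E := E) ⊤ (l := 2) (by rw [finrank_top]; omega)
    have hw : w ∈ LW D E 2 := ⟨hw1, hw2⟩
    have hwS : w ∈ LS (sp D w) 2 := ⟨hw, fun _ h => mem_sp h⟩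
    obtain ⟨K', hc'⟩ := Submodule.exists_isCompl (sp D w)
    obtain ⟨t, rfl⟩ := hsur ζ
    obtain ⟨y2, rfl⟩ := (lSh_surj hw hc' i).2 t
    have hbd : bd (single w 1) = bdw w := by rw [bd_single, one_smul]
    have hface := LS_face _ 1 _ hwS 0 (by omega)
    have halt : ∑ j ∈ Finset.range w.length, (-1 : ℤ) ^ j = 0 := by rw [hw2, alt_even 2 (by decide)]
    have e1 : Hmap (lzinc D E 1) i (Hmap (zSES (LW_inv 1) (LW_inv 2) (LW_face 1) hex1).mg i
      (tm _ (GSK (sp D w) K').subtype i y2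
      (fx (GSK (sp D w) K').subtype (GSK_fix _ _) (single w 1) (single_mem_CC hwS 1)))) = 0 := by
      rw [tm_mg hex1 _ _ i y2 _ _ (by rw [hbd]; exact bdw_LS hwS), tm_zi,
        tm_aug hc' i y2 hface, hbd, eps_bdw, halt]
      exact zero_zsmul _
    refine (lSh_surj hvW hc i).1 ((hζ.symm.trans e1).trans (tm_zero' _ _ i rfl _).symm)

/-- Stability for general linear groups in the form used below. -/
theorem GL_conn [Infinite D] [FiniteDimensional D E] {m : ℕ} (hm : Module.finrank D E = m) {v : E} (hv : v ≠ 0)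
    {K : Submodule D E} (hc : IsCompl (Submodule.span D {v}) K) {Q : Type} [Group Q] (κ : Q →* (E ≃ₗ[D] E))
    (hκ : Function.Injective κ) (h1 : ∀ q, κ q v = v) (h2 : ∀ q, ∀ x ∈ K, κ q x ∈ K)
    (h3 : ∀ g : E ≃ₗ[D] E, g v = v → (∀ x, x ∈ K ↔ g x ∈ K) → g ∈ κ.range) : Conn (triv κ) m := by
  have hr : ∀ q, κ q ∈ GSK (Submodule.span D {v}) K := by
    intro q
    refine ⟨fun x hx => ?_, fun x => ⟨h2 q x, fun hx => ?_⟩⟩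
    · obtain ⟨c, rfl⟩ := Submodule.mem_span_singleton.1 hx
      rw [map_smul, h1]
    · have := h2 q⁻¹ _ hx
      rwa [map_inv, show (κ q)⁻¹ (κ q x) = x from (κ q).symm_apply_apply x] at this
  let κ' : Q →* GSK (Submodule.span D {v}) K := κ.codRestrict _ hr
  have hb : Function.Bijective κ' := by
    refine ⟨fun a b h => hκ (congrArg Subtype.val h), fun g => ?_⟩
    obtain ⟨q, hq⟩ := h3 g.1 (g.2.1 v (Submodule.mem_span_singleton_self v)) g.2.2
    exact ⟨q, Subtype.ext hq⟩
  let e := MulEquiv.ofBijective κ' hb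
  have h0 := GL_conn0 hm hv hc
  have hb' := triv_bij e
  have hcomp : ∀ i x, Hmap (triv κ) i x = Hmap (triv (GSK (Submodule.span D {v}) K).subtype) i
      (Hmap (triv e.toMonoidHom) i x) := by
    intro i x
    rw [triv_comp]; rfl
  refine ⟨fun i hi => ?_, fun i hi => ?_⟩
  · rw [show (Hmap (triv κ) i : _ → _) = _ from funext (hcomp i)]
    exact (h0.1 i hi).comp (hb' i).2
  · rw [show (Hmap (triv κ) i : _ → _) = _ from funext (hcomp i)]
    exact (h0.2 i hi).comp (hb' i).1
end glc
end Stmt3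

namespace Stmt3
open Finsupp
set_option linter.all false
set_option linter.unusedSectionVars false
set_option linter.unusedSimpArgs false
set_option linter.unusedVariables false

section cone
variable {α : Type}

/-- induced map on chains of words -/
noncomputable def mp (f : List α → List α) : (List α →₀ ℤ) →+ (List α →₀ ℤ) :=
  indAux f (AddMonoidHom.id ℤ)

@[simp] theorem mp_single (f : List α → List α) (w : List α) (n : ℤ) :
    mp f (single w n) = single (f w) n := by
  simp [mp]

/-- faces -/
noncomputable def er (i : ℕ) : (List α →₀ ℤ) →+ (List α →₀ ℤ) := mp (fun w => w.eraseIdx i)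

@[simp] theorem er_single (i : ℕ) (w : List α) (n : ℤ) :
    er i (single w n) = single (w.eraseIdx i) n := mp_single _ _ _

/-- extend a function on words to chains -/
noncomputable def ext1 (f : List α → (List α →₀ ℤ)) : (List α →₀ ℤ) →+ (List α →₀ ℤ) :=
  Finsupp.liftAddHom fun w => (zmultiplesHom _ (f w))

theorem ext1_single (f : List α → (List α →₀ ℤ)) (w : List α) (n : ℤ) :
    ext1 f (single w n) = n • f w := by simp [ext1]

theorem ext1_one (f : List α → (List α →₀ ℤ)) (w : List α) :
    ext1 f (single w 1) = f w := by simp [ext1]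

theorem er_pre_zero (t : α) (x : List α →₀ ℤ) : er 0 (pre [t] x) = x := by
  induction x using Finsupp.induction_linear with
  | zero => simp
  | add x y hx hy => simp only [map_add, hx, hy]
  | single w n => simp

theorem er_pre_succ (t : α) (i : ℕ) (x : List α →₀ ℤ) : er (i + 1) (pre [t] x) = pre [t] (er i x) := by
  induction x using Finsupp.induction_linear with
  | zero => simp
  | add x y hx hy => simp only [map_add, hx, hy]
  | single w n => simp

theorem er_er_zero (i : ℕ) (x : List α →₀ ℤ) : er i (er 0 x) = er 0 (er (i + 1) x) := by
  induction x using Finsupp.induction_linear with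
  | zero => simp
  | add x y hx hy => simp only [map_add, hx, hy]
  | single w n => cases w <;> simp

/-- homotopy on words -/
noncomputable def mw (a b : α → α) : List α → (List α →₀ ℤ)
  | [] => 0
  | t :: w => single (a t :: t :: w) 1 - single (a t :: b t :: w.map b) 1 - pre [a t] (mw a b w)

theorem er_mw_zero (a b : α → α) (w : List α) :
    er 0 (mw a b w) = single w 1 - single (w.map b) 1 - ext1 (mw a b) (er 0 (single w 1)) := by
  cases w with
  | nil => simp [mw, ext1_one]
  | cons t w => rw [mw, map_sub, map_sub, er_pre_zero]; simp [ext1_one]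

/-- head extension of an additive map -/
noncomputable def hx (a : α → α) (Ψ : (List α →₀ ℤ) →+ (List α →₀ ℤ)) :
    (List α →₀ ℤ) →+ (List α →₀ ℤ) :=
  ext1 fun w => match w with
    | [] => 0
    | t :: v => pre [a t] (Ψ (single v 1))

theorem hx_cons (a : α → α) (Ψ : (List α →₀ ℤ) →+ (List α →₀ ℤ)) (t : α) (v : List α) :
    hx a Ψ (single (t :: v) 1) = pre [a t] (Ψ (single v 1)) := by
  rw [hx, ext1_one]

theorem er_mw (a b : α → α) : ∀ L j, j < L → ∃ Ψ : ℕ → ((List α →₀ ℤ) →+ (List α →₀ ℤ)),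
    ∀ w : List α, w.length = L →
      er (j + 1) (mw a b w) = ∑ i ∈ Finset.range L, Ψ i (er i (single w 1)) := by
  intro L
  induction L with
  | zero => intro j hj; omega
  | succ L ih =>
    intro j hj
    cases j with
    | zero =>
      cases L with
      | zero =>
        refine ⟨fun _ => 0, fun w hw => ?_⟩
        obtain ⟨t, rfl⟩ := List.length_eq_one_iff.1 hw
        simp [mw]
      | succ L =>
        refine ⟨fun i => if i = 1 then hx a (ext1 (mw a b)) else 0, fun w hw => ?_⟩
        rw [Finset.sum_eq_single 1 (fun i _ hi => by simp only [if_neg hi]; rfl)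
          (fun h => absurd (Finset.mem_range.2 (by omega)) h)]
        simp only [if_true]
        match w, hw with
        | t :: w, hw =>
          rw [mw, map_sub, map_sub, er_pre_succ, er_mw_zero]
          simp only [er_single, List.eraseIdx_cons_succ, hx_cons, map_sub, pre_single]
          simp
    | succ j =>
      obtain ⟨Ψ, hΨ⟩ := ih j (by omega)
      refine ⟨fun i => (if i = j + 1 then ext1 (fun w => match w with
        | [] => 0
        | t :: v => single (a t :: t :: v) 1 - single (a t :: b t :: v.map b) 1) else 0) -
          (if i = 0 then 0 else hx a (Ψ (i - 1))), fun w hw => ?_⟩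
      match w, hw with
      | t :: w, hw =>
        rw [mw, map_sub, map_sub, er_pre_succ, hΨ w (by simpa using hw)]
        simp only [AddMonoidHom.sub_apply, Finset.sum_sub_distrib]
        congr 1
        · rw [Finset.sum_eq_single (j + 1) (fun i _ hi => by rw [if_neg hi]; rfl)
            (fun h => absurd (Finset.mem_range.2 (by omega)) h), if_pos rfl]
          simp only [er_single, List.eraseIdx_cons_succ, ext1_one, List.eraseIdx_map]
        · rw [Finset.sum_range_succ', map_sum]
          simp only [er_single, List.eraseIdx_cons_succ, hx_cons]
          simp [hx_cons]

/-- the cone: a cycle is homologous to its image under `b` -/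
theorem mw_main (a b : α → α) (L : ℕ) (x : List α →₀ ℤ) (hx : x ∈ CC {w : List α | w.length = L})
    (h : ∀ i < L, er i x = 0) (hL : 0 < L) :
    er 0 (ext1 (mw a b) x) = x - mp (List.map b) x ∧
      ∀ j < L, er (j + 1) (ext1 (mw a b) x) = 0 := by
  constructor
  · have : ∀ x : List α →₀ ℤ, er 0 (ext1 (mw a b) x) =
        x - mp (List.map b) x - ext1 (mw a b) (er 0 x) := by
      intro x
      induction x using Finsupp.induction_linear with
      | zero => simp
      | add x y hx hy => simp only [map_add, hx, hy]; abel
      | single w n =>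
        rw [single_smul' w n]
        simp only [map_zsmul]
        rw [ext1_one, er_mw_zero]; simp [smul_sub]
    rw [this, h 0 hL, map_zero, sub_zero]
  · intro j hj
    obtain ⟨Ψ, hΨ⟩ := er_mw a b L j hj
    have : er (j + 1) (ext1 (mw a b) x) = ∑ i ∈ Finset.range L, Ψ i (er i x) := by
      refine CC_ind (p := fun x => er (j + 1) (ext1 (mw a b) x) = ∑ i ∈ Finset.range L, Ψ i (er i x))
        (by simp) (fun x y hx hy => by simp only [map_add, hx, hy, Finset.sum_add_distrib])
        (fun w hw n => ?_) hx
      rw [single_smul' w n]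
      simp only [map_zsmul]
      rw [ext1_one, hΨ w hw, Finset.smul_sum]
    rw [this]
    exact Finset.sum_eq_zero fun i hi => by rw [h i (Finset.mem_range.1 hi), map_zero]

variable [PartialOrder α]

/-- flags: `Q l s` says `s` is allowed to be followed by `l` letters -/
def FL (Q : ℕ → α → Prop) : List α → Prop
  | [] => True
  | s :: w => Q w.length s ∧ (∀ t ∈ w, s ≤ t) ∧ FL Q w

/-- flags of given length -/
def FW (Q : ℕ → α → Prop) (L : ℕ) : Set (List α) := {w | FL Q w ∧ w.length = L}

/-- chains killed by the later faces -/
def EE (Q : ℕ → α → Prop) (L : ℕ) : AddSubgroup (List α →₀ ℤ) where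
  carrier := {x | x ∈ CC (FW Q L) ∧ ∀ i, 0 < i → i < L → er i x = 0}
  zero_mem' := ⟨zero_mem _, by simp⟩
  add_mem' h1 h2 := ⟨add_mem h1.1 h2.1, fun i hi hi' => by rw [map_add, h1.2 i hi hi', h2.2 i hi hi', add_zero]⟩
  neg_mem' h := ⟨neg_mem h.1, fun i hi hi' => by rw [map_neg, h.2 i hi hi', neg_zero]⟩

def YY (Q : ℕ → α → Prop) (L : ℕ) : AddSubgroup (List α →₀ ℤ) where
  carrier := {x | x ∈ CC (FW Q L) ∧ ∀ i, i < L → er i x = 0}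
  zero_mem' := ⟨zero_mem _, by simp⟩
  add_mem' h1 h2 := ⟨add_mem h1.1 h2.1, fun i hi => by rw [map_add, h1.2 i hi, h2.2 i hi, add_zero]⟩
  neg_mem' h := ⟨neg_mem h.1, fun i hi => by rw [map_neg, h.2 i hi, neg_zero]⟩

theorem YY_le (Q : ℕ → α → Prop) (L : ℕ) : YY Q L ≤ EE Q L := fun _ h => ⟨h.1, fun i _ => h.2 i⟩

theorem FW_tail {Q : ℕ → α → Prop} {L : ℕ} {w : List α} (h : w ∈ FW Q (L + 1)) :
    w.eraseIdx 0 ∈ FW Q L := by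
  match w, h with
  | s :: w, h => exact ⟨h.1.2.2, by simpa using h.2⟩

theorem er_EE {Q : ℕ → α → Prop} {L : ℕ} {x : List α →₀ ℤ} (h : x ∈ EE Q (L + 1)) :
    er 0 x ∈ YY Q L := by
  refine ⟨CC_map (er 0) (fun w hw => ?_) h.1, fun i hi => ?_⟩
  · rw [er_single]; exact single_mem_CC (FW_tail hw) 1
  · rw [er_er_zero, h.2 (i + 1) (by omega) (by omega), map_zero]

theorem FL_mono {Q Q' : ℕ → α → Prop} {w : List α} (h : FL Q w)
    (hQ : ∀ l s, l < w.length → Q l s → s ∈ w → Q' l s) : FL Q' w := by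
  induction w with
  | nil => trivial
  | cons s w ih =>
    exact ⟨hQ _ _ (by simp) h.1 (by simp), h.2.1, ih h.2.2 (fun l t hl ht hm =>
      hQ l t (by simp; omega) ht (by simp [hm]))⟩

theorem FL_mem {Q : ℕ → α → Prop} {w : List α} (h : FL Q w) {s : α} (hs : s ∈ w) :
    ∃ l < w.length, Q l s := by
  induction w with
  | nil => simp at hs
  | cons t w ih =>
    rcases List.mem_cons.1 hs with rfl | hs
    · exact ⟨_, by simp, h.1⟩
    · obtain ⟨l, hl, hq⟩ := ih h.2.2 hs
      exact ⟨l, by simp; omega, hq⟩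

/-- exactness -/
def XX (Q : ℕ → α → Prop) (L : ℕ) : Prop := ∀ x ∈ YY Q L, ∃ y ∈ EE Q (L + 1), er 0 y = x

theorem FL_map {Q Q' : ℕ → α → Prop} (b : α → α) {w : List α} (h : FL Q w)
    (hb : ∀ l s, l < w.length → Q l s → s ∈ w → Q' l (b s))
    (hm : ∀ s ∈ w, ∀ t ∈ w, s ≤ t → b s ≤ b t) : FL Q' (w.map b) := by
  induction w with
  | nil => trivial
  | cons s w ih =>
    refine ⟨?_, ?_, ?_⟩
    · rw [List.length_map]; exact hb _ _ (by simp) h.1 (by simp)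
    · intro t ht
      obtain ⟨t0, ht0, e0⟩ := List.mem_map.1 ht
      subst e0
      clear ht
      rename' t0 => t, ht0 => ht
      exact hm _ (by simp) _ (by simp [ht]) (h.2.1 t ht)
    · exact ih h.2.2 (fun l t hl hq ht => hb l t (by simp; omega) hq (by simp [ht]))
        (fun s hs t ht => hm s (by simp [hs]) t (by simp [ht]))

theorem mw_FL {Q : ℕ → α → Prop} (a b : α → α) {w : List α} (h : FL Q w)
    (ha : ∀ l s, l < w.length → Q l s → s ∈ w → Q (l + 1) (a s))
    (hb : ∀ l s, l < w.length → Q l s → s ∈ w → Q l (b s))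
    (haa : ∀ s ∈ w, ∀ t ∈ w, s ≤ t → a s ≤ a t) (hbb : ∀ s ∈ w, ∀ t ∈ w, s ≤ t → b s ≤ b t)
    (h1 : ∀ s ∈ w, a s ≤ s) (h2 : ∀ s ∈ w, a s ≤ b s) :
    mw a b w ∈ CC {v | v ∈ FW Q (w.length + 1) ∧
      ∀ s0, (∀ t ∈ w, a s0 ≤ a t ∧ a s0 ≤ b t ∧ a s0 ≤ t) → ∀ t ∈ v, a s0 ≤ t} := by
  induction w with
  | nil => exact zero_mem _
  | cons s w ih =>
    have ih' := ih h.2.2 (fun l t hl hq ht => ha l t (by simp; omega) hq (by simp [ht]))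
      (fun l t hl hq ht => hb l t (by simp; omega) hq (by simp [ht]))
      (fun s hs t ht => haa s (by simp [hs]) t (by simp [ht]))
      (fun s hs t ht => hbb s (by simp [hs]) t (by simp [ht]))
      (fun s hs => h1 s (by simp [hs])) (fun s hs => h2 s (by simp [hs]))
    have hs : ∀ t ∈ s :: w, a s ≤ a t ∧ a s ≤ b t ∧ a s ≤ t := by
      intro t ht
      have hst : s ≤ t := by
        rcases List.mem_cons.1 ht with rfl | ht'
        · exact le_rfl
        · exact h.2.1 t ht'
      have := haa s (by simp) t ht hst
      exact ⟨this, this.trans (h2 t ht), this.trans (h1 t ht)⟩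
    have hQ := ha w.length s (by simp) h.1 (by simp)
    rw [mw]
    refine sub_mem (sub_mem (single_mem_CC ?_ 1) (single_mem_CC ?_ 1)) (CC_map _ (fun v hv => ?_) ih')
    · refine ⟨⟨⟨hQ, fun t ht => (hs t ht).2.2, h⟩, rfl⟩, fun s0 hs0 t ht => ?_⟩
      rcases List.mem_cons.1 ht with rfl | ht
      · exact (hs0 s (by simp)).1
      · exact (hs0 t ht).2.2
    · refine ⟨⟨⟨by simpa using hQ, ?_, FL_map (w := s :: w) b h hb hbb⟩, by simp⟩, fun s0 hs0 t ht => ?_⟩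
      · intro t ht
        rw [← List.map_cons] at ht
        obtain ⟨t0, ht0, e0⟩ := List.mem_map.1 ht
        subst e0
        clear ht
        rename' t0 => t, ht0 => ht
        exact (hs t ht).2.1
      · rcases List.mem_cons.1 ht with rfl | ht
        · exact (hs0 s (by simp)).1
        · rw [← List.map_cons] at ht
          obtain ⟨t0, ht0, e0⟩ := List.mem_map.1 ht
          subst e0
          clear ht
          exact (hs0 t0 ht0).2.1
    · rw [pre_single]
      refine single_mem_CC ?_ 1
      refine ⟨⟨⟨by change Q v.length (a s); rw [hv.1.2]; exact hQ, hv.2 s (fun t ht => hs t (by simp [ht])), hv.1.1⟩, by simp [hv.1.2]⟩, fun s0 hs0 t ht => ?_⟩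
      rcases List.mem_cons.1 ht with rfl | ht
      · exact (hs0 s (by simp)).1
      · exact hv.2 s0 (fun t ht => hs0 t (by simp [ht])) t ht

/-- the inductive step for exactness -/
theorem XX_step {Q : ℕ → α → Prop} {L : ℕ} (hL : 0 < L)
    (hex : ∀ A : Set α, A.Finite → (∀ s ∈ A, ∃ l < L, Q l s) → ∃ (Q' : ℕ → α → Prop) (a b : α → α),
      XX Q' L ∧ (∀ l s, l ≤ L → Q' l s → Q l s) ∧
      (∀ s t, s ≤ t → a s ≤ a t) ∧ (∀ s t, s ≤ t → b s ≤ b t) ∧ (∀ s, a s ≤ s) ∧ (∀ s, a s ≤ b s) ∧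
      ∀ s ∈ A, ∀ l < L, Q l s → Q (l + 1) (a s) ∧ Q l (b s) ∧ Q' l (b s)) : XX Q L := by
  intro x hx
  obtain ⟨Q', a, b, hX, hQQ, haa, hbb, h1, h2, hA⟩ := hex {s | ∃ w ∈ x.support, s ∈ w} (by
      have : {s | ∃ w ∈ x.support, s ∈ w} = ⋃ w ∈ x.support, {s | s ∈ w} := by ext; simp
      rw [this]
      exact x.support.finite_toSet.biUnion fun w _ => w.finite_toSet) (by
      rintro s ⟨w, hw, hs⟩
      have hw' := hx.1 w (by simpa using hw)
      obtain ⟨l, hl, h⟩ := FL_mem hw'.1 hs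
      exact ⟨l, by rw [hw'.2] at hl; exact hl, h⟩)
  have hx' : x ∈ CC {w | w ∈ FW Q L ∧ ∀ s ∈ w, ∀ l < L, Q l s → Q (l + 1) (a s) ∧ Q l (b s) ∧ Q' l (b s)} := by
    intro w hw
    exact ⟨hx.1 w hw, fun s hs => hA s ⟨w, by simpa using hw, hs⟩⟩
  obtain ⟨e0, ej⟩ := mw_main a b L x (CC_mono (S := FW Q L) (fun w hw => hw.2) hx.1) hx.2 hL
  have hbx : mp (List.map b) x ∈ YY Q' L := by
    refine ⟨CC_map (mp (List.map b)) (fun w hw => ?_) hx', fun i hi => ?_⟩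
    · rw [mp_single]
      refine single_mem_CC (S := FW Q' L) ⟨FL_map b hw.1.1 (fun l s hl hq hs => (hw.2 s hs l ?_ hq).2.2) (fun s _ t _ => hbb s t), by simpa using hw.1.2⟩ 1
      rw [← hw.1.2]; exact hl
    · have : ∀ x : List α →₀ ℤ, er i (mp (List.map b) x) = mp (List.map b) (er i x) := by
        intro x
        induction x using Finsupp.induction_linear with
        | zero => simp
        | add x y hx hy => simp only [map_add, hx, hy]
        | single w n => simp [List.eraseIdx_map]
      rw [this, hx.2 i hi, map_zero]
  obtain ⟨y, hy, hye⟩ := hX _ hbx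
  refine ⟨ext1 (mw a b) x + y, add_mem ⟨?_, ?_⟩ ⟨?_, hy.2⟩, ?_⟩
  · refine CC_map _ (fun w hw => ?_) hx'
    rw [ext1_one]
    have := mw_FL a b hw.1.1 (fun l s hl hq hs => (hw.2 s hs l (hw.1.2 ▸ hl) hq).1)
      (fun l s hl hq hs => (hw.2 s hs l (hw.1.2 ▸ hl) hq).2.1) (fun s _ t _ => haa s t)
      (fun s _ t _ => hbb s t) (fun s _ => h1 s) (fun s _ => h2 s)
    rw [hw.1.2] at this
    exact CC_mono (fun v hv => hv.1) this
  · intro i hi hi'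
    obtain ⟨j, rfl⟩ : ∃ j, i = j + 1 := ⟨i - 1, by omega⟩
    exact ej j (by omega)
  · refine CC_mono (S := FW Q' (L + 1)) (T := FW Q (L + 1)) (fun w hw => ⟨FL_mono hw.1 (fun l s hl hq _ => hQQ l s ?_ hq), hw.2⟩) hy.1
    have := hw.2; omega
  · rw [map_add, e0, hye]; abel

/-- exactness when a smallest element can be adjoined -/
theorem XX_min {Q : ℕ → α → Prop} {L : ℕ} (σ : α) (hσ : Q L σ) (hle : ∀ l s, Q l s → σ ≤ s) : XX Q L := by
  intro x hx
  refine ⟨pre [σ] x, ⟨CC_map (pre [σ]) (fun w hw => ?_) hx.1, fun i hi hi' => ?_⟩, er_pre_zero _ _⟩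
  · rw [pre_single]
    refine single_mem_CC (S := FW Q (L + 1)) (w := σ :: w) ⟨⟨by change Q w.length σ; rw [hw.2]; exact hσ, fun t ht => ?_, hw.1⟩, by simp [hw.2]⟩ 1
    obtain ⟨l, _, hl⟩ := FL_mem hw.1 ht
    exact hle l t hl
  · obtain ⟨j, rfl⟩ : ∃ j, i = j + 1 := ⟨i - 1, by omega⟩
    rw [er_pre_succ, hx.2 j (by omega), map_zero]

theorem XX_zero {Q Q' : ℕ → α → Prop} (hX : XX Q' 0) (hQQ : ∀ s, Q' 0 s → Q 0 s) : XX Q 0 := by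
  intro x hx
  obtain ⟨y, hy, e⟩ := hX x ⟨CC_mono (S := FW Q 0) (T := FW Q' 0) (fun w hw => by
    have := List.eq_nil_of_length_eq_zero hw.2
    subst this; exact ⟨trivial, rfl⟩) hx.1, fun i hi => by omega⟩
  refine ⟨y, ⟨CC_mono (S := FW Q' 1) (T := FW Q 1) (fun w hw => ⟨FL_mono hw.1 (fun l s hl hq _ => ?_), hw.2⟩) hy.1, hy.2⟩, e⟩
  have := hw.2
  obtain rfl : l = 0 := by omega
  exact hQQ s hq
end cone
end Stmt3

namespace Stmt3
open Finsupp
set_option linter.all false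
set_option linter.unusedSectionVars false
set_option linter.unusedSimpArgs false
set_option linter.unusedVariables false

section flag
variable {α : Type} [PartialOrder α] {G : Type} [Group G] [MulAction G α]

theorem lrep_er (g : G) (i : ℕ) (x : List α →₀ ℤ) : er i (lrep G α g x) = lrep G α g (er i x) := by
  induction x using Finsupp.induction_linear with
  | zero => simp
  | add x y hx hy => simp only [map_add, hx, hy]
  | single w n => simp [List.eraseIdx_map]

/-- invariance of the data -/
structure QInv (G : Type) [Group G] [MulAction G α] (Q : ℕ → α → Prop) : Prop where
  mono : ∀ (g : G) (s t : α), s ≤ t → g • s ≤ g • t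
  inv : ∀ (g : G) l s, Q l s → Q l (g • s)

theorem FW_inv {Q : ℕ → α → Prop} (h : QInv G Q) (L : ℕ) : WInv G (FW Q L) := by
  intro g w hw
  exact ⟨FL_map _ hw.1 (fun l s _ hq _ => h.inv g l s hq) (fun s _ t _ => h.mono g s t), by simpa using hw.2⟩

theorem EE_inv {Q : ℕ → α → Prop} (h : QInv G Q) (L : ℕ) (g : G) (x : List α →₀ ℤ) (hx : x ∈ EE Q L) :
    lrep G α g x ∈ EE Q L :=
  ⟨CC_inv (FW_inv h L) g x hx.1, fun i hi hi' => by rw [lrep_er, hx.2 i hi hi', map_zero]⟩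

theorem YY_inv {Q : ℕ → α → Prop} (h : QInv G Q) (L : ℕ) (g : G) (x : List α →₀ ℤ) (hx : x ∈ YY Q L) :
    lrep G α g x ∈ YY Q L :=
  ⟨CC_inv (FW_inv h L) g x hx.1, fun i hi => by rw [lrep_er, hx.2 i hi, map_zero]⟩

/-- representation on `EE` -/
noncomputable def eRep {Q : ℕ → α → Prop} (h : QInv G Q) (L : ℕ) : G →* AddMonoid.End (EE Q L) :=
  subRep (lrep G α) (EE Q L) (EE_inv h L)

/-- representation on `YY` -/
noncomputable def yRep {Q : ℕ → α → Prop} (h : QInv G Q) (L : ℕ) : G →* AddMonoid.End (YY Q L) :=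
  subRep (lrep G α) (YY Q L) (YY_inv h L)

/-- exact sequence -/
noncomputable def ySES {Q : ℕ → α → Prop} (h : QInv G Q) {L : ℕ} (hX : XX Q L) :
    SES (yRep h (L + 1)) (eRep h (L + 1)) (yRep h L) where
  f := AddSubgroup.inclusion (YY_le Q (L + 1))
  g := ((er 0).comp (EE Q (L + 1)).subtype).codRestrict (YY Q L) (fun x => er_EE x.2)
  fe _ _ := rfl
  ge g x := Subtype.ext (lrep_er g 0 x.1)
  inj _ _ h := Subtype.ext (congrArg (fun y : EE Q (L + 1) => (y : List α →₀ ℤ)) h)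
  surj z := by
    obtain ⟨y, hy, e⟩ := hX z.1 z.2
    exact ⟨⟨y, hy⟩, Subtype.ext e⟩
  exact b hb := ⟨⟨b.1, b.2.1, fun i hi => by
    cases i with
    | zero => exact congrArg (fun y : YY Q L => (y : List α →₀ ℤ)) hb
    | succ i => exact b.2.2 (i + 1) (by omega) hi⟩, rfl⟩
  gf a := Subtype.ext (a.2.2 0 (by omega))

variable {G' : Type} [Group G'] [MulAction G' α]

theorem lrep_res (φ : G' →* G) (hφ : ∀ g (s : α), φ g • s = g • s) (g : G') (x : List α →₀ ℤ) :
    lrep G' α g x = lrep G α (φ g) x := by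
  induction x using Finsupp.induction_linear with
  | zero => simp
  | add x y hx hy => simp only [map_add, hx, hy]
  | single w n => simp [hφ]

theorem EE_le {Q Q' : ℕ → α → Prop} (hQ : ∀ l s, Q' l s → Q l s) (L : ℕ) : EE Q' L ≤ EE Q L :=
  fun x hx => ⟨CC_mono (S := FW Q' L) (T := FW Q L) (fun w hw => ⟨FL_mono hw.1 (fun l s _ h _ => hQ l s h), hw.2⟩) hx.1, hx.2⟩

theorem YY_le' {Q Q' : ℕ → α → Prop} (hQ : ∀ l s, Q' l s → Q l s) (L : ℕ) : YY Q' L ≤ YY Q L :=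
  fun x hx => ⟨CC_mono (S := FW Q' L) (T := FW Q L) (fun w hw => ⟨FL_mono hw.1 (fun l s _ h _ => hQ l s h), hw.2⟩) hx.1, hx.2⟩

/-- inclusion of complexes -/
noncomputable def eInc {Q Q' : ℕ → α → Prop} (h : QInv G Q) (h' : QInv G' Q') (hQ : ∀ l s, Q' l s → Q l s)
    (φ : G' →* G) (hφ : ∀ g (s : α), φ g • s = g • s) (L : ℕ) : RMor (eRep h' L) (eRep h L) where
  φ := φ
  f := AddSubgroup.inclusion (EE_le hQ L)
  comm g m := Subtype.ext (lrep_res φ hφ g m.1)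

/-- inclusion of complexes -/
noncomputable def yInc {Q Q' : ℕ → α → Prop} (h : QInv G Q) (h' : QInv G' Q') (hQ : ∀ l s, Q' l s → Q l s)
    (φ : G' →* G) (hφ : ∀ g (s : α), φ g • s = g • s) (L : ℕ) : RMor (yRep h' L) (yRep h L) where
  φ := φ
  f := AddSubgroup.inclusion (YY_le' hQ L)
  comm g m := Subtype.ext (lrep_res φ hφ g m.1)

theorem nil_YY (Q : ℕ → α → Prop) : single ([] : List α) (1 : ℤ) ∈ YY Q 0 :=
  ⟨single_mem_CC (S := FW Q 0) (w := []) ⟨trivial, rfl⟩ 1, fun i hi => by omega⟩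

/-- degree zero -/
noncomputable def nilMor {Q : ℕ → α → Prop} (h : QInv G Q) : RMor (1 : G →* AddMonoid.End ℤ) (yRep h 0) :=
  fixMor (MonoidHom.id G) ⟨single [] 1, nil_YY Q⟩ (fun p => Subtype.ext (by
    change lrep G α p (single [] 1) = _; rw [lrep_single]; rfl))

theorem nilMor_bij {Q : ℕ → α → Prop} (h : QInv G Q) (i : ℕ) : Function.Bijective (Hmap (nilMor h) i) := by
  refine Hmap_bij _ Function.bijective_id ⟨?_, ?_⟩ i
  · intro m n e
    have e1 : (m • single ([] : List α) (1 : ℤ)) [] = (n • single ([] : List α) (1 : ℤ)) [] :=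
      congrArg (fun y : YY Q 0 => (y : List α →₀ ℤ) []) e
    simpa using e1
  · intro y
    refine ⟨y.1 [], Subtype.ext ?_⟩
    change y.1 [] • single ([] : List α) (1 : ℤ) = y.1
    ext w
    by_cases hw : w = []
    · subst hw; simp
    · have : y.1 w = 0 := by
        by_contra hne
        exact hw (List.eq_nil_of_length_eq_zero (y.2.1 w hne).2)
      rw [this]
      simp [Ne.symm hw]

theorem flag_conn {Q Q' : ℕ → α → Prop} (h : QInv G Q) (h' : QInv G' Q') (hQ : ∀ l s, Q' l s → Q l s)
    (φ : G' →* G) (hφ : ∀ g (s : α), φ g • s = g • s) (n : ℕ) (hX : ∀ L < n, XX Q L) (hX' : ∀ L < n, XX Q' L)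
    (hc : ∀ L < n, Conn (eInc h h' hQ φ hφ (L + 1)) (n - L)) : Conn (triv φ) n := by
  have key : ∀ m ≤ n, Conn (yInc h h' hQ φ hφ (n - m)) m := by
    intro m
    induction m with
    | zero => intro _; exact ⟨fun i hi => by omega, fun i hi => by omega⟩
    | succ m ih =>
      intro hm
      have hL : n - (m + 1) < n := by omega
      have e : n - m = n - (m + 1) + 1 := by omega
      let M : (ySES h' (hX' _ hL)).Mor (ySES h (hX _ hL)) :=
        { a := yInc h h' hQ φ hφ (n - (m + 1) + 1)
          b := eInc h h' hQ φ hφ (n - (m + 1) + 1)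
          c := yInc h h' hQ φ hφ (n - (m + 1))
          hφa := fun _ => rfl
          hφc := fun _ => rfl
          hf := fun _ => rfl
          hg := fun _ => rfl }
      have h1 := ih (by omega)
      rw [e] at h1
      have h2 := hc _ hL
      rw [show n - (n - (m + 1)) = m + 1 by omega] at h2
      exact Conn.ses M h1 h2
  have h0 := key n le_rfl
  rw [Nat.sub_self] at h0
  exact (Conn.sq (a := triv φ) (b := yInc h h' hQ φ hφ 0) (nilMor h') (nilMor h) (fun _ => rfl)
    (fun m => Subtype.ext rfl) (nilMor_bij h') (nilMor_bij h) n).2 h0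

/-- fibre over a bottom letter -/
noncomputable def NN (Q : ℕ → α → Prop) (L : ℕ) (s : α) : AddSubgroup (List α →₀ ℤ) :=
  EE Q L ⊓ CC {w | w.head? = some s}

open Classical in
/-- restriction to words with given head -/
noncomputable def hd (s : α) : (List α →₀ ℤ) →+ (List α →₀ ℤ) :=
  ext1 fun w => if w.head? = some s then single w 1 else 0

open Classical in
theorem hd_single (s : α) (w : List α) (n : ℤ) :
    hd s (single w n) = if w.head? = some s then single w n else 0 := by
  rw [hd, ext1_single]; split_ifs <;> simp

theorem hd_apply (s : α) (x : List α →₀ ℤ) (w : List α) [Decidable (w.head? = some s)] :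
    hd s x w = if w.head? = some s then x w else 0 := by
  classical
  induction x using Finsupp.induction_linear with
  | zero => simp
  | add x y hx hy => simp only [map_add, Finsupp.add_apply, hx, hy]; split_ifs <;> simp
  | single v n =>
    rw [hd_single]
    by_cases hv : v = w
    · subst hv; split_ifs <;> simp
    · split_ifs <;> simp [single_apply, hv]

theorem hd_er (s : α) (i : ℕ) (x : List α →₀ ℤ) : hd s (er (i + 1) x) = er (i + 1) (hd s x) := by
  classical
  induction x using Finsupp.induction_linear with
  | zero => simp
  | add x y hx hy => simp only [map_add, hx, hy]
  | single w n =>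
    cases w with
    | nil => simp [hd_single]
    | cons t w => simp only [er_single, hd_single, List.eraseIdx_cons_succ, List.head?_cons]; by_cases e : t = s <;> simp [e]

theorem hd_mem {Q : ℕ → α → Prop} {L : ℕ} (s : α) {x : List α →₀ ℤ} (hx : x ∈ EE Q L) : hd s x ∈ NN Q L s := by
  classical
  refine ⟨⟨fun w hw => ?_, fun i hi hi' => ?_⟩, fun w hw => ?_⟩
  · rw [hd_apply] at hw
    split_ifs at hw
    · exact hx.1 w hw
    · exact absurd rfl hw
  · obtain ⟨j, rfl⟩ : ∃ j, i = j + 1 := ⟨i - 1, by omega⟩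
    rw [← hd_er, hx.2 _ hi hi', map_zero]
  · rw [hd_apply] at hw
    split_ifs at hw with h
    · exact h
    · exact absurd rfl hw

theorem hd_eq {s : α} {x : List α →₀ ℤ} (hx : x ∈ CC {w : List α | w.head? = some s}) : hd s x = x := by
  classical
  ext w
  rw [hd_apply]
  split_ifs with h
  · rfl
  · by_contra hne; exact h (hx w (fun e => hne e.symm))

theorem hd_zero {s t : α} (hst : s ≠ t) {x : List α →₀ ℤ} (hx : x ∈ CC {w : List α | w.head? = some t}) :
    hd s x = 0 := by
  classical
  ext w
  rw [hd_apply]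
  split_ifs with h
  · by_contra hne
    have := hx w hne
    exact hst (Option.some.inj (h.symm.trans this))
  · rfl

theorem lrep_head (g : G) {s : α} {x : List α →₀ ℤ} (hx : x ∈ CC {w : List α | w.head? = some s}) :
    lrep G α g x ∈ CC {w : List α | w.head? = some (g • s)} := by
  refine CC_map (S := {w : List α | w.head? = some s}) (lrep G α g) (fun w hw => ?_) hx
  have e : lrep G α g (single w 1) ∈ CC {w : List α | w.head? = some (g • s)} := by
    rw [lrep_single]
    refine single_mem_CC (S := {w : List α | w.head? = some (g • s)}) ?_ 1
    have hw' : w.head? = some s := hw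
    change (w.map _).head? = _
    rw [List.head?_map, hw']; rfl
  exact e

/-- representation of the stabilizer on the fibre -/
noncomputable def nRep {Q : ℕ → α → Prop} (h : QInv G Q) (L : ℕ) (s : α) :
    MulAction.stabilizer G s →* AddMonoid.End (NN Q L s) :=
  subRep ((lrep G α).comp (MulAction.stabilizer G s).subtype) (NN Q L s) (fun g m hm =>
    ⟨EE_inv h L g.1 m hm.1, by
      have := lrep_head g.1 hm.2
      rwa [show g.1 • s = s from g.2] at this⟩)

/-- Shapiro morphism -/
noncomputable def nMor {Q : ℕ → α → Prop} (h : QInv G Q) (L : ℕ) (s : α) : RMor (nRep h L s) (eRep h L) where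
  φ := (MulAction.stabilizer G s).subtype
  f := AddSubgroup.inclusion inf_le_left
  comm g m := rfl

theorem nMor_sh {Q : ℕ → α → Prop} (h : QInv G Q) (L : ℕ) (s : α)
    (htr : ∀ t, Q L t → ∃ g : G, g • s = t) :
    Sh (nMor h (L + 1) s) (((hd s).comp (EE Q (L + 1)).subtype).codRestrict (NN Q (L + 1) s) (fun x => hd_mem s x.2)) where
  inj := Subtype.val_injective
  rj n := Subtype.ext (hd_eq n.2.2)
  r0 g hg n := by
    refine Subtype.ext ?_
    change hd s (lrep G α g n.1) = 0
    refine hd_zero (t := g • s) ?_ (lrep_head g n.2.2)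
    intro e
    exact hg ⟨⟨g, e.symm⟩, rfl⟩
  gen m := by
    classical
    set C := AddSubgroup.closure {m | ∃ g n, m = (eRep h (L + 1) g) ((nMor h (L + 1) s).f n)} with hC
    have h1 : ∀ t, (⟨hd t m.1, (hd_mem t m.2).1⟩ : EE Q (L + 1)) ∈ C := by
      intro t
      by_cases h0 : hd t m.1 = 0
      · have : (⟨hd t m.1, (hd_mem t m.2).1⟩ : EE Q (L + 1)) = 0 := Subtype.ext h0
        rw [this]; exact zero_mem _
      · obtain ⟨w, hw⟩ := Finsupp.ne_iff.1 h0
        have hm := hd_mem t m.2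
        have hw1 := hm.1.1 w hw
        have hw2 : w.head? = some t := hm.2 w hw
        have hQt : Q L t := by
          match w, hw1, hw2 with
          | t' :: v, hw1, hw2 =>
            obtain rfl : t' = t := by simpa using hw2
            have h3 := hw1.1.1
            rwa [show v.length = L by simpa using hw1.2] at h3
        obtain ⟨g, rfl⟩ := htr t hQt
        have hn := lrep_head g⁻¹ hm.2
        rw [inv_smul_smul] at hn
        refine AddSubgroup.subset_closure ⟨g, ⟨lrep G α g⁻¹ (hd (g • s) m.1), EE_inv h _ _ _ hm.1, hn⟩, Subtype.ext ?_⟩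
        exact (rep_inv' (lrep G α) g _).symm
    have h2 : m = ∑ t ∈ m.1.support.image List.head?, (match t with
        | Option.none => 0
        | Option.some t => (⟨hd t m.1, (hd_mem t m.2).1⟩ : EE Q (L + 1))) := by
      refine Subtype.ext (Finsupp.ext fun w => ?_)
      rw [AddSubgroup.val_finsetSum, Finsupp.finset_sum_apply]
      by_cases hw : m.1 w = 0
      · rw [hw]
        refine (Finset.sum_eq_zero fun t _ => ?_).symm
        cases t with
        | none => rfl
        | some t => change hd t m.1 w = 0; rw [hd_apply, hw]; simp
      · rw [Finset.sum_eq_single w.head?]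
        · have := (m.2.1 w hw).2
          match w, this with
          | t :: w, _ => change _ = hd t m.1 (t :: w); rw [hd_apply]; simp
        · intro t _ ht
          cases t with
          | none => rfl
          | some t => change hd t m.1 w = 0; rw [hd_apply, if_neg (Ne.symm ht)]
        · intro hne
          exact absurd (Finset.mem_image.2 ⟨w, by simpa using hw, rfl⟩) hne
    rw [h2]
    refine sum_mem fun t _ => ?_
    cases t with
    | none => exact zero_mem _
    | some t => exact h1 t

/-- map of stabilizers -/
def stMap (φ : G' →* G) (hφ : ∀ g (s : α), φ g • s = g • s) (s : α) :
    MulAction.stabilizer G' s →* MulAction.stabilizer G s :=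
  (φ.comp (MulAction.stabilizer G' s).subtype).codRestrict _ (fun g => (hφ g.1 s).trans g.2)

/-- map of fibres -/
noncomputable def nInc {Q Q' : ℕ → α → Prop} (h : QInv G Q) (h' : QInv G' Q') (hQ : ∀ l s, Q' l s → Q l s)
    (φ : G' →* G) (hφ : ∀ g (s : α), φ g • s = g • s) (L : ℕ) (s : α) :
    RMor (nRep h' L s) (nRep h L s) where
  φ := stMap φ hφ s
  f := AddSubgroup.inclusion (inf_le_inf_right _ (EE_le hQ L))
  comm g m := Subtype.ext (lrep_res φ hφ g.1 m.1)

theorem eInc_conn {Q Q' : ℕ → α → Prop} (h : QInv G Q) (h' : QInv G' Q') (hQ : ∀ l s, Q' l s → Q l s)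
    (φ : G' →* G) (hφ : ∀ g (s : α), φ g • s = g • s) (L : ℕ) (s : α)
    (htr : ∀ t, Q L t → ∃ g : G, g • s = t) (htr' : ∀ t, Q' L t → ∃ g : G', g • s = t)
    (hN : ∀ l t, s ≤ t → Q l t → Q' l t) {c : ℕ}
    (hc : Conn (resMor (stMap φ hφ s) (nRep h (L + 1) s)) c) :
    Conn (eInc h h' hQ φ hφ (L + 1)) c := by
  let ν := nInc h h' hQ φ hφ (L + 1) s
  have hν : Function.Bijective ν.f := by
    refine ⟨AddSubgroup.inclusion_injective (inf_le_inf_right _ (EE_le hQ (L + 1))), fun x => ?_⟩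
    refine ⟨⟨x.1, ⟨fun w hw => ?_, x.2.1.2⟩, x.2.2⟩, rfl⟩
    have h1 := x.2.1.1 w hw
    have h2 : w.head? = some s := x.2.2 w hw
    refine ⟨FL_mono h1.1 (fun l t _ hq ht => hN l t ?_ hq), h1.2⟩
    match w, h1, h2 with
    | s' :: v, h1, h2 =>
      obtain rfl : s' = s := by simpa using h2
      rcases List.mem_cons.1 ht with rfl | ht
      · exact le_rfl
      · exact h1.1.2.1 t ht
  have h1 : Conn ν c := Conn.of_res ν hν hc
  exact (Conn.sq (a := ν) (b := eInc h h' hQ φ hφ (L + 1)) (nMor h' (L + 1) s) (nMor h (L + 1) s)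
    (fun _ => rfl) (fun _ => rfl) (nMor_sh h' L s htr').bij (nMor_sh h L s htr).bij c).1 h1
end flag
end Stmt3

namespace Stmt3
open Finsupp
set_option linter.all false
set_option linter.unusedSectionVars false
set_option linter.unusedSimpArgs false
set_option linter.unusedVariables false
open scoped Pointwise

section pairs
variable {D V : Type} [Field D] [AddCommGroup V] [Module D V] [FiniteDimensional D V] (B : V →ₗ[D] V →ₗ[D] D)

/-- dual pairs of isotropic subspaces -/
structure IsPr (s : Submodule D V × Submodule D V) (d : ℕ) : Prop where
  iso1 : ∀ x ∈ s.1, ∀ y ∈ s.1, B x y = 0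
  iso2 : ∀ x ∈ s.2, ∀ y ∈ s.2, B x y = 0
  nd1 : ∀ x ∈ s.1, (∀ y ∈ s.2, B x y = 0) → x = 0
  nd2 : ∀ y ∈ s.2, (∀ x ∈ s.1, B x y = 0) → y = 0
  dim : Module.finrank D s.1 = d

variable {B}
variable {s : Submodule D V × Submodule D V} {d : ℕ}

theorem IsPr.rank_le (h : IsPr B s d) : Module.finrank D s.1 ≤ Module.finrank D s.2 := by
  let f : s.1 →ₗ[D] Module.Dual D s.2 := (LinearMap.lcomp D D s.2.subtype).comp (B.comp s.1.subtype)
  have hf : Function.Injective f := by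
    rw [injective_iff_map_eq_zero]
    intro x hx
    exact Subtype.ext (h.nd1 x.1 x.2 (fun y hy => LinearMap.congr_fun hx ⟨y, hy⟩))
  have := LinearMap.finrank_le_finrank_of_injective hf
  rwa [Subspace.dual_finrank_eq] at this

theorem IsPr.rank_le' (h : IsPr B s d) : Module.finrank D s.2 ≤ Module.finrank D s.1 := by
  let f : s.2 →ₗ[D] Module.Dual D s.1 := (LinearMap.lcomp D D s.1.subtype).comp (B.flip.comp s.2.subtype)
  have hf : Function.Injective f := by
    rw [injective_iff_map_eq_zero]
    intro x hx
    exact Subtype.ext (h.nd2 x.1 x.2 (fun y hy => LinearMap.congr_fun hx ⟨y, hy⟩))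
  have := LinearMap.finrank_le_finrank_of_injective hf
  rwa [Subspace.dual_finrank_eq] at this

theorem IsPr.dim2 (h : IsPr B s d) : Module.finrank D s.2 = d :=
  (le_antisymm h.rank_le' h.rank_le).trans h.dim

theorem IsPr.swap (hB : ∀ x y, B x y = B y x) (h : IsPr B s d) : IsPr B s.swap d where
  iso1 := h.iso2
  iso2 := h.iso1
  nd1 x hx h' := h.nd2 x hx (fun y hy => by rw [hB]; exact h' y hy)
  nd2 x hx h' := h.nd1 x hx (fun y hy => by rw [hB]; exact h' y hy)
  dim := h.dim2

/-- linear representation of functionals -/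
theorem IsPr.repr (h : IsPr B s d) : ∃ P : Module.Dual D s.2 →ₗ[D] V, ∀ ψ, P ψ ∈ s.1 ∧ ∀ y : s.2, B (P ψ) y.1 = ψ y := by
  let f : s.1 →ₗ[D] Module.Dual D s.2 := (LinearMap.lcomp D D s.2.subtype).comp (B.comp s.1.subtype)
  have hf : Function.Injective f := by
    rw [injective_iff_map_eq_zero]
    intro x hx
    exact Subtype.ext (h.nd1 x.1 x.2 (fun y hy => LinearMap.congr_fun hx ⟨y, hy⟩))
  have hs : Function.Surjective f :=
    (LinearMap.injective_iff_surjective_of_finrank_eq_finrank (by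
      rw [Subspace.dual_finrank_eq, h.dim, h.dim2])).1 hf
  let e := LinearEquiv.ofBijective f ⟨hf, hs⟩
  refine ⟨s.1.subtype.comp e.symm.toLinearMap, fun ψ => ⟨(e.symm ψ).2, fun y => ?_⟩⟩
  exact LinearMap.congr_fun (e.apply_symm_apply ψ) y

/-- projection -/
theorem IsPr.proj (h : IsPr B s d) : ∃ P : V →ₗ[D] V, ∀ v, P v ∈ s.1 ∧ ∀ y ∈ s.2, B (P v) y = B v y := by
  obtain ⟨P, hP⟩ := h.repr
  refine ⟨P.comp ((LinearMap.lcomp D D s.2.subtype).comp B), fun v => ⟨(hP _).1, fun y hy => ?_⟩⟩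
  exact (hP _).2 ⟨y, hy⟩

/-- kernel of pairing with a vector -/
def kr (B : V →ₗ[D] V →ₗ[D] D) (u : V) : Submodule D V := LinearMap.ker (B u)

theorem mem_kr {u x : V} : x ∈ kr B u ↔ B u x = 0 := LinearMap.mem_ker

theorem finrank_cut {F : Submodule D V} {u e : V} (he : e ∈ F) (hu : B u e ≠ 0) :
    Module.finrank D (F ⊓ kr B u : Submodule D V) + 1 = Module.finrank D F := by
  have h1 := LinearMap.finrank_range_add_finrank_ker ((B u).comp F.subtype)
  have h2 : Module.finrank D (LinearMap.range ((B u).comp F.subtype)) = 1 := by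
    rw [LinearMap.range_eq_top.2, finrank_top, Module.finrank_self]
    exact LinearMap.surjective (f := (B u).comp F.subtype) (fun h => hu (LinearMap.congr_fun h ⟨e, he⟩))
  have h3 : Module.finrank D (LinearMap.ker ((B u).comp F.subtype)) = Module.finrank D (F ⊓ kr B u : Submodule D V) := by
    rw [LinearEquiv.finrank_eq (Submodule.equivSubtypeMap F (LinearMap.ker ((B u).comp F.subtype)))]
    have h4 : Submodule.map F.subtype (LinearMap.ker ((B u).comp F.subtype)) = F ⊓ kr B u := ?_
    · rw [h4]
    ext x
    simp only [Submodule.mem_map, Submodule.mem_inf, mem_kr, LinearMap.mem_ker]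
    constructor
    · rintro ⟨y, hy, rfl⟩; exact ⟨y.2, hy⟩
    · rintro ⟨h1, h2⟩; exact ⟨⟨x, h1⟩, h2, rfl⟩
  omega

/-- cutting down a pair; `u`, `u'` are represented by `p'`, `p` -/
theorem IsPr.cut (hB : ∀ x y, B x y = B y x) (h : IsPr B s (d + 1)) {u u' p p' : V} (hp : p ∈ s.1) (hp' : p' ∈ s.2)
    (h1 : ∀ x ∈ s.1, B u x = B p' x) (h2 : ∀ y ∈ s.2, B u' y = B p y) (hne : B p p' ≠ 0) :
    IsPr B (s.1 ⊓ kr B u, s.2 ⊓ kr B u') d where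
  iso1 x hx y hy := h.iso1 x hx.1 y hy.1
  iso2 x hx y hy := h.iso2 x hx.1 y hy.1
  nd1 x hx h' := by
    refine h.nd1 x hx.1 fun y hy => ?_
    have hx2 : B p' x = 0 := by rw [← h1 x hx.1]; exact hx.2
    have := h' (y - (B p y / B p p') • p') ⟨sub_mem hy (Submodule.smul_mem _ _ hp'), by
      change B u' _ = 0
      rw [h2 _ (sub_mem hy (Submodule.smul_mem _ _ hp')), map_sub, map_smul, smul_eq_mul, div_mul_cancel₀ _ hne, sub_self]⟩
    rwa [map_sub, map_smul, hB x p', hx2, smul_zero, sub_zero] at this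
  nd2 y hy h' := by
    refine h.nd2 y hy.1 fun x hx => ?_
    have hy2 : B p y = 0 := by rw [← h2 y hy.1]; exact hy.2
    have := h' (x - (B p' x / B p p') • p) ⟨sub_mem hx (Submodule.smul_mem _ _ hp), by
      change B u _ = 0
      rw [h1 _ (sub_mem hx (Submodule.smul_mem _ _ hp)), map_sub, map_smul, smul_eq_mul, hB p' p, div_mul_cancel₀ _ hne, sub_self]⟩
    rw [map_sub, map_smul, LinearMap.sub_apply, LinearMap.smul_apply, hy2, smul_zero, sub_zero] at this
    exact this
  dim := by
    have := finrank_cut (B := B) (u := u) hp (by rw [h1 p hp, hB]; exact hne)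
    have h3 := h.dim
    change Module.finrank D (s.1 ⊓ kr B u : Submodule D V) = d
    omega

theorem finrank_add {F : Submodule D V} {e : V} (he : e ∉ F) :
    Module.finrank D (F ⊔ Submodule.span D {e} : Submodule D V) = Module.finrank D F + 1 := by
  have h1 := Submodule.finrank_sup_add_finrank_inf_eq F (Submodule.span D {e})
  have h2 : F ⊓ Submodule.span D {e} = ⊥ := by
    rw [eq_bot_iff]
    rintro x ⟨hx, hx'⟩
    obtain ⟨c, rfl⟩ := Submodule.mem_span_singleton.1 hx'
    by_cases hc : c = 0
    · simp [hc]
    · exact absurd (by simpa [smul_smul, hc] using F.smul_mem c⁻¹ hx) he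
  have h3 : e ≠ 0 := fun h => he (by rw [h]; exact zero_mem _)
  rw [h2, finrank_bot, finrank_span_singleton (K := D) h3] at h1
  omega

theorem mem_sup_span {F : Submodule D V} {e x : V} (h : x ∈ F ⊔ Submodule.span D {e}) :
    ∃ y ∈ F, ∃ c : D, x = y + c • e := by
  obtain ⟨y, hy, z, hz, rfl⟩ := Submodule.mem_sup.1 h
  obtain ⟨c, rfl⟩ := Submodule.mem_span_singleton.1 hz
  exact ⟨y, hy, c, rfl⟩

theorem IsPr.add (hB : ∀ x y, B x y = B y x) (h : IsPr B s d) {e f : V} (hee : B e e = 0) (hff : B f f = 0) (hef : B e f ≠ 0)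
    (e1 : ∀ x ∈ s.1, B x e = 0) (e2 : ∀ x ∈ s.2, B x e = 0) (f1 : ∀ x ∈ s.1, B x f = 0) (f2 : ∀ x ∈ s.2, B x f = 0) :
    IsPr B (s.1 ⊔ Submodule.span D {e}, s.2 ⊔ Submodule.span D {f}) (d + 1) where
  iso1 x hx0 y hy0 := by
    obtain ⟨x, hx, c, rfl⟩ := mem_sup_span hx0
    obtain ⟨y, hy, c', rfl⟩ := mem_sup_span hy0
    simp [h.iso1 x hx y hy, e1 x hx, hB e y, e1 y hy, hee]
  iso2 x hx0 y hy0 := by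
    obtain ⟨x, hx, c, rfl⟩ := mem_sup_span hx0
    obtain ⟨y, hy, c', rfl⟩ := mem_sup_span hy0
    simp [h.iso2 x hx y hy, f2 x hx, hB f y, f2 y hy, hff]
  nd1 x hx0 h' := by
    obtain ⟨x, hx, c, rfl⟩ := mem_sup_span hx0
    have hc := h' f (Submodule.mem_sup_right (Submodule.mem_span_singleton_self f))
    simp [f1 x hx, hef] at hc
    subst hc
    simp only [zero_smul, add_zero] at h' ⊢
    exact h.nd1 x hx (fun y hy => h' y (Submodule.mem_sup_left hy))
  nd2 x hx0 h' := by
    obtain ⟨x, hx, c, rfl⟩ := mem_sup_span hx0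
    have hc := h' e (Submodule.mem_sup_right (Submodule.mem_span_singleton_self e))
    simp [hB e x, e2 x hx, hef] at hc
    subst hc
    simp only [zero_smul, add_zero] at h' ⊢
    exact h.nd2 x hx (fun y hy => h' y (Submodule.mem_sup_left hy))
  dim := by
    rw [finrank_add, h.dim]
    intro he
    exact hef (f1 e he)

theorem isPr_bot : IsPr B ((⊥ : Submodule D V), (⊥ : Submodule D V)) 0 where
  iso1 x hx y hy := by rw [(Submodule.mem_bot D).1 hx]; simp
  iso2 x hx y hy := by rw [(Submodule.mem_bot D).1 hx]; simp
  nd1 x hx _ := (Submodule.mem_bot D).1 hx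
  nd2 x hx _ := (Submodule.mem_bot D).1 hx
  dim := finrank_bot D V

/-- the pair spanned by a word -/
def fsp (D : Type) {V : Type} [Field D] [AddCommGroup V] [Module D V] : List (V × V) → Submodule D V × Submodule D V
  | [] => (⊥, ⊥)
  | a :: w => ((fsp D w).1 ⊔ Submodule.span D {a.1}, (fsp D w).2 ⊔ Submodule.span D {a.2})

theorem fsp_le {w : List (V × V)} {s : Submodule D V × Submodule D V} : fsp D w ≤ s ↔ ∀ a ∈ w, a.1 ∈ s.1 ∧ a.2 ∈ s.2 := by
  induction w with
  | nil => simp [fsp, Prod.le_def]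
  | cons a w ih =>
    rw [Prod.le_def] at ih ⊢
    simp only [fsp, sup_le_iff, Submodule.span_singleton_le_iff_mem, List.forall_mem_cons, ← ih]
    tauto

theorem mem_fsp {w : List (V × V)} {a : V × V} (ha : a ∈ w) : a.1 ∈ (fsp D w).1 ∧ a.2 ∈ (fsp D w).2 :=
  fsp_le.1 le_rfl a ha

theorem mem_perp_fsp (hB : ∀ x y, B x y = B y x) {w : List (V × V)} {t : V} :
    t ∈ perp B w ↔ (∀ x ∈ (fsp D w).1, B x t = 0) ∧ ∀ x ∈ (fsp D w).2, B x t = 0 := by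
  constructor
  · intro h
    have := (fsp_le (w := w) (s := (kr B t, kr B t))).2 (fun a ha => ⟨by
      rw [mem_kr, hB]; exact (h a ha).1, by rw [mem_kr, hB]; exact (h a ha).2⟩)
    exact ⟨fun x hx => by rw [hB]; exact this.1 hx, fun x hx => by rw [hB]; exact this.2 hx⟩
  · intro h a ha
    exact ⟨h.1 _ (mem_fsp ha).1, h.2 _ (mem_fsp ha).2⟩

theorem fsp_isPr (hB : ∀ x y, B x y = B y x) : ∀ {d : ℕ} {w : List (V × V)} (hw : w ∈ WW (OR B) (HL B ⊤) d),
    IsPr B (fsp D w) d := by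
  intro d
  induction d with
  | zero =>
    intro w hw
    obtain rfl := List.eq_nil_of_length_eq_zero hw.2.2
    exact isPr_bot
  | succ d ih =>
    intro w hw
    match w, hw with
    | a :: w, hw =>
      have hp := List.pairwise_cons.1 hw.1
      have ha := (hw.2.1 a (by simp)).1
      have h := ih (w := w) ⟨hp.2, fun b hb => hw.2.1 b (by simp [hb]), by simpa using hw.2.2⟩
      have h1 : a.1 ∈ perp B w := fun b hb => by
        have := OR_symm hB (hp.1 b hb); exact ⟨this.1, this.2.2.1⟩
      have h2 : a.2 ∈ perp B w := fun b hb => by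
        have := OR_symm hB (hp.1 b hb); exact ⟨this.2.1, this.2.2.2⟩
      rw [mem_perp_fsp hB] at h1 h2
      exact h.add hB ha.1 ha.2.1 (by rw [ha.2.2]; exact one_ne_zero) h1.1 h1.2 h2.1 h2.2

theorem IsPr.cut_hp (hB : ∀ x y, B x y = B y x) (h : IsPr B s (d + 1)) {a : V × V} (ha : HP B a) (h1 : a.1 ∈ s.1) (h2 : a.2 ∈ s.2) :
    IsPr B (s.1 ⊓ kr B a.2, s.2 ⊓ kr B a.1) d ∧
      ((s.1 ⊓ kr B a.2) ⊔ Submodule.span D {a.1}, (s.2 ⊓ kr B a.1) ⊔ Submodule.span D {a.2}) = s := by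
  refine ⟨h.cut hB h1 h2 (fun _ _ => rfl) (fun _ _ => rfl) (by rw [ha.2.2]; exact one_ne_zero), ?_⟩
  refine Prod.ext (le_antisymm (sup_le inf_le_left (by simpa using h1)) fun x hx => ?_)
    (le_antisymm (sup_le inf_le_left (by simpa using h2)) fun x hx => ?_)
  · rw [← sub_add_cancel x (B a.2 x • a.1)]
    refine add_mem (Submodule.mem_sup_left ⟨sub_mem hx (Submodule.smul_mem _ _ h1), ?_⟩)
      (Submodule.mem_sup_right (Submodule.smul_mem _ _ (Submodule.mem_span_singleton_self _)))
    change B a.2 _ = 0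
    rw [map_sub, map_smul, hB a.2 a.1, ha.2.2]; simp
  · rw [← sub_add_cancel x (B a.1 x • a.2)]
    refine add_mem (Submodule.mem_sup_left ⟨sub_mem hx (Submodule.smul_mem _ _ h2), ?_⟩)
      (Submodule.mem_sup_right (Submodule.smul_mem _ _ (Submodule.mem_span_singleton_self _)))
    change B a.1 _ = 0
    rw [map_sub, map_smul, ha.2.2]; simp

theorem IsPr.cons_word (hB : ∀ x y, B x y = B y x) (h : IsPr B s (d + 1)) {a : V × V} (ha : HP B a) (h1 : a.1 ∈ s.1) (h2 : a.2 ∈ s.2)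
    {u : List (V × V)} (hu : u ∈ WW (OR B) (HL B ⊤) d) (hf : fsp D u = (s.1 ⊓ kr B a.2, s.2 ⊓ kr B a.1)) :
    u ∈ SW B [a] d ∧ fsp D (a :: u) = s := by
  refine ⟨⟨hu.1, fun b hb => ⟨(hu.2.1 b hb).1, ?_, ?_⟩, hu.2.2⟩, ?_⟩
  · have := (mem_fsp (D := D) hb).1
    rw [hf] at this
    intro c hc
    rw [List.mem_singleton.1 hc]
    exact ⟨h.iso1 _ h1 _ this.1, this.2⟩
  · have := (mem_fsp (D := D) hb).2
    rw [hf] at this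
    intro c hc
    rw [List.mem_singleton.1 hc]
    exact ⟨this.2, h.iso2 _ h2 _ this.1⟩
  · rw [fsp, hf]
    exact (h.cut_hp hB ha h1 h2).2

theorem SW_cons1 (hB : ∀ x y, B x y = B y x) {a : V × V} (ha : HP B a) {u : List (V × V)} (hu : u ∈ SW B [a] d) :
    a :: u ∈ WW (OR B) (HL B ⊤) (d + 1) := by
  refine ⟨List.pairwise_cons.2 ⟨fun b hb => ?_, hu.1⟩, fun b hb => ?_, by simp [hu.2.2]⟩
  · have := hu.2.1 b hb
    have h1 := this.2.1 a (by simp)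
    have h2 := this.2.2 a (by simp)
    exact ⟨h1.1, h2.1, h1.2, h2.2⟩
  · rcases List.mem_cons.1 hb with rfl | hb
    · exact ⟨ha, trivial, trivial⟩
    · exact ⟨(hu.2.1 b hb).1, trivial, trivial⟩

theorem IsPr.exists_hp (h : IsPr B s (d + 1)) : ∃ a : V × V, HP B a ∧ a.1 ∈ s.1 ∧ a.2 ∈ s.2 := by
  have : s.1 ≠ ⊥ := by
    intro e
    have := h.dim
    rw [e, finrank_bot] at this
    omega
  obtain ⟨e, he, hne⟩ := Submodule.exists_mem_ne_zero_of_ne_bot this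
  obtain ⟨f, hf, hef⟩ : ∃ f ∈ s.2, B e f ≠ 0 := by
    by_contra hcon
    push Not at hcon
    exact hne (h.nd1 e he hcon)
  refine ⟨(e, (B e f)⁻¹ • f), ⟨h.iso1 e he e he, ?_, ?_⟩, he, Submodule.smul_mem _ _ hf⟩
  · exact h.iso2 _ (Submodule.smul_mem _ _ hf) _ (Submodule.smul_mem _ _ hf)
  · simp [hef]

/-- every pair is spanned by a word -/
theorem IsPr.word (hB : ∀ x y, B x y = B y x) : ∀ {d : ℕ} {s : Submodule D V × Submodule D V} (h : IsPr B s d),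
    ∃ w ∈ WW (OR B) (HL B ⊤) d, fsp D w = s := by
  intro d
  induction d with
  | zero =>
    intro s h
    refine ⟨[], ⟨List.Pairwise.nil, by simp, rfl⟩, ?_⟩
    have h1 := Submodule.finrank_eq_zero.1 h.dim
    have h2 := Submodule.finrank_eq_zero.1 h.dim2
    exact Prod.ext h1.symm h2.symm
  | succ d ih =>
    intro s h
    obtain ⟨a, ha, h1, h2⟩ := h.exists_hp
    obtain ⟨u, hu, hf⟩ := ih (h.cut_hp hB ha h1 h2).1
    obtain ⟨h3, h4⟩ := h.cons_word hB ha h1 h2 hu hf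
    exact ⟨a :: u, SW_cons1 hB ha h3, h4⟩

theorem IsPr.word_cons (hB : ∀ x y, B x y = B y x) (h : IsPr B s (d + 1)) {a : V × V} (ha : HP B a) (h1 : a.1 ∈ s.1) (h2 : a.2 ∈ s.2) :
    ∃ u ∈ SW B [a] d, fsp D (a :: u) = s := by
  obtain ⟨u, hu, hf⟩ := (h.cut_hp hB ha h1 h2).1.word hB
  exact ⟨u, h.cons_word hB ha h1 h2 hu hf⟩

/-- completion of a word -/
theorem HypSp.complete {N : ℕ} (H : HypSp B N) {w : List (V × V)} (hw : w ∈ WW (OR B) (HL B ⊤) d) (hd : d ≤ N) :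
    ∃ u ∈ SW B w (N - d), u ++ w ∈ WW (OR B) (HL B ⊤) N := by
  have h1 := H.gen
  rw [← Nat.sub_add_cancel hd] at h1
  obtain ⟨u, hu⟩ := gen_word H.symm h1 hw
  rw [top_inf_eq] at hu
  refine ⟨u, hu, ?_⟩
  have := SW_append H.symm hw hu
  rwa [Nat.sub_add_cancel hd] at this

/-- action on spans of words -/
theorem smul_fsp (g : V ≃ₗ[D] V) (w : List (V × V)) : g • fsp D w = fsp D (w.map (g • ·)) := by
  induction w with
  | nil => exact Prod.ext (Submodule.smul_bot' g) (Submodule.smul_bot' g)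
  | cons a w ih =>
    rw [List.map_cons, fsp, fsp, ← ih]
    refine Prod.ext ?_ ?_
    · change g • (_ ⊔ _) = g • _ ⊔ _
      rw [Submodule.smul_sup', Submodule.smul_span]; simp
    · change g • (_ ⊔ _) = g • _ ⊔ _
      rw [Submodule.smul_sup', Submodule.smul_span]; simp

theorem mem_smul_sub (g : V ≃ₗ[D] V) (F : Submodule D V) (x : V) : g x ∈ g • F ↔ x ∈ F := by
  rw [Submodule.mem_smul_pointwise_iff_exists]
  constructor
  · rintro ⟨y, hy, e⟩
    rwa [← g.injective e]
  · intro h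
    exact ⟨x, h, rfl⟩

theorem IsPr.smul {g : V ≃ₗ[D] V} (hg : ∀ x y, B (g x) (g y) = B x y) (h : IsPr B s d) : IsPr B (g • s) d := by
  have key : ∀ (F : Submodule D V), ∀ x ∈ g • F, ∃ y ∈ F, x = g y := by
    intro F x hx
    obtain ⟨y, hy, e⟩ := (Submodule.mem_smul_pointwise_iff_exists x g F).1 hx
    exact ⟨y, hy, e.symm⟩
  refine ⟨?_, ?_, ?_, ?_, ?_⟩
  · intro x hx0 y hy0
    obtain ⟨x, hx, rfl⟩ := key _ x hx0
    obtain ⟨y, hy, rfl⟩ := key _ y hy0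
    rw [hg]; exact h.iso1 x hx y hy
  · intro x hx0 y hy0
    obtain ⟨x, hx, rfl⟩ := key _ x hx0
    obtain ⟨y, hy, rfl⟩ := key _ y hy0
    rw [hg]; exact h.iso2 x hx y hy
  · intro x hx0 h'
    obtain ⟨x, hx, rfl⟩ := key _ x hx0
    rw [h.nd1 x hx (fun y hy => by rw [← hg]; exact h' _ ((mem_smul_sub g s.2 y).2 hy)), map_zero]
  · intro x hx0 h'
    obtain ⟨x, hx, rfl⟩ := key _ x hx0
    rw [h.nd2 x hx (fun y hy => by rw [← hg]; exact h' _ ((mem_smul_sub g s.1 y).2 hy)), map_zero]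
  · rw [← h.dim]
    exact (LinearEquiv.finrank_map_eq g s.1)
end pairs
end Stmt3

namespace Stmt3
open Finsupp
set_option linter.all false
set_option linter.unusedSectionVars false
set_option linter.unusedSimpArgs false
set_option linter.unusedVariables false
open scoped Pointwise

section pairgroups
variable {D V : Type} [Field D] [AddCommGroup V] [Module D V] [FiniteDimensional D V] {B : V →ₗ[D] V →ₗ[D] D}
variable {s : Submodule D V × Submodule D V} {d N : ℕ}

/-- pairs above a given one -/
def QQ (B : V →ₗ[D] V →ₗ[D] D) (N : ℕ) (σ : Submodule D V × Submodule D V) (l : ℕ) (s : Submodule D V × Submodule D V) : Prop :=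
  σ ≤ s ∧ IsPr B s (N - l)

theorem smul_mono_pair (g : V ≃ₗ[D] V) {s t : Submodule D V × Submodule D V} (h : s ≤ t) : g • s ≤ g • t :=
  ⟨Submodule.map_mono h.1, Submodule.map_mono h.2⟩

theorem stab_fsp {u : List (V × V)} (g : stab B u) : g.1 • fsp D u = fsp D u := by
  rw [smul_fsp]
  congr 1
  conv_rhs => rw [← List.map_id u]
  refine List.map_congr_left fun a ha => ?_
  exact Prod.ext (g.2.2 a ha).1 (g.2.2 a ha).2

theorem QQ_inv (u : List (V × V)) : QInv (stab B u) (QQ B N (fsp D u)) where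
  mono g s t h := smul_mono_pair g.1 h
  inv g l s h := ⟨by rw [← stab_fsp g]; exact smul_mono_pair g.1 h.1, h.2.smul g.2.1⟩

theorem WW_nil : SW B [] d = WW (OR B) (HL B ⊤) d := by
  have : perp B [] = ⊤ := by
    rw [eq_top_iff]; intro x _ a ha; simp at ha
  rw [SW, this]

theorem map_stab {u : List (V × V)} (g : stab B u) (w : List (V × V)) : w.map (g • ·) = w.map (g.1 • ·) := rfl

theorem trans_nil (H : HypSp B N) (hd : d ≤ N) {s t : Submodule D V × Submodule D V} (hs : IsPr B s d) (ht : IsPr B t d) :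
    ∃ g : stab B [], g • s = t := by
  obtain ⟨w, hw, rfl⟩ := hs.word H.symm
  obtain ⟨w', hw', rfl⟩ := ht.word H.symm
  rw [← WW_nil] at hw hw'
  obtain ⟨g, hg⟩ := SW_trans H.symm H.full H.gen (m := 0) (w := []) (by simpa using hd) ⟨List.Pairwise.nil, by simp, rfl⟩ hw hw'
  refine ⟨g, ?_⟩
  rw [← hg]
  exact smul_fsp g.1 w

theorem trans_one (H : HypSp B N) (hd : d + 1 ≤ N) {a : V × V} (ha : HP B a) {s t : Submodule D V × Submodule D V} (hs : IsPr B s (d + 1))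
    (ht : IsPr B t (d + 1)) (has : fsp D [a] ≤ s) (hat : fsp D [a] ≤ t) :
    ∃ g : stab B ([a] ++ []), g • s = t := by
  have h1 := fsp_le.1 has a (by simp)
  have h2 := fsp_le.1 hat a (by simp)
  obtain ⟨w, hw, rfl⟩ := hs.word_cons H.symm ha h1.1 h1.2
  obtain ⟨w', hw', rfl⟩ := ht.word_cons H.symm ha h2.1 h2.2
  obtain ⟨g, hg⟩ := SW_trans H.symm H.full H.gen (m := 1) (w := [a]) (by simpa using hd)
    ⟨List.pairwise_singleton _ _, by simpa [HL] using ha, rfl⟩ hw hw'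
  refine ⟨g, ?_⟩
  rw [← hg]
  refine (smul_fsp g.1 (a :: w)).trans ?_
  rw [List.map_cons]
  have : g.1 • a = a := Prod.ext (g.2.2 a (by simp)).1 (g.2.2 a (by simp)).2
  rw [this]; rfl

/-- orthogonal complement of a pair -/
def Tt (B : V →ₗ[D] V →ₗ[D] D) (s : Submodule D V × Submodule D V) : Submodule D V where
  carrier := {t | (∀ x ∈ s.1, B x t = 0) ∧ ∀ x ∈ s.2, B x t = 0}
  zero_mem' := ⟨fun x _ => map_zero _, fun x _ => map_zero _⟩
  add_mem' ha hb := ⟨fun x hx => by rw [map_add, ha.1 x hx, hb.1 x hx, add_zero], fun x hx => by rw [map_add, ha.2 x hx, hb.2 x hx, add_zero]⟩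
  smul_mem' c x h := ⟨fun y hy => by rw [map_smul, h.1 y hy, smul_zero], fun y hy => by rw [map_smul, h.2 y hy, smul_zero]⟩

theorem perp_fsp (H : HypSp B N) (w : List (V × V)) : perp B w = Tt B (fsp D w) := by
  ext t; exact mem_perp_fsp H.symm

theorem stab_mem1 {u : List (V × V)} (g : MulAction.stabilizer (stab B u) s) (x : V) : g.1.1 x ∈ s.1 ↔ x ∈ s.1 := by
  have h : g.1.1 • s = s := g.2
  have := mem_smul_sub g.1.1 s.1 x
  rwa [show g.1.1 • s.1 = s.1 from congrArg Prod.fst h] at this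

theorem stab_mem2 {u : List (V × V)} (g : MulAction.stabilizer (stab B u) s) (x : V) : g.1.1 x ∈ s.2 ↔ x ∈ s.2 := by
  have h : g.1.1 • s = s := g.2
  have := mem_smul_sub g.1.1 s.2 x
  rwa [show g.1.1 • s.2 = s.2 from congrArg Prod.snd h] at this

theorem stab_memT {u : List (V × V)} (g : MulAction.stabilizer (stab B u) s) {x : V} (hx : x ∈ Tt B s) : g.1.1 x ∈ Tt B s := by
  constructor
  · intro y hy
    rw [← g.1.1.apply_symm_apply y, g.1.2.1]
    exact hx.1 _ (by rw [← stab_mem1 g, LinearEquiv.apply_symm_apply]; exact hy)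
  · intro y hy
    rw [← g.1.1.apply_symm_apply y, g.1.2.1]
    exact hx.2 _ (by rw [← stab_mem2 g, LinearEquiv.apply_symm_apply]; exact hy)

/-- elements of the stabilizer acting trivially on the complement -/
def nz (B : V →ₗ[D] V →ₗ[D] D) (s : Submodule D V × Submodule D V) : Subgroup (MulAction.stabilizer (stab B []) s) where
  carrier := {p | ∀ t ∈ Tt B s, p.1.1 t = t}
  one_mem' t ht := rfl
  mul_mem' {p q} hp hq t ht := by
    change p.1.1 (q.1.1 t) = t
    rw [hq t ht, hp t ht]
  inv_mem' {p} hp t ht := by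
    change p.1.1.symm t = t
    rw [LinearEquiv.symm_apply_eq, hp t ht]

instance nz_normal : (nz B s).Normal where
  conj_mem n hn g t ht := by
    change g.1.1 (n.1.1 (g⁻¹.1.1 t)) = t
    rw [hn _ (stab_memT g⁻¹ ht)]
    exact g.1.1.apply_symm_apply t

/-- lifting -/
theorem lift_iso (H : HypSp B N) (hd : d ≤ N) {w w1 : List (V × V)} (hw : w ∈ WW (OR B) (HL B ⊤) d) (hw1 : w1 ∈ WW (OR B) (HL B ⊤) d)
    (hs : fsp D w = s) (hs1 : fsp D w1 = s) (p : MulAction.stabilizer (stab B []) s) :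
    ∃ g : MulAction.stabilizer (stab B []) s, w.map (g.1.1 • ·) = w1 ∧ ∀ t ∈ Tt B s, g.1.1 t = p.1.1 t := by
  obtain ⟨w2, h2, hf⟩ := H.complete hw hd
  have hp : ∀ t ∈ perp B w, p.1.1 t ∈ perp B w1 := by
    intro t ht
    rw [perp_fsp H, hs] at ht
    rw [perp_fsp H, hs1]
    exact stab_memT p ht
  have h2' : w2.map (p.1.1 • ·) ∈ SW B w1 (N - d) := by
    refine ⟨List.pairwise_map.2 (h2.1.imp fun {a b} h => ?_), fun b hb => ?_, by simpa using h2.2.2⟩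
    · refine ⟨?_, ?_, ?_, ?_⟩
      · exact (p.1.2.1 _ _).trans h.1
      · exact (p.1.2.1 _ _).trans h.2.1
      · exact (p.1.2.1 _ _).trans h.2.2.1
      · exact (p.1.2.1 _ _).trans h.2.2.2
    · obtain ⟨c, hc, rfl⟩ := List.mem_map.1 hb
      have hc1 := h2.2.1 c hc
      exact ⟨⟨(p.1.2.1 _ _).trans hc1.1.1, (p.1.2.1 _ _).trans hc1.1.2.1, (p.1.2.1 _ _).trans hc1.1.2.2⟩, hp _ hc1.2.1, hp _ hc1.2.2⟩
  have hf' := SW_append H.symm hw1 h2'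
  rw [Nat.sub_add_cancel hd] at hf'
  obtain ⟨g, hg, hgw⟩ := full_iso H.symm H.full hf hf'
  rw [List.map_append] at hgw
  obtain ⟨e1, e2⟩ := List.append_inj hgw (by simp)
  have hgs : g • s = s := by
    rw [← hs, smul_fsp, hs, ← hs1, ← e2]; rfl
  refine ⟨⟨⟨g, hg, by simp⟩, hgs⟩, e2, fun t ht => ?_⟩
  rw [← sub_eq_zero, ← Submodule.mem_bot D, ← H.full _ hf']
  change g t - p.1.1 t ∈ _
  have hpt := stab_memT p ht
  intro b hb
  rcases List.mem_append.1 hb with hb | hb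
  · obtain ⟨c, hc, rfl⟩ := List.mem_map.1 hb
    have e3 : (g c.1, g c.2) = p.1.1 • c := (List.map_inj_left.1 e1) c hc
    have e4 : g c.1 = p.1.1 c.1 := congrArg Prod.fst e3
    have e5 : g c.2 = p.1.1 c.2 := congrArg Prod.snd e3
    change B (p.1.1 c.1) _ = 0 ∧ B (p.1.1 c.2) _ = 0
    rw [map_sub, map_sub, p.1.2.1, p.1.2.1, ← e4, ← e5, hg, hg, sub_self, sub_self]
    exact ⟨rfl, rfl⟩
  · rw [← e2] at hb
    obtain ⟨c, hc, rfl⟩ := List.mem_map.1 hb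
    have hc1 := mem_fsp (D := D) hc
    rw [hs] at hc1
    have h3 := (stab_mem1 (u := []) ⟨⟨g, hg, by simp⟩, hgs⟩ c.1).2 hc1.1
    have h4 := (stab_mem2 (u := []) ⟨⟨g, hg, by simp⟩, hgs⟩ c.2).2 hc1.2
    change B (g c.1) _ = 0 ∧ B (g c.2) _ = 0
    rw [map_sub, map_sub, hg, hg, ht.1 _ hc1.1, ht.2 _ hc1.2]
    refine ⟨?_, ?_⟩
    · rw [hpt.1 _ h3, sub_zero]
    · rw [hpt.2 _ h4, sub_zero]

theorem iso_unique (H : HypSp B N) (hs : IsPr B s d) (hd : d ≤ N) (g : nz B s) (hg : ∀ x ∈ s.1, g.1.1.1 x = x) :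
    (∀ x, g.1.1.1 x = x) := by
  have hg2 : ∀ y ∈ s.2, g.1.1.1 y = y := by
    intro y hy
    rw [← sub_eq_zero]
    refine hs.nd2 _ (sub_mem ((stab_mem2 g.1 y).2 hy) hy) fun x hx => ?_
    rw [map_sub, sub_eq_zero]
    conv_lhs => rw [← hg x hx]
    exact g.1.1.2.1 x y
  obtain ⟨w, hw, hws⟩ := hs.word H.symm
  obtain ⟨w2, h2, hf⟩ := H.complete hw hd
  intro x
  rw [← sub_eq_zero, ← Submodule.mem_bot D, ← H.full _ hf]
  intro b hb
  have hb2 : g.1.1.1 b.1 = b.1 ∧ g.1.1.1 b.2 = b.2 := by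
    rcases List.mem_append.1 hb with hb | hb
    · have := (h2.2.1 b hb).2
      rw [perp_fsp H, hws] at this
      exact ⟨g.2 _ this.1, g.2 _ this.2⟩
    · have := mem_fsp (D := D) hb
      rw [hws] at this
      exact ⟨hg _ this.1, hg2 _ this.2⟩
  rw [map_sub, map_sub, sub_eq_zero, sub_eq_zero]
  constructor
  · conv_lhs => rw [← hb2.1]
    exact g.1.1.2.1 _ _
  · conv_lhs => rw [← hb2.2]
    exact g.1.1.2.1 _ _

/-- restriction to the first space -/
def rst (B : V →ₗ[D] V →ₗ[D] D) (s : Submodule D V × Submodule D V) : nz B s →* (s.1 ≃ₗ[D] s.1) where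
  toFun g := 
    { toFun := fun x => ⟨g.1.1.1 x.1, (stab_mem1 g.1 x.1).2 x.2⟩
      invFun := fun x => ⟨g.1.1.1.symm x.1, by rw [← stab_mem1 g.1, LinearEquiv.apply_symm_apply]; exact x.2⟩
      map_add' := fun x y => Subtype.ext (map_add g.1.1.1 x.1 y.1)
      map_smul' := fun c x => Subtype.ext (map_smul g.1.1.1 c x.1)
      left_inv := fun x => Subtype.ext (g.1.1.1.symm_apply_apply x.1)
      right_inv := fun x => Subtype.ext (g.1.1.1.apply_symm_apply x.1) }
  map_one' := rfl
  map_mul' _ _ := rfl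

theorem rst_apply (g : nz B s) (x : s.1) : (rst B s g x).1 = g.1.1.1 x.1 := rfl

theorem rst_inj (H : HypSp B N) (hs : IsPr B s d) (hd : d ≤ N) : Function.Injective (rst B s) := by
  rw [injective_iff_map_eq_one]
  intro g hg
  have := iso_unique H hs hd g (fun x hx => congrArg Subtype.val (LinearEquiv.congr_fun hg ⟨x, hx⟩))
  exact Subtype.ext (Subtype.ext (Subtype.ext (LinearEquiv.ext this)))

theorem rst_surj (H : HypSp B N) (hs : IsPr B s d) (hd : d ≤ N) : Function.Surjective (rst B s) := by
  intro f
  obtain ⟨w, hw, hws⟩ := hs.word H.symm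
  obtain ⟨P, hP⟩ := (hs.swap H.symm).repr
  -- the contragredient map
  have hex : ∃ f' : V → V, (∀ y ∈ s.2, f' y ∈ s.2 ∧ ∀ x : s.1, B (f x).1 (f' y) = B x.1 y) := by
    refine ⟨fun y => P (((B y).comp s.1.subtype).comp f.symm.toLinearMap), fun y hy => ⟨(hP _).1, fun x => ?_⟩⟩
    rw [H.symm]
    refine ((hP _).2 (f x)).trans ?_
    change B y (f.symm (f x)).1 = _
    rw [LinearEquiv.symm_apply_apply, H.symm]
  obtain ⟨f', hf'⟩ := hex
  classical
  let f0 : V → V := fun x => if h : x ∈ s.1 then (f ⟨x, h⟩).1 else 0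
  have hf0 : ∀ x (h : x ∈ s.1), f0 x = (f ⟨x, h⟩).1 := fun x h => dif_pos h
  have hf0m : ∀ x (h : x ∈ s.1), f0 x ∈ s.1 := fun x h => by rw [hf0 x h]; exact (f _).2
  have hmem : ∀ b ∈ w, b.1 ∈ s.1 ∧ b.2 ∈ s.2 := fun b hb => by
    have := mem_fsp (D := D) hb; rwa [hws] at this
  have hb1 : ∀ x ∈ s.1, ∀ y ∈ s.2, B (f0 x) (f' y) = B x y := fun x hx y hy => by
    rw [hf0 x hx]; exact (hf' y hy).2 ⟨x, hx⟩
  have hw1 : w.map (fun b => (f0 b.1, f' b.2)) ∈ WW (OR B) (HL B ⊤) d := by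
    refine ⟨List.pairwise_map.2 (List.Pairwise.imp_of_mem (fun {a b} ha hb h => ?_) hw.1), fun b hb => ?_, by simpa using hw.2.2⟩
    · have ha := hmem a ha
      have hb := hmem b hb
      refine ⟨hs.iso1 _ (hf0m _ ha.1) _ (hf0m _ hb.1), ?_, ?_, hs.iso2 _ (hf' _ ha.2).1 _ (hf' _ hb.2).1⟩
      · exact (hb1 _ ha.1 _ hb.2).trans h.2.1
      · rw [H.symm]
        refine (hb1 _ hb.1 _ ha.2).trans ?_
        rw [H.symm]; exact h.2.2.1
    · obtain ⟨c, hc, rfl⟩ := List.mem_map.1 hb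
      have hc1 := hmem c hc
      exact ⟨⟨hs.iso1 _ (hf0m _ hc1.1) _ (hf0m _ hc1.1), hs.iso2 _ (hf' _ hc1.2).1 _ (hf' _ hc1.2).1,
        (hb1 _ hc1.1 _ hc1.2).trans (hw.2.1 c hc).1.2.2⟩, trivial, trivial⟩
  have hw1s : fsp D (w.map (fun b => (f0 b.1, f' b.2))) = s := by
    have hle : fsp D (w.map (fun b => (f0 b.1, f' b.2))) ≤ s := by
      rw [fsp_le]
      intro b hb
      obtain ⟨c, hc, rfl⟩ := List.mem_map.1 hb
      exact ⟨hf0m _ (hmem c hc).1, (hf' _ (hmem c hc).2).1⟩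
    have h3 := fsp_isPr H.symm hw1
    exact Prod.ext (Submodule.eq_of_le_of_finrank_eq hle.1 (h3.dim.trans hs.dim.symm))
      (Submodule.eq_of_le_of_finrank_eq hle.2 (h3.dim2.trans hs.dim2.symm))
  obtain ⟨g, hg1, hg2⟩ := lift_iso H hd hw hw1 hws hw1s 1
  refine ⟨⟨g, hg2⟩, ?_⟩
  have key : s.1 ≤ (LinearMap.eqLocus (g.1.1.toLinearMap.comp s.1.subtype) (s.1.subtype.comp f.toLinearMap)).map s.1.subtype := by
    have h4 : fsp D w ≤ ((LinearMap.eqLocus (g.1.1.toLinearMap.comp s.1.subtype) (s.1.subtype.comp f.toLinearMap)).map s.1.subtype, ⊤) := by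
      rw [fsp_le]
      intro b hb
      refine ⟨⟨⟨b.1, (hmem b hb).1⟩, ?_, rfl⟩, trivial⟩
      have := congrArg Prod.fst ((List.map_inj_left.1 hg1) b hb)
      exact this.trans (hf0 _ (hmem b hb).1)
    rw [hws] at h4
    exact h4.1
  refine LinearEquiv.ext fun x => Subtype.ext ?_
  obtain ⟨y, hy, e⟩ := key x.2
  have : y = x := Subtype.ext e
  subst this
  exact hy

theorem fix_aux (H : HypSp B N) (hs : IsPr B s d) {t : Submodule D V × Submodule D V} {d' : ℕ} (ht : IsPr B t d') (hst : s ≤ t)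
    (g : nz B s) : g.1.1.1 • t ≤ t := by
  constructor
  · rintro _ ⟨v, hv, rfl⟩
    obtain ⟨P, hP⟩ := hs.proj
    have hT : v - P v ∈ Tt B s := by
      constructor
      · intro x hx
        rw [map_sub, ht.iso1 x (hst.1 hx) v hv, hs.iso1 x hx _ (hP v).1, sub_zero]
      · intro x hx
        rw [map_sub, H.symm x, H.symm x, (hP v).2 x hx, sub_self]
    have e : g.1.1.1 v = g.1.1.1 (P v) + (v - P v) := by
      rw [← g.2 _ hT, ← map_add]
      congr 1; abel
    change g.1.1.1 v ∈ t.1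
    rw [e]
    exact add_mem (hst.1 ((stab_mem1 g.1 _).2 (hP v).1)) (sub_mem hv (hst.1 (hP v).1))
  · rintro _ ⟨v, hv, rfl⟩
    obtain ⟨P, hP⟩ := (hs.swap H.symm).proj
    have hT : v - P v ∈ Tt B s := by
      constructor
      · intro x hx
        rw [map_sub, H.symm x, H.symm x, (hP v).2 x hx, sub_self]
      · intro x hx
        rw [map_sub, ht.iso2 x (hst.2 hx) v hv, hs.iso2 x hx _ (hP v).1, sub_zero]
    have e : g.1.1.1 v = g.1.1.1 (P v) + (v - P v) := by
      rw [← g.2 _ hT, ← map_add]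
      congr 1; abel
    change g.1.1.1 v ∈ t.2
    rw [e]
    exact add_mem (hst.2 ((stab_mem2 g.1 _).2 (hP v).1)) (sub_mem hv (hst.2 (hP v).1))

theorem fix_above (H : HypSp B N) (hs : IsPr B s d) {t : Submodule D V × Submodule D V} {d' : ℕ} (ht : IsPr B t d') (hst : s ≤ t)
    (g : nz B s) : g.1.1 • t = t := by
  refine le_antisymm (fix_aux H hs ht hst g) ?_
  have := smul_mono_pair g.1.1.1 (fix_aux H hs ht hst g⁻¹)
  rwa [show g.1.1.1 • ((g⁻¹).1.1.1 • t) = t from smul_inv_smul g.1.1.1 t] at this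

end pairgroups
end Stmt3

namespace Stmt3
open Finsupp
set_option linter.all false
set_option linter.unusedSectionVars false
set_option linter.unusedSimpArgs false
set_option linter.unusedVariables false
open scoped Pointwise

section pairconn
variable {D V : Type} [Field D] [AddCommGroup V] [Module D V] [FiniteDimensional D V] {B : V →ₗ[D] V →ₗ[D] D}
variable {s : Submodule D V × Submodule D V} {d N : ℕ}

theorem sinc_smul (a : V × V) (g : stab B ([a] ++ [])) (s : Submodule D V × Submodule D V) : sinc B [a] [] g • s = g • s := rfl

/-- the subgroup of the small stabilizer -/
def nz' (B : V →ₗ[D] V →ₗ[D] D) (a : V × V) (s : Submodule D V × Submodule D V) :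
    Subgroup (MulAction.stabilizer (stab B ([a] ++ [])) s) :=
  (nz B s).comap (stMap (sinc B [a] []) (sinc_smul a) s)

/-- inclusion -/
def kz (B : V →ₗ[D] V →ₗ[D] D) (a : V × V) (s : Submodule D V × Submodule D V) : nz' B a s →* nz B s :=
  ((stMap (sinc B [a] []) (sinc_smul a) s).comp (nz' B a s).subtype).codRestrict _ (fun g => g.2)

theorem kz_coe (a : V × V) (g : nz' B a s) : (kz B a s g).1.1.1 = g.1.1.1 := rfl

theorem kz_conn [Infinite D] (H : HypSp B N) (hs : IsPr B s d) (hd : d ≤ N) {a : V × V} (ha : HP B a) (h1 : a.1 ∈ s.1) (h2 : a.2 ∈ s.2) :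
    Conn (triv (kz B a s)) d := by
  have hfix : ∀ g : nz' B a s, (kz B a s g).1.1.1 a.1 = a.1 ∧ (kz B a s g).1.1.1 a.2 = a.2 := fun g =>
    g.1.1.2.2 a (by simp)
  have hC : Conn (triv ((rst B s).comp (kz B a s))) d := by
    have hne : (⟨a.1, h1⟩ : s.1) ≠ 0 := by
      intro e
      have e1 : a.1 = 0 := congrArg Subtype.val e
      have := ha.2.2
      rw [e1] at this
      simp at this
    have hdec : ∀ x : s.1, ∃ k ∈ (kr B a.2).comap s.1.subtype, x = B a.2 x.1 • (⟨a.1, h1⟩ : s.1) + k := by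
      intro x
      refine ⟨x - B a.2 x.1 • (⟨a.1, h1⟩ : s.1), ?_, by abel⟩
      change B a.2 (x.1 - B a.2 x.1 • a.1) = 0
      rw [map_sub, map_smul, H.symm a.2 a.1, ha.2.2]; simp
    refine GL_conn (E := s.1) hs.dim (v := ⟨a.1, h1⟩) (K := (kr B a.2).comap s.1.subtype) hne ⟨?_, ?_⟩ _ ?_ ?_ ?_ ?_
    · rw [Submodule.disjoint_def]
      intro x hx hx2
      obtain ⟨c, rfl⟩ := Submodule.mem_span_singleton.1 hx
      have : B a.2 (c • a.1) = 0 := hx2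
      rw [map_smul, H.symm a.2 a.1, ha.2.2] at this
      simp at this
      rw [this, zero_smul]
    · rw [codisjoint_iff, eq_top_iff]
      intro x _
      obtain ⟨k, hk, e⟩ := hdec x
      rw [e]
      exact Submodule.add_mem_sup (Submodule.smul_mem _ _ (Submodule.mem_span_singleton_self _)) hk
    · refine (rst_inj H hs hd).comp ?_
      intro g g' e
      have : (kz B a s g).1.1.1 = (kz B a s g').1.1.1 := congrArg (fun z : nz B s => z.1.1.1) e
      exact Subtype.ext (Subtype.ext (Subtype.ext this))
    · intro g
      exact Subtype.ext (hfix g).1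
    · intro g x hx
      have hx : B a.2 x.1 = 0 := hx
      change B a.2 ((kz B a s g).1.1.1 x.1) = 0
      rw [← hx, ← (kz B a s g).1.1.2.1 a.2 x.1, (hfix g).2]
    · intro f hf1 hf2
      obtain ⟨p, hp⟩ := rst_surj H hs hd f
      have hpf : ∀ x : s.1, p.1.1.1 x.1 = (f x).1 := fun x => by rw [← hp]; rfl
      have hp1 : p.1.1.1 a.1 = a.1 := (hpf ⟨a.1, h1⟩).trans (congrArg Subtype.val hf1)
      have hp2 : p.1.1.1 a.2 = a.2 := by
        rw [← sub_eq_zero]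
        refine hs.nd2 _ (sub_mem ((stab_mem2 p.1 _).2 h2) h2) fun y hy => ?_
        have hx : p.1.1.1.symm y ∈ s.1 := by rw [← stab_mem1 p.1, LinearEquiv.apply_symm_apply]; exact hy
        obtain ⟨k, hk, e⟩ := hdec ⟨_, hx⟩
        have e1 : y = B a.2 (p.1.1.1.symm y) • a.1 + (f k).1 := by
          rw [← hpf k]
          conv_lhs => rw [← p.1.1.1.apply_symm_apply y]
          have := congrArg Subtype.val e
          conv_lhs => rw [show p.1.1.1.symm y = B a.2 (p.1.1.1.symm y) • a.1 + k.1 from this]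
          rw [map_add, map_smul, hp1]
        have e2 : B a.2 (f k).1 = 0 := (hf2 k).1 hk
        rw [map_sub, sub_eq_zero]
        conv_lhs => rw [← p.1.1.1.apply_symm_apply y]
        rw [p.1.1.2.1]
        conv_rhs => rw [e1]
        rw [H.symm _ a.2, H.symm _ a.2, map_add, map_smul, e2, H.symm a.2 a.1, ha.2.2]
        simp
      have hst : p.1.1.1 ∈ stab B ([a] ++ []) := ⟨p.1.1.2.1, fun b hb => by
        simp at hb; rw [hb]; exact ⟨hp1, hp2⟩⟩
      exact ⟨⟨⟨⟨p.1.1.1, hst⟩, p.1.2⟩, p.2⟩, hp⟩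
  refine (Conn.sq (a := triv (kz B a s)) (b := triv ((rst B s).comp (kz B a s))) (triv (MonoidHom.id _)) (triv (rst B s))
    (fun _ => rfl) (fun _ => rfl) ?_ ?_ d).2 hC
  · exact Hmap_bij _ Function.bijective_id Function.bijective_id
  · exact Hmap_bij _ ⟨rst_inj H hs hd, rst_surj H hs hd⟩ Function.bijective_id

theorem nz_triv (H : HypSp B N) {L : ℕ} (hs : IsPr B s d) (g : nz B s) (n : NN (QQ B N (fsp D [])) L s) :
    nRep (QQ_inv (B := B) (N := N) []) L s g.1 n = n := by
  refine Subtype.ext ?_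
  change lrep (stab B []) _ g.1.1 n.1 = n.1
  have h1 : n.1 ∈ CC {w : List (Submodule D V × Submodule D V) | ∀ t ∈ w, g.1.1 • t = t} := by
    intro w hw
    have h2 := n.2.1.1 w hw
    have h3 := n.2.2 w hw
    intro t ht
    match w, h2, h3, ht with
    | s' :: w, h2, h3, ht =>
      have e : s' = s := by simpa using h3
      subst e
      have hle : s' ≤ t := by
        rcases List.mem_cons.1 ht with rfl | ht
        · exact le_rfl
        · exact h2.1.2.1 t ht
      obtain ⟨l, hl⟩ := FL_mem h2.1 ht
      exact fix_above H hs hl.2.2 hle g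
  refine CC_ind (p := fun x => lrep (stab B []) _ g.1.1 x = x) ?_ ?_ ?_ h1
  · exact map_zero _
  · intro x y hx hy
    rw [map_add, hx, hy]
  · intro w hw k
    rw [lrep_single]
    congr 1
    conv_rhs => rw [← List.map_id w]
    exact List.map_congr_left hw

theorem pair_conn [Infinite D] (H : HypSp B N) {a : V × V} (ha : HP B a) {L : ℕ} (hL : L < N) :
    Conn (eInc (QQ_inv (B := B) (N := N) []) (QQ_inv (B := B) (N := N) ([a] ++ []))
      (fun l s h => ⟨⟨bot_le, bot_le⟩, h.2⟩) (sinc B [a] []) (sinc_smul a) (L + 1)) (N - L) := by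
  obtain ⟨d, hd⟩ : ∃ d, N - L = d + 1 := ⟨N - L - 1, by omega⟩
  have h1 : [a] ∈ WW (OR B) (HL B ⊤) 1 := ⟨List.pairwise_singleton _ _, by simpa [HL] using ha, rfl⟩
  obtain ⟨u0, hu0, _⟩ := H.complete h1 (by omega : 1 ≤ N)
  obtain ⟨u, hu⟩ : ∃ u, u ∈ SW B [a] d := by
    have : gen B (perp B [a]) d := gen.le ⟨u0, hu0⟩ (by omega)
    exact this
  have hs := fsp_isPr H.symm (SW_cons1 H.symm ha hu)
  have has : fsp D [a] ≤ fsp D (a :: u) := fsp_le.2 (by simpa using mem_fsp (D := D) (w := a :: u) (a := a) (by simp))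
  have has1 := fsp_le.1 has a (by simp)
  refine eInc_conn _ _ _ _ _ L (fsp D (a :: u)) ?_ ?_ ?_ ?_
  · intro t ht
    exact trans_nil H (d := d + 1) (by omega) hs (hd ▸ ht.2)
  · intro t ht
    exact trans_one H (d := d) (by omega) ha hs (hd ▸ ht.2) has ht.1
  · intro l t hst h
    exact ⟨has.trans hst, h.2⟩
  · rw [hd]
    refine K_conn (stMap (sinc B [a] []) (sinc_smul a) (fsp D (a :: u))) (QuotientGroup.mk' (nz B (fsp D (a :: u)))) (nz B _).subtype
      (nz' B a _).subtype (kz B a _) Subtype.val_injective Subtype.val_injective ?_ ?_ ?_ ?_ ?_ (kz_conn H hs (by omega) ha has1.1 has1.2) _ ?_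
    · intro g
      exact (QuotientGroup.eq_one_iff _).2 g.2
    · intro p hp
      exact ⟨⟨p, (QuotientGroup.eq_one_iff _).1 hp⟩, rfl⟩
    · intro p hp
      exact ⟨⟨p, (QuotientGroup.eq_one_iff (N := nz B (fsp D (a :: u))) _).1 hp⟩, rfl⟩
    · intro q
      obtain ⟨p, rfl⟩ := QuotientGroup.mk'_surjective _ q
      obtain ⟨g, hg1, hg2⟩ := lift_iso H (by omega : d + 1 ≤ N) (SW_cons1 H.symm ha hu) (SW_cons1 H.symm ha hu) rfl rfl p
      have e := (List.map_inj_left.1 (hg1.trans (List.map_id (a :: u)).symm)) a (by simp)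
      have e1 : g.1.1 a.1 = a.1 := congrArg Prod.fst e
      have e2 : g.1.1 a.2 = a.2 := congrArg Prod.snd e
      have hst : g.1.1 ∈ stab B ([a] ++ []) := ⟨g.1.2.1, fun b hb => by
        simp at hb; rw [hb]; exact ⟨e1, e2⟩⟩
      refine ⟨⟨⟨g.1.1, hst⟩, g.2⟩, ?_⟩
      refine QuotientGroup.eq.2 ?_
      intro t ht
      change g.1.1.symm (p.1.1 t) = t
      rw [LinearEquiv.symm_apply_eq]
      exact (hg2 t ht).symm
    · intro g
      rfl
    · intro g n
      exact nz_triv H hs g n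

theorem pair_main [Infinite D] (H : HypSp B N) {a : V × V} (ha : HP B a)
    (hX : ∀ (σ : Submodule D V × Submodule D V) (r L : ℕ), IsPr B σ r → L + r ≤ N → XX (QQ B N σ) L) :
    Conn (triv (sinc B [a] [])) N := by
  refine flag_conn (QQ_inv (B := B) (N := N) []) (QQ_inv (B := B) (N := N) ([a] ++ []))
      (fun l s h => ⟨⟨bot_le, bot_le⟩, h.2⟩) (sinc B [a] []) (sinc_smul a) N ?_ ?_ (fun L hL => pair_conn H ha hL)
  · intro L hL
    exact hX _ 0 L isPr_bot (by omega)
  · intro L hL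
    exact hX _ 1 L (fsp_isPr H.symm ⟨List.pairwise_singleton _ _, by simpa [HL] using ha, rfl⟩) (by omega)

end pairconn
end Stmt3

namespace Stmt3
open Finsupp
set_option linter.all false
set_option linter.unusedSectionVars false
set_option linter.unusedSimpArgs false
set_option linter.unusedVariables false
open scoped Pointwise

section generic
variable {D V : Type} [Field D] [AddCommGroup V] [Module D V]

/-- functions polynomial along quadratic curves -/
def PolyFun (f : V → D) : Prop := ∀ v0 v1 v2 : V, ∃ P : Polynomial D, ∀ t : D, f (v0 + t • v1 + t ^ 2 • v2) = Polynomial.eval t P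

theorem PolyFun.mul {f g : V → D} (hf : PolyFun f) (hg : PolyFun g) : PolyFun (fun v => f v * g v) := by
  intro v0 v1 v2
  obtain ⟨P, hP⟩ := hf v0 v1 v2
  obtain ⟨Q, hQ⟩ := hg v0 v1 v2
  exact ⟨P * Q, fun t => by simp [hP, hQ]⟩

theorem PolyFun.add {f g : V → D} (hf : PolyFun f) (hg : PolyFun g) : PolyFun (fun v => f v + g v) := by
  intro v0 v1 v2
  obtain ⟨P, hP⟩ := hf v0 v1 v2
  obtain ⟨Q, hQ⟩ := hg v0 v1 v2
  exact ⟨P + Q, fun t => by simp [hP, hQ]⟩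

theorem PolyFun.sub {f g : V → D} (hf : PolyFun f) (hg : PolyFun g) : PolyFun (fun v => f v - g v) := by
  intro v0 v1 v2
  obtain ⟨P, hP⟩ := hf v0 v1 v2
  obtain ⟨Q, hQ⟩ := hg v0 v1 v2
  exact ⟨P - Q, fun t => by simp [hP, hQ]⟩

theorem PolyFun.const (c : D) : PolyFun (fun _ : V => c) := fun _ _ _ => ⟨Polynomial.C c, fun t => by simp⟩

theorem PolyFun.lin (l : V →ₗ[D] D) : PolyFun (fun v => l v) := fun v0 v1 v2 =>
  ⟨Polynomial.C (l v0) + Polynomial.X * Polynomial.C (l v1) + Polynomial.X ^ 2 * Polynomial.C (l v2), fun t => by simp; ring⟩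

theorem PolyFun.quad (q : V →ₗ[D] V →ₗ[D] D) : PolyFun (fun v => q v v) := fun v0 v1 v2 =>
  ⟨Polynomial.C (q v0 v0) + Polynomial.X * Polynomial.C (q v0 v1) + Polynomial.X ^ 2 * Polynomial.C (q v0 v2)
    + Polynomial.X * (Polynomial.C (q v1 v0) + Polynomial.X * Polynomial.C (q v1 v1) + Polynomial.X ^ 2 * Polynomial.C (q v1 v2))
    + Polynomial.X ^ 2 * (Polynomial.C (q v2 v0) + Polynomial.X * Polynomial.C (q v2 v1) + Polynomial.X ^ 2 * Polynomial.C (q v2 v2)),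
    fun t => by simp; ring⟩

/-- common non-vanishing -/
theorem common_witness [Infinite D] {ι : Type} {A : Set ι} (hA : A.Finite) (f : ι → V → D) (hf : ∀ i ∈ A, PolyFun (f i))
    (Z : Set V) (hne : Z.Nonempty)
    (hZ : ∀ v ∈ Z, ∀ v' ∈ Z, ∃ v1 v2 : V, (∀ t : D, v + t • v1 + t ^ 2 • v2 ∈ Z) ∧ v + v1 + v2 = v')
    (hw : ∀ i ∈ A, ∃ v ∈ Z, f i v ≠ 0) : ∃ v ∈ Z, ∀ i ∈ A, f i v ≠ 0 := by
  classical
  induction A, hA using Set.Finite.induction_on with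
  | empty => obtain ⟨v, hv⟩ := hne; exact ⟨v, hv, by simp⟩
  | insert hi hS ih =>
    rename_i i S
    obtain ⟨v, hv, hvS⟩ := ih (fun j hj => hf j (Set.mem_insert_of_mem _ hj)) (fun j hj => hw j (Set.mem_insert_of_mem _ hj))
    obtain ⟨v', hv', hvi⟩ := hw i (Set.mem_insert _ _)
    obtain ⟨v1, v2, hc, e⟩ := hZ v hv v' hv'
    have hP : ∀ j, ∃ P : Polynomial D, j ∈ insert i S → ∀ t, f j (v + t • v1 + t ^ 2 • v2) = Polynomial.eval t P := by
      intro j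
      by_cases hj : j ∈ insert i S
      · obtain ⟨P, hP⟩ := hf j hj v v1 v2
        exact ⟨P, fun _ => hP⟩
      · exact ⟨0, fun h => absurd h hj⟩
    choose P hP using hP
    have hPne : ∀ j ∈ insert i S, P j ≠ 0 := by
      intro j hj h0
      rcases Set.mem_insert_iff.1 hj with rfl | hj'
      · have := hP j hj 1
        rw [h0] at this
        simp [e] at this
        exact hvi this
      · have := hP j hj 0
        rw [h0] at this
        simp at this
        exact hvS j hj' this
    have hprod : (P i * ∏ j ∈ hS.toFinset, P j) ≠ 0 := by
      refine mul_ne_zero (hPne i (Set.mem_insert _ _)) (Finset.prod_ne_zero_iff.2 fun j hj => hPne j (Set.mem_insert_of_mem _ (by simpa using hj)))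
    obtain ⟨t, ht⟩ : ∃ t, Polynomial.eval t (P i * ∏ j ∈ hS.toFinset, P j) ≠ 0 := by
      by_contra hcon
      push Not at hcon
      exact hprod (Polynomial.funext (fun t => by rw [hcon t]; simp))
    rw [Polynomial.eval_mul, Polynomial.eval_prod] at ht
    refine ⟨_, hc t, fun j hj => ?_⟩
    rw [hP j hj t]
    rcases Set.mem_insert_iff.1 hj with rfl | hj'
    · exact left_ne_zero_of_mul ht
    · exact Finset.prod_ne_zero_iff.1 (right_ne_zero_of_mul ht) j (by simpa using hj')

variable {B : V →ₗ[D] V →ₗ[D] D}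

/-- isotropic partners of a vector -/
def partners (B : V →ₗ[D] V →ₗ[D] D) (W : Submodule D V) (u : V) : Set V := {v | v ∈ W ∧ B v v = 0 ∧ B u v = 1}

theorem partners_curve (hB : ∀ x y, B x y = B y x) {W : Submodule D V} {u : V} (hu : u ∈ W) (huu : B u u = 0) :
    ∀ v ∈ partners B W u, ∀ v' ∈ partners B W u, ∃ v1 v2 : V, (∀ t : D, v + t • v1 + t ^ 2 • v2 ∈ partners B W u) ∧ v + v1 + v2 = v' := by
  rintro v ⟨hv, h1, h2⟩ v' ⟨hv', h1', h2'⟩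
  refine ⟨v' - v - B v v' • u, B v v' • u, fun t => ⟨?_, ?_, ?_⟩, by abel⟩
  · exact add_mem (add_mem hv (Submodule.smul_mem _ _ (sub_mem (sub_mem hv' hv) (Submodule.smul_mem _ _ hu))))
      (Submodule.smul_mem _ _ (Submodule.smul_mem _ _ hu))
  · simp only [map_add, map_sub, map_smul, LinearMap.add_apply, LinearMap.sub_apply, LinearMap.smul_apply, smul_eq_mul,
      h1, h2, h1', h2', huu, hB v u, hB v' u, hB v' v]
    ring
  · simp only [map_add, map_sub, map_smul, smul_eq_mul, h2, h2', huu]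
    ring

def cutp (B : V →ₗ[D] V →ₗ[D] D) (u u' : V) (s : Submodule D V × Submodule D V) : Submodule D V × Submodule D V :=
  (s.1 ⊓ kr B u, s.2 ⊓ kr B u')

def addp (D : Type) {V : Type} [Field D] [AddCommGroup V] [Module D V] (u u' : V) (s : Submodule D V × Submodule D V) : Submodule D V × Submodule D V :=
  (s.1 ⊔ Submodule.span D {u}, s.2 ⊔ Submodule.span D {u'})

theorem sup_span_sub {F : Submodule D V} {u x : V} (hx : x ∈ F) : F ⊔ Submodule.span D {u} = F ⊔ Submodule.span D {u - x} := by
  apply le_antisymm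
  · refine sup_le le_sup_left ?_
    rw [Submodule.span_singleton_le_iff_mem]
    rw [← sub_add_cancel u x]
    refine add_mem (Submodule.mem_sup_right ?_) (Submodule.mem_sup_left hx)
    rw [sub_add_cancel]
    exact Submodule.mem_span_singleton_self _
  · refine sup_le le_sup_left ?_
    rw [Submodule.span_singleton_le_iff_mem]
    exact sub_mem (Submodule.mem_sup_right (Submodule.mem_span_singleton_self _)) (Submodule.mem_sup_left hx)

variable [FiniteDimensional D V]
variable {s : Submodule D V × Submodule D V} {d N : ℕ}

theorem IsPr.exchange (hB : ∀ x y, B x y = B y x) (h : IsPr B s (d + 1)) {u u' p p' α α' : V} (hu : B u u = 0) (hu' : B u' u' = 0)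
    (huu : B u u' = 1) (hp : p ∈ s.1) (hp' : p' ∈ s.2) (hα : α ∈ s.1) (hα' : α' ∈ s.2)
    (e1 : ∀ y ∈ s.2, B p y = B u' y) (e2 : ∀ x ∈ s.1, B p' x = B u x) (e3 : ∀ y ∈ s.2, B α y = B u y) (e4 : ∀ x ∈ s.1, B α' x = B u' x)
    (n1 : B p p' ≠ 0) (n2 : B p p' * (1 - B α α') + B α p' * B p α' ≠ 0) :
    IsPr B (cutp B u u' s) d ∧ IsPr B (addp D u u' (cutp B u u' s)) (d + 1) := by
  have hcut : IsPr B (cutp B u u' s) d := h.cut hB hp hp' (fun x hx => (e2 x hx).symm) (fun y hy => (e1 y hy).symm) n1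
  refine ⟨hcut, ?_⟩
  obtain ⟨c, hc⟩ : ∃ c, c * B p p' = B α p' := ⟨B α p' / B p p', div_mul_cancel₀ _ n1⟩
  obtain ⟨c', hc'⟩ : ∃ c', c' * B p p' = B p α' := ⟨B p α' / B p p', div_mul_cancel₀ _ n1⟩
  have m1 : α - c • p ∈ s.1 := sub_mem hα (Submodule.smul_mem _ _ hp)
  have m2 : α' - c' • p' ∈ s.2 := sub_mem hα' (Submodule.smul_mem _ _ hp')
  have k1 : B u (α - c • p) = 0 := by
    rw [← e2 _ m1, map_sub, map_smul, hB p' α, hB p' p, smul_eq_mul, hc, sub_self]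
  have k2 : B u' (α' - c' • p') = 0 := by
    rw [← e1 _ m2, map_sub, map_smul, smul_eq_mul, hc', sub_self]
  obtain ⟨x, hx⟩ : ∃ x, x = α - c • p := ⟨_, rfl⟩
  obtain ⟨y, hy⟩ : ∃ y, y = α' - c' • p' := ⟨_, rfl⟩
  rw [← hx] at m1 k1
  rw [← hy] at m2 k2
  -- pairings
  have q1 : B u y = B x y := by
    rw [← e3 y m2, hx, map_sub, map_smul, LinearMap.sub_apply, LinearMap.smul_apply, e1 y m2, k2, smul_zero, sub_zero]
  have q2 : B x u' = B x y := by
    rw [hB x u', ← e4 x m1, hy, map_sub, map_smul, hB x α', hB x p', e2 x m1, k1, smul_zero, sub_zero]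
  have q3 : B x y = B α α' - c * B p α' := by
    have : B x p' = 0 := by rw [hB, e2 x m1, k1]
    rw [hy, map_sub, map_smul, this, smul_zero, sub_zero, hx, map_sub, map_smul, LinearMap.sub_apply, LinearMap.smul_apply, smul_eq_mul]
  have hef : B (u - x) (u' - y) ≠ 0 := by
    have : B (u - x) (u' - y) = 1 - B x y := by
      simp only [map_sub, LinearMap.sub_apply, huu, q1, q2]; ring
    rw [this, q3]
    intro h0
    apply n2
    rw [← hc]
    linear_combination B p p' * h0
  have hcx : x ∈ (cutp B u u' s).1 := ⟨m1, k1⟩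
  have hcy : y ∈ (cutp B u u' s).2 := ⟨m2, k2⟩
  rw [addp, sup_span_sub hcx, sup_span_sub hcy]
  refine hcut.add hB ?_ ?_ hef ?_ ?_ ?_ ?_
  · simp only [map_sub, LinearMap.sub_apply, hu, k1, hB x u, h.iso1 x m1 x m1]; ring
  · simp only [map_sub, LinearMap.sub_apply, hu', k2, hB y u', h.iso2 y m2 y m2]; ring
  · intro z hz
    have hz2 : B u z = 0 := hz.2
    rw [map_sub, hB z u, hz2, h.iso1 z hz.1 x m1, sub_zero]
  · intro z hz
    have hz2 : B u' z = 0 := hz.2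
    rw [map_sub, hB z u, hB z x, ← e3 z hz.1, hx, map_sub, map_smul, LinearMap.sub_apply, LinearMap.smul_apply, e1 z hz.1, hz2]; simp
  · intro z hz
    have hz2 : B u z = 0 := hz.2
    rw [map_sub, hB z u', ← e4 z hz.1, hy, map_sub, map_smul, hB z α', hB z p', e2 z hz.1, hz2]; simp
  · intro z hz
    have hz2 : B u' z = 0 := hz.2
    rw [map_sub, hB z u', hz2, h.iso2 z hz.1 y m2, sub_zero]

end generic
end Stmt3

namespace Stmt3
open Finsupp
set_option linter.all false
set_option linter.unusedSectionVars false
set_option linter.unusedSimpArgs false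
set_option linter.unusedVariables false
open scoped Pointwise

section exactness
variable {D V : Type} [Field D] [AddCommGroup V] [Module D V] [FiniteDimensional D V] {B : V →ₗ[D] V →ₗ[D] D}
variable {s σ : Submodule D V × Submodule D V} {d N r : ℕ}

theorem exists_inter (h : IsPr B s d) (hσ : IsPr B σ r) (hle : σ ≤ s) (hrd : r < d) : ∃ x ∈ s.1, x ∈ Tt B σ ∧ x ≠ 0 := by
  let f : s.1 →ₗ[D] Module.Dual D σ.2 := (LinearMap.lcomp D D σ.2.subtype).comp (B.flip.comp s.1.subtype)
  have hk : LinearMap.ker f ≠ ⊥ := LinearMap.ker_ne_bot_of_finrank_lt (by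
    rw [Subspace.dual_finrank_eq, hσ.dim2, h.dim]; exact hrd)
  obtain ⟨x, hx, hne⟩ := Submodule.exists_mem_ne_zero_of_ne_bot hk
  refine ⟨x.1, x.2, ⟨fun y hy => h.iso1 y (hle.1 hy) x.1 x.2, fun y hy => ?_⟩, fun e => hne (Subtype.ext e)⟩
  exact LinearMap.congr_fun (LinearMap.mem_ker.1 hx) ⟨y, hy⟩

/-- a good supply of partners -/
theorem exists_base (H : HypSp B N) (hσ : IsPr B σ r) (hr : r + 2 ≤ N) : ∃ a : V × V, HP B a ∧ a.1 ∈ Tt B σ ∧ a.2 ∈ Tt B σ ∧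
    ∀ x ∈ Tt B σ, x ≠ 0 → ∃ v ∈ partners B (Tt B σ) a.2, B v x ≠ 0 := by
  obtain ⟨w, hw, hws⟩ := hσ.word H.symm
  obtain ⟨w2, h2, hf⟩ := H.complete hw (by omega)
  have hT : ∀ b ∈ w2, HP B b ∧ b.1 ∈ Tt B σ ∧ b.2 ∈ Tt B σ := by
    intro b hb
    have := h2.2.1 b hb
    rw [perp_fsp H, hws] at this
    exact this
  have hlen := h2.2.2
  match w2, hlen, h2, hT, hf with
  | [], hlen, h2, hT, hf => simp at hlen; omega
  | [_], hlen, h2, hT, hf => simp at hlen; omega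
  | a :: b :: w3, hlen, h2, hT, hf =>
    have ha := hT a (by simp)
    have hb := hT b (by simp)
    have hor := (List.pairwise_cons.1 h2.1).1
    refine ⟨a, ha.1, ha.2.1, ha.2.2, fun x hx hne => ?_⟩
    by_contra hcon
    push Not at hcon
    have p0 : B a.1 x = 0 := hcon a.1 ⟨ha.2.1, ha.1.1, by rw [H.symm]; exact ha.1.2.2⟩
    have p1 : ∀ z ∈ Tt B σ, B z z = 0 → B a.1 z = 0 → B a.2 z = 0 → B z x = 0 := by
      intro z hz hzz h3 h4
      have := hcon (a.1 + z) ⟨add_mem ha.2.1 hz, by simp [ha.1.1, hzz, h3, H.symm z a.1], by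
        rw [map_add, h4, H.symm, ha.1.2.2, add_zero]⟩
      rwa [map_add, LinearMap.add_apply, p0, zero_add] at this
    have p2 : ∀ c ∈ b :: w3, B c.1 x = 0 ∧ B c.2 x = 0 := by
      intro c hc
      have h3 := hor c hc
      have h4 := hT c (List.mem_cons_of_mem _ hc)
      exact ⟨p1 c.1 h4.2.1 h4.1.1 h3.1 h3.2.2.1, p1 c.2 h4.2.2 h4.1.2.1 h3.2.1 h3.2.2.2⟩
    have p3 : B a.2 x = 0 := by
      have h3 := hor b (by simp)
      have h5 := hb.1
      have h6 := ha.1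
      have := hcon (a.1 + b.1 + b.2 - a.2) ⟨sub_mem (add_mem (add_mem ha.2.1 hb.2.1) hb.2.2) ha.2.2, by
        simp only [map_add, map_sub, LinearMap.add_apply, LinearMap.sub_apply, h3.1, h3.2.1, h3.2.2.1, h3.2.2.2, h5.1, h5.2.1, h5.2.2,
          h6.1, h6.2.1, h6.2.2, H.symm b.1 a.1, H.symm b.1 a.2, H.symm b.2 a.1, H.symm b.2 a.2, H.symm b.2 b.1, H.symm a.2 a.1]
        ring, by
        simp only [map_add, map_sub, h3.2.2.1, h3.2.2.2, h6.2.1, h6.2.2, H.symm a.2 a.1]; ring⟩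
      have q := p2 b (by simp)
      simpa [p0, q.1, q.2] using this
    apply hne
    rw [← Submodule.mem_bot D, ← H.full _ hf]
    intro c hc
    rcases List.mem_append.1 hc with hc | hc
    · rcases List.mem_cons.1 hc with rfl | hc
      · exact ⟨p0, p3⟩
      · exact p2 c hc
    · have := mem_fsp (D := D) hc
      rw [hws] at this
      exact ⟨hx.1 _ this.1, hx.2 _ this.2⟩

theorem exists_generic [Infinite D] (H : HypSp B N) (hσ : IsPr B σ r) (hr : r + 2 ≤ N) {A : Set (Submodule D V × Submodule D V)}
    (hA : A.Finite) : ∃ u u' : V, u ∈ Tt B σ ∧ u' ∈ Tt B σ ∧ HP B (u, u') ∧ ∀ s ∈ A, ∀ d, r < d + 1 → σ ≤ s → IsPr B s (d + 1) →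
      IsPr B (cutp B u u' s) d ∧ IsPr B (addp D u u' (cutp B u u' s)) (d + 1) := by
  classical
  obtain ⟨a, ha, ha1, ha2, hbase⟩ := exists_base H hσ hr
  let good : (Submodule D V × Submodule D V) → Prop := fun s => σ ≤ s ∧ ∃ d, r < d + 1 ∧ IsPr B s (d + 1)
  have hchoose : ∀ s, ∃ (x : V) (P P' : V →ₗ[D] V), good s → (x ∈ s.1 ∧ x ∈ Tt B σ ∧ x ≠ 0) ∧
      (∀ v, P v ∈ s.1 ∧ ∀ y ∈ s.2, B (P v) y = B v y) ∧ (∀ v, P' v ∈ s.2 ∧ ∀ y ∈ s.1, B (P' v) y = B v y) := by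
    intro s
    by_cases hs : good s
    · obtain ⟨hle, d, hd, h⟩ := hs
      obtain ⟨x, hx⟩ := exists_inter h hσ hle hd
      obtain ⟨P, hP⟩ := h.proj
      obtain ⟨P', hP'⟩ := (h.swap H.symm).proj
      exact ⟨x, P, P', fun _ => ⟨hx, hP, hP'⟩⟩
    · exact ⟨0, 0, 0, fun h => absurd h hs⟩
  choose x P P' hall using hchoose
  have hA' : {s ∈ A | good s}.Finite := hA.subset (Set.sep_subset _ _)
  obtain ⟨u, ⟨huT, huu, hau⟩, hu⟩ := common_witness hA' (fun s v => B v (x s))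
    (fun s _ => PolyFun.lin (B.flip (x s))) (partners B (Tt B σ) a.2) ⟨a.1, ha1, ha.1, by rw [H.symm]; exact ha.2.2⟩
    (partners_curve H.symm ha2 ha.2.1) (fun s hs => by
      have := (hall s hs.2).1
      exact hbase (x s) this.2.1 this.2.2)
  let F : (Submodule D V × Submodule D V) → V → D := fun s v => B (P s v) (P' s u) *
    (B (P s v) (P' s u) * (1 - B (P s u) (P' s v)) + B (P s u) (P' s u) * B (P s v) (P' s v))
  have hF : ∀ s, PolyFun (F s) := by
    intro s
    have f1 : PolyFun (fun v => B (P s v) (P' s u)) := PolyFun.lin ((B.flip (P' s u)).comp (P s))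
    have f2 : PolyFun (fun v => B (P s u) (P' s v)) := PolyFun.lin ((B (P s u)).comp (P' s))
    have f3 : PolyFun (fun v => B (P s v) (P' s v)) := PolyFun.quad (B.compl₁₂ (P s) (P' s))
    exact f1.mul ((f1.mul ((PolyFun.const 1).sub f2)).add ((PolyFun.const _).mul f3))
  obtain ⟨u', ⟨huT', huu', hau'⟩, hu'⟩ := common_witness hA' F (fun s _ => hF s) (partners B (Tt B σ) u)
    ⟨a.2, ha2, ha.2.1, by rw [H.symm]; exact hau⟩ (partners_curve H.symm huT huu) (fun s hs => by
      obtain ⟨⟨x1, x2, x3⟩, hP, hP'⟩ := hall s hs.2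
      obtain ⟨hle, d, hd, h⟩ := hs.2
      have hux : B u (x s) ≠ 0 := hu s hs
      have hz : (B u (x s))⁻¹ • x s ∈ s.1 := Submodule.smul_mem _ _ x1
      have huz : B u ((B u (x s))⁻¹ • x s) = 1 := by rw [map_smul, smul_eq_mul, inv_mul_cancel₀ hux]
      refine ⟨(B u (x s))⁻¹ • x s, ⟨Submodule.smul_mem _ _ x2, h.iso1 _ hz _ hz, huz⟩, ?_⟩
      generalize (B u (x s))⁻¹ • x s = z at hz huz
      have e1 : P s z = z := by
        rw [← sub_eq_zero]
        refine h.nd1 _ (sub_mem (hP z).1 hz) fun y hy => ?_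
        rw [map_sub, LinearMap.sub_apply, (hP z).2 y hy, sub_self]
      have e2 : P' s z = 0 := by
        refine h.nd2 _ (hP' z).1 fun y hy => ?_
        rw [H.symm, (hP' z).2 y hy, h.iso1 z hz y hy]
      have e3 : B z (P' s u) = 1 := by rw [H.symm, (hP' u).2 z hz, huz]
      simp only [F, e1, e2, e3, map_zero]
      simp)
  refine ⟨u, u', huT, huT', ⟨huu, huu', hau'⟩, fun s hs d hd hle h => ?_⟩
  have hg : good s := ⟨hle, d, hd, h⟩
  obtain ⟨_, hP, hP'⟩ := hall s hg
  have hne := hu' s ⟨hs, hg⟩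
  exact h.exchange H.symm huu huu' hau' (hP u').1 (hP' u).1 (hP u).1 (hP' u').1 (hP u').2 (hP' u).2 (hP u).2 (hP' u').2
    (left_ne_zero_of_mul hne) (right_ne_zero_of_mul hne)

theorem addp_isPr (H : HypSp B N) (hσ : IsPr B σ r) {u u' : V} (hu : u ∈ Tt B σ) (hu' : u' ∈ Tt B σ) (h : HP B (u, u')) :
    IsPr B (addp D u u' σ) (r + 1) :=
  hσ.add H.symm h.1 h.2.1 (by rw [h.2.2]; exact one_ne_zero) hu.1 hu.2 hu'.1 hu'.2

theorem le_addp (u u' : V) : σ ≤ addp D u u' σ := ⟨le_sup_left, le_sup_left⟩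

theorem flags_exact [Infinite D] (H : HypSp B N) : ∀ (m : ℕ) (σ : Submodule D V × Submodule D V) (r L : ℕ), L + r + m = N → IsPr B σ r →
    XX (QQ B N σ) L := by
  intro m
  induction m with
  | zero =>
    intro σ r L hm hσ
    refine XX_min σ ⟨le_rfl, ?_⟩ (fun l s h => h.1)
    rwa [show N - L = r by omega]
  | succ m ih =>
    intro σ r L hm hσ
    rcases Nat.eq_zero_or_pos L with rfl | hL
    · obtain ⟨w, hw, hws⟩ := hσ.word H.symm
      obtain ⟨w2, h2, hf⟩ := H.complete hw (by omega)
      have hlen := h2.2.2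
      obtain ⟨b, w3, rfl⟩ : ∃ b w3, w2 = b :: w3 := by
        cases w2 with
        | nil => simp at hlen; omega
        | cons b w3 => exact ⟨b, w3, rfl⟩
      have hb := h2.2.1 b (by simp)
      rw [perp_fsp H, hws] at hb
      have h3 := addp_isPr H hσ hb.2.1 hb.2.2 hb.1
      exact XX_zero (ih _ (r + 1) 0 (by omega) h3) (fun s hs => ⟨(le_addp _ _).trans hs.1, hs.2⟩)
    · refine XX_step hL fun A hA hAQ => ?_
      obtain ⟨u, u', hu, hu', hp, hall⟩ := exists_generic H hσ (by omega) hA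
      refine ⟨QQ B N (addp D u u' σ), cutp B u u', fun s => addp D u u' (cutp B u u' s), ih _ (r + 1) L (by omega) (addp_isPr H hσ hu hu' hp),
        fun l s _ h => ⟨(le_addp _ _).trans h.1, h.2⟩, ?_, ?_, ?_, ?_, ?_⟩
      · intro s t h
        exact ⟨inf_le_inf_right _ h.1, inf_le_inf_right _ h.2⟩
      · intro s t h
        exact ⟨sup_le_sup_right (inf_le_inf_right _ h.1) _, sup_le_sup_right (inf_le_inf_right _ h.2) _⟩
      · intro s
        exact ⟨inf_le_left, inf_le_left⟩
      · intro s
        exact le_addp _ _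
      · intro s hs l hl h
        have h3 := hall s hs (N - (l + 1)) (by omega) h.1 (by
          rw [show N - (l + 1) + 1 = N - l by omega]; exact h.2)
        rw [show N - (l + 1) + 1 = N - l by omega] at h3
        have hle : σ ≤ cutp B u u' s := by
          refine ⟨fun y hy => ⟨h.1.1 hy, ?_⟩, fun y hy => ⟨h.1.2 hy, ?_⟩⟩
          · exact (H.symm u y).trans (hu.1 y hy)
          · exact (H.symm u' y).trans (hu'.2 y hy)
        have hle2 : addp D u u' σ ≤ addp D u u' (cutp B u u' s) := ⟨sup_le_sup_right hle.1 _, sup_le_sup_right hle.2 _⟩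
        exact ⟨⟨hle, h3.1⟩, ⟨hle.trans (le_addp _ _), h3.2⟩, hle2, h3.2⟩

theorem hyp_conn [Infinite D] (H : HypSp B N) {a : V × V} (ha : HP B a) : Conn (triv (sinc B [a] [])) N :=
  pair_main H ha (fun σ r L hσ hL => flags_exact H (N - (L + r)) σ r L (by omega) hσ)

end exactness
end Stmt3

namespace Stmt3
open Matrix
variable (D : Type) [Field D]

/-- Let `D` be a field and `k ≥ 1`, `n ≥ 1`.  If `D` is infinite and either
(`k = 1` and `n ≥ 2`) or (`2 ≤ k ≤ n`), or if `D` is finite and `n ≥ 2k`, then the relative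
integral group homology `H_k(O_{n+1,n+1}(D), O_{n,n}(D); ℤ)` vanishes; equivalently, the map
`H_k(O_{n,n}(D); ℤ) → H_k(O_{n+1,n+1}(D); ℤ)` induced by the hyperbolic embedding is
surjective, and the induced map in degree `k − 1` is injective. -/
theorem statement3 (k n : ℕ) (hk : 1 ≤ k) (hn : 1 ≤ n)
    (h : (Infinite D ∧ ((k = 1 ∧ 2 ≤ n) ∨ (2 ≤ k ∧ k ≤ n))) ∨ (Finite D ∧ 2 * k ≤ n)) :
    BarInducedSurj ℤ (embO D n) k ∧ BarInducedInj ℤ (embO D n) (k - 1) := by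
  rcases h with ⟨hD, ⟨h1, h2⟩ | ⟨h2, h3⟩⟩ | ⟨_, h2⟩
  · exact finite_branch D k n hk (by omega)
  · have := hD
    have : FiniteDimensional D (MV D (n + 1)) := by unfold MV; infer_instance
    have C := hyp_conn (mHyp D (n + 1)) (mL_mem D (n + 1) (Fin.last n)).1
    exact ⟨frozen_surj D k n (C.1 k (by omega)), frozen_inj D (k - 1) n (C.2 (k - 1) (by omega))⟩
  · exact finite_branch D k n hk h2

end Stmt3
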